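/- For every integer n ≥ 1, the n-th prime p_n satisfies p_n ≥ n · log n. -/

import Mathlib

section

open Finset in
/-- `∑_{n ≤ M} Λ(n) ⌊K/n⌋ = log K!` for `K ≤ M`. -/
theorem sum_vM_div {K M : ℕ} (h : K ≤ M) :
    ∑ n ∈ Finset.Icc 1 M, ArithmeticFunction.vonMangoldt n * ((K / n : ℕ) : ℝ) = Real.log (K.factorial) := by
  induction K with
  | zero => simp
  | succ K ih =>
    rw [Nat.factorial_succ, Nat.cast_mul, Real.log_mul (by positivity) (by positivity),
      ← ih (by omega), ← ArithmeticFunction.vonMangoldt_sum]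
    have h1 : ∑ i ∈ (K+1).divisors, ArithmeticFunction.vonMangoldt i
        = ∑ n ∈ Finset.Icc 1 M, ArithmeticFunction.vonMangoldt n * (if n ∣ K + 1 then 1 else 0 : ℝ) := by
      simp only [mul_ite, mul_one, mul_zero]
      rw [← Finset.sum_filter]
      apply Finset.sum_congr _ (fun _ _ => rfl)
      ext i
      simp only [Nat.mem_divisors, Finset.mem_filter, Finset.mem_Icc]
      constructor
      · rintro ⟨h1, _⟩
        exact ⟨⟨Nat.pos_of_dvd_of_pos h1 (by omega), (Nat.le_of_dvd (by omega) h1).trans h⟩, h1⟩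
      · rintro ⟨_, h1⟩; exact ⟨h1, by omega⟩
    rw [h1, ← Finset.sum_add_distrib]
    apply Finset.sum_congr rfl
    intro n _
    rw [Nat.succ_div]
    split_ifs <;> push_cast <;> ring

theorem logfact_lower (K : ℕ) (hK : 1 ≤ K) : K * Real.log K - K ≤ Real.log (K.factorial) := by
  induction K, hK using Nat.le_induction with
  | base => simp
  | succ K hK ih =>
    rw [Nat.factorial_succ, Nat.cast_mul, Real.log_mul (by positivity) (by positivity)]
    have hk : (1:ℝ) ≤ K := by exact_mod_cast hK
    have h2 : Real.log ((K+1:ℕ):ℝ) - Real.log K ≤ 1 / K := by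
      rw [← Real.log_div (by positivity) (by positivity)]
      have := Real.log_le_sub_one_of_pos (show 0 < ((K+1:ℕ):ℝ) / K by positivity)
      refine this.trans (le_of_eq ?_)
      push_cast; field_simp; ring
    have h3 : K * (Real.log ((K+1:ℕ):ℝ) - Real.log K) ≤ 1 := by
      calc _ ≤ K * (1/K : ℝ) := by gcongr
        _ = 1 := by field_simp
    push_cast at *
    nlinarith

theorem logfact_upper (K : ℕ) (hK : 1 ≤ K) :
    Real.log (K.factorial) ≤ K * Real.log K - K + Real.log K + 1 := by
  induction K, hK using Nat.le_induction with
  | base => simp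
  | succ K hK ih =>
    rw [Nat.factorial_succ, Nat.cast_mul, Real.log_mul (by positivity) (by positivity)]
    have hk : (1:ℝ) ≤ K := by exact_mod_cast hK
    have h2 : 1 / (K+1:ℝ) ≤ Real.log ((K+1:ℕ):ℝ) - Real.log K := by
      rw [← Real.log_div (by positivity) (by positivity)]
      have := Real.one_sub_inv_le_log_of_pos (show 0 < ((K+1:ℕ):ℝ) / K by positivity)
      refine le_trans (le_of_eq ?_) this
      push_cast; field_simp; ring
    have h3 : 1 ≤ (K+1) * (Real.log ((K+1:ℕ):ℝ) - Real.log K) := by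
      calc (1:ℝ) = (K+1) * (1/(K+1) : ℝ) := by field_simp
        _ ≤ _ := by gcongr
    push_cast at *
    nlinarith

theorem g_mono_step {a t : ℝ} (ha : 1 ≤ a) (hat : a ≤ t) (h1 : t ≤ a + 1) :
    a * Real.log a - a ≤ t * Real.log t - t ∧ t * Real.log t - t ≤ a * Real.log a - a + Real.log t := by
  have ha0 : 0 < a := by linarith
  have ht0 : 0 < t := by linarith
  have h2 : 1 - a / t ≤ Real.log t - Real.log a := by
    rw [← Real.log_div (by positivity) (by positivity)]
    have := Real.one_sub_inv_le_log_of_pos (show 0 < t / a by positivity)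
    rwa [inv_div] at this
  have h3 : Real.log t - Real.log a ≤ t / a - 1 := by
    rw [← Real.log_div (by positivity) (by positivity)]
    exact Real.log_le_sub_one_of_pos (by positivity)
  have h4 : t * (1 - a / t) = t - a := by field_simp
  have h5 : a * (t/a - 1) = t - a := by field_simp
  have h6 : 0 ≤ Real.log a := Real.log_nonneg ha
  have h7 : 0 ≤ Real.log t := Real.log_nonneg (by linarith)
  constructor
  · nlinarith [mul_nonneg (sub_nonneg.2 hat) h6]
  · nlinarith [mul_nonneg (sub_nonneg.2 h1) h7]

theorem logfact_floor {t : ℝ} (ht : 1 ≤ t) :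
    |Real.log ((⌊t⌋₊).factorial) - (t * Real.log t - t)| ≤ Real.log t + 1 := by
  have hK : 1 ≤ ⌊t⌋₊ := by rwa [Nat.one_le_floor_iff]
  have h1 := logfact_lower _ hK
  have h2 := logfact_upper _ hK
  have hfl : (⌊t⌋₊:ℝ) ≤ t := Nat.floor_le (by linarith)
  have hfl2 : t ≤ (⌊t⌋₊:ℝ) + 1 := (Nat.lt_floor_add_one t).le
  have hK' : (1:ℝ) ≤ ⌊t⌋₊ := by exact_mod_cast hK
  obtain ⟨h3, h4⟩ := g_mono_step hK' hfl hfl2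
  have h5 : Real.log (⌊t⌋₊) ≤ Real.log t := Real.log_le_log (by linarith) hfl
  rw [abs_le]; constructor <;> linarith

/-- weighted sum over a list of `(d, a_d)`. -/
noncomputable def lsum (I : List (ℕ × ℝ)) (f : ℕ → ℝ) : ℝ := (I.map (fun p => p.2 * f p.1)).sum

@[simp] theorem lsum_nil (f : ℕ → ℝ) : lsum [] f = 0 := rfl
@[simp] theorem lsum_cons (p : ℕ × ℝ) (I : List (ℕ × ℝ)) (f : ℕ → ℝ) :
    lsum (p :: I) f = p.2 * f p.1 + lsum I f := by simp [lsum]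
@[simp] theorem lsum_append (I J : List (ℕ × ℝ)) (f : ℕ → ℝ) :
    lsum (I ++ J) f = lsum I f + lsum J f := by simp [lsum]

theorem lsum_sum (I : List (ℕ × ℝ)) {ι : Type*} (T : Finset ι) (w : ι → ℝ) (f : ℕ → ι → ℝ) :
    ∑ n ∈ T, w n * lsum I (fun d => f d n) = lsum I (fun d => ∑ n ∈ T, w n * f d n) := by
  induction I with
  | nil => simp
  | cons p I ih =>
    simp only [lsum_cons, mul_add, Finset.sum_add_distrib, ih, Finset.mul_sum]
    congr 1
    exact Finset.sum_congr rfl fun n _ => by ring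

theorem lsum_congr {I : List (ℕ × ℝ)} {f g : ℕ → ℝ} (h : ∀ p ∈ I, f p.1 = g p.1) :
    lsum I f = lsum I g := by
  unfold lsum
  congr 1
  exact List.map_congr_left fun p hp => by rw [h p hp]

theorem lsum_sub (I : List (ℕ × ℝ)) (f g : ℕ → ℝ) :
    lsum I (fun d => f d - g d) = lsum I f - lsum I g := by
  induction I with
  | nil => simp
  | cons p I ih => simp only [lsum_cons, ih]; ring

theorem lsum_mul (I : List (ℕ × ℝ)) (c : ℝ) (f : ℕ → ℝ) :
    lsum I (fun d => c * f d) = c * lsum I f := by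
  induction I with
  | nil => simp
  | cons p I ih => simp only [lsum_cons, ih]; ring

/-- sum of absolute values of the weights against `f` -/
noncomputable def labs (I : List (ℕ × ℝ)) (f : ℕ → ℝ) : ℝ := (I.map (fun p => |p.2| * f p.1)).sum
@[simp] theorem labs_nil (f : ℕ → ℝ) : labs [] f = 0 := rfl
@[simp] theorem labs_cons (p : ℕ × ℝ) (I : List (ℕ × ℝ)) (f : ℕ → ℝ) :
    labs (p :: I) f = |p.2| * f p.1 + labs I f := by simp [labs]
@[simp] theorem labs_append (I J : List (ℕ × ℝ)) (f : ℕ → ℝ) :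
    labs (I ++ J) f = labs I f + labs J f := by simp [labs]

theorem lsum_abs_le {I : List (ℕ × ℝ)} {f g : ℕ → ℝ} (h : ∀ p ∈ I, |f p.1| ≤ g p.1) :
    |lsum I f| ≤ labs I g := by
  induction I with
  | nil => simp
  | cons p I ih =>
    simp only [lsum_cons, labs_cons]
    refine (abs_add_le _ _).trans (add_le_add ?_ (ih fun q hq => h q (by simp [hq])))
    rw [abs_mul]
    exact mul_le_mul_of_nonneg_left (h p (by simp)) (abs_nonneg _)

theorem labs_le {I : List (ℕ × ℝ)} {f g : ℕ → ℝ} (h : ∀ p ∈ I, f p.1 ≤ g p.1) :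
    labs I f ≤ labs I g := by
  induction I with
  | nil => simp
  | cons p I ih =>
    simp only [labs_cons]
    refine (add_le_add ?_ (ih fun q hq => h q (by simp [hq])))
    exact mul_le_mul_of_nonneg_left (h p (by simp)) (abs_nonneg _)

theorem labs_mul (I : List (ℕ × ℝ)) (c : ℝ) (f : ℕ → ℝ) :
    labs I (fun d => c * f d) = c * labs I f := by
  induction I with
  | nil => simp
  | cons p I ih => simp only [labs_cons, ih]; ring

noncomputable def sC (I : List (ℕ × ℝ)) : ℝ := lsum I (fun d => 1 / d)
noncomputable def aC (I : List (ℕ × ℝ)) : ℝ := - lsum I (fun d => Real.log d / d)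
/-- `C̃(m) = 1 - ∑ a_d ⌊m/d⌋ + s m`. -/
noncomputable def Ct (I : List (ℕ × ℝ)) (m : ℕ) : ℝ := 1 - lsum I (fun d => ((m / d : ℕ) : ℝ)) + sC I * m

/-- the step function -/
noncomputable def stp (S : List (ℕ × ℝ)) (m : ℕ) : ℝ := lsum S (fun N => if N ≤ m then 1 else 0)

theorem psi_eq_Icc (x : ℝ) : Chebyshev.psi x = ∑ n ∈ Finset.Icc 1 ⌊x⌋₊, ArithmeticFunction.vonMangoldt n := by
  rw [Chebyshev.psi]; rfl

theorem psi_ident (I : List (ℕ × ℝ)) (M : ℕ) :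
    Chebyshev.psi M = lsum I (fun d => Real.log ((M / d).factorial)) - sC I * Real.log (M.factorial)
      + ∑ n ∈ Finset.Icc 1 M, ArithmeticFunction.vonMangoldt n * Ct I (M / n) := by
  have h1 : ∀ n ∈ Finset.Icc 1 M, ArithmeticFunction.vonMangoldt n * Ct I (M / n)
      = ArithmeticFunction.vonMangoldt n - ArithmeticFunction.vonMangoldt n * lsum I (fun d => ((M / d / n : ℕ) : ℝ))
        + sC I * (ArithmeticFunction.vonMangoldt n * ((M / n : ℕ):ℝ)) := by
    intro n _
    unfold Ct
    simp only [Nat.div_right_comm M n]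
    ring
  rw [Finset.sum_congr rfl h1, Finset.sum_add_distrib, Finset.sum_sub_distrib, ← Finset.mul_sum,
    sum_vM_div le_rfl, psi_eq_Icc, Nat.floor_natCast, lsum_sum]
  have : (fun d => ∑ n ∈ Finset.Icc 1 M, ArithmeticFunction.vonMangoldt n * ((M / d / n : ℕ) : ℝ))
      = fun d => Real.log ((M / d).factorial) := by
    funext d
    exact sum_vM_div (Nat.div_le_self _ _)
  rw [this]; ring

theorem stp_sum (S : List (ℕ × ℝ)) (hS : ∀ p ∈ S, 1 ≤ p.1) (x : ℝ) :
    ∑ n ∈ Finset.Icc 1 ⌊x⌋₊, ArithmeticFunction.vonMangoldt n * stp S (⌊x⌋₊ / n)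
      = lsum S (fun N => Chebyshev.psi (x / N)) := by
  unfold stp
  rw [lsum_sum]
  apply lsum_congr
  intro p hp
  simp only [mul_ite, mul_one, mul_zero]
  rw [← Finset.sum_filter, psi_eq_Icc, Nat.floor_div_natCast]
  apply Finset.sum_congr _ (fun _ _ => rfl)
  ext i
  simp only [Finset.mem_filter, Finset.mem_Icc]
  have := hS p hp
  constructor
  · rintro ⟨⟨h1, h2⟩, h3⟩
    refine ⟨h1, ?_⟩
    rw [Nat.le_div_iff_mul_le (by omega)] at h3 ⊢
    linarith
  · rintro ⟨h1, h2⟩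
    refine ⟨⟨h1, h2.trans (Nat.div_le_self _ _)⟩, ?_⟩
    rw [Nat.le_div_iff_mul_le (by omega)] at h2 ⊢
    linarith

theorem main_err (I : List (ℕ × ℝ)) {x : ℝ} (hx : 1 ≤ x) (hI : ∀ p ∈ I, 1 ≤ p.1 ∧ (p.1:ℝ) ≤ x) :
    |lsum I (fun d => Real.log ((⌊x⌋₊ / d).factorial)) - sC I * Real.log (⌊x⌋₊.factorial) - aC I * x|
      ≤ (labs I (fun _ => 1) + |sC I|) * (Real.log x + 1) := by
  have hx0 : 0 < x := by linarith
  have e1 : aC I * x = lsum I (fun d => x / d * Real.log (x / d) - x / d) - sC I * (x * Real.log x - x) := by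
    have : lsum I (fun d => x / d * Real.log (x / d) - x / d)
        = lsum I (fun d => (x * Real.log x - x) * (1 / d) - x * (Real.log d / d)) := by
      apply lsum_congr
      intro p hp
      have := (hI p hp).1
      have h1 : (0:ℝ) < p.1 := by exact_mod_cast this
      rw [Real.log_div hx0.ne' h1.ne']; field_simp; ring
    rw [this, lsum_sub, lsum_mul, lsum_mul]
    unfold aC sC; ring
  have e2 : lsum I (fun d => Real.log ((⌊x⌋₊ / d).factorial)) - sC I * Real.log (⌊x⌋₊.factorial) - aC I * x
      = lsum I (fun d => Real.log ((⌊x⌋₊ / d).factorial) - (x / d * Real.log (x / d) - x / d))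
        - sC I * (Real.log (⌊x⌋₊.factorial) - (x * Real.log x - x)) := by
    rw [e1, lsum_sub I (fun d => Real.log ((⌊x⌋₊ / d).factorial)) (fun d => x / d * Real.log (x / d) - x / d)]
    ring
  rw [e2]
  refine (abs_sub _ _).trans ?_
  rw [add_mul]
  refine add_le_add ?_ ?_
  · refine (lsum_abs_le (g := fun _ => (Real.log x + 1) * 1) ?_).trans ?_
    · intro p hp
      have h1 := hI p hp
      have h2 : (1:ℝ) ≤ p.1 := by exact_mod_cast h1.1
      rw [← Nat.floor_div_natCast]
      refine (logfact_floor ((one_le_div (by linarith)).2 h1.2)).trans ?_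
      rw [mul_one]
      have : Real.log (x / p.1) ≤ Real.log x :=
        Real.log_le_log (by positivity) (div_le_self hx0.le h2)
      linarith
    · rw [labs_mul]; linarith
  · rw [abs_mul]
    exact mul_le_mul_of_nonneg_left (logfact_floor hx) (abs_nonneg _)

theorem step_upper (I S : List (ℕ × ℝ)) (hS : ∀ p ∈ S, 1 ≤ p.1) (hC : ∀ m, 1 ≤ m → Ct I m ≤ stp S m)
    {x : ℝ} (hx : 1 ≤ x) (hI : ∀ p ∈ I, 1 ≤ p.1 ∧ (p.1:ℝ) ≤ x) :
    Chebyshev.psi x ≤ aC I * x + lsum S (fun N => Chebyshev.psi (x / N))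
      + (labs I (fun _ => 1) + |sC I|) * (Real.log x + 1) := by
  have h1 := (abs_le.1 (main_err I hx hI)).2
  rw [Chebyshev.psi_eq_psi_coe_floor, psi_ident I, ← stp_sum S hS]
  have : ∑ n ∈ Finset.Icc 1 ⌊x⌋₊, ArithmeticFunction.vonMangoldt n * Ct I (⌊x⌋₊ / n)
    ≤ ∑ n ∈ Finset.Icc 1 ⌊x⌋₊, ArithmeticFunction.vonMangoldt n * stp S (⌊x⌋₊ / n) := by
    apply Finset.sum_le_sum
    intro n hn
    rw [Finset.mem_Icc] at hn
    exact mul_le_mul_of_nonneg_left (hC _ (Nat.div_pos hn.2 hn.1)) ArithmeticFunction.vonMangoldt_nonneg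
  linarith

theorem step_lower (I S : List (ℕ × ℝ)) (hS : ∀ p ∈ S, 1 ≤ p.1) (hC : ∀ m, 1 ≤ m → stp S m ≤ Ct I m)
    {x : ℝ} (hx : 1 ≤ x) (hI : ∀ p ∈ I, 1 ≤ p.1 ∧ (p.1:ℝ) ≤ x) :
    aC I * x + lsum S (fun N => Chebyshev.psi (x / N))
      - (labs I (fun _ => 1) + |sC I|) * (Real.log x + 1) ≤ Chebyshev.psi x := by
  have h1 := (abs_le.1 (main_err I hx hI)).1
  rw [Chebyshev.psi_eq_psi_coe_floor x, psi_ident I, ← stp_sum S hS]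
  have : ∑ n ∈ Finset.Icc 1 ⌊x⌋₊, ArithmeticFunction.vonMangoldt n * stp S (⌊x⌋₊ / n)
    ≤ ∑ n ∈ Finset.Icc 1 ⌊x⌋₊, ArithmeticFunction.vonMangoldt n * Ct I (⌊x⌋₊ / n) := by
    apply Finset.sum_le_sum
    intro n hn
    rw [Finset.mem_Icc] at hn
    exact mul_le_mul_of_nonneg_left (hC _ (Nat.div_pos hn.2 hn.1)) ArithmeticFunction.vonMangoldt_nonneg
  linarith

/-- with `|ψ y - y| ≤ ε y` for `y ≥ X` -/
theorem lsum_psi (S : List (ℕ × ℝ)) {X ε x : ℝ} (hε : ∀ y, X ≤ y → |Chebyshev.psi y - y| ≤ ε * y)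
    (hS : ∀ p ∈ S, 1 ≤ p.1 ∧ X * p.1 ≤ x) :
    |lsum S (fun N => Chebyshev.psi (x / N)) - lsum S (fun N => 1 / N) * x|
      ≤ ε * labs S (fun N => 1 / N) * x := by
  have : lsum S (fun N => Chebyshev.psi (x / N)) - lsum S (fun N => 1 / N) * x
      = lsum S (fun N => Chebyshev.psi (x / N) - x * (1 / N)) := by
    rw [lsum_sub, lsum_mul]; ring
  rw [this]
  refine (lsum_abs_le (g := fun N => (ε * x) * (1 / N)) ?_).trans ?_
  · intro p hp
    obtain ⟨h1, h2⟩ := hS p hp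
    have h3 : (0:ℝ) < p.1 := by exact_mod_cast h1
    have := hε (x / p.1) ((le_div_iff₀ h3).2 h2)
    rw [mul_one_div]
    refine this.trans (le_of_eq ?_)
    ring
  · rw [labs_mul]; apply le_of_eq; ring

end

section

/-- `rep p k = 1 + 2^p + ... + 2^(p (k-1))`. -/
def rep (p k : ℕ) : ℕ := Nat.div (Nat.sub (Nat.pow 2 (Nat.mul p k)) 1) (Nat.sub (Nat.pow 2 p) 1)

/-- bit pattern of `{t < B : (c + t) % p = a}` (for `2 ≤ p`, `a < p`). -/
def pat (B c a p : ℕ) : ℕ :=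
  Nat.div (Nat.pow 2 (Nat.add B (Nat.mod (Nat.sub (Nat.add a p) (Nat.mod (Nat.add c B) p)) p))) (Nat.sub (Nat.pow 2 p) 1)

/-- carry-save adder level: returns sum plane and carries. -/
noncomputable def csaGo (L : List ℕ) : ℕ → Bool → ℕ → List ℕ → ℕ × List ℕ :=
  List.rec (motive := fun _ => ℕ → Bool → ℕ → List ℕ → ℕ × List ℕ)
    (fun s pend b cs => Bool.rec (s, cs) (Nat.xor s b, Nat.land s b :: cs) pend)
    (fun x _ ih s pend b cs =>
      Bool.rec (ih s true x cs)
        (Bool.rec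
          (ih (Nat.xor (Nat.xor s b) x) false 0 (Nat.lor (Nat.land s b) (Nat.land x (Nat.xor s b)) :: cs))
          (ih (Nat.xor (Nat.xor s b) x) false 0 (Nat.lor (Nat.land s b) (Nat.land x (Nat.xor s b)) :: cs))
          (Nat.beq (Nat.xor (Nat.xor s b) x) 0)) pend) L

noncomputable def planes (n : ℕ) : List ℕ → List ℕ × List ℕ :=
  Nat.rec (motive := fun _ => List ℕ → List ℕ × List ℕ) (fun L => ([], L))
    (fun _ ih L => Prod.rec (fun s cs => Prod.rec (fun ps left => (s :: ps, left)) (ih cs)) (csaGo L 0 false 0 [])) n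

noncomputable def allZero (L : List ℕ) : Bool :=
  List.rec (motive := fun _ => Bool) true (fun x _ ih => Bool.rec false ih (Nat.beq x 0)) L

noncomputable def ext (M r : ℕ) (L : List ℕ) : ℕ :=
  List.rec (motive := fun _ => ℕ) 0
    (fun x _ ih => Nat.add (Nat.land (Nat.shiftRight x r) M) (Nat.mul 2 ih)) L

noncomputable def cumI (f : ℕ → ℕ) (n : ℕ) : ℕ :=
  Nat.rec (motive := fun _ => ℕ) 0 (fun i acc => Nat.add acc (f i)) n

noncomputable def allB (f : ℕ → Bool) (n : ℕ) : Bool :=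
  Nat.rec (motive := fun _ => Bool) true (fun i acc => Bool.rec false acc (f i)) n

/-- check of one direction -/
noncomputable def dirChk2 (Q M M2 w0 wl W : ℕ) (Ip Im : ℕ → ℕ) : Bool :=
  and (Nat.beq (Nat.add (Nat.add (Nat.mul 4095 W) w0) (cumI Ip 12))
        (Nat.add (Nat.mul wl (Nat.pow 4096 Q)) (cumI Im 12)))
  (and (Nat.beq (Nat.land W (Nat.mul 3584 M)) 0)
  (and (Nat.ble (Nat.succ W) (Nat.pow 4096 Q))
    (allB (fun i => Nat.beq (Nat.land (Nat.sub (Nat.add (Nat.add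
      (Nat.mod (Nat.add (Nat.mul 4096 W) w0) (Nat.pow 4096 Q)) M2)
      (cumI Ip (Nat.succ i))) (cumI Im (Nat.succ i))) M2) M2) 12)))

noncomputable def dirChk (Q M w0 wl : ℕ) (Ip Im : ℕ → ℕ) : Bool :=
  dirChk2 Q M (Nat.mul 2048 M) w0 wl
    (Nat.div (Nat.sub (Nat.sub (Nat.add (Nat.mul wl (Nat.pow 4096 Q)) (cumI Im 12)) w0) (cumI Ip 12)) 4095) Ip Im

/-- cell decoding: unit steps -/
noncomputable def repl (N n : ℕ) (acc : List ℕ) : List ℕ :=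
  Nat.rec (motive := fun _ => List ℕ) acc (fun _ l => N :: l) n

/-- decode table: returns positive and negative unit steps -/
noncomputable def decP (K n : ℕ) : ℕ → ℕ → List ℕ :=
  Nat.rec (motive := fun _ => ℕ → ℕ → List ℕ) (fun _ _ => [])
    (fun _ ih N T => repl N (Nat.sub (Nat.mod T 128) 64)
      (ih (Nat.add N (Nat.succ (Nat.div (Nat.sub N K) K))) (Nat.div T 128))) n

noncomputable def decM (K n : ℕ) : ℕ → ℕ → List ℕ :=
  Nat.rec (motive := fun _ => ℕ → ℕ → List ℕ) (fun _ _ => [])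
    (fun _ ih N T => repl N (Nat.sub 64 (Nat.mod T 128))
      (ih (Nat.add N (Nat.succ (Nat.div (Nat.sub N K) K))) (Nat.div T 128))) n

/-- list of digits base 2^16, until zero -/
noncomputable def digs (n : ℕ) : ℕ → List ℕ :=
  Nat.rec (motive := fun _ => ℕ → List ℕ) (fun _ => [])
    (fun _ ih T => Bool.rec (Nat.mod T 65536 :: ih (Nat.div T 65536)) [] (Nat.beq T 0)) n

/-- blocks of 64 digits -/
noncomputable def digB (n : ℕ) : ℕ → List (List ℕ) :=
  Nat.rec (motive := fun _ => ℕ → List (List ℕ)) (fun _ => [])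
    (fun _ ih T => digs 64 (Nat.mod T (Nat.pow 2 1024)) :: ih (Nat.div T (Nat.pow 2 1024))) n

/-- next grid point after `n` cells -/
noncomputable def gridN (K n : ℕ) : ℕ → ℕ :=
  Nat.rec (motive := fun _ => ℕ → ℕ) (fun N => N)
    (fun _ ih N => Bool.rec (ih (Nat.add N (Nat.succ (Nat.div (Nat.sub N K) K))))
       (ih (Nat.add N (Nat.succ (Nat.div (Nat.sub N K) K)))) (Nat.beq N 0)) n

noncomputable def decPB (K n : ℕ) : ℕ → ℕ → List (List ℕ) :=
  Nat.rec (motive := fun _ => ℕ → ℕ → List (List ℕ)) (fun _ _ => [])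
    (fun _ ih N T => decP K 32 N (Nat.mod T (Nat.pow 2 224)) ::
      ih (gridN K 32 N) (Nat.div T (Nat.pow 2 224))) n

noncomputable def decMB (K n : ℕ) : ℕ → ℕ → List (List ℕ) :=
  Nat.rec (motive := fun _ => ℕ → ℕ → List (List ℕ)) (fun _ _ => [])
    (fun _ ih N T => decM K 32 N (Nat.mod T (Nat.pow 2 224)) ::
      ih (gridN K 32 N) (Nat.div T (Nat.pow 2 224))) n

noncomputable def mapPair (B c : ℕ) (L : List ℕ) : List ℕ :=
  List.rec (motive := fun _ => List ℕ) [] (fun e _ ih => pat B c e (Nat.mul 2 e) :: ih) L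

noncomputable def mapSingle (B c : ℕ) (L : List ℕ) : List ℕ :=
  List.rec (motive := fun _ => List ℕ) [] (fun e _ ih => pat B c 0 e :: ih) L

noncomputable def mapBit (c : ℕ) (L : List ℕ) : List ℕ :=
  List.rec (motive := fun _ => List ℕ) [] (fun e _ ih => Nat.shiftLeft 1 (Nat.sub e c) :: ih) L

noncomputable def mapB (f : List ℕ → List ℕ) (L acc : List (List ℕ)) : List (List ℕ) :=
  List.rec (motive := fun _ => List (List ℕ)) acc (fun e _ ih => f e :: ih) L

noncomputable def rangeChk (c d : ℕ) (L : List ℕ) : Bool :=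
  List.rec (motive := fun _ => Bool) true
    (fun e _ ih => Bool.rec false (Bool.rec false ih (Nat.ble (Nat.succ e) d)) (Nat.ble c e)) L

noncomputable def allL (f : List ℕ → Bool) (L : List (List ℕ)) : Bool :=
  List.rec (motive := fun _ => Bool) true (fun e _ ih => Bool.rec false ih (f e)) L

/-- ripple addition of plane lists -/
noncomputable def addPl (L : List ℕ) : ℕ → List ℕ → List ℕ × ℕ :=
  List.rec (motive := fun _ => ℕ → List ℕ → List ℕ × ℕ) (fun c _ => ([], c))
    (fun a _ ih c bs => List.rec (motive := fun _ => List ℕ × ℕ) ([], 1)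
      (fun b bs' _ => Prod.rec (fun l k => (Nat.xor (Nat.xor a b) c :: l, k))
        (ih (Nat.lor (Nat.land a b) (Nat.land c (Nat.xor a b))) bs')) bs) L

/-- sum of all blocks, as planes; second component says that no overflow happened -/
noncomputable def sumPl (LL : List (List ℕ)) : List ℕ × Bool :=
  List.rec (motive := fun _ => List ℕ × Bool) ([0, 0, 0, 0, 0, 0], true)
    (fun L _ ih => Prod.rec (fun acc ok => Prod.rec (fun ps left =>
      Prod.rec (fun l k => (l, and ok (and (allZero left) (Nat.beq k 0)))) (addPl acc 0 ps)) (planes 6 L)) ih) LL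

noncomputable def chunk3 (Q M u0 u1 l0 l1 : ℕ) (P N up um lp lm : List ℕ × Bool) : Bool :=
  and P.2 (and N.2 (and up.2 (and um.2 (and lp.2 (and lm.2
  (and (dirChk Q M u0 u1 (fun r => Nat.add (ext M r P.1) (ext M r up.1)) (fun r => Nat.add (ext M r N.1) (ext M r um.1)))
    (dirChk Q M l0 l1 (fun r => Nat.add (ext M r N.1) (ext M r lm.1)) (fun r => Nat.add (ext M r P.1) (ext M r lp.1)))))))))

noncomputable def chunk2 (pp np ps ns : List (List ℕ)) (c Q u0 u1 l0 l1 : ℕ) (up um lp lm : List (List ℕ)) : Bool :=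
  and (allL (rangeChk c (Nat.add c (Nat.mul 12 Q))) up) (and (allL (rangeChk c (Nat.add c (Nat.mul 12 Q))) um)
  (and (allL (rangeChk c (Nat.add c (Nat.mul 12 Q))) lp) (and (allL (rangeChk c (Nat.add c (Nat.mul 12 Q))) lm)
  (chunk3 Q (rep 12 Q) u0 u1 l0 l1
    (sumPl (mapB (mapPair (Nat.mul 12 Q) c) pp (mapB (mapSingle (Nat.mul 12 Q) c) ps [])))
    (sumPl (mapB (mapPair (Nat.mul 12 Q) c) np (mapB (mapSingle (Nat.mul 12 Q) c) ns [])))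
    (sumPl (mapB (mapBit c) up [])) (sumPl (mapB (mapBit c) um []))
    (sumPl (mapB (mapBit c) lp [])) (sumPl (mapB (mapBit c) lm []))))))

noncomputable def chunkChk (pp np ps ns : List (List ℕ)) (K c Q u0 u1 l0 l1 N0 nb tu tl : ℕ) : Bool :=
  chunk2 pp np ps ns c Q u0 u1 l0 l1 (decPB K nb N0 tu) (decMB K nb N0 tu) (decPB K nb N0 tl) (decMB K nb N0 tl)

end

section

/-! Correctness of the digit-packed verification. -/

/-- `pack Q f = ∑_{q<Q} f q 4096^q` -/
def pack : ℕ → (ℕ → ℕ) → ℕ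
  | 0, _ => 0
  | Q+1, f => f 0 + 4096 * pack Q (fun q => f (q+1))

theorem pack_succ (Q : ℕ) (f : ℕ → ℕ) : pack (Q+1) f = f 0 + 4096 * pack Q (fun q => f (q+1)) := rfl

theorem pack_congr {Q : ℕ} {f g : ℕ → ℕ} (h : ∀ q < Q, f q = g q) : pack Q f = pack Q g := by
  induction Q generalizing f g with
  | zero => rfl
  | succ Q ih => rw [pack_succ, pack_succ, h 0 (by omega), ih fun q hq => h (q+1) (by omega)]

theorem pack_add (Q : ℕ) (f g : ℕ → ℕ) : pack Q (fun q => f q + g q) = pack Q f + pack Q g := by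
  induction Q generalizing f g with
  | zero => rfl
  | succ Q ih => rw [pack_succ, pack_succ, pack_succ, ih]; ring

theorem pack_mul (Q c : ℕ) (f : ℕ → ℕ) : pack Q (fun q => c * f q) = c * pack Q f := by
  induction Q generalizing f with
  | zero => rfl
  | succ Q ih => rw [pack_succ, pack_succ, ih]; ring

theorem pack_zero (Q : ℕ) : pack Q (fun _ => 0) = 0 := by
  induction Q with
  | zero => rfl
  | succ Q ih => rw [pack_succ, ih]

theorem pack_lt {Q : ℕ} {f : ℕ → ℕ} (h : ∀ q < Q, f q < 4096) : pack Q f < 4096 ^ Q := by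
  induction Q generalizing f with
  | zero => simp [pack]
  | succ Q ih =>
    have h1 := h 0 (by omega)
    have h2 := ih (f := fun q => f (q+1)) fun q hq => h (q+1) (by omega)
    rw [pack_succ, pow_succ]; omega

theorem pack_high (Q : ℕ) (f : ℕ → ℕ) : pack (Q+1) f = pack Q f + 4096 ^ Q * f Q := by
  induction Q generalizing f with
  | zero => simp [pack]
  | succ Q ih => rw [pack_succ, ih, pack_succ]; ring

theorem pack_inj {Q : ℕ} {f g : ℕ → ℕ} (hf : ∀ q < Q, f q < 4096) (hg : ∀ q < Q, g q < 4096)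
    (h : pack Q f = pack Q g) : ∀ q < Q, f q = g q := by
  induction Q generalizing f g with
  | zero => simp
  | succ Q ih =>
    rw [pack_succ, pack_succ] at h
    have h1 := hf 0 (by omega)
    have h2 := hg 0 (by omega)
    have h3 : f 0 = g 0 := by omega
    have h4 : pack Q (fun q => f (q+1)) = pack Q (fun q => g (q+1)) := by omega
    intro q hq
    cases q with
    | zero => exact h3
    | succ q => exact ih (fun q hq => hf (q+1) (by omega)) (fun q hq => hg (q+1) (by omega)) h4 q (by omega)

theorem land_split (a b x y : ℕ) (ha : a < 4096) (hb : b < 4096) :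
    (a + 4096 * x) &&& (b + 4096 * y) = (a &&& b) + 4096 * (x &&& y) := by
  have hab : a &&& b < 2 ^ 12 := Nat.and_lt_two_pow _ hb
  rw [show (4096:ℕ) = 2 ^ 12 by norm_num] at *
  apply Nat.eq_of_testBit_eq
  intro i
  rw [add_comm a, add_comm b, add_comm (a &&& b), Nat.testBit_and, Nat.testBit_two_pow_mul_add _ ha,
    Nat.testBit_two_pow_mul_add _ hb, Nat.testBit_two_pow_mul_add _ hab]
  split_ifs <;> simp

theorem pack_land {Q : ℕ} {f g : ℕ → ℕ} (hf : ∀ q < Q, f q < 4096) (hg : ∀ q < Q, g q < 4096) :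
    pack Q f &&& pack Q g = pack Q (fun q => f q &&& g q) := by
  induction Q generalizing f g with
  | zero => simp [pack]
  | succ Q ih =>
    rw [pack_succ, pack_succ, pack_succ, land_split _ _ _ _ (hf 0 (by omega)) (hg 0 (by omega)),
      ih (fun q hq => hf (q+1) (by omega)) (fun q hq => hg (q+1) (by omega))]

theorem pack_digits {Q W : ℕ} (h : W < 4096 ^ Q) : pack Q (fun q => W / 4096 ^ q % 4096) = W := by
  induction Q generalizing W with
  | zero => simp at h; simp [pack, h]
  | succ Q ih =>
    rw [pack_succ]
    have h2 : W / 4096 < 4096 ^ Q := by rw [Nat.div_lt_iff_lt_mul (by norm_num)]; rwa [pow_succ] at h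
    have h3 := ih h2
    simp only [Nat.div_div_eq_div_mul, ← pow_succ'] at h3
    rw [h3]; simp; omega

theorem rep_eq (Q : ℕ) : rep 12 Q = pack Q (fun _ => 1) := by
  have h : 4095 * pack Q (fun _ => 1) + 1 = 4096 ^ Q := by
    induction Q with
    | zero => rfl
    | succ Q ih => rw [pack_succ, pow_succ]; omega
  unfold rep
  show (2 ^ (12 * Q) - 1) / (2 ^ 12 - 1) = _
  rw [pow_mul, show (2:ℕ) ^ 12 = 4096 by norm_num, ← h]
  omega

theorem cumI_eq (f : ℕ → ℕ) (n : ℕ) : cumI f n = ∑ i ∈ Finset.range n, f i := by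
  induction n with
  | zero => rfl
  | succ n ih => rw [Finset.sum_range_succ, ← ih]; rfl

theorem allB_iff (f : ℕ → Bool) (n : ℕ) (h : allB f n = true) : ∀ i < n, f i = true := by
  induction n with
  | zero => simp
  | succ n ih =>
    have h1 : allB f (n+1) = Bool.rec false (allB f n) (f n) := rfl
    rw [h1] at h
    intro i hi
    cases hf : f n with
    | false => rw [hf] at h; simp at h
    | true =>
      rw [hf] at h
      rcases Nat.lt_succ_iff_lt_or_eq.1 hi with h2 | h2
      · exact ih h i h2
      · rw [h2, hf]

theorem cumI_pack (Q : ℕ) (I : ℕ → ℕ) (p : ℕ → ℕ) (n : ℕ)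
    (h : ∀ r < n, I r = pack Q (fun q => p (12 * q + r))) :
    cumI I n = pack Q (fun q => ∑ r ∈ Finset.range n, p (12 * q + r)) := by
  rw [cumI_eq]
  induction n with
  | zero => simp [pack_zero]
  | succ n ih =>
    simp only [Finset.sum_range_succ]
    rw [ih fun r hr => h r (by omega), h n (by omega), pack_add]

theorem sum_range_12 (p : ℕ → ℕ) (q r : ℕ) :
    ∑ i ∈ Finset.range (12 * q + r), p i
      = ∑ i ∈ Finset.range (12 * q), p i + ∑ j ∈ Finset.range r, p (12 * q + j) :=
  Finset.sum_range_add _ _ _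

theorem land2048 {x : ℕ} (hx : x < 4096) (h : x &&& 2048 = 2048) : 2048 ≤ x := by
  have : x &&& 2048 ≤ x := Nat.and_le_left
  omega

theorem land3584 {x : ℕ} (hx : x < 4096) (h : x &&& 3584 = 0) : x < 512 := by
  have h1 : (x &&& 3584) >>> 9 = (x >>> 9) &&& (3584 >>> 9) := Nat.shiftRight_and_distrib
  rw [h, show 3584 >>> 9 = 2 ^ 3 - 1 by decide, Nat.and_two_pow_sub_one_eq_mod, Nat.shiftRight_eq_div_pow,
    Nat.shiftRight_eq_div_pow] at h1
  omega

theorem dirChk_sound {Q w0 wl : ℕ} (hQ : 1 ≤ Q) {p n : ℕ → ℕ} {Ip Im : ℕ → ℕ}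
    (hp : ∀ i, p i ≤ 126) (hn : ∀ i, n i ≤ 126)
    (hIp : ∀ r < 12, Ip r = pack Q (fun q => p (12 * q + r)))
    (hIm : ∀ r < 12, Im r = pack Q (fun q => n (12 * q + r)))
    (h0 : w0 < 512) (h : dirChk Q (rep 12 Q) w0 wl Ip Im = true) :
    wl < 512 ∧ (w0 + ∑ i ∈ Finset.range (12 * Q), p i = wl + ∑ i ∈ Finset.range (12 * Q), n i) ∧
      ∀ t, t ≤ 12 * Q → ∑ i ∈ Finset.range t, n i ≤ w0 + ∑ i ∈ Finset.range t, p i := by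
  unfold dirChk at h
  revert h
  generalize (Nat.div _ 4095) = W
  intro h
  unfold dirChk2 at h
  simp only [Bool.and_eq_true, Nat.beq_eq, Nat.ble_eq] at h
  obtain ⟨h1, h2, h3, h4⟩ := h
  change 4095 * W + w0 + cumI Ip 12 = wl * 4096 ^ Q + cumI Im 12 at h1
  change W &&& (3584 * rep 12 Q) = 0 at h2
  change W < 4096 ^ Q at h3
  have h5 : ∀ i < 12, ((((4096 * W + w0) % 4096 ^ Q + 2048 * rep 12 Q) + cumI Ip (i+1)) - cumI Im (i+1))
      &&& (2048 * rep 12 Q) = 2048 * rep 12 Q := by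
    intro i hi
    have := allB_iff _ _ h4 i hi
    rw [Nat.beq_eq] at this
    exact this
  clear h4
  set ω : ℕ → ℕ := fun q => W / 4096 ^ q % 4096 with hω
  have hωlt : ∀ q, ω q < 4096 := fun q => Nat.mod_lt _ (by norm_num)
  have hW : pack Q ω = W := pack_digits h3
  -- digits of W are small
  have hω5 : ∀ q < Q, ω q < 512 := by
    rw [rep_eq, ← pack_mul, ← hW, pack_land (fun q _ => hωlt q) (by intros; norm_num)] at h2
    have := pack_inj (g := fun _ => 0) (fun q hq => lt_of_le_of_lt Nat.and_le_left (hωlt q)) (by simp)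
      (h2.trans (pack_zero Q).symm)
    intro q hq
    exact land3584 (hωlt q) (by simpa using this q hq)
  -- previous digit
  set ρ : ℕ → ℕ := fun q => if q = 0 then w0 else ω (q - 1) with hρ
  have hρ5 : ∀ q < Q, ρ q < 512 := by
    intro q hq
    simp only [hρ]
    split_ifs with hq0
    · exact h0
    · exact hω5 _ (by omega)
  obtain ⟨R, rfl⟩ : ∃ R, Q = R + 1 := ⟨Q - 1, by omega⟩
  have hshift : 4096 * W + w0 = pack (R+1) ρ + 4096 ^ (R+1) * ω R := by
    have e1 : pack (R+2) ρ = 4096 * W + w0 := by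
      rw [pack_succ, ← hW]
      simp only [hρ]
      simp
      ring
    rw [← e1, pack_high (R+1)]
    simp [hρ]
  have hmod : (4096 * W + w0) % 4096 ^ (R+1) = pack (R+1) ρ := by
    rw [hshift, Nat.add_mul_mod_self_left]
    exact Nat.mod_eq_of_lt (pack_lt fun q hq => (hρ5 q hq).trans (by norm_num))
  have hcp : ∀ k ≤ 12, cumI Ip k = pack (R+1) (fun q => ∑ r ∈ Finset.range k, p (12 * q + r)) :=
    fun k hk => cumI_pack _ _ _ _ fun r hr => hIp r (by omega)
  have hcn : ∀ k ≤ 12, cumI Im k = pack (R+1) (fun q => ∑ r ∈ Finset.range k, n (12 * q + r)) :=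
    fun k hk => cumI_pack _ _ _ _ fun r hr => hIm r (by omega)
  have bp : ∀ k ≤ 12, ∀ q, ∑ r ∈ Finset.range k, p (12 * q + r) ≤ 1512 := by
    intro k hk q
    refine (Finset.sum_le_card_nsmul _ _ 126 fun i _ => hp _).trans ?_
    simp; omega
  have bn : ∀ k ≤ 12, ∀ q, ∑ r ∈ Finset.range k, n (12 * q + r) ≤ 1512 := by
    intro k hk q
    refine (Finset.sum_le_card_nsmul _ _ 126 fun i _ => hn _).trans ?_
    simp; omega
  -- digit equations
  have hdig : pack (R+2) (fun q => if q < R + 1 then ρ q + ∑ r ∈ Finset.range 12, p (12 * q + r) else ω R)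
      = pack (R+2) (fun q => if q < R + 1 then ω q + ∑ r ∈ Finset.range 12, n (12 * q + r) else wl) := by
    rw [pack_high (R+1), pack_high (R+1)]
    have e1 : pack (R+1) (fun q => if q < R + 1 then ρ q + ∑ r ∈ Finset.range 12, p (12 * q + r) else ω R)
        = pack (R+1) ρ + cumI Ip 12 := by
      rw [hcp 12 le_rfl, ← pack_add]
      exact pack_congr fun q hq => by simp [hq]
    have e2 : pack (R+1) (fun q => if q < R + 1 then ω q + ∑ r ∈ Finset.range 12, n (12 * q + r) else wl)
        = W + cumI Im 12 := by
      rw [hcn 12 le_rfl]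
      rw [show W + pack (R+1) (fun q => ∑ r ∈ Finset.range 12, n (12 * q + r))
        = pack (R+1) ω + pack (R+1) (fun q => ∑ r ∈ Finset.range 12, n (12 * q + r)) by rw [hW], ← pack_add]
      exact pack_congr fun q hq => by simp [hq]
    rw [e1, e2]
    simp only [lt_irrefl, if_false]
    have : pack (R+1) ρ + 4096 ^ (R+1) * ω R + cumI Ip 12 = W + wl * 4096 ^ (R+1) + cumI Im 12 := by
      rw [← hshift]; omega
    linarith
  have hd1 : ∀ q < R + 1, ρ q + ∑ r ∈ Finset.range 12, p (12 * q + r) = ω q + ∑ r ∈ Finset.range 12, n (12 * q + r) := by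
    have hd := hdig
    rw [pack_high (R+1), pack_high (R+1)] at hd
    simp only [lt_irrefl, if_false] at hd
    have l1 : pack (R+1) (fun q => if q < R + 1 then ρ q + ∑ r ∈ Finset.range 12, p (12 * q + r) else ω R) < 4096 ^ (R+1) := by
      apply pack_lt; intro q hq; have := bp 12 le_rfl q; have := hρ5 q hq; rw [if_pos hq]; omega
    have l2 : pack (R+1) (fun q => if q < R + 1 then ω q + ∑ r ∈ Finset.range 12, n (12 * q + r) else wl) < 4096 ^ (R+1) := by
      apply pack_lt; intro q hq; have := bn 12 le_rfl q; have := hω5 q hq; rw [if_pos hq]; omega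
    have e3 : pack (R+1) (fun q => if q < R + 1 then ρ q + ∑ r ∈ Finset.range 12, p (12 * q + r) else ω R)
      = pack (R+1) (fun q => if q < R + 1 then ω q + ∑ r ∈ Finset.range 12, n (12 * q + r) else wl) := by
      have := congrArg (· % 4096 ^ (R+1)) hd
      simp only [Nat.add_mul_mod_self_left] at this
      rwa [Nat.mod_eq_of_lt l1, Nat.mod_eq_of_lt l2] at this
    intro q hq
    have := pack_inj (fun q hq => by
        have := bp 12 le_rfl q; have := hρ5 q hq; simp only [if_pos hq]; omega) (fun q hq => by
        have := bn 12 le_rfl q; have := hω5 q hq; simp only [if_pos hq]; omega) e3 q hq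
    simpa [hq] using this
  have hd2 : ω R = wl := by
    have hd := hdig
    rw [pack_high (R+1), pack_high (R+1)] at hd
    simp only [lt_irrefl, if_false] at hd
    have e3 : pack (R+1) (fun q => if q < R + 1 then ρ q + ∑ r ∈ Finset.range 12, p (12 * q + r) else ω R)
      = pack (R+1) (fun q => if q < R + 1 then ω q + ∑ r ∈ Finset.range 12, n (12 * q + r) else wl) :=
      pack_congr fun q hq => by simp only [if_pos hq]; exact hd1 q hq
    rw [e3] at hd
    exact Nat.eq_of_mul_eq_mul_left (by positivity) (Nat.add_left_cancel hd)
  -- running values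
  have hrun : ∀ q ≤ R + 1, w0 + ∑ i ∈ Finset.range (12 * q), p i = ρ q + ∑ i ∈ Finset.range (12 * q), n i := by
    intro q
    induction q with
    | zero => intro; simp [hρ]
    | succ q ih =>
      intro hq
      have e1 := ih (by omega)
      have e2 := hd1 q (by omega)
      have e3 : ρ (q+1) = ω q := by simp [hρ]
      rw [show 12 * (q+1) = 12 * q + 12 by ring, sum_range_12, sum_range_12, e3]
      omega
  have hfin := hrun (R+1) le_rfl
  have e4 : ρ (R+1) = wl := by simp [hρ, hd2]
  rw [e4] at hfin
  refine ⟨hd2 ▸ hω5 R (by omega), hfin, ?_⟩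
  intro t ht
  rcases Nat.eq_zero_or_pos t with rfl | htpos
  · simp
  obtain ⟨q, r, hr, rfl⟩ : ∃ q r, r < 12 ∧ t = 12 * q + (r + 1) :=
    ⟨(t-1)/12, (t-1)%12, Nat.mod_lt _ (by norm_num), by omega⟩
  have hq : q < R + 1 := by omega
  have e1 := hrun q hq.le
  rw [sum_range_12, sum_range_12]
  have key := h5 r hr
  rw [hmod, rep_eq, ← pack_mul, hcp (r+1) (by omega), hcn (r+1) (by omega), ← pack_add, ← pack_add] at key
  have e5 : pack (R+1) (fun q => ρ q + 2048 * 1 + ∑ j ∈ Finset.range (r+1), p (12 * q + j))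
      - pack (R+1) (fun q => ∑ j ∈ Finset.range (r+1), n (12 * q + j))
      = pack (R+1) (fun q => ρ q + 2048 * 1 + ∑ j ∈ Finset.range (r+1), p (12 * q + j) - ∑ j ∈ Finset.range (r+1), n (12 * q + j)) := by
    rw [Nat.sub_eq_iff_eq_add, ← pack_add]
    · apply pack_congr; intro q hq
      have := bn (r+1) (by omega) q
      omega
    · have : pack (R+1) (fun q => ρ q + 2048 * 1 + ∑ j ∈ Finset.range (r+1), p (12 * q + j))
       = pack (R+1) (fun q => ∑ j ∈ Finset.range (r+1), n (12 * q + j)) + pack (R+1) (fun q => ρ q + 2048 * 1 + ∑ j ∈ Finset.range (r+1), p (12 * q + j) - ∑ j ∈ Finset.range (r+1), n (12 * q + j)) := by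
        rw [← pack_add]
        apply pack_congr; intro q hq
        have := bn (r+1) (by omega) q
        omega
      omega
  have b6 : ∀ q < R + 1, ρ q + 2048 * 1 + ∑ j ∈ Finset.range (r+1), p (12 * q + j) - ∑ j ∈ Finset.range (r+1), n (12 * q + j) < 4096 := by
    intro q hq
    have := bp (r+1) (by omega) q
    have := hρ5 q hq
    omega
  rw [e5, pack_land b6 (by intros; norm_num)] at key
  have k2 := pack_inj (fun q hq => lt_of_le_of_lt Nat.and_le_left (b6 q hq)) (by intros; norm_num) key q hq
  have k3 := land2048 (b6 q hq) (by simpa using k2)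
  have := bn (r+1) (by omega) q
  omega

end

section

def bt (x t : ℕ) : ℕ := (x.testBit t).toNat

/-- number of list elements with bit `t` set -/
def bs (L : List ℕ) (t : ℕ) : ℕ := (L.map (fun x => bt x t)).sum
/-- value at position `t` of a list of bit planes -/
def bv : List ℕ → ℕ → ℕ
  | [], _ => 0
  | x :: l, t => bt x t + 2 * bv l t

@[simp] theorem bs_nil (t : ℕ) : bs [] t = 0 := rfl
@[simp] theorem bs_cons (x : ℕ) (L : List ℕ) (t : ℕ) : bs (x :: L) t = bt x t + bs L t := by simp [bs]
@[simp] theorem bt_zero (t : ℕ) : bt 0 t = 0 := by simp [bt]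

theorem bt_le (x t : ℕ) : bt x t ≤ 1 := by unfold bt; exact Bool.toNat_le _

theorem fa (s b x t : ℕ) : bt (Nat.xor (Nat.xor s b) x) t
    + 2 * bt (Nat.lor (Nat.land s b) (Nat.land x (Nat.xor s b))) t = bt s t + bt b t + bt x t := by
  change bt ((s ^^^ b) ^^^ x) t + 2 * bt ((s &&& b) ||| (x &&& (s ^^^ b))) t = _
  unfold bt
  simp only [Nat.testBit_xor, Nat.testBit_or, Nat.testBit_and]
  cases s.testBit t <;> cases b.testBit t <;> cases x.testBit t <;> rfl

theorem ha (s b t : ℕ) : bt (Nat.xor s b) t + 2 * bt (Nat.land s b) t = bt s t + bt b t := by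
  change bt (s ^^^ b) t + 2 * bt (s &&& b) t = _
  unfold bt
  simp only [Nat.testBit_xor, Nat.testBit_and]
  cases s.testBit t <;> cases b.testBit t <;> rfl

theorem fa' (a b c t : ℕ) : bt (Nat.xor (Nat.xor a b) c) t
    + 2 * bt (Nat.lor (Nat.land a b) (Nat.land c (Nat.xor a b))) t = bt a t + bt b t + bt c t := fa a b c t

theorem csaGo_cons_true (x : ℕ) (L : List ℕ) (s b : ℕ) (cs : List ℕ) :
    csaGo (x :: L) s true b cs = csaGo L (Nat.xor (Nat.xor s b) x) false 0
      (Nat.lor (Nat.land s b) (Nat.land x (Nat.xor s b)) :: cs) := by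
  have : csaGo (x :: L) s true b cs = Bool.rec
          (csaGo L (Nat.xor (Nat.xor s b) x) false 0 (Nat.lor (Nat.land s b) (Nat.land x (Nat.xor s b)) :: cs))
          (csaGo L (Nat.xor (Nat.xor s b) x) false 0 (Nat.lor (Nat.land s b) (Nat.land x (Nat.xor s b)) :: cs))
          (Nat.beq (Nat.xor (Nat.xor s b) x) 0) := rfl
  rw [this]
  cases Nat.beq (Nat.xor (Nat.xor s b) x) 0 <;> rfl

theorem csaGo_sound (L : List ℕ) : ∀ (s : ℕ) (pend : Bool) (b : ℕ) (cs : List ℕ) (t : ℕ),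
    bt (csaGo L s pend b cs).1 t + 2 * bs (csaGo L s pend b cs).2 t
      = bt s t + (if pend then bt b t else 0) + 2 * bs cs t + bs L t := by
  induction L with
  | nil =>
    intro s pend b cs t
    cases pend with
    | false => change bt s t + 2 * bs cs t = _; simp
    | true =>
      change bt (Nat.xor s b) t + 2 * bs (Nat.land s b :: cs) t = _
      have := ha s b t
      rw [bs_cons, bs_nil, if_pos rfl]; omega
  | cons x L ih =>
    intro s pend b cs t
    cases pend with
    | false =>
      change bt (csaGo L s true x cs).1 t + 2 * bs (csaGo L s true x cs).2 t = _
      rw [ih]; simp; ring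
    | true =>
      rw [csaGo_cons_true, ih]
      have := fa s b x t
      rw [bs_cons, bs_cons, if_pos rfl]
      simp only [Bool.false_eq_true, if_false]
      omega

theorem planes_sound (n : ℕ) : ∀ (L : List ℕ) (t : ℕ),
    (planes n L).1.length = n ∧ bv (planes n L).1 t + 2 ^ n * bs (planes n L).2 t = bs L t := by
  induction n with
  | zero => intro L t; exact ⟨rfl, by change bv [] t + 2 ^ 0 * bs L t = bs L t; simp [bv]⟩
  | succ n ih =>
    intro L t
    have e : planes (n+1) L = ((csaGo L 0 false 0 []).1 :: (planes n (csaGo L 0 false 0 []).2).1,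
      (planes n (csaGo L 0 false 0 []).2).2) := rfl
    have h1 := csaGo_sound L 0 false 0 [] t
    obtain ⟨h2, h3⟩ := ih (csaGo L 0 false 0 []).2 t
    rw [e]
    refine ⟨by simp [h2], ?_⟩
    simp only [bv]
    simp at h1
    rw [← h1, ← h3]; ring

theorem allZero_sound (L : List ℕ) (h : allZero L = true) (t : ℕ) : bs L t = 0 := by
  induction L with
  | nil => rfl
  | cons x L ih =>
    have e : allZero (x :: L) = Bool.rec false (allZero L) (Nat.beq x 0) := rfl
    rw [e] at h
    cases hx : Nat.beq x 0 with
    | false => rw [hx] at h; simp at h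
    | true =>
      rw [hx] at h
      rw [Nat.beq_eq] at hx
      rw [bs_cons, hx, ih h]; simp

theorem addPl_sound (L : List ℕ) : ∀ (c : ℕ) (M : List ℕ) (t : ℕ), M.length = L.length →
    (addPl L c M).1.length = L.length ∧
    bv (addPl L c M).1 t + 2 ^ L.length * bt (addPl L c M).2 t = bv L t + bv M t + bt c t := by
  induction L with
  | nil =>
    intro c M t hM
    obtain rfl : M = [] := List.eq_nil_of_length_eq_zero hM
    refine ⟨rfl, ?_⟩
    change bv [] t + 2 ^ 0 * bt c t = _
    simp [bv]
  | cons a L ih =>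
    intro c M t hM
    match M, hM with
    | b :: M, hM =>
      have e : addPl (a :: L) c (b :: M) = (Nat.xor (Nat.xor a b) c ::
        (addPl L (Nat.lor (Nat.land a b) (Nat.land c (Nat.xor a b))) M).1,
        (addPl L (Nat.lor (Nat.land a b) (Nat.land c (Nat.xor a b))) M).2) := rfl
      obtain ⟨h1, h2⟩ := ih (Nat.lor (Nat.land a b) (Nat.land c (Nat.xor a b))) M t (by simpa using hM)
      rw [e]
      refine ⟨by rw [List.length_cons, List.length_cons, h1], ?_⟩
      have h3 := fa a b c t
      simp only [bv, List.length_cons, pow_succ]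
      linarith

def bss (LL : List (List ℕ)) (t : ℕ) : ℕ := (LL.map (fun L => bs L t)).sum

theorem sumPl_sound (LL : List (List ℕ)) (h : (sumPl LL).2 = true) (t : ℕ) :
    (sumPl LL).1.length = 6 ∧ bv (sumPl LL).1 t = bss LL t := by
  induction LL with
  | nil =>
    refine ⟨rfl, ?_⟩
    change bv [0,0,0,0,0,0] t = 0
    simp [bv]
  | cons L LL ih =>
    have e : sumPl (L :: LL) = ((addPl (sumPl LL).1 0 (planes 6 L).1).1,
      and (sumPl LL).2 (and (allZero (planes 6 L).2) (Nat.beq (addPl (sumPl LL).1 0 (planes 6 L).1).2 0))) := rfl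
    rw [e] at h ⊢
    simp only [Bool.and_eq_true, Nat.beq_eq] at h
    obtain ⟨h1, h2, h3⟩ := h
    obtain ⟨h4, h5⟩ := ih h1
    obtain ⟨h6, h7⟩ := planes_sound 6 L t
    obtain ⟨h8, h9⟩ := addPl_sound (sumPl LL).1 0 (planes 6 L).1 t (by omega)
    rw [allZero_sound _ h2] at h7
    rw [h3] at h9
    refine ⟨by simpa [h4] using h8, ?_⟩
    simp only [bt_zero] at h9
    simp only [bss, List.map_cons, List.sum_cons]
    simp only [bss] at h5
    omega

theorem bv_lt (L : List ℕ) (t : ℕ) : bv L t < 2 ^ L.length := by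
  induction L with
  | nil => simp [bv]
  | cons x L ih => have := bt_le x t; simp only [bv, List.length_cons, pow_succ]; omega

theorem land_pack_ones (Q : ℕ) : ∀ y : ℕ, y &&& pack Q (fun _ => 1) = pack Q (fun q => bt y (12 * q)) := by
  induction Q with
  | zero => intro y; simp [pack]
  | succ Q ih =>
    intro y
    have e1 : y = y % 4096 + 4096 * (y / 4096) := by omega
    conv_lhs => rw [e1, pack_succ]
    rw [land_split _ _ _ _ (Nat.mod_lt _ (by norm_num)) (by norm_num), ih, pack_succ]
    congr 1
    · rw [Nat.and_one_is_mod]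
      simp only [bt, mul_zero, Nat.testBit_zero]
      rcases Nat.mod_two_eq_zero_or_one y with h | h
      · simp [h]
      · simp [h]
    · congr 1
      apply pack_congr
      intro q _
      simp only [bt]
      rw [show (4096:ℕ) = 2 ^ 12 by norm_num, Nat.testBit_div_two_pow]
      ring_nf

theorem ext_sound (Q r : ℕ) (L : List ℕ) : ext (rep 12 Q) r L = pack Q (fun q => bv L (12 * q + r)) := by
  induction L with
  | nil => change 0 = _; simp [bv, pack_zero]
  | cons x L ih =>
    have e : ext (rep 12 Q) r (x :: L) = (x >>> r &&& rep 12 Q) + 2 * ext (rep 12 Q) r L := rfl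
    rw [e, ih, rep_eq, land_pack_ones, ← pack_mul, ← pack_add]
    apply pack_congr
    intro q _
    simp only [bv, bt, Nat.testBit_shiftRight]
    rw [add_comm r]

/-- bits of `2^n / (2^p - 1)` -/
theorem pat_aux {p : ℕ} (hp : 2 ≤ p) (n : ℕ) : 2 ^ n / (2 ^ p - 1) < 2 ^ n ∧ 
    (∀ t, (2 ^ n / (2 ^ p - 1)).testBit t = decide (t + p ≤ n ∧ t % p = n % p)) := by
  have h2p : 4 ≤ 2 ^ p := by
    calc 4 = 2 ^ 2 := by norm_num
      _ ≤ 2 ^ p := Nat.pow_le_pow_right (by norm_num) hp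
  induction n using Nat.strong_induction_on with
  | _ n ih =>
    refine ⟨Nat.div_lt_self (by positivity) (by omega), ?_⟩
    rcases lt_or_ge n p with hn | hn
    · have : 2 ^ n / (2 ^ p - 1) = 0 := by
        apply Nat.div_eq_of_lt
        have : 2 ^ n ≤ 2 ^ (p-1) := Nat.pow_le_pow_right (by norm_num) (by omega)
        have h3 : 2 ^ p = 2 * 2 ^ (p-1) := by rw [← pow_succ']; congr 1; omega
        omega
      intro t
      rw [this]
      symm
      simp; omega
    · obtain ⟨m, rfl⟩ := Nat.exists_eq_add_of_le hn
      obtain ⟨h1, h2⟩ := ih m (by omega)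
      have e : 2 ^ (p + m) / (2 ^ p - 1) = 2 ^ m + 2 ^ m / (2 ^ p - 1) := by
        have : 2 ^ (p + m) = 2 ^ m + (2 ^ p - 1) * 2 ^ m := by
          rw [pow_add, Nat.sub_mul, one_mul]
          have : 2 ^ m ≤ 2 ^ p * 2 ^ m := Nat.le_mul_of_pos_left _ (by positivity)
          omega
        rw [this, Nat.add_mul_div_left _ _ (by omega), add_comm]
      intro t
      rw [e, show 2 ^ m = 2 ^ m * 1 by ring, Nat.testBit_two_pow_mul_add _ (by simpa using h1)]
      split_ifs with ht
      · rw [mul_one, h2]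
        simp only [Nat.add_mod_left, decide_eq_decide]
        constructor
        · rintro ⟨h3, h4⟩; exact ⟨by omega, h4⟩
        · rintro ⟨_, h4⟩
          refine ⟨?_, h4⟩
          have h5 := (Nat.modEq_iff_dvd' ht.le).1 h4
          have := Nat.le_of_dvd (by omega) h5
          omega
      · rcases Nat.eq_or_lt_of_le (not_lt.1 ht) with h3 | h3
        · subst h3; simp; omega
        · have : (1:ℕ).testBit (t - m) = false := by
            rw [Bool.eq_false_iff, ne_eq, Nat.testBit_one_eq_true_iff_self_eq_zero]; omega
          rw [this]; symm; simp; omega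

theorem pat_sound {B c a p t : ℕ} (hp : 2 ≤ p) (ha : a < p) (ht : t < B) :
    bt (pat B c a p) t = if (c + t) % p = a then 1 else 0 := by
  have e : pat B c a p = 2 ^ (B + (a + p - (c + B) % p) % p) / (2 ^ p - 1) := rfl
  set j := (a + p - (c + B) % p) % p with hj
  have hjp : j < p := Nat.mod_lt _ (by omega)
  have hmod : (c + (B + j)) % p = a := by
    have h1 : (c + B) % p < p := Nat.mod_lt _ (by omega)
    have h2 : j ≡ a + p - (c + B) % p [MOD p] := Nat.mod_modEq _ _
    have h3 : c + B ≡ (c + B) % p [MOD p] := (Nat.mod_modEq _ _).symm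
    have h4 := h3.add h2
    rw [show (c + B) % p + (a + p - (c + B) % p) = a + p by omega] at h4
    rw [← add_assoc]
    have h5 : (c + B + j) % p = (a + p) % p := h4
    rw [h5, Nat.add_mod_right, Nat.mod_eq_of_lt ha]
  have h1 := (pat_aux hp (B + j)).2 t
  have hiff : (t + p ≤ B + j ∧ t % p = (B + j) % p) ↔ (c + t) % p = a := by
    constructor
    · rintro ⟨_, h⟩
      rw [← hmod]
      exact Nat.ModEq.add_left c h
    · intro h
      have h2 : c + t ≡ c + (B + j) [MOD p] := by rw [← hmod] at h; exact h
      have h3 : t ≡ B + j [MOD p] := Nat.ModEq.add_left_cancel' c h2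
      refine ⟨?_, h3⟩
      have h5 := (Nat.modEq_iff_dvd' (by omega)).1 h3
      have := Nat.le_of_dvd (by omega) h5
      omega
  unfold bt
  rw [e, h1]
  by_cases h : (c + t) % p = a
  · simp [hiff.2 h, h]
  · rw [if_neg h, decide_eq_false (fun h' => h (hiff.1 h'))]; rfl

end

section

def hitPair (L : List ℕ) (i : ℕ) : ℕ := (L.map (fun e => if i % (2 * e) = e then 1 else 0)).sum
def hitSingle (L : List ℕ) (i : ℕ) : ℕ := (L.map (fun e => if i % e = 0 then 1 else 0)).sum

/-- number of hits at `i` -/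
def hits (pp ps : List (List ℕ)) (i : ℕ) : ℕ := hitPair pp.flatten i + hitSingle ps.flatten i

theorem bs_append (L M : List ℕ) (t : ℕ) : bs (L ++ M) t = bs L t + bs M t := by simp [bs]

theorem bss_eq (LL : List (List ℕ)) (t : ℕ) : bss LL t = bs LL.flatten t := by
  induction LL with
  | nil => rfl
  | cons L LL ih =>
    rw [List.flatten_cons, bs_append, ← ih]; simp [bss]

theorem bss_append (L M : List (List ℕ)) (t : ℕ) : bss (L ++ M) t = bss L t + bss M t := by simp [bss]

theorem mapB_eq (f : List ℕ → List ℕ) (L acc : List (List ℕ)) : mapB f L acc = L.map f ++ acc := by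
  induction L with
  | nil => rfl
  | cons x L ih => rw [List.map_cons, List.cons_append, ← ih]; rfl

theorem mapPair_eq (B c : ℕ) (L : List ℕ) : mapPair B c L = L.map (fun e => pat B c e (2 * e)) := by
  induction L with
  | nil => rfl
  | cons x L ih => rw [List.map_cons, ← ih]; rfl

theorem mapSingle_eq (B c : ℕ) (L : List ℕ) : mapSingle B c L = L.map (fun e => pat B c 0 e) := by
  induction L with
  | nil => rfl
  | cons x L ih => rw [List.map_cons, ← ih]; rfl

theorem mapBit_eq (c : ℕ) (L : List ℕ) : mapBit c L = L.map (fun e => 1 <<< (e - c)) := by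
  induction L with
  | nil => rfl
  | cons x L ih => rw [List.map_cons, ← ih]; rfl

theorem rangeChk_sound {c d : ℕ} {L : List ℕ} (h : rangeChk c d L = true) : ∀ e ∈ L, c ≤ e ∧ e < d := by
  induction L with
  | nil => simp
  | cons x L ih =>
    have e : rangeChk c d (x :: L) = Bool.rec false (Bool.rec false (rangeChk c d L) (Nat.ble (Nat.succ x) d)) (Nat.ble c x) := rfl
    rw [e] at h
    cases h1 : Nat.ble c x with
    | false => rw [h1] at h; simp at h
    | true =>
      rw [h1] at h
      cases h2 : Nat.ble (Nat.succ x) d with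
      | false => rw [h2] at h; simp at h
      | true =>
        rw [h2] at h
        rw [Nat.ble_eq] at h1 h2
        intro y hy
        rcases List.mem_cons.1 hy with rfl | hy
        · exact ⟨h1, h2⟩
        · exact ih h y hy

theorem allL_sound {f : List ℕ → Bool} {LL : List (List ℕ)} (h : allL f LL = true) : ∀ L ∈ LL, f L = true := by
  induction LL with
  | nil => simp
  | cons x LL ih =>
    have e : allL f (x :: LL) = Bool.rec false (allL f LL) (f x) := rfl
    rw [e] at h
    cases h1 : f x with
    | false => rw [h1] at h; simp at h
    | true =>
      rw [h1] at h
      intro y hy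
      rcases List.mem_cons.1 hy with rfl | hy
      · exact h1
      · exact ih h y hy

theorem allRange_sound {c d : ℕ} {LL : List (List ℕ)} (h : allL (rangeChk c d) LL = true) :
    ∀ e ∈ LL.flatten, c ≤ e ∧ e < d := by
  intro e he
  obtain ⟨L, hL, heL⟩ := List.mem_flatten.1 he
  exact rangeChk_sound (allL_sound h L hL) e heL

theorem bss_map (f : List ℕ → List ℕ) (g : ℕ → ℕ) (hf : ∀ L, f L = L.map g) (LL : List (List ℕ)) (t : ℕ) :
    bss (mapB f LL []) t = bs (LL.flatten.map g) t := by
  rw [mapB_eq, List.append_nil, bss_eq]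
  congr 1
  induction LL with
  | nil => rfl
  | cons L LL ih => simp [hf, ih]

theorem bss_steps {c : ℕ} {LL : List (List ℕ)} (h : ∀ e ∈ LL.flatten, c ≤ e) (t : ℕ) :
    bss (mapB (mapBit c) LL []) t = LL.flatten.count (c + t) := by
  rw [bss_map _ _ (mapBit_eq c)]
  revert h
  generalize LL.flatten = L
  intro h
  induction L with
  | nil => rfl
  | cons x L ih =>
    rw [List.map_cons, bs_cons, ih fun e he => h e (by simp [he]), List.count_cons, add_comm]
    congr 1
    have hx := h x (by simp)
    simp only [bt, Nat.testBit_shiftLeft]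
    by_cases h1 : x = c + t
    · subst h1; simp
    · have h2 : ¬ (x == c + t) := by simpa using h1
      simp only [h2]
      by_cases h3 : x - c ≤ t
      · have : (1:ℕ).testBit (t - (x - c)) = false := by
          rw [Bool.eq_false_iff, ne_eq, Nat.testBit_one_eq_true_iff_self_eq_zero]; omega
        simp [this]
      · simp [h3]

theorem bss_hits {B c : ℕ} {pp ps : List (List ℕ)} (h1 : ∀ e ∈ pp.flatten, 1 ≤ e) (h2 : ∀ e ∈ ps.flatten, 2 ≤ e)
    {t : ℕ} (ht : t < B) : bss (mapB (mapPair B c) pp (mapB (mapSingle B c) ps [])) t = hits pp ps (c + t) := by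
  rw [mapB_eq, bss_append, bss_map _ _ (mapSingle_eq B c)]
  have : bss (pp.map (mapPair B c)) t = bs (pp.flatten.map (fun e => pat B c e (2 * e))) t := by
    rw [← bss_map _ _ (mapPair_eq B c), mapB_eq, List.append_nil]
  rw [this]
  unfold hits
  congr 1
  · unfold hitPair bs
    rw [List.map_map]
    congr 1
    apply List.map_congr_left
    intro e he
    have := h1 e he
    exact pat_sound (by omega) (by omega) ht
  · unfold hitSingle bs
    rw [List.map_map]
    congr 1
    apply List.map_congr_left
    intro e he
    have := h2 e he
    exact pat_sound (by omega) (by omega) ht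

/-- semantic content of one direction on a chunk -/
def Seg (p n : ℕ → ℕ) (c B w0 w1 : ℕ) : Prop :=
  w1 < 512 ∧ (w0 + ∑ i ∈ Finset.range B, p (c + i) = w1 + ∑ i ∈ Finset.range B, n (c + i)) ∧
      ∀ t, t ≤ B → ∑ i ∈ Finset.range t, n (c + i) ≤ w0 + ∑ i ∈ Finset.range t, p (c + i)

theorem dir_seg {Q w0 wl c : ℕ} (hQ : 1 ≤ Q) {X1 X2 Y1 Y2 : List (List ℕ)} {p n : ℕ → ℕ}
    (hX1 : (sumPl X1).2 = true) (hX2 : (sumPl X2).2 = true) (hY1 : (sumPl Y1).2 = true) (hY2 : (sumPl Y2).2 = true)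
    (hp : ∀ t < 12 * Q, bss X1 t + bss X2 t = p (c + t)) (hn : ∀ t < 12 * Q, bss Y1 t + bss Y2 t = n (c + t))
    (h0 : w0 < 512)
    (h : dirChk Q (rep 12 Q) w0 wl (fun r => Nat.add (ext (rep 12 Q) r (sumPl X1).1) (ext (rep 12 Q) r (sumPl X2).1))
      (fun r => Nat.add (ext (rep 12 Q) r (sumPl Y1).1) (ext (rep 12 Q) r (sumPl Y2).1)) = true) :
    Seg p n c (12 * Q) w0 wl := by
  have key : ∀ (X : List (List ℕ)) (hX : (sumPl X).2 = true) (i : ℕ), bss X i ≤ 63 := by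
    intro X hX i
    obtain ⟨h1, h2⟩ := sumPl_sound X hX i
    have := bv_lt (sumPl X).1 i
    rw [h1, h2] at this
    omega
  have kext : ∀ (X : List (List ℕ)) (hX : (sumPl X).2 = true) (r : ℕ),
      ext (rep 12 Q) r (sumPl X).1 = pack Q (fun q => bss X (12 * q + r)) := by
    intro X hX r
    rw [ext_sound]
    exact pack_congr fun q _ => (sumPl_sound X hX _).2
  obtain ⟨h1, h2, h3⟩ := dirChk_sound hQ (p := fun i => bss X1 i + bss X2 i) (n := fun i => bss Y1 i + bss Y2 i)
    (fun i => by have := key X1 hX1 i; have := key X2 hX2 i; omega)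
    (fun i => by have := key Y1 hY1 i; have := key Y2 hY2 i; omega)
    (fun r _ => by
      change ext (rep 12 Q) r (sumPl X1).1 + ext (rep 12 Q) r (sumPl X2).1 = _
      rw [kext X1 hX1, kext X2 hX2, ← pack_add])
    (fun r _ => by
      change ext (rep 12 Q) r (sumPl Y1).1 + ext (rep 12 Q) r (sumPl Y2).1 = _
      rw [kext Y1 hY1, kext Y2 hY2, ← pack_add]) h0 h
  have sp : ∀ t ≤ 12 * Q, ∑ i ∈ Finset.range t, (bss X1 i + bss X2 i) = ∑ i ∈ Finset.range t, p (c + i) :=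
    fun t ht => Finset.sum_congr rfl fun i hi => hp i (by rw [Finset.mem_range] at hi; omega)
  have sn : ∀ t ≤ 12 * Q, ∑ i ∈ Finset.range t, (bss Y1 i + bss Y2 i) = ∑ i ∈ Finset.range t, n (c + i) :=
    fun t ht => Finset.sum_congr rfl fun i hi => hn i (by rw [Finset.mem_range] at hi; omega)
  refine ⟨h1, ?_, ?_⟩
  · rw [← sp _ le_rfl, ← sn _ le_rfl]; exact h2
  · intro t ht
    rw [← sp _ ht, ← sn _ ht]; exact h3 t ht

def WF (pp np ps ns : List (List ℕ)) : Prop :=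
  (∀ e ∈ pp.flatten, 1 ≤ e) ∧ (∀ e ∈ np.flatten, 1 ≤ e) ∧ (∀ e ∈ ps.flatten, 2 ≤ e) ∧ (∀ e ∈ ns.flatten, 2 ≤ e)

theorem chunk2_sound {pp np ps ns : List (List ℕ)} (hwf : WF pp np ps ns) {c Q u0 u1 l0 l1 : ℕ}
    {up um lp lm : List (List ℕ)} (hQ : 1 ≤ Q) (hu : u0 < 512) (hl : l0 < 512)
    (h : chunk2 pp np ps ns c Q u0 u1 l0 l1 up um lp lm = true) :
    (∀ e ∈ up.flatten, c ≤ e ∧ e < c + 12 * Q) ∧ (∀ e ∈ um.flatten, c ≤ e ∧ e < c + 12 * Q) ∧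
    (∀ e ∈ lp.flatten, c ≤ e ∧ e < c + 12 * Q) ∧ (∀ e ∈ lm.flatten, c ≤ e ∧ e < c + 12 * Q) ∧
    Seg (fun i => hits pp ps i + up.flatten.count i) (fun i => hits np ns i + um.flatten.count i) c (12 * Q) u0 u1 ∧
    Seg (fun i => hits np ns i + lm.flatten.count i) (fun i => hits pp ps i + lp.flatten.count i) c (12 * Q) l0 l1 := by
  unfold chunk2 chunk3 at h
  simp only [Bool.and_eq_true] at h
  obtain ⟨r1, r2, r3, r4, s1, s2, s3, s4, s5, s6, d1, d2⟩ := h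
  obtain ⟨w1, w2, w3, w4⟩ := hwf
  have r1' := allRange_sound r1
  have r2' := allRange_sound r2
  have r3' := allRange_sound r3
  have r4' := allRange_sound r4
  refine ⟨r1', r2', r3', r4', ?_, ?_⟩
  · exact dir_seg hQ s1 s3 s2 s4
      (fun t ht => by rw [bss_steps (fun e he => (r1' e he).1)]; congr 1; exact bss_hits w1 w3 ht)
      (fun t ht => by rw [bss_steps (fun e he => (r2' e he).1)]; congr 1; exact bss_hits w2 w4 ht) hu d1
  · exact dir_seg hQ s2 s6 s1 s5
      (fun t ht => by rw [bss_steps (fun e he => (r4' e he).1)]; congr 1; exact bss_hits w2 w4 ht)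
      (fun t ht => by rw [bss_steps (fun e he => (r3' e he).1)]; congr 1; exact bss_hits w1 w3 ht) hl d2

/-- accumulated content -/
def Dir (p n : ℕ → ℕ) (c w : ℕ) : Prop :=
  w < 512 ∧ (∑ i ∈ Finset.Ico 2 c, p i = w + ∑ i ∈ Finset.Ico 2 c, n i) ∧
    ∀ t, t ≤ c → ∑ i ∈ Finset.Ico 2 t, n i ≤ ∑ i ∈ Finset.Ico 2 t, p i

theorem Dir.step {p n p' n' p2 n2 : ℕ → ℕ} {c B w w' : ℕ} (hc : 2 ≤ c) (h : Dir p n c w) (hs : Seg p' n' c B w w')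
    (e1 : ∀ i < c, p2 i = p i) (e2 : ∀ i < c, n2 i = n i) (e3 : ∀ i, c ≤ i → p2 i = p' i)
    (e4 : ∀ i, c ≤ i → n2 i = n' i) : Dir p2 n2 (c + B) w' := by
  obtain ⟨h1, h2, h3⟩ := h
  obtain ⟨g1, g2, g3⟩ := hs
  have a1 : ∀ t ≤ c, ∑ i ∈ Finset.Ico 2 t, p2 i = ∑ i ∈ Finset.Ico 2 t, p i :=
    fun t ht => Finset.sum_congr rfl fun i hi => e1 i (by rw [Finset.mem_Ico] at hi; omega)
  have a2 : ∀ t ≤ c, ∑ i ∈ Finset.Ico 2 t, n2 i = ∑ i ∈ Finset.Ico 2 t, n i :=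
    fun t ht => Finset.sum_congr rfl fun i hi => e2 i (by rw [Finset.mem_Ico] at hi; omega)
  have a3 : ∀ t, ∑ i ∈ Finset.Ico 2 (c + t), p2 i = ∑ i ∈ Finset.Ico 2 c, p i + ∑ i ∈ Finset.range t, p' (c + i) := by
    intro t
    rw [← Finset.sum_Ico_consecutive _ hc (Nat.le_add_right c t), a1 c le_rfl, Finset.sum_Ico_eq_sum_range _ c, Nat.add_sub_cancel_left]
    congr 1
    exact Finset.sum_congr rfl fun i _ => e3 _ (by omega)
  have a4 : ∀ t, ∑ i ∈ Finset.Ico 2 (c + t), n2 i = ∑ i ∈ Finset.Ico 2 c, n i + ∑ i ∈ Finset.range t, n' (c + i) := by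
    intro t
    rw [← Finset.sum_Ico_consecutive _ hc (Nat.le_add_right c t), a2 c le_rfl, Finset.sum_Ico_eq_sum_range _ c, Nat.add_sub_cancel_left]
    congr 1
    exact Finset.sum_congr rfl fun i _ => e4 _ (by omega)
  refine ⟨g1, ?_, ?_⟩
  · rw [a3, a4]; omega
  · intro t ht
    rcases le_total t c with h | h
    · rw [a1 t h, a2 t h]; exact h3 t h
    · obtain ⟨k, rfl⟩ := Nat.exists_eq_add_of_le h
      rw [a3, a4]
      have := g3 k (by omega)
      omega

/-- weights of a list of steps -/
noncomputable def qs1 (L : List ℕ) : ℕ :=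
  List.rec (motive := fun _ => ℕ) 0 (fun N _ ih => Nat.add (Nat.succ (Nat.div (Nat.pow 2 60) N)) ih) L
noncomputable def qs2 (LL : List (List ℕ)) : ℕ :=
  List.rec (motive := fun _ => ℕ) 0 (fun L _ ih => Nat.add (qs1 L) ih) LL

def qw (L : List ℕ) : ℕ := (L.map (fun N => 2 ^ 60 / N + 1)).sum

theorem qs1_eq (L : List ℕ) : qs1 L = qw L := by
  induction L with
  | nil => rfl
  | cons N L ih =>
    change (2 ^ 60 / N + 1) + qs1 L = _
    rw [ih]; simp [qw]

theorem qs2_eq (LL : List (List ℕ)) : qs2 LL = qw LL.flatten := by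
  induction LL with
  | nil => rfl
  | cons L LL ih =>
    change qs1 L + qs2 LL = _
    rw [ih, qs1_eq]; simp [qw]

theorem qw_append (L M : List ℕ) : qw (L ++ M) = qw L + qw M := by simp [qw]

/-- full chunk check -/
noncomputable def fullChk2 (pp np ps ns : List (List ℕ)) (c Q u0 u1 l0 l1 a b d e a' b' d' e' : ℕ)
    (up um lp lm : List (List ℕ)) : Bool :=
  and (Nat.ble 1 Q) (and (Nat.beq (Nat.add a (qs2 up)) a') (and (Nat.beq (Nat.add b (qs2 um)) b')
   (and (Nat.beq (Nat.add d (qs2 lp)) d') (and (Nat.beq (Nat.add e (qs2 lm)) e')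
    (chunk2 pp np ps ns c Q u0 u1 l0 l1 up um lp lm)))))

noncomputable def fullChk (pp np ps ns : List (List ℕ)) (K c u0 l0 a b d e Q u1 l1 a' b' d' e' N0 nb tu tl : ℕ) : Bool :=
  fullChk2 pp np ps ns c Q u0 u1 l0 l1 a b d e a' b' d' e'
    (decPB K nb N0 tu) (decMB K nb N0 tu) (decPB K nb N0 tl) (decMB K nb N0 tl)

/-- the accumulated statement for all arguments below `c` -/
def BI (pp np ps ns : List (List ℕ)) (c u l a b d e : ℕ) : Prop :=
  2 ≤ c ∧ ∃ Up Um Lp Lm : List ℕ, (∀ N ∈ Up, 2 ≤ N ∧ N < c) ∧ (∀ N ∈ Um, 2 ≤ N ∧ N < c) ∧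
    (∀ N ∈ Lp, 2 ≤ N ∧ N < c) ∧ (∀ N ∈ Lm, 2 ≤ N ∧ N < c) ∧
    qw Up = a ∧ qw Um = b ∧ qw Lp = d ∧ qw Lm = e ∧
    Dir (fun i => hits pp ps i + Up.count i) (fun i => hits np ns i + Um.count i) c u ∧
    Dir (fun i => hits np ns i + Lm.count i) (fun i => hits pp ps i + Lp.count i) c l

theorem BI.init (pp np ps ns : List (List ℕ)) : BI pp np ps ns 2 0 0 0 0 0 0 := by
  refine ⟨le_rfl, [], [], [], [], by simp, by simp, by simp, by simp, rfl, rfl, rfl, rfl, ?_, ?_⟩ <;>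
  · refine ⟨by norm_num, by simp, ?_⟩
    intro t ht
    rw [Finset.Ico_eq_empty_of_le ht]; simp

theorem count_old {L M : List ℕ} {c i : ℕ} (hM : ∀ e ∈ M, c ≤ e) (hi : i < c) :
    (L ++ M).count i = L.count i := by
  have h0 : M.count i = 0 := List.count_eq_zero_of_not_mem (fun h => by have := hM i h; omega)
  rw [List.count_append, h0, add_zero]

theorem count_new {L M : List ℕ} {c i : ℕ} (hL : ∀ e ∈ L, e < c) (hi : c ≤ i) :
    (L ++ M).count i = M.count i := by
  rw [List.count_append, List.count_eq_zero_of_not_mem (fun h => by have := hL i h; omega), zero_add]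

theorem BI.step {pp np ps ns : List (List ℕ)} (hwf : WF pp np ps ns) {c u l a b d e : ℕ}
    (h : BI pp np ps ns c u l a b d e) (K Q N0 nb tu tl : ℕ) {u1 l1 a' b' d' e' : ℕ}
    (hk : fullChk pp np ps ns K c u l a b d e Q u1 l1 a' b' d' e' N0 nb tu tl = true) :
    BI pp np ps ns (c + 12 * Q) u1 l1 a' b' d' e' := by
  unfold fullChk at hk
  revert hk
  generalize decPB K nb N0 tu = up
  generalize decMB K nb N0 tu = um
  generalize decPB K nb N0 tl = lp
  generalize decMB K nb N0 tl = lm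
  intro hk
  unfold fullChk2 at hk
  simp only [Bool.and_eq_true, Nat.beq_eq, Nat.ble_eq] at hk
  obtain ⟨hQ, q1, q2, q3, q4, hk⟩ := hk
  obtain ⟨hc, Up, Um, Lp, Lm, i1, i2, i3, i4, v1, v2, v3, v4, D1, D2⟩ := h
  obtain ⟨r1, r2, r3, r4, S1, S2⟩ := chunk2_sound hwf hQ D1.1 D2.1 hk
  have mem : ∀ {L M : List ℕ}, (∀ N ∈ L, 2 ≤ N ∧ N < c) → (∀ N ∈ M, c ≤ N ∧ N < c + 12 * Q) →
      ∀ N ∈ L ++ M, 2 ≤ N ∧ N < c + 12 * Q := by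
    intro L M hL hM N hN
    rcases List.mem_append.1 hN with h | h
    · have := hL N h; omega
    · have := hM N h; omega
  have qq : ∀ {L : List ℕ} {M : List (List ℕ)} {x y : ℕ}, qw L = x → Nat.add x (qs2 M) = y → qw (L ++ M.flatten) = y := by
    intro L M x y h1 h2
    rw [qw_append, h1, ← qs2_eq]; exact h2
  refine ⟨by omega, Up ++ up.flatten, Um ++ um.flatten, Lp ++ lp.flatten, Lm ++ lm.flatten, mem i1 r1, mem i2 r2,
    mem i3 r3, mem i4 r4, qq v1 q1, qq v2 q2, qq v3 q3, qq v4 q4, ?_, ?_⟩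
  · refine D1.step hc S1 ?_ ?_ ?_ ?_
    · intro i hi; rw [count_old (fun e he => (r1 e he).1) hi]
    · intro i hi; rw [count_old (fun e he => (r2 e he).1) hi]
    · intro i hi; rw [count_new (fun e he => (i1 e he).2) hi]
    · intro i hi; rw [count_new (fun e he => (i2 e he).2) hi]
  · refine D2.step hc S2 ?_ ?_ ?_ ?_
    · intro i hi; rw [count_old (fun e he => (r4 e he).1) hi]
    · intro i hi; rw [count_old (fun e he => (r3 e he).1) hi]
    · intro i hi; rw [count_new (fun e he => (i4 e he).2) hi]
    · intro i hi; rw [count_new (fun e he => (i3 e he).2) hi]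

end

section

/-- real sum over a list -/
noncomputable def ls (L : List ℕ) (g : ℕ → ℝ) : ℝ := (L.map g).sum
@[simp] theorem ls_nil (g : ℕ → ℝ) : ls [] g = 0 := rfl
@[simp] theorem ls_cons (x : ℕ) (L : List ℕ) (g : ℕ → ℝ) : ls (x :: L) g = g x + ls L g := by simp [ls]

theorem ls_le {L : List ℕ} {f g : ℕ → ℝ} (h : ∀ x ∈ L, f x ≤ g x) : ls L f ≤ ls L g := by
  induction L with
  | nil => simp
  | cons x L ih =>
    rw [ls_cons, ls_cons]
    exact add_le_add (h x (by simp)) (ih fun y hy => h y (by simp [hy]))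
theorem ls_congr {L : List ℕ} {f g : ℕ → ℝ} (h : ∀ x ∈ L, f x = g x) : ls L f = ls L g :=
  le_antisymm (ls_le fun x hx => (h x hx).le) (ls_le fun x hx => (h x hx).ge)
theorem ls_const (L : List ℕ) (c : ℝ) : ls L (fun _ => c) = L.length * c := by simp [ls]
theorem ls_add (L : List ℕ) (f g : ℕ → ℝ) : ls L (fun x => f x + g x) = ls L f + ls L g := by
  induction L with
  | nil => simp
  | cons x L ih => simp only [ls_cons, ih]; ring
theorem ls_sub (L : List ℕ) (f g : ℕ → ℝ) : ls L (fun x => f x - g x) = ls L f - ls L g := by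
  induction L with
  | nil => simp
  | cons x L ih => simp only [ls_cons, ih]; ring
theorem ls_mul (L : List ℕ) (c : ℝ) (f : ℕ → ℝ) : ls L (fun x => c * f x) = c * ls L f := by
  induction L with
  | nil => simp
  | cons x L ih => simp only [ls_cons, ih]; ring

/-- weighted pairs `(e, t), (2 * e, -t)` -/
def prs (t : ℝ) : List ℕ → List (ℕ × ℝ)
  | [] => []
  | e :: L => (e, t) :: (2 * e, -t) :: prs t L
def sgl (t : ℝ) (L : List ℕ) : List (ℕ × ℝ) := L.map (fun e => (e, t))

theorem lsum_prs (t : ℝ) (L : List ℕ) (f : ℕ → ℝ) : lsum (prs t L) f = t * ls L (fun e => f e - f (2 * e)) := by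
  induction L with
  | nil => simp [prs]
  | cons e L ih => simp only [prs, lsum_cons, ls_cons, ih]; ring
theorem lsum_sgl (t : ℝ) (L : List ℕ) (f : ℕ → ℝ) : lsum (sgl t L) f = t * ls L f := by
  induction L with
  | nil => simp [sgl]
  | cons e L ih => simp only [sgl, List.map_cons, lsum_cons, ls_cons] at *; rw [ih]; ring
theorem labs_prs (t : ℝ) (L : List ℕ) (f : ℕ → ℝ) : labs (prs t L) f = |t| * ls L (fun e => f e + f (2 * e)) := by
  induction L with
  | nil => simp [prs]
  | cons e L ih => simp only [prs, labs_cons, ls_cons, ih, abs_neg]; ring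
theorem labs_sgl (t : ℝ) (L : List ℕ) (f : ℕ → ℝ) : labs (sgl t L) f = |t| * ls L f := by
  induction L with
  | nil => simp [sgl]
  | cons e L ih => simp only [sgl, List.map_cons, labs_cons, ls_cons] at *; rw [ih]; ring

noncomputable def itm (pp np ps ns : List (List ℕ)) : List (ℕ × ℝ) :=
  prs 1 pp.flatten ++ prs (-1) np.flatten ++ sgl 1 ps.flatten ++ sgl (-1) ns.flatten

theorem lsum_itm (pp np ps ns : List (List ℕ)) (f : ℕ → ℝ) : lsum (itm pp np ps ns) f
    = ls pp.flatten (fun e => f e - f (2 * e)) - ls np.flatten (fun e => f e - f (2 * e))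
      + ls ps.flatten f - ls ns.flatten f := by
  simp only [itm, lsum_append, lsum_prs, lsum_sgl]; ring

/-- floor sums, as natural numbers -/
def fls (pp ps : List (List ℕ)) (m : ℕ) : ℕ :=
  (pp.flatten.map (fun e => m / e - m / (2 * e))).sum + (ps.flatten.map (fun e => m / e)).sum

theorem sum_hitPair (L : List ℕ) (hL : ∀ e ∈ L, 1 ≤ e) (m : ℕ) :
    ∑ i ∈ Finset.Ico 1 (m+1), hitPair L i = (L.map (fun e => m / e - m / (2 * e))).sum := by
  induction L with
  | nil => simp [hitPair]
  | cons e L ih =>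
    have h0 : ∀ i, hitPair (e :: L) i = (if i % (2 * e) = e then 1 else 0) + hitPair L i := by
      intro i; simp [hitPair]
    simp only [h0, Finset.sum_add_distrib, List.map_cons, List.sum_cons]
    rw [ih fun x hx => hL x (by simp [hx])]
    congr 1
    have he := hL e (by simp)
    clear ih h0
    have key : ∀ m, (∑ i ∈ Finset.Ico 1 (m+1), if i % (2 * e) = e then 1 else 0) + m / (2 * e) = m / e := by
      intro m
      induction m with
      | zero => simp
      | succ m ih =>
        rw [Finset.sum_Ico_succ_top (by omega), Nat.succ_div, Nat.succ_div, ← ih]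
        have h3 : (if (m+1) % (2 * e) = e then 1 else 0) + (if 2 * e ∣ m + 1 then 1 else 0)
          = if e ∣ m + 1 then 1 else 0 := by
          have hr : (m+1) % (2*e) < 2 * e := Nat.mod_lt _ (by omega)
          have hd := Nat.div_add_mod (m+1) (2*e)
          set q := (m+1) / (2*e)
          set r := (m+1) % (2*e) with hrdef
          have hdvd : e ∣ m + 1 ↔ e ∣ r := by
            rw [← hd, mul_assoc, mul_comm 2, mul_assoc]
            exact Nat.dvd_add_right (Dvd.intro _ rfl)
          have hdvd2 : 2 * e ∣ m + 1 ↔ r = 0 := Nat.dvd_iff_mod_eq_zero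
          have hdvd3 : e ∣ r ↔ r = 0 ∨ r = e := by
            constructor
            · rintro ⟨k, hk⟩
              have : k < 2 := by
                by_contra hk2
                have : e * 2 ≤ e * k := Nat.mul_le_mul_left _ (by omega)
                omega
              interval_cases k
              · left; omega
              · right; omega
            · rintro (h | h) <;> simp [h]
          simp only [hdvd, hdvd2, hdvd3]
          by_cases h1 : r = 0
          · have : r ≠ e := by omega
            simp [h1]; omega
          · by_cases h2 : r = e
            · simp [h2]; omega
            · simp [h1, h2]
        omega
    have := key m
    omega

theorem sum_hitSingle (L : List ℕ) (m : ℕ) :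
    ∑ i ∈ Finset.Ico 1 (m+1), hitSingle L i = (L.map (fun e => m / e)).sum := by
  induction L with
  | nil => simp [hitSingle]
  | cons e L ih =>
    have h0 : ∀ i, hitSingle (e :: L) i = (if i % e = 0 then 1 else 0) + hitSingle L i := by
      intro i; simp [hitSingle]
    simp only [h0, Finset.sum_add_distrib, List.map_cons, List.sum_cons]
    rw [ih]
    congr 1
    clear ih h0
    induction m with
    | zero => simp
    | succ m ih =>
      rw [Finset.sum_Ico_succ_top (by omega), Nat.succ_div, ← ih]
      simp only [Nat.dvd_iff_mod_eq_zero]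

theorem sum_hits {pp ps : List (List ℕ)} (h1 : ∀ e ∈ pp.flatten, 1 ≤ e) (m : ℕ) :
    ∑ i ∈ Finset.Ico 1 (m+1), hits pp ps i = fls pp ps m := by
  simp only [hits, Finset.sum_add_distrib]
  rw [sum_hitPair _ h1, sum_hitSingle]; rfl

theorem natsum_cast (L : List ℕ) (f : ℕ → ℕ) : (((L.map f).sum : ℕ) : ℝ) = ls L (fun e => (f e : ℝ)) := by
  induction L with
  | nil => simp
  | cons x L ih => simp [← ih]

theorem fls_cast (pp ps : List (List ℕ)) (m : ℕ) : (fls pp ps m : ℝ)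
    = ls pp.flatten (fun e => ((m / e : ℕ):ℝ) - ((m / (2 * e) : ℕ) : ℝ)) + ls ps.flatten (fun e => ((m / e : ℕ) : ℝ)) := by
  unfold fls
  rw [Nat.cast_add, natsum_cast, natsum_cast]
  congr 1
  apply ls_congr
  intro e _
  rw [Nat.cast_sub]
  rw [mul_comm, ← Nat.div_div_eq_div_mul]
  exact Nat.div_le_self _ _

theorem Ct_itm (pp np ps ns : List (List ℕ)) (m : ℕ) : Ct (itm pp np ps ns) m
    = 1 - fls pp ps m + fls np ns m + sC (itm pp np ps ns) * m := by
  unfold Ct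
  rw [lsum_itm, fls_cast, fls_cast]; ring

theorem div_bounds (m e : ℕ) (he : 1 ≤ e) : (m:ℝ) / e - 1 ≤ ((m / e : ℕ):ℝ) ∧ ((m / e : ℕ):ℝ) ≤ (m:ℝ) / e := by
  have he' : (0:ℝ) < e := by exact_mod_cast he
  refine ⟨?_, Nat.cast_div_le⟩
  rw [sub_le_iff_le_add, div_le_iff₀ he']
  have := Nat.div_add_mod m e
  have h2 := Nat.mod_lt m (show e > 0 by omega)
  have h3 : m ≤ (m / e + 1) * e := by nlinarith
  exact_mod_cast h3

theorem pair_bounds (m e : ℕ) (he : 1 ≤ e) :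
    (m:ℝ) * (1 / e - 1 / (2 * e : ℕ)) - 1 / 2 ≤ ((m / e : ℕ):ℝ) - ((m / (2 * e) : ℕ):ℝ) ∧
    ((m / e : ℕ):ℝ) - ((m / (2 * e) : ℕ):ℝ) ≤ (m:ℝ) * (1 / e - 1 / (2 * e : ℕ)) + 1 / 2 := by
  have he' : (0:ℝ) < e := by exact_mod_cast he
  have e1 : (m:ℝ) * (1 / e - 1 / (2 * e : ℕ)) = m / (2 * e) := by push_cast; field_simp; norm_num
  rw [e1]
  obtain ⟨q, r, hr, rfl⟩ : ∃ q r, r < 2 * e ∧ m = 2 * e * q + r :=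
    ⟨m / (2*e), m % (2*e), Nat.mod_lt _ (by omega), (Nat.div_add_mod _ _).symm⟩
  have h1 : (2 * e * q + r) / (2 * e) = q := by
    rw [Nat.mul_add_div (by omega), Nat.div_eq_of_lt hr, add_zero]
  have h2 : (2 * e * q + r) / e = 2 * q + r / e := by
    rw [show 2 * e * q + r = e * (2 * q) + r by ring, Nat.mul_add_div (by omega)]
  rw [h1, h2]
  have hr' : (r:ℝ) < 2 * e := by exact_mod_cast hr
  have e2 : (((2 * e * q + r : ℕ)) : ℝ) / (2 * e) = q + r / (2 * e) := by push_cast; field_simp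
  rw [e2]
  push_cast
  rcases lt_or_ge r e with h3 | h3
  · rw [Nat.div_eq_of_lt h3]
    have h4 : (r:ℝ) < e := by exact_mod_cast h3
    have h5 : (r:ℝ) / (2 * e) ≤ 1 / 2 := by rw [div_le_div_iff₀ (by positivity) (by norm_num)]; linarith
    have h6 : 0 ≤ (r:ℝ) / (2 * e) := by positivity
    constructor <;> push_cast <;> linarith
  · have : r / e = 1 := by
      rw [Nat.div_eq_iff (by omega)]; omega
    rw [this]
    have h4 : (e:ℝ) ≤ r := by exact_mod_cast h3
    have h5 : (r:ℝ) / (2 * e) ≤ 1 := by rw [div_le_one (by positivity)]; linarith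
    have h6 : 1 / 2 ≤ (r:ℝ) / (2 * e) := by rw [div_le_div_iff₀ (by norm_num) (by positivity)]; linarith
    constructor <;> push_cast <;> linarith

theorem fls_bounds {pp ps : List (List ℕ)} (h1 : ∀ e ∈ pp.flatten, 1 ≤ e) (h2 : ∀ e ∈ ps.flatten, 2 ≤ e) (m : ℕ) :
    (m:ℝ) * (ls pp.flatten (fun e => 1 / (e:ℝ) - 1 / ((2 * e : ℕ):ℝ)) + ls ps.flatten (fun e => 1 / (e:ℝ)))
      - (pp.flatten.length / 2 + ps.flatten.length) ≤ fls pp ps m ∧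
    fls pp ps m ≤ (m:ℝ) * (ls pp.flatten (fun e => 1 / (e:ℝ) - 1 / ((2 * e : ℕ):ℝ)) + ls ps.flatten (fun e => 1 / (e:ℝ)))
      + pp.flatten.length / 2 := by
  rw [fls_cast]
  have a1 : ls pp.flatten (fun e => (m:ℝ) * (1 / e - 1 / (2 * e : ℕ)) - 1 / 2) ≤ _ :=
    ls_le fun e he => (pair_bounds m e (h1 e he)).1
  have a2 : _ ≤ ls pp.flatten (fun e => (m:ℝ) * (1 / e - 1 / (2 * e : ℕ)) + 1 / 2) :=
    ls_le fun e he => (pair_bounds m e (h1 e he)).2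
  have a3 : ls ps.flatten (fun e => (m:ℝ) / e - 1) ≤ _ :=
    ls_le fun e he => (div_bounds m e (by have := h2 e he; omega)).1
  have a4 : _ ≤ ls ps.flatten (fun e => (m:ℝ) / e) :=
    ls_le fun e he => (div_bounds m e (by have := h2 e he; omega)).2
  have e5 : ∀ L : List ℕ, ls L (fun e => (m:ℝ) / e) = m * ls L (fun e => 1 / (e:ℝ)) := by
    intro L; rw [← ls_mul]; exact ls_congr fun e _ => by ring
  rw [ls_sub, ls_mul, ls_const] at a1
  rw [ls_add, ls_mul, ls_const] at a2
  rw [ls_sub, ls_const, e5] at a3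
  rw [e5] at a4
  constructor <;> linarith

theorem Ct_bounds {pp np ps ns : List (List ℕ)} (hwf : WF pp np ps ns) {R : ℝ}
    (hR1 : 1 + (pp.flatten.length + np.flatten.length) / 2 + ps.flatten.length ≤ R)
    (hR2 : (pp.flatten.length + np.flatten.length) / 2 + ns.flatten.length ≤ R + 1) (m : ℕ) :
    Ct (itm pp np ps ns) m ≤ R ∧ -R ≤ Ct (itm pp np ps ns) m := by
  obtain ⟨w1, w2, w3, w4⟩ := hwf
  obtain ⟨a1, a2⟩ := fls_bounds w1 w3 m
  obtain ⟨a3, a4⟩ := fls_bounds w2 w4 m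
  have hs : sC (itm pp np ps ns) = ls pp.flatten (fun e => 1 / (e:ℝ) - 1 / ((2 * e : ℕ):ℝ)) + ls ps.flatten (fun e => 1 / (e:ℝ))
     - (ls np.flatten (fun e => 1 / (e:ℝ) - 1 / ((2 * e : ℕ):ℝ)) + ls ns.flatten (fun e => 1 / (e:ℝ))) := by
    unfold sC; rw [lsum_itm]; ring
  rw [Ct_itm, hs]
  constructor <;> nlinarith

theorem stp_sgl (t : ℝ) {L : List ℕ} (hL : ∀ N ∈ L, 2 ≤ N) (m : ℕ) :
    stp (sgl t L) m = t * ((∑ i ∈ Finset.Ico 2 (m+1), L.count i : ℕ) : ℝ) := by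
  unfold stp
  rw [lsum_sgl]
  congr 1
  induction L with
  | nil => simp
  | cons N L ih =>
    rw [ls_cons, ih fun x hx => hL x (by simp [hx])]
    have h2 := hL N (by simp)
    simp only [List.count_cons, Finset.sum_add_distrib]
    push_cast
    rw [add_comm]
    congr 1
    have : ∀ i, (if N == i then 1 else 0 : ℝ) = if N = i then 1 else 0 := by intro i; simp
    simp only [beq_iff_eq]
    rw [Finset.sum_ite_eq]
    simp only [Finset.mem_Ico, Nat.lt_succ_iff]
    by_cases h : N ≤ m
    · simp [h, h2]
    · simp [h]

theorem qw_one (T N : ℕ) (hN : 2 ≤ N) (hT : 2 ^ 36 * N ≤ T) :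
    1 / (N:ℝ) ≤ (T:ℝ)⁻¹ * ((T / N + 1 : ℕ) : ℝ) ∧
    (1 - 1 / 2 ^ 36) * (T:ℝ)⁻¹ * ((T / N + 1 : ℕ) : ℝ) ≤ 1 / (N:ℝ) := by
  have h2 : (0:ℝ) < N := by exact_mod_cast (by omega : 0 < N)
  have h3 : (0:ℝ) < T := by exact_mod_cast (by omega : 0 < T)
  have h4 : (2:ℝ) ^ 36 * N ≤ T := by exact_mod_cast hT
  obtain ⟨b1, b2⟩ := div_bounds T N (by omega)
  rw [Nat.cast_add, Nat.cast_one]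
  generalize ((T / N : ℕ) : ℝ) = q at *
  rw [sub_le_iff_le_add, div_le_iff₀ h2] at b1
  rw [le_div_iff₀ h2] at b2
  constructor
  · rw [inv_mul_eq_div, div_le_div_iff₀ h2 h3]; linarith
  · rw [mul_assoc, inv_mul_eq_div, le_div_iff₀ h2, mul_div_assoc', div_mul_eq_mul_div, div_le_one h3]
    have h5 : (q + 1) * N ≤ T + N := by linarith
    calc (1 - 1 / 2 ^ 36 : ℝ) * (q + 1) * N = (1 - 1 / 2 ^ 36 : ℝ) * ((q + 1) * N) := by ring
      _ ≤ (1 - 1 / 2 ^ 36 : ℝ) * (T + N) := mul_le_mul_of_nonneg_left h5 (by norm_num)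
      _ ≤ T := by nlinarith

theorem qw_real {L : List ℕ} {c : ℕ} (hL : ∀ N ∈ L, 2 ≤ N ∧ N < c) (hc : c ≤ 2 ^ 24) :
    ls L (fun N => 1 / (N:ℝ)) ≤ qw L / 2 ^ 60 ∧ qw L / 2 ^ 60 * (1 - 1 / 2 ^ 36) ≤ ls L (fun N => 1 / (N:ℝ)) := by
  unfold qw
  rw [natsum_cast, div_eq_inv_mul, mul_comm _ (1 - 1 / 2 ^ 36 : ℝ), ← mul_assoc, ← ls_mul, ← ls_mul]
  have hT : ((2 ^ 60 : ℕ) : ℝ) = 2 ^ 60 := by norm_num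
  rw [← hT]
  have hq : ∀ N ∈ L, _ := fun N hN => qw_one (2 ^ 60) N (hL N hN).1 (by have := (hL N hN).2; omega)
  exact ⟨ls_le fun N hN => (hq N hN).1, ls_le fun N hN => (hq N hN).2⟩

/-- main soundness statement for a certificate -/
theorem cert_bounds {pp np ps ns : List (List ℕ)} (hwf : WF pp np ps ns) {c u l a b d e : ℕ} (hc : c ≤ 2 ^ 24)
    (h : BI pp np ps ns c u l a b d e) (h1 : fls pp ps 1 = fls np ns 1 + 1)
    {R : ℝ} (hR1 : 1 + (pp.flatten.length + np.flatten.length) / 2 + ps.flatten.length ≤ R)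
    (hR2 : (pp.flatten.length + np.flatten.length) / 2 + ns.flatten.length ≤ R + 1)
    {σ : ℝ} (hσ : |sC (itm pp np ps ns)| ≤ σ) {M1 : ℕ} (hM1 : 1 ≤ M1) (hM1c : M1 ≤ c) {Ru Rl Cc : ℝ}
    (hC : Cc = 1 - fls pp ps (c - 1) + fls np ns (c - 1)) (hRu0 : 0 ≤ Ru) (hRl0 : 0 ≤ Rl)
    (hRu : R - u - Cc ≤ Ru) (hRl : R + Cc - l ≤ Rl) :
    (∃ S : List (ℕ × ℝ), (∀ p ∈ S, 1 ≤ p.1 ∧ p.1 ≤ c) ∧ (∀ m, 1 ≤ m → Ct (itm pp np ps ns) m ≤ stp S m) ∧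
      labs S (fun N => 1 / (N:ℝ)) ≤ (a + b) / 2 ^ 60 + (σ * M1 + σ * c / M1 + Ru / c) ∧
      lsum S (fun N => 1 / (N:ℝ)) ≤ (a - b * (1 - 1 / 2 ^ 36)) / 2 ^ 60 + (σ * M1 + σ * c / M1 + Ru / c)) ∧
    (∃ S : List (ℕ × ℝ), (∀ p ∈ S, 1 ≤ p.1 ∧ p.1 ≤ c) ∧ (∀ m, 1 ≤ m → stp S m ≤ Ct (itm pp np ps ns) m) ∧
      labs S (fun N => 1 / (N:ℝ)) ≤ (d + e) / 2 ^ 60 + (σ * M1 + σ * c / M1 + Rl / c) ∧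
      (d * (1 - 1 / 2 ^ 36) - e) / 2 ^ 60 - (σ * M1 + σ * c / M1 + Rl / c) ≤ lsum S (fun N => 1 / (N:ℝ))) := by
  obtain ⟨hc2, Up, Um, Lp, Lm, hUp, hUm, hLp, hLm, rfl, rfl, rfl, rfl, hdu, hdl⟩ := h
  obtain ⟨-, du2, du3⟩ := hdu
  obtain ⟨-, dl2, dl3⟩ := hdl
  have hσ0 : 0 ≤ σ := (abs_nonneg _).trans hσ
  have hM1' : (1:ℝ) ≤ M1 := by exact_mod_cast hM1
  have hc' : (2:ℝ) ≤ c := by exact_mod_cast hc2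
  have hCB := fun m => Ct_bounds hwf hR1 hR2 m
  -- partial sums
  have hpre : ∀ m, 1 ≤ m → 1 - (fls pp ps m : ℝ) + fls np ns m =
      ((∑ i ∈ Finset.Ico 2 (m+1), hits np ns i : ℕ) : ℝ) - ((∑ i ∈ Finset.Ico 2 (m+1), hits pp ps i : ℕ) : ℝ) := by
    intro m hm
    have e1 := sum_hits (ps := ps) hwf.1 m
    have e2 := sum_hits (ps := ns) hwf.2.1 m
    have e3 := sum_hits (ps := ps) hwf.1 1
    have e4 := sum_hits (ps := ns) hwf.2.1 1
    rw [Finset.sum_eq_sum_Ico_succ_bot (by omega)] at e1 e2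
    rw [Finset.sum_eq_sum_Ico_succ_bot (by omega)] at e3 e4
    simp at e3 e4
    have f1 : (fls pp ps m : ℝ) = fls pp ps 1 + ((∑ i ∈ Finset.Ico 2 (m+1), hits pp ps i : ℕ) : ℝ) := by
      rw [← e1, ← e3]; push_cast; rfl
    have f2 : (fls np ns m : ℝ) = fls np ns 1 + ((∑ i ∈ Finset.Ico 2 (m+1), hits np ns i : ℕ) : ℝ) := by
      rw [← e2, ← e4]; push_cast; rfl
    have f3 : (fls pp ps 1 : ℝ) = fls np ns 1 + 1 := by exact_mod_cast h1
    rw [f1, f2, f3]; ring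
  have hsm : ∀ m : ℕ, |sC (itm pp np ps ns) * m| ≤ σ * m := by
    intro m; rw [abs_mul, Nat.abs_cast]; exact mul_le_mul_of_nonneg_right hσ (Nat.cast_nonneg _)
  -- counts stabilize
  have hst : ∀ L : List ℕ, (∀ N ∈ L, 2 ≤ N ∧ N < c) → ∀ m, c ≤ m + 1 →
      ∑ i ∈ Finset.Ico 2 (m+1), L.count i = ∑ i ∈ Finset.Ico 2 c, L.count i := by
    intro L hL m hm
    symm
    apply Finset.sum_subset (Finset.Ico_subset_Ico_right hm)
    intro x _ hx
    apply List.count_eq_zero_of_not_mem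
    intro hxL
    exact hx (Finset.mem_Ico.2 (hL x hxL))
  have hcm : c - 1 + 1 = c := by omega
  have hCe := hpre (c-1) (by omega)
  rw [hcm, ← hC] at hCe
  have h3pt : ∀ (x y z : ℝ) (m : ℕ), stp [(1, x), (M1, y), (c, z)] m
      = x * (if 1 ≤ m then 1 else 0) + (y * (if M1 ≤ m then 1 else 0) + z * (if c ≤ m then 1 else 0)) := by
    intro x y z m; simp [stp]
  have extra : ∀ m : ℕ, 1 ≤ m → m < c → σ * m ≤ σ * M1 * (if 1 ≤ m then 1 else 0) + σ * c * (if M1 ≤ m then 1 else 0) := by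
    intro m hm hmc
    rw [if_pos hm]
    have hmc' : (m:ℝ) ≤ c := by exact_mod_cast hmc.le
    by_cases hmm : M1 ≤ m
    · rw [if_pos hmm]; nlinarith
    · rw [if_neg hmm]
      have : (m:ℝ) ≤ M1 := by exact_mod_cast (by omega : m ≤ M1)
      nlinarith
  have qUp := qw_real hUp hc
  have qUm := qw_real hUm hc
  have qLp := qw_real hLp hc
  have qLm := qw_real hLm hc
  refine ⟨⟨sgl 1 Up ++ sgl (-1) Um ++ [(1, σ * M1), (M1, σ * c), (c, Ru)], ?_, ?_, ?_, ?_⟩,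
    ⟨sgl 1 Lp ++ sgl (-1) Lm ++ [(1, -(σ * M1)), (M1, -(σ * c)), (c, -Rl)], ?_, ?_, ?_, ?_⟩⟩
  · intro p hp
    simp only [sgl, List.mem_append, List.mem_map, List.mem_cons, List.not_mem_nil, or_false] at hp
    rcases hp with (⟨N, hN, rfl⟩ | ⟨N, hN, rfl⟩) | rfl | rfl | rfl
    · have := hUp N hN; simp only; omega
    · have := hUm N hN; simp only; omega
    · simp only; omega
    · simp only; omega
    · simp only; omega
  · intro m hm
    have hs2 : stp (sgl 1 Up ++ sgl (-1) Um ++ [(1, σ * M1), (M1, σ * c), (c, Ru)]) m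
      = stp (sgl 1 Up) m + stp (sgl (-1) Um) m + stp [(1, σ * M1), (M1, σ * c), (c, Ru)] m := by
      simp only [stp, lsum_append]
    rw [hs2, stp_sgl _ fun N hN => (hUp N hN).1, stp_sgl _ fun N hN => (hUm N hN).1, h3pt]
    rcases lt_or_ge m c with hmc | hmc
    · have e1 := du3 (m+1) (by omega)
      rw [Finset.sum_add_distrib, Finset.sum_add_distrib] at e1
      have e2 : ((∑ i ∈ Finset.Ico 2 (m+1), hits np ns i : ℕ) : ℝ) + ((∑ i ∈ Finset.Ico 2 (m+1), Um.count i : ℕ) : ℝ)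
        ≤ ((∑ i ∈ Finset.Ico 2 (m+1), hits pp ps i : ℕ) : ℝ) + ((∑ i ∈ Finset.Ico 2 (m+1), Up.count i : ℕ) : ℝ) := by
        exact_mod_cast e1
      have e3 := extra m hm hmc
      have e4 := (le_abs_self _).trans (hsm m)
      rw [Ct_itm, hpre m hm, if_neg (by omega : ¬ c ≤ m)]
      linarith
    · rw [hst _ hUp m (by omega), hst _ hUm m (by omega), if_pos hmc, if_pos hm, if_pos (by omega)]
      rw [Finset.sum_add_distrib, Finset.sum_add_distrib] at du2
      have e2 : ((∑ i ∈ Finset.Ico 2 c, hits pp ps i : ℕ) : ℝ) + ((∑ i ∈ Finset.Ico 2 c, Up.count i : ℕ) : ℝ)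
        = u + (((∑ i ∈ Finset.Ico 2 c, hits np ns i : ℕ) : ℝ) + ((∑ i ∈ Finset.Ico 2 c, Um.count i : ℕ) : ℝ)) := by
        exact_mod_cast du2
      have e5 := (hCB m).1
      have : 0 ≤ σ * M1 := by positivity
      have : 0 ≤ σ * c := by positivity
      linarith
  · simp only [labs_append, labs_sgl, labs_cons, labs_nil]
    rw [abs_of_nonneg (by positivity : 0 ≤ σ * M1), abs_of_nonneg (by positivity : 0 ≤ σ * (c:ℝ)), abs_of_nonneg hRu0]
    have := qUp.1; have := qUm.1
    have e6 : σ * c / M1 = σ * c * (1 / M1) := by ring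
    have e7 : Ru / c = Ru * (1 / c) := by ring
    rw [e6, e7, add_div]
    simp
    simp at *
    linarith
  · simp only [lsum_append, lsum_sgl, lsum_cons, lsum_nil]
    have := qUp.1; have := qUm.2
    have e6 : σ * c / M1 = σ * c * (1 / M1) := by ring
    have e7 : Ru / c = Ru * (1 / c) := by ring
    rw [e6, e7, sub_div, mul_div_right_comm]
    simp
    simp at *
    linarith
  · intro p hp
    simp only [sgl, List.mem_append, List.mem_map, List.mem_cons, List.not_mem_nil, or_false] at hp
    rcases hp with (⟨N, hN, rfl⟩ | ⟨N, hN, rfl⟩) | rfl | rfl | rfl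
    · have := hLp N hN; simp only; omega
    · have := hLm N hN; simp only; omega
    · simp only; omega
    · simp only; omega
    · simp only; omega
  · intro m hm
    have hs2 : stp (sgl 1 Lp ++ sgl (-1) Lm ++ [(1, -(σ * M1)), (M1, -(σ * c)), (c, -Rl)]) m
      = stp (sgl 1 Lp) m + stp (sgl (-1) Lm) m + stp [(1, -(σ * M1)), (M1, -(σ * c)), (c, -Rl)] m := by
      simp only [stp, lsum_append]
    rw [hs2, stp_sgl _ fun N hN => (hLp N hN).1, stp_sgl _ fun N hN => (hLm N hN).1, h3pt]
    rcases lt_or_ge m c with hmc | hmc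
    · have e1 := dl3 (m+1) (by omega)
      rw [Finset.sum_add_distrib, Finset.sum_add_distrib] at e1
      have e2 : ((∑ i ∈ Finset.Ico 2 (m+1), hits pp ps i : ℕ) : ℝ) + ((∑ i ∈ Finset.Ico 2 (m+1), Lp.count i : ℕ) : ℝ)
        ≤ ((∑ i ∈ Finset.Ico 2 (m+1), hits np ns i : ℕ) : ℝ) + ((∑ i ∈ Finset.Ico 2 (m+1), Lm.count i : ℕ) : ℝ) := by
        exact_mod_cast e1
      have e3 := extra m hm hmc
      have e4 := (neg_abs_le _).trans' (neg_le_neg (hsm m))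
      rw [Ct_itm, hpre m hm, if_neg (by omega : ¬ c ≤ m)]
      linarith
    · rw [hst _ hLp m (by omega), hst _ hLm m (by omega), if_pos hmc, if_pos hm, if_pos (by omega)]
      rw [Finset.sum_add_distrib, Finset.sum_add_distrib] at dl2
      have e2 : ((∑ i ∈ Finset.Ico 2 c, hits np ns i : ℕ) : ℝ) + ((∑ i ∈ Finset.Ico 2 c, Lm.count i : ℕ) : ℝ)
        = l + (((∑ i ∈ Finset.Ico 2 c, hits pp ps i : ℕ) : ℝ) + ((∑ i ∈ Finset.Ico 2 c, Lp.count i : ℕ) : ℝ)) := by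
        exact_mod_cast dl2
      have e5 := (hCB m).2
      have : 0 ≤ σ * M1 := by positivity
      have : 0 ≤ σ * c := by positivity
      linarith
  · simp only [labs_append, labs_sgl, labs_cons, labs_nil, abs_neg]
    rw [abs_of_nonneg (by positivity : 0 ≤ σ * M1), abs_of_nonneg (by positivity : 0 ≤ σ * (c:ℝ)), abs_of_nonneg hRl0]
    have := qLp.1; have := qLm.1
    have e6 : σ * c / M1 = σ * c * (1 / M1) := by ring
    have e7 : Rl / c = Rl * (1 / c) := by ring
    rw [e6, e7, add_div]
    simp
    simp at *
    linarith
  · simp only [lsum_append, lsum_sgl, lsum_cons, lsum_nil]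
    have := qLp.2; have := qLm.1
    have e6 : σ * c / M1 = σ * c * (1 / M1) := by ring
    have e7 : Rl / c = Rl * (1 / c) := by ring
    rw [e6, e7, sub_div, mul_div_right_comm]
    simp
    simp at *
    linarith

end

section

/-- kernel-friendly version of all computations over lists of lists -/
noncomputable def sumK (f : ℕ → ℕ) (L : List ℕ) : ℕ :=
  List.rec (motive := fun _ => ℕ) 0 (fun e _ ih => Nat.add (f e) ih) L
noncomputable def sumKK (f : ℕ → ℕ) (LL : List (List ℕ)) : ℕ :=
  List.rec (motive := fun _ => ℕ) 0 (fun L _ ih => Nat.add (sumK f L) ih) LL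

theorem sumK_eq (f : ℕ → ℕ) (L : List ℕ) : sumK f L = (L.map f).sum := by
  induction L with
  | nil => rfl
  | cons e L ih =>
    rw [List.map_cons, List.sum_cons, ← ih]; rfl
theorem sumKK_eq (f : ℕ → ℕ) (LL : List (List ℕ)) : sumKK f LL = (LL.flatten.map f).sum := by
  induction LL with
  | nil => rfl
  | cons e L ih =>
    rw [List.flatten_cons, List.map_append, List.sum_append, ← ih, ← sumK_eq]; rfl

theorem fls_K (pp ps : List (List ℕ)) (m : ℕ) : fls pp ps m =
    Nat.add (sumKK (fun e => Nat.sub (Nat.div m e) (Nat.div m (Nat.mul 2 e))) pp) (sumKK (fun e => Nat.div m e) ps) := by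
  rw [sumKK_eq, sumKK_eq]; rfl

theorem len_K (pp : List (List ℕ)) : pp.flatten.length = sumKK (fun _ => 1) pp := by
  rw [sumKK_eq]; generalize pp.flatten = L; simp

theorem wfChk_sound {pp np ps ns : List (List ℕ)} (h : and (allL (rangeChk 1 65536) pp) (and (allL (rangeChk 1 65536) np)
    (and (allL (rangeChk 2 65536) ps) (allL (rangeChk 2 65536) ns))) = true) : WF pp np ps ns := by
  simp only [Bool.and_eq_true] at h
  obtain ⟨h1, h2, h3, h4⟩ := h
  exact ⟨fun e he => (allRange_sound h1 e he).1, fun e he => (allRange_sound h2 e he).1,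
    fun e he => (allRange_sound h3 e he).1, fun e he => (allRange_sound h4 e he).1⟩

end

section

noncomputable def big_pp : List (List ℕ) := digB 10 8497098576865630398815500019725545436827296363590335125328264608190034212484450044044565234648844872294902145527568923881963363336388731496407131896133651996183864778780297376962189411956086481011239084452091327601378431520708965131777937443192252349943552137841543586055136781028418776884891131551853777665354515821147586888736858060659129116229361667897346992305031476027093864572458067239065293805964863167346284561666542560847428351635794115704644533133890349619550921969625347109029156741592852710602327306381183503669741603732666542876812965420011500486904590454625183290628602363912202213145340284928890045268180145396844786573766913440607195393314218548880386797616294367563343218061996162044003065231283853030147438539165843316289548966844100926084670332476583302396292606457280330844222747948766009821177756761410845486550076947101592560355808343647803590328423289725399801187319671152225312532602404105824457799462288406389361823071312272685620650245580090523211887783839077433078453739610923258825224135336122700139169840784603463068156377345225288194823709469268266558805368932039809665403033282152847285928343393253402533337130986740638340577671224075127827740626242637565857987036361729261232821396849588086647314680570923333687884744029938977778941103712120837365893360611464203108822644203103558161056540535886104790929148228734508723942639031430036006881864737171382575546022474235028736003610205126102727542956562016471463102164815263056187844428474621255634623307000888986546333801279302081882734886614700068341287142468117037536318910426713236800074404397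21904957931579218086449238082788240423341515205925108578402107891734737142421369751197682317879575190859313953969857312202026785220356843929956267523642623972656810786658579939197601592286784497840516327874731444732896483215528299732829523436153976648833104696510960209573036329341834329378447457899584625858489630426533104028862736940213089822653870859385956512027174048492714452311181317591445256009008863561124084221189238217795120859376590877902393373774065993362852573182394421172384185510608461185229715158361213410715381024318355648950296963583092055688246359513026571564076983474208724659777484467844453685981032922249179212960919535310583494281031122425693642852166183652572578165355970519080396394074716115470693149889529822249279055756100195870843478800279041021737984697044319776358035607605450109856056017909494385516270842879134390741310526584051218920022803178161047746186395371040223059821818113741469077854499750951069810028953015915864195639306355634126986256481986100695848438757113828655090188168462798423536560067897694309834277595807479197669467990810552134570008824589350314002468585327888676020299793457487141206692267375795182006935157181305639565882202362701534166844499825721142447339126346655762476139076628307053831454721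
noncomputable def big_np : List (List ℕ) := digB 10 2657948356386605790007756248758880103932131855695754301982215699944213013530807429746203753242442078250363463988594467541512376628339547412270675100420397086481360863837206297125366364344059103423021429125944291644111709513912059629408492311343749612211798927677776291727293713693710152320197273081673013448156964867997389008065376668234037569779070328244344485300080342174601317490017997173194824772491587440059156898975472308919218282368349828565215558675015987113706714091492677897158563602013958756780863717061680320305828306072639416460753924518807342512655606728892536585403916032107453422448138069263308177249966780533325613148539671546621441815040320738699013563639773222086812656245190144537065980862119957755598664950830269460842598763867835258037747973344716585034178722708455803759934783276877839708139738905201810885244147198015563118555393318904840162418659361128051271453582299813211780392073165886188992611815029063605261256210899460963360106361523206980581762515236883858682870533149590472334960158459639968312521935168178026070253691327364229389313027382796628612039595341147752375054510881036860915802458883201867290107704745166321117526547991113116273669836742613320500734690285054220095672398702212153121739315560041068565928149051913689295401471355045216610316231043111021513610251729450146308896970232658893135730245381841567693959419301223826151212992155727337311292253194735485742665270342129725813573842687716825250616129137268675876405296506115467457971836231845768833097205778725528000037385762394255476968041568389954712763698048429572021609311286591028388530609435008878500670974210389865111900229545532953063564668119887907465354716336385836410767720029806749295801139278298123505945798424556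441294216872332435104649139479406194486764005785102780925962782871194080378663502971938397576285052238163494089037025965036881790310021715636480232211466641378593875567192995731707588755766690785669859247992380250096804171378307371490301777551414652186472177295062362033452795461232405976528606608582308904663240669946434189921783305311523908201120194353104342013559742283548667389633559983713700537832352855255347211192714244731395864737498991042848749607374921237090820155368463566905488314550799208961927419779459371966066332404646641520736612771663152045307736778025004985630676847394372498644882670914465417805951165595911897697817984498115498888912713972851036240301703237933323667386233806754618692885440082693396548646541304808900521798909676732660399683478835001682757475695306445351008771813315624884968290884623251487167034323987510626381773947475540735325246744619125389190983464143346919382598150858838838473046829707351875412113038630794382368300471928203722746744843313067146371825431393955945687869538156697515075584169205347505735267692708932133237168570020917729603031548917476656645572732584583795150286104594975385826723130660879812856029688680569815757485612850558374335086988068862374283330039897916923438206920689021796810755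
noncomputable def big_ps : List (List ℕ) := digB 10 1872078520898536353880243832170293556837437292085407911621214399182351403333315660497505872753531364931318173737689336106704201867934156590317461197941687580728905225139197323530725640605341161587544903837252349370640534498946706627660423034685381403252690649394690062017384355421359637683650511157572102198639892992303197197289762552271535629279666061931387353384119697666175503002344109687070696232531471312566962712462651572277521684569803395014718980078543770338403517780390669706325254071259741417362150380056692493259963877664672159779889233650974091623359807093673079405912686284390738098333448375167248831017504631108688034264049303224615433501791328275944620738881023854884558358925118350921037686360609070088458807007184099650972314874104848733099483022059821127591752101907347309124630058586946957829876720567424852625095572026334890130431544802507987374905500073910340241427896898382171465839940031366513224242891591642743702161771461114074237004692302091102263290539901864693129545345463732899159416904068051651085949101822593168925267931035041151201243747296759156564040997450456602275317800620778384268161106109267568826033324431410577692596958097215308497396302505972341806242097026101242094992224267022335962292857348579811067379681890941548606596487920613935822155396487483682878024216988873630979958361389146828435930087130610228389602544944944775692875819519208963074136350481089497299890723531947251622213692885772022248187523695932220916277065117759652919220523502724399503994215207355775628065926936393397086928843075970197966024013848521655923858296234927923678375703752607069675915146290315488784157959131832224861059297626223687380413999285635169107809873631653749054692052794414187422889439306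1167014857196275015235749311445129202871699194242425958857878326420135488432740387099417895827189866723134741269879258606080801006578981193599872434881953154450678617326872081799178886625831442782897299584610020809273053984173456572540904611624126405752346298563753989383954150159116031713848819139203097323017677407944980178968585003122578954607703629034793749906542386413984068179324392184963488074354676504604105216821630296067519107336577299420891200740673511062757813459977465287906468811825337032109237978310579503602862554898060874268297048283472051014546161256237132860456731114934725759924729971850804101142341818275115529824276412398691551431853258872957275160786354119787331286490012911479706785127672303503448589562953462251069588401926503631802925681822475954371505905644439068506959637985251199066769484173724355589602040648733014104735670176007599597708468919131900647903322303964443620898191899948983570749150395699656652479768310729886113721983617919285287499005835897833304145874338631556535470182811948669858513182698470903026038946237883275523116341004080593023254862658177410946652056782171468649356395128603275480319330838526459145104385204888702204483013533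
noncomputable def big_ns : List (List ℕ) := digB 10 1292875333365989099926492175493365842888085000510782468859426946307115820087205443875335929305477019568526266207272277622261920671064266197045998054392969208824919092621807643079642310647715625413917520356234496249648487986457257653989644549188600986428910635165575089350497121174354141303628995488035860285741857627436424543194068668897462972231575143476531516743069980888996904109655444376266029199431906073044632492946809554794777018648653570651128659805426850486160811570831479284401410516501049041480908201499944151955882810052191773096380045762090757131670450971794678103828032390050078442825444136332539608158016451527101546005587150947836722407790782425375088590038529380098854157826453187740634709511091552736556271825109557724491632086433518686191805492536964032822159356356677214129365446784119398128314390078714298030172985355422076108599495623283354162492557402289375179911705124810529792794913162630790723383090379050683579785323805675622557758349818411327762419473629861409751112711405986106222251383411288240773791190780391675957035358257472709485050167670291233699670929625442522134929120145686632640364704578760996123781607584467954773866404219684805662085970636930724368448812684086305495127310231219170297849574706005452782496182420964442742613596208233741461778854733444792759575828023684346407242069480013008921441935108373685249712009966007606534452130239882373242986549908872499789659835404865760395678547256344141286159866226177490916808846404266600574389833960681180335204681077932366510412090294545731575610991884258544275882544557531747348847696960379216370149305955856998880044988241624796772438517399084798649635860202303039112331645075435461277841543650787617103971784176998244962762846648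7379060001114473414739127866614498767522898382062718229112892175482091106839018139015201275133589387217981254127126743623877446467933680411826142399293236503165303815693776557634315811933536480484669937521074259069776969103476324580015216072191185123738792131443091471438913341128626482634014909475684656244184083050183741566978230046464686736482721519794595345861730979151304317495073281999704227187320742799080858123642104991807990340598609628005417670666560548009670957811112091182998220023101880150049750264637776929984523830085592977094751616979205844795241543146672764331063380014531538066057499952717504505024007087171352199135804365612701050778111237693771655533145993197993627067017160150973096989554580328032610366474585999416150015567342870082244673827766107459299912257319855787686874910093963480971216946433889220910247204953295777746042912277700985806759021943946329839263891529843652845015836304819459692317184362472600593852273054437095027908551901439673807832462846637896174073230842177510527931104757272899283860875562768441257797435852122793247832093202793557651999932228180840782783806608426635611685004567773092769569596202918769909144798487810442117922068158813244329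
theorem big_wf : WF big_pp big_np big_ps big_ns := wfChk_sound (by decide +kernel)
theorem big_c0 : BI big_pp big_np big_ps big_ns 2 0 0 0 0 0 0 := BI.init _ _ _ _
theorem big_c1 : BI big_pp big_np big_ps big_ns 602 0 0 0 0 0 0 :=
  BI.step big_wf big_c0 1600 50 2 19 (64 * (128 ^ 608 - 1) / 127) (64 * (128 ^ 608 - 1) / 127) (by decide +kernel)
theorem big_c2 : BI big_pp big_np big_ps big_ns 1202 0 0 0 0 0 0 :=
  BI.step big_wf big_c1 1600 50 602 19 (64 * (128 ^ 608 - 1) / 127) (64 * (128 ^ 608 - 1) / 127) (by decide +kernel)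
theorem big_c3 : BI big_pp big_np big_ps big_ns 1802 0 0 0 0 0 0 :=
  BI.step big_wf big_c2 1600 50 1202 19 (64 * (128 ^ 608 - 1) / 127) (64 * (128 ^ 608 - 1) / 127) (by decide +kernel)
theorem big_c4 : BI big_pp big_np big_ps big_ns 2402 0 0 0 0 0 0 :=
  BI.step big_wf big_c3 1600 50 1802 19 (64 * (128 ^ 608 - 1) / 127) (64 * (128 ^ 608 - 1) / 127) (by decide +kernel)
theorem big_c5 : BI big_pp big_np big_ps big_ns 3194 0 0 0 0 0 0 :=
  BI.step big_wf big_c4 1600 66 2402 25 (64 * (128 ^ 800 - 1) / 127) (64 * (128 ^ 800 - 1) / 127) (by decide +kernel)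
theorem big_c6 : BI big_pp big_np big_ps big_ns 4250 0 0 0 0 0 0 :=
  BI.step big_wf big_c5 1600 88 3194 17 (64 * (128 ^ 544 - 1) / 127) (64 * (128 ^ 544 - 1) / 127) (by decide +kernel)
theorem big_c7 : BI big_pp big_np big_ps big_ns 5666 0 0 0 0 0 0 :=
  BI.step big_wf big_c6 1600 118 4250 18 (64 * (128 ^ 576 - 1) / 127) (64 * (128 ^ 576 - 1) / 127) (by decide +kernel)
theorem big_c8 : BI big_pp big_np big_ps big_ns 7550 2 0 26241177621952535 24457005261172795 26892128405724033 25486152118882302 :=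
  BI.step big_wf big_c7 1600 157 5667 17 1058277935605176856007805734077932231394177644565722624286229614951003160948886693300666066333146666769336271098240557308012157825436551015941815378117672559506738989898280067066024500163003041485310994583684190388213807109370716666905966358619884007438181745810072319142896263810769153258654065079938941274362371205075555906171968034543197526058611804988068611310342181298640657598093565838591827406479965883146397158732253958241972710620456402627847377756866596839637396156929686024272639721128041504214061806767882465653742177658683458610415504168439675172034121436059837759514084022594259392292164579337885480760313862516770825563057065674099868121413704306240420711238630303542483018463036937739356460975487413459184968857492606922257210069064654112331257216981114377262002236285019988107694737920932953289591628315558147882609169333927168956216373114331683701892592365976958512238632759575620436227241451796172376611306238044234534770093746669001835859085166176139289011673963868869112309948857293193156279030161696429213193100600255218833559006355869099601966356451208329331889857321721538025285901996150584544519492683767669796871854891072 1058277935605176856007805733236419060756680049344775962478482689434671641318138760757001240111939323940886386169005410755334501121930492344517889535038408295992049068838143273195798698554432521563685199676718427392065333820739671592570748638720692189062272114862871474997788324920341393501033415615786666499361870720399242731592383809128044719830283065052726475803911445712890325238658843955116329410184330947871851889712842567420497342756798921851368347095404783528160503175978463191250989335905323015881254499114807481950719412932103630663906665151216465571961136794864064223001626362561779822394744726434450832786269709659857243261185069293795338575129967215299708019174548914632684384834824670664830619855684230982342299894417771293159195643264022960090805115596309794558429899573166661170281198125135925041285015220949214545938226245356591750318635342902423433347030148660073317939374203575815948189412199664410032768218090320964575402490042685478131515331585096353266209926278275316370921287757726079325432945740873438655217716449710117216626466887325717971688550784180008739285404053411140771116570437098550992437800087845892942404122583104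 (by decide +kernel)
theorem big_c9 : BI big_pp big_np big_ps big_ns 10058 0 3 51394786093614585 52768575568371305 53291263148141196 55163150433094520 :=
  BI.step big_wf big_c8 1600 209 7550 16 39253710571280174475234480624739081782321766546959077133900239152055613126829724766836441993135960138567191327530103005310207958905266341414543796234575417574471185862210022893176046960693986522182790658091302316388537589448652390037936263412749163253043060150414312733121936596752666729674768429265727171530844799804201644972288119466653492189415543306726529967338884428254737899713655386145389799842416563111190730193573427292988850239468423851139633569358663305050253002586076882697385629459370076787984768375090442802459761509183382627801449805054613068941151709892150398598447471971817836863612124553229437614924710123354341548687104368608729071647845459586744255144411396582747381598209526778308140453714491081703832776811502207048561983970796255754460014782339418338699202673299609884926561594393139436414310448219007328129675240463804787428571360023598872844548858770849942862544234404862737537226690956512359583078721519780692866823433942637510680397400466032744428746889473575699490133154662677402461563452009164840095098211664999489048732053423687325572671732280467390 39253710281102382489760286116573275126161707234588752880888113061460915335807862300243205285724503754614874278240737647198666012478037381205202352624244065910104488972725258379409127908884987988432400204977809495025744878040933129182417360719405492754163497372998211931309513699668678820909002669165606128003932730988436861271645251532903052994225857782144772909224260504987668291887214306831144939386089836567987630320454238814882300112910003376710901071176158306611401252006715717522260323657081429860748021921382923679080342625471269460624562295741073097686500369910807847905365024082769173412608489965451667580703718458819524579070331083685738655763846065525313592494914563039094420997087155868297143019710006993832411056423103554661615889703000153736468714634210886955149346312914049992631750051281680682193904023759367382613088051936944126584166118905107712882094956158849570402842545257381055681765252855288836098553835160331392628355890727810382474891585316174916059253077177857903352408279238856389077823118228573646297523680533866778078895231804305892014015877621997503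 (by decide +kernel)
theorem big_c10 : BI big_pp big_np big_ps big_ns 13406 2 3 73694728566567777 74635055313690204 73625382120671822 75224820263206221 :=
  BI.step big_wf big_c9 1600 279 10058 16 39253710278835088511248482495450002459594967188299534743261031066157303926729364292763703257451226655342928847640767413538720281396597475136647704448306674408991193286195503772538552399606533483798024922830671411252413084312728171092292529215279221587105752911473794264615823749762605198719833563328227224456116705801020682906856954350651335378184859224980350452421709368254975282110524652139350756588076340435793251671489309128987725620370886923578600676728575332001098526305531662699045923688504027498835749830743088057550027884712149070820560978271161272932029339703371664496361242658472263034162328019955824434112582607896003743720162220114094687445225055426144812033403479525919704995697139133170877305758619290187825259779666130029502044244126944844569425073293632086863217726685915114381151390317232521688014106161570770466108437370199866230430824183339730652032372303903332353884184761022992827952575465833423421492814952108358451251186824757956643141698644721158562414081168172551179350475020444280851087335275879234607063964738414607879691966312936520219059660558180415 39253710278835088511248482495450002461411774567534646449841828236539674818724863221809213882868012361049810470851814957965729063033543374506211791985630490467463944442591091580729536013056900630021814086373721187400284352681675276409042242186778802055894500155609216375582056235038890132533333099830549371734118796761286167528078298124451451243173220053806130691178218796030368202227476095338395466048475560814823020988018874526079178892978640828449929928903869191808122376796870297075081682251852257092734324300202402356263987374664052092042629394920416953393422202402672651616361597100352483624458203092760796010941144033607385293080875683116978662957122290638764968200749467466681133132526157774647035536482890367555441892431488050583527322997302362265077621888628812481015385670310622351570722398395574082567811944738208848638044375558007377658961175125658045776215207927825207401511334726603324108857198992914346577279674735492070202217861923618404938746663778179136153852830144653215967655304712971567547328716838473586205359507941612618314432024514130406124028873728352192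 (by decide +kernel)
theorem big_c11 : BI big_pp big_np big_ps big_ns 17870 1 1 90636213771811451 89747866471508020 91295727950940787 90833171923128659 :=
  BI.step big_wf big_c10 1600 372 13408 16 39253710278835088511248482495450002461411716934826384224742158007216206913314347003212573779206185745103021726523329144183633903922623695871768420203471171564948207488145755114039533721271996375402001437334457333048038121667555441766008361049933916563730847171149754990465375393906846023052971443846092213053446426520621999571405961704294372207319185099802182456479541503700136287072565375343687725249702835239256513556472831073641117800440028697974873342439027842514245955627660655125885794532078599395477439945250857128153644777474316683106428276606296208582622508396025270882977118377344896811499723291913524155356348524206688675268835342107057604019302349306253114948222963691488521381962486715204888712721076475771713367774369360145755380970817637395097301366082380851868699034545102173559226094582381907583852093216197707453375298329585263351784531384656407555546729406105892735608747596752897182627819062993452343561721118761332310401258227926926793563403690436764967896051730147497307172306409830241854047219312375034391834775210958332460379660408972090621092500073357373 39253710278835088511248482495450002461411716934826384237548484804948301190894779001461591785236167720593162564652513589549319954012105825340719538281422148628480713843211401537015156229736958227237752310124108502487495320301074528010699787351549940993151522836714131878594818661265864701528201375828245367714278933158272409869756229455170676303440339533246851116067256530978896047386615039830483408195493089171463568687447695609659803215477665763126085845780062459905835149570272164949361237766877072326418747915440831022918271701055028743314821188424022082037112190924121545711683461315404350506925898039974798571784086174092334073063123571041028922380829147959650902316426554839410032961195879257933752370660856633518290920616948875360355779700666015953914248814437317014216003248934677752609763513278655480051441745883759759087536562351557959908390979704533977151619999767075059961211305787591743997924143214973479211184312544256936727698611498701624089604132568706806828469927028640185044127011382846396340785576947297707120750020571031517367497810073147011470915675813339198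 (by decide +kernel)
theorem big_c12 : BI big_pp big_np big_ps big_ns 23822 2 0 105340219392031648 105414296620186755 106368107534121451 106893826695361243 :=
  BI.step big_wf big_c11 1600 496 17877 15 1455471998014683031631476800892872034593363547854959539728281706334482168687507430594401621544225124762232006238178155642418234549284125400594653521703704265677487968225500163332536693681531482876220423143809450082392795070582249639921874696274667224018797102213016149641448923628096211356220073097067547580587916174632237737513644179435153802629426555763773405842383951162849401153674642125704010222858176555012498898179233891265037341540053742486318125986569664867125764878141158953556949168634742433434125365817864021618100498448311918901843249499947344183338297368411575049413554686461605138015096859859102160800492787441277137320998376991437741568632211939735398631213257380784116575396136729377715888291064932679319928488257245065045740856791884156325778248024141572275788636416868256001622389693060229983218290815233272460323860048705210373550910930144749384002669445192907069704654400347575086244816641186966348685250880745037402663746297091173765011352823581705773547543889152730578487869242361846440000 1456001025102773380956023333491041162361925428139356174740908662180704059539477289312368154314150026220446288540482042524996949150434400104009439831429454085949337367022564519720827444792349179919598547082320591512030106252264928611978294120946675939214050416167406628351736891459694479200892452111777990565038438450627097642365216361316668035595133827901387201920455069454653109171877941919966411564226842569606857318809366703064009787290443118204738677750878066944406642308538153857126149971570415107073636048861000676502543565748767873936668792379832978200972014711371557861223501265227145414264439945820914725119552867534148816386239828601271535822725253673220712607363301520138323082379259240039595402861872008659039945292021637206706670536567833088899784323868235539012261400963632124859248933116564546841373959459772681751990011079920139659282852635676267199456751280111842884187595364744245172654853051644688654225129299922229229658081578491933534419290713340058391894065342484964020481754433358641766464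 (by decide +kernel)
theorem big_c13 : BI big_pp big_np big_ps big_ns 31754 0 2 117453644517685749 117245181487421135 119111075802771960 119379047518251336 :=
  BI.step big_wf big_c12 1600 661 23831 15 1456001036035571650569546456700902500523305423016050454144275044564281120573331841160531220494792197567552249552698664675576120229129128468467693118425851590733866576975754686689083692259310393222148965056857443233688856460394608002636381823892050883853044136707790347395673421081740858732483614036152960489667518903006024123524516241448524496722121036436944068696023839279569795301322059142279830014204826858793488796944414124107297213616388499675694156977722208349508655806350446910239620047496595025223743345846973128497728667221429038660442187216206577203407444102786212175948223281314880454760104907327210574402083449113438321502738281827942601764368131368138452706731333324798253062866533372521422951512780979396868487701619934628084152590536969117677744967207004494958935035076901808224324460760537100933528099282983549584938036439203258744998679871335151451634224958321660624406485163900230655056256618396224146792710869056621574418280915714731714610006240467546382537691669320576314867366299332040941501 1456001036035587087691438540708328920664109809250404222862778471317244928124605097837981769282776377209548492348877994317434438107366498450444119160259138400621229727200184990921075133323702195730011965695875965714731629925095439537772729270126845029646379164773352484143702936198326203248970001311320410873147732951816937190370642225098018730754377461539579129743392685306437936585888234176184820520067401845187514120162643292764108565146584116977021383600104854780065242670413250586696364505537879372563373891453081013227669652971619038160681371942702462977776382915020909837680343551595789887559339115419361665337151718824750827305079396956164886958184971333432045658358560556134330218216478708378043768036301684220375755267634390506244351795834075320688142991252159832750386683404168600163271878711182932039053265790989030558755958020042932873331068807286030245351391204582797777779735334595335789683974039101450111223001625101853546634162883837412258126879166988628569732716170974064011926989960250666229565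 (by decide +kernel)
theorem big_c14 : BI big_pp big_np big_ps big_ns 42338 2 4 129607034876978271 129291970756974192 131275896735078676 131570338874807871 :=
  BI.step big_wf big_c13 1600 882 31771 15 1456001036035571650567194757652659667820626620229074959659872683112323780043677917726178670229273288094222142766835748460856340224785315078863774041425752230522818522704655734329072657415732089496824785503554668235291519871597762657495994231049770372102591484917314748135528756408324453060706190670972465875326385286915028431399918993558851169940131097137202675481004042548639196419698581688960801931276774047432788791658471010894709643640890978855571514765586709190944111636209891172255710444825681586077780976158113473862568961323692106330066015321112788340973539263649125304402625806633897673735508856247382489970069878493329741626360730619382292802136920987411104952427077927016061085155997654830387616319406088995116850143849819697511940481433125845303287857165896718621375777096685250692723706725913689192462112465927760821913257949000231026080779414907270094905500329943384211898854725706419093286584913935033348299612583020728112772828060279305794500597887075197673063205945292584273224120485682466545730 1456001036035571650567156669248624363631447688458694574968980029339643240140179620495713374479815635087664411012996384535257838552038688761586478691908069760175665212672123737133944662555804454674486144289226035871279957849983081311689005035513624347344434647046696222022001197288514825517041356523983793206543262657254605978295129336486129223847984854172674758389251764205927665882700914410953410948854339615268456158464242665988904295309518356157587186844099117530965533485806943188898806431458484266263930798477965751476809222573392161600979232057398008141060109270468467127549942991223599570910365421274146912244836103728130103814442652291038188692845208534502763047392424891271689699726535989194268232747005773594595799901479209937169543457609005443908829924865006945902936513814822078781814879533869861551753472034238610249734410794094495199976654288034343901270167139893563719652442055591662910987822484831886189190652892109702668427820237378497838327461489810340074634185278028434519414713988307393470528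 (by decide +kernel)
theorem big_c15 : BI big_pp big_np big_ps big_ns 56450 2 3 139710560740296240 139370686170309707 141923567985599968 142169654367765036 :=
  BI.step big_wf big_c14 1600 1176 42343 15 1456001036035571650567060921379846678796940221332325713200892401291109758773330803495747300741996446344507307647987440381141450327411438417059289477626142353120705939000732869806994486948808174320447123873328535870010050135766717360617246126913137186925110510840532351929901305415218704174075325681448551618370320025186785448231336731305554258815147676200672533916457750034311077293034444165802087480920133932144248955809649166093347063323162127957912311226295950755859608932517354054974432153991329048056125177987723509080776545569611525926247704281541964101349695700585282079576436260637395510753096578985137680763128424843633220376762837009792099670653696765033500085069498931677081869572717491865867072087461395725259606113215601246469739502918037666239191795612589953658886503864337404321509748708323613710970848658197275604821227115066189051592967871440688911858972750120735443762213830279822017396352859863957284583067592028201499788570836765730374290612057183119341089325926002796974781262963157020647616 1456001036035571650567060921388892877306516299082305337482388730721755711598384698016881623712140992082142735710500468580069793390972829971399389218893627396217008555383763067128092655197890422974148959977456732115165038074903893323441157233762354089136817978160044827450851521109106575576385066442699351999819712386301574437072987358138616719351705128160167108812091063727623507666848657283572497339707618465766234770009958345783718891708897514847715386978124516904584310177145332811079375338635090978091453013791205322099190283979071095550842523075580031992416474673417288915427015843599302426641151269166959760442634903518522265480468482738974972990604869155077392779184007376610754966246960622704302572552194757524993424826467435682659825042318464404902736930566315361413013926229781408981854000275290957089559437806425749414765151195055959252554942499889576320477471136673746523276763453953368152237443400530923860729888275150542233398889129194879529363846324946974526321512936164203927274446903322568745025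 (by decide +kernel)
theorem big_c16 : BI big_pp big_np big_ps big_ns 75266 5 2 148344318835941131 148115628028714133 150479885299786563 150874323999410789 :=
  BI.step big_wf big_c15 1600 1568 56484 15 1456001036035571650567060921388748752382935021658641479343081109441610988940434684447305832019781186106638695518642837772077903997956163850746134252365493580180417477080051269183470286532979800240407187396248927557447883090842484638889164667498792186014269993587929531041152741166511581446068052986367454706294397083545686619944916564118960110962116562466522767732686762599506540181734714534738867235111989479747846680791099423019139780313365194132749732194103718846967673011036414322593631960868671493454763391550346691827580074380075217865653601440223082400523105660803408600710231082835422118398577662627917832732576903032972402569976969648303650115255889464188988368174106506796712176877659680555885820489570598526902248005761566648738850724533250848706451484009219527617035232309790059241041004053395915821889923908091593958138976403777410695368473563961597359197230533149997387630659295579871335780612479662630720335324311521420316505755701863787619440072265727002263116093070684082875499695641576214618176 1456001036035571650567060921388677518228040577449023031164917561866945387215515960008755552797237379678513831240349939960707730599220100010319253015747460564612506576493073185842460886471738962018658670414120765094190233817703461834300497384078514477375945185375729920252056649258261455994808163630989464974176658452734464988060095275463603265403434568261018877195737843538303499407412757520808158378871867166372885733455505476672268201637874411369022186530000094861536538361323207235093230053251223583518643170230603268460618650951336320166165221706107376130661846388744273824273660576384959802486282407219998455566715388965730081067409597298863937912887704657698673279044641295075236307027997527057440554916416386571637378339791919792449315533864601918893811686488034255470573258726976479086063577226454975380409478233185688613529526961813594730578615041222010990728618699937539643449399124896992558668128892065451303249056906001338680704929431661719223093785886431985777538873342660145071087155452714274512960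 (by decide +kernel)
theorem big_c17 : BI big_pp big_np big_ps big_ns 100346 3 3 155624943109971055 155263042651796208 158154740090480196 158406731373799929 :=
  BI.step big_wf big_c16 1600 2090 75301 15 1456001036035571650567060921388891764304157783828765910511685551792386756952805226682806226256952791518537329942221343652701895919842397851682295570994799153328617941569664975216476677996649403302432479728985588068712001139965904417143380136747608275156272151056348101739460350178988850401967159889320643710149505625644950257125580571005896347452796581014926007819744460300649247966377046730034418899143797664009930988560238195452516451515644416507739196113026383302236848833369970705523427773142001852872478798640426897845651229258325497732467683691467983849907418650718280870178983723423791710826466289995985450709420687225384133522523994717056909970565901003569554675574254163023986681735555508378267486067027192147614225193418069551808314481677765470070915210197111648743537144842759951540506386831011781633187684811291516400881098164333883499560635574766593216084348960848544453140109563626487115858873859613403900320736737716670668237239593314208258786984768945135568509805141152676354203718098681869557824 1456001036035571650567060921388891777413075656601928130275842150047228234538853898107434364167511083428778701733370109880173555575184621398830103121325097202220872702017199942051122582714668018292893134483032431778609262497430338988382246563851324259463202420771743093092578979970177556436271131862107989033430079148338930544073045995093981619085009377540105140430367781320191788752039163660939048034542583695200724080279654754031024259204467816175491547752395944494606545161707679831121914158981479019983626377190115590193344628131675073418467648815948310264904364029327713354191217626971062341226847775532910164786939269145395114859640891027539984017001949443354556673444448738888543124466376046179894861191976336768005299575425298172636638730082559430226856951912195678144126482795925321867493552397971340010785087279263970715670377751612896707085365450015118722869720451314322777967093637758533352919753470427757075822731270412606880411471297921848338972385169813486218044259485385236107580359965702301311040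 (by decide +kernel)
theorem big_c18 : BI big_pp big_np big_ps big_ns 133790 1 5 162007930666584810 161871689427203800 164819989251122770 165305544003093522 :=
  BI.step big_wf big_c17 1600 2787 100359 15 1456001036035571650567060921388891755711783321789691297146515477628880937465719734759519325456671142940743772740561506513708693943491391396711717943261982846753687892588029314890484320590944518486817815367429791023900352535538719038992644175290440916729273289508253947610945562496617016822540139061150446183523554485486167968854213693411464282957042686365899142537401332571512549214315478719666524771602402551224933773256403217074911540934379875890573024307812341774241501341269381836458140667358309613267986337565547901853380313721709002515571385673514387143477788574433488353889648014774870589290533090174158857612376282923153764435272537652071077196454796314014641459508791832125158928259194437475283651076599081842795113243532323590556159919283601678375742254169405156377979466596110295838224010444914906661438344626860901083012031564069121467757084373850071187437588675709929724657565145296977045186112892371779483883672112279083713667972655840514556909562972299371005542466106509920432258067633637166145347 1456001036035571650567060921388891751499576036337352129846583706802460133784064070299915530304679561976235268570481038697814256606104981843843451641689704725929604412811386378247598788569390363194239483687590806309477718439846638588495715305939004057131556299399810780364146564263280451773843530291558172923654715437837462698031527044352717186344253073853743381367812135501551911118963060172574144310880394349792312784791841316713154802392221482696215865574405037758522417242006641543123254977512699329383651401120692074264602003700877922656968393113407093045967335802657495796736210916825113398391229773625112474253573890314211637505942285236271447236644913010879530376233517601143766355318995799993000456753842381713269618084767526693251609991226827421220858585274006359477296710067052898860356363902213333856335342089058039302983207823722513216574438396189921441845874267579290464088232461061849242978466563445558275451598528869257327306269187067426804406784898071187692690256454678203437766969164067295305792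 (by decide +kernel)
theorem big_c19 : BI big_pp big_np big_ps big_ns 178382 1 7 167241015974082102 166933997483589876 170338878944894879 170675155363383952 :=
  BI.step big_wf big_c18 1600 3716 133840 15 1456001036035571650567060921388891751262349260185738358593707981171241562915179943115605862179052974566511426983914660167322000294489559893572073711403449581705317085421410416142707993854062727161425200905549619080823361839555886248282871679281092994839670590535023014341114151392609250084196604763041107009681298285110335520218045542449339851085518822798353314891144350764039791697684372057436521119997967032883480911490615707070096507251394699867436427078228875897063269831212581079305655656202915948990823008602569085788264196049619666155235458147948234601417034851968638355244268687821054252692741846725413307144333329374490954706908001195408245968203486363691574672825975502035310316732143137325341488070587356181500470053812344104477045049370663561344053284379729324442797857156526590523089945933063093008019324071083672754096432699223632668860731443093564018232559009676128108849229840718123819748035403813917498270446244686592051663715643181129281250161484855358805225679150202838724661599218786504712770 1456001036035571650567060921388891751194435611495170336329813638973208670313024009425853390762306721271374658849187666957630406860368360812965592137047405694282955221885553187436571659904533231108711853010349168824149332085032582616788293393954516222832429726057511855446437080038731552628130258501822667233908755863353202529239351687396586652088530971508799299213711090556260858616646987363577389174730095974175935519215407955133766442304974095106702914512233713367634598783180553603808749101490472793567411371856142671131316595268393577580323179417232163483162205763779363830858363826989867697523913101085594307739464294271740888832127471184458583583724985215747673321704013716433402771094283361341515722791814565175900980245216696091043212836786429602777193963745387279571183472407453667312169199858402462053411681827108356188586489562183799422361403042980262654787980514000736613702698839537483115892516813234378613463180356612610140431668070926030786971667729974139101796389659090277761613760839662508580928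 (by decide +kernel)
theorem big_c20 : BI big_pp big_np big_ps big_ns 237842 1 10 171958206879320769 171685210879848832 175173324952823283 175564972882544737 :=
  BI.step big_wf big_c19 1600 4955 178471 15 1456001036035571650567060921388891751263168006536904322537861830954887039343306630113809725323653635211968432597670506443194586605607127906020546555189467757084322005501162273256021731585571794112126601379658927561613704252975133755112613967421440991420254889133530794817919211250308835997924350911410496577472762670405867214811871161779537344760735276904511009389892519064137761078027408933352367091970765379582808193052287267173281880756039207038372012310793054927661131098630949569568436436348513840526691090344697345040706258343812107926459486046823428399459276775997533538216151488520823829431051469283196658750331156419645449356916067283270340461579156016078347308666259801714961807561548414259393073281959268447404866800573267642054589170980446150489461963745378772274078822517296503403511670623426200419321333070693161442534787276396647291924456138310771242053921843469140774314701202922597976608411648029697111044839518513197242506793584265213224735380557746183539223420768931752884805381418938996367426 1456001036035571650567060921388891751262366054464841609022663984840314644222199231202254776694919758708139885406045500275571571465290996557573461460152599279834464443204830927665787848830640982378268343220385201283497613592285202540711825269298435662943754864050457988869011550669555503028577765244609810100952060396442094517606016781173770789289447670237002360752485717614653666244184190240074409100154631509744666133478963791091934069752804439691647349040564592422149043032643680862316519981879645302552856427168081035089813961128171870491394864070888474525883049903860372227319674711662946843931274295382389567209234223761870901619750386488016689050741463008938116722295508121074736258157050978229761723916689710972882534468868980246732857538334847389851078309241655560006495413096921468952976547540442039339487251230115016065514087486252974977305151137534441622244504704167287355222894601077798887277744852312482927929001366223365581321505508736702125109090080729284327000262740482650162181977602979477315520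 (by decide +kernel)
theorem big_c21 : BI big_pp big_np big_ps big_ns 317114 14 7 176275555649260302 176019337523018827 179482430596163326 179931367537535402 :=
  BI.step big_wf big_c20 1600 6606 237924 15 1456001036035571650567060921388891751262630954884060545637280728699505950717037909439507605267473754028541026485069536744668755687592130061405945485775737963651180401206230679070821783306758683342613906042300833887232874632076096286710077207266961510119412754717678986485073760169709301728333199318081339539532708098733576673465045633324889809668857642817294424736633755318056538840006897518404339526357764196900360208692387982095534829029395701557151578924085074098711723325303933171020775193879362738804314075597485069056951970611301166356633402107115288682809411805635743395515829930048335224348279060331913519939366038541065856946098538517616600417274710205795419237043720158622446458615607620119672125447579680752552369058356315167430997921822284228869325541030857368884235277269515082135851679093352608733171545390677109660838182561039942167146365171190629366135387145353473560635778954302379282063251548392452266223036257037027862928901034783092118371504386696324906434862348322310234110333518628854161092 1456001036035571650567060921388891751262087974653634252890365299723123876264183285867839228350238706369867578794967131056322046208562667884352939780003276585150001266947641617119701671531231318432381348777513045645270131040799400063474923927241498384097535373107127734877061850811274633845279978948006790647942705874283677376321163149166655461531632421247881437184563466638669145982973893357703683749129585548339500876532613887525384023445168531936133367057176764319614126350341228357404084827945290937954940083609952167045334301853621495552787595356349753667260261636638672479261965255532747970544696566444825746927962255267385328896507531879375741299911611041705560022286288775353245758690963025685740285269430306877106514402320204403615711718340933431444541694742042411759418337992344415121228165473590647795009164044477025376305872585585553989198982756248080343644345974217488877752578518401614223427862522727570028926958971185393619942655472149384939205270453442145167431575087024258341363912234014184709440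 (by decide +kernel)
theorem big_c22 : BI big_pp big_np big_ps big_ns 422810 15 7 179725248839719504 179500500687897592 182765477701879088 183244669322029103 :=
  BI.step big_wf big_c21 1600 8808 317277 15 1456001036035571650567060921388891751262631081024493698967827355962804072610103682843885619962075000238537633368790182083048268142308839527049713271546350445916480517911520197220956564241008690667881164220978619497950293577232660718435525189042036997299436752188654494970641425285447346838168345931792499534110801425982523707768720234569302686024750679099258045414982729003776812081193687688690964420312897433919154645919760903853336421951806032075720315239285045713956192996735033080655611507216886388106679019680115121045668184014509338859765654434984375322612127106478597532374344840087719402397960322472101960460792972050695821049290438406984966831270914137145480117399410584524408370854857522864046613092484744194279094562904256464381540934058990585624934196633733476779338691494328665456280876382921975827551999390710199939259772789536533677009441335026573560979332165975723088382363235152716946264760034029186156662142483651348177577274704141469728244543804011321856078401132734237839128282037522585886783 1456001036035571650567060921388891751262635211831842345418739093035484010184177598084540727131587149640819209867955997324231714279672147070724506150219246650298867676183369597551910054674225038286849054450677634568944445962854840818341028800791189281344215251197082375173386749868916341146718384427874205523176802835513233441759451003462427301066618085775452816608286457276635301265811260141314030080014884786666898340043675309696295442731949439266166059561002850607007493575986500798101146392781004425501909381153188091492068476554789008073837839050233764161698497932935394475534587271739663618283924046833549310552032124164384059728719612968392079348875140514581914265266812149246408672388286591555374235020782241504938619356890838165340637933649815673484370565553942654861536462600508201764918623129969730888236575389881871391265453821076274260640060565671861647247680683329516694419053715028167872660552788719730689307554168277923983599718962552729148610750714280954959023759107900868169031216216001702027333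 (by decide +kernel)
theorem big_c23 : BI big_pp big_np big_ps big_ns 563738 13 11 182616634063992045 182371016153756049 185759748714729637 186220209723722178 :=
  BI.step big_wf big_c22 1600 11744 422923 15 1456001036035571650567060921388891751262641445683293545821050778622114660348315612154028124433486029097113087462049991905949984445446746308820537733713984341755416357834544750270705631474064145300450785317324840198479158473816977533702846668364295556918223567009943238850828496749584672241717278675208584650253062155585334367928010017900730110937019087018861534322891879204301775687296702233026354227561667966734854663466007370020591010166803726711670358663869381256732442375672570820257655136832176674403047059951812537776210159082783180086329195724286431279983212080370839073072921773664466587841273079170232930577214253129748822380981203231896554841791395080592270702214479271353917119024591628424275630814987941343703161984359332374656592700728316451435929642580611531652589937716581956698311899663290004582105474414478559552772034132190498804582538772787144195473290995172624950533626013683439561667611740359584439544765853814655951554743998621395044165043268723449331701644994331173427443874461512604066496 1456001036035571650567060921388891751262666255139941435871089735147391921148415223644654204543589744432990975058294276841233882241059105947740686224229664771301439055811441611863757526131128157299455591698147689497909099313755278627325411594513210428668964162196304944440103805598268844710864429969906581620358509188724145174609171519565884165706875592614743610059567346228243869825094665211279110335962948326649164691834054637336503543710938483293461572055265897119220513727973546866202843070724176584956258395661007290563320969461173708475775364120428573448585973551011297218905609351892029061009433900166778228916433173430771396713598287318872096397167908873936794715261642939541615920266301261640159889014636041324559016976035228225260308236072047285516202945251472389524979802931476470827031474943535086992233316896126657133855379345463226527565567683951359810914230134068401460917267933686803818428472133799787223956301175395833872630104468811143445294970833622865578789522348806397912065454102001595965516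 (by decide +kernel)
theorem big_c24 : BI big_pp big_np big_ps big_ns 723734 5 15 185007594551675104 184752225614829697 188054239514437956 188498044804921814 :=
  BI.step big_wf big_c23 1600 13333 563825 13 2003196840463625134809656647860830139717181268744404510858616516023565772771994954958121685397149573505250133502809093311049316415792068788558567767684215856303097046958075296912253858895034861491111225153695124356168273503437556062676911941617439611159076222777497637910959422201287582805160763841347445528385411332862488372039538262237632688190284440132064230518837836037726532636066414491137762109793709485967360825515439976708212768601956561505749992818924713513576685852569440552508878618549310725351942388620895342989856893190011456833192607191784138047802587633667116237665930902417789911087864150871688265674106972174271911259658513779333033527141342214114145089902910839951559709127575945551163375995042496524534360674776105817663322088927755623759260546577399129674272377407733159383459213481992078695144929728082374067116823574635877142008624125841405211385378350786 2003196840463625134809656647860830139853358149373279325153072795143825249299305608752332424926133669775686956119700800299664536539288563228403338742925554458126726056363355741395226801011710263461004507362723924317995535838670118795020302385851931557056676599884198445423383238209373216146660054410349131415617802235420070530475464647588406085141295334040127513060616549897955426028937329060010128430672451724508123745503727833242506956512582798525418387087102265467884416406263764897208915125421023800230144250311597739543676467178085740413544879110636604250330417340406915769548241926327752444700943824235032142870993276174782467933637264406767322548943926732541207774657899067840077116452490978455526084630609884109398732846371128771151906791174665508249299501574231774259950937895413814239455144467679089398158495156457165091318814183102817939466923459288779552864492052561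 (by decide +kernel)
theorem big_c25 : BI big_pp big_np big_ps big_ns 883730 9 13 186463449023892593 186222435339142710 189451297878588116 189913531897058533 :=
  BI.step big_wf big_c24 1600 13333 724134 10 102165309701951909708055795275196282847283556417247923513218167278378500565496885700298103408487225812912779596079608570577738109859165385590757165968043293561190478165232561909877325169620087998984200711032571000787578780362345669758201945040495477105013674838941749620421563207611101937168882435190124257326092377177392081083341162441532709854728282015579488415664910097664671456782441486897866205366946042911788852804621713777062171947838451329555070222462398802614245995158540798582081784893871736992450261962133977231655853654317498386958727807183423205765480129512821580894129395966135875294052361041299023081850374233686580683286858383006130576408737915791621003156927 102214833881999520931217867520262400654088902405828600156705402703322796769944988527553996935841351082986403633556703836139735065848626048743246652757372872689380372969786866860329301130190584352345104530640884298089589934440509248957789884363184562226444797710495683977970535975602549534576716062583500439580504139688553973391202788848036890449102167707935951427568112902825369576528660624480811697182656726443241657743751994895745702227594626907503607749262347609598099913022113188381919033813131621470563684142320970079939565564678266794653246823297374838002615221523571366921171846565059047497503389843429632023205749037188708645764898645184071259725385153331807327805248 (by decide +kernel)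
theorem big_c26 : BI big_pp big_np big_ps big_ns 1043726 13 22 187630815826898459 187372923213755105 190685443710609883 191146382764059097 :=
  BI.step big_wf big_c25 1600 13333 884229 9 3791818242292588069297534824434926186073026163152390242059368831175907488628045372296302772944726954404641518560690833854351004748491833726677440670303778371646821971153384790499202060639255432772317316046094188955179405306994964529160453038470692522212402217325767573990323705024904592604249257952017709627841421536455950936551398493148590359440019645212304303249606405736431280431694266037578811484262242908714984516834505432017715233754198337468343547422497688451875448552885214851179375088349419919055739666490036281990082476940871068433769545545757500162365531641835109900064553973196173731884545696704 3791818242292588069297534824434926186073026163121679937036982192049786722206403488466835170201574944357100198319293768298003572946997406334478073670382825021202307948016399948606468185627153688325750402769588841953403196289791182375951991960896854247247219451194427389266011152764651726846065082615390301926783110530088101870752218973456295580337528995063438288434578897022829348025370574846600808991714063723168181845402988536766720515176400034874885084799538973796764168686811446805262000574509886680779692619818063230323777376408068487002953349657314384682733855675922183502151449199660298223032346880572 (by decide +kernel)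
theorem big_c27 : BI big_pp big_np big_ps big_ns 1203722 5 26 188502430978368996 188247313423160891 191507563278711125 191966745252501190 :=
  BI.step big_wf big_c26 1600 13333 1043959 8 140646355466004347166146859297292635165171872930096505255307710247560562010283231324441118050855364777848410052417512431846092709419077603309568208415842927760030359296106203780686957221737814929589433255169173373234699272389277262794853424644024052756008190927742268789100106447917439839306557116657413268157257850070776315705833719513247456365450689649341378893667255900086109854193333304293366889059427079232026953146578623355864272092968301674804669185104988549212656017102575285767289489142328446770731707633563423912729360688510670148 140646355466004347166146859297292635165171872930096505255302001173829029553579080309121000651183846811909586043449847992965512476205296078879844851568152703615771192792462174926109051860769440129867094899237515160243864429988083228410452856839231256278878902211474240421088319066951677396347705721624645687742370089511482845229147822282631388773046857117998195541016894454044534325608967087062518457515662572035257500511386897632622565116366262255536032317711250548537947064652535323003575305107793679988658980838342720923315725794117016000 (by decide +kernel)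
theorem big_c28 : BI big_pp big_np big_ps big_ns 1363718 37 10 189072546037041679 188803380261113351 192113563285500275 192572391839532980 :=
  BI.step big_wf big_c27 1600 13333 1204419 7 5216863267662727530079659287563149891009860446150124469547864742995422812641504711052118451107146531127590339433540002988715011769563614003498812836019958261627822001660333475232363630505797887420583549343454956429075757224039117973349929068557462562146349686010599470338185377149645403644276472449677092276424815979285020184395977585105223127091529419701010671904822565107616052848204519079676644752767944216992411314968812842807547121054287902661083251602814722437489606 5216863267662727530079659287563149891009860446150124462633478648793260017808069766245234704048461066611546802546000321499790921079942806450350982790239390239803607611620483436167506772890865767616177132029962344096933640808291812241150889253733406459171397014929125731838560702386594451906800262420594328564315510947496943360164890548924906759152800156640987619847456329744059551546406885518037754796187899829608769099828250869708434399407663285767297356700996605045465159 (by decide +kernel)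
theorem big_c29 : BI big_pp big_np big_ps big_ns 1523714 30 25 189529867171149219 189260896197807969 192524231688377999 192988104279158734 :=
  BI.step big_wf big_c28 1600 13333 1363770 6 193504213197098684569754828985604278381311700769225114052415217975708974151821051963229368956489006327825106981177141234336801074586412105703838331544279664364173427149319635962705049426836674835800244581923604336577822307488942088168325178180685860014667735418513131395262783379619491277959969994626158594089075698617907443526345755809739379019742223209919929751268105802139737126991303510708877402841119 193504213197098684569754828985536772103550616962668345223103176104893692596364637608972236055943822980240072458710847391409231223132439427295325275247101776954015382555908863592494346590459241101185534408831754871808503941409278931205522874109183515100950105676340265002102980450771699605748482028361662957388774386837066965607113750892027453039754407439883702691253812078815431071094487832270723431637798 (by decide +kernel)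
theorem big_c30 : BI big_pp big_np big_ps big_ns 1683710 20 41 189930237215071483 189664730906766156 192899655635242143 193369771140740855 :=
  BI.step big_wf big_c29 1600 13333 1524104 5 9514124289640491557838678309845545742517155367537406806809393349161619120932909745883101696564113115416468496001652041890034787553378831063637625136725579268245874482283845307728271942703682484350123349726634290516637062304139736951302504040855462206453907708374765689939331566655661989517086813146983205486592381572782308100115056943152 9155132463630182938169377791474817940165165746309712600259852863564025510216662889043032420194495325353005633766762366425137771565123107554572396237004164362025438879066036312473126592917122391222955161264157469803368413807314311565667173005132377336481174080160669317309394694723989986095658399468948395260461576402866721483624683825325 (by decide +kernel)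
theorem big_c31 : BI big_pp big_np big_ps big_ns 1843706 10 17 190301211624092878 190047903793673154 193240055803140266 193699752497461971 :=
  BI.step big_wf big_c30 1600 13333 1684260 5 7177470177746085373439234274485654504991030790841039281180236762328892765154631723763854677338086321545756102560187705637507869224871558351389671438838183384831956350740255721444871911923434736175513615162307057108328861048178471802871314250883277546171201798806712547134676633651986159530106341399531185186627927013233490125325081596993 7177470177746085373439234274485651891188919608385224196433093722618554769408433726452350243218526287139293984065063631599887997345813335837324126077273917257728814406438227836741353029911178252653150392872366983403822629691480477589321805624428324928349865905896733317287983726249936109763346434302901793277582556044362792858549739790418 (by decide +kernel)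
theorem big_c32 : BI big_pp big_np big_ps big_ns 2003702 39 13 190546172572484202 190286407548229852 193509879369806944 193978095257445891 :=
  BI.step big_wf big_c31 1600 13333 1843894 5 7177470177746085373439234274485651762599998306974745060771543351106427701919750517016783829313331100038636978101174169831177063056724660928354909914256046547164305439059241222517240543119168569759367203485918153608779814676310139014102167672340629212092067562698605129300934295425554067846187755988179122489172936728381128202343257269440 7177470177746085373439234274485651762599998306974745060771671956000640302771284832736976198783093105635384349002460023856245475391783880024750473383370475246299597131447986124246781405335770663758848223986532839044482242066956641422692750497377102198196844598361122800691086819988424286314959079484973620768540816625881850964171994179378 (by decide +kernel)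
theorem big_c33 : BI big_pp big_np big_ps big_ns 2163698 25 11 190735683731102293 190481517090068315 193709718297084228 194174654322670529 :=
  BI.step big_wf big_c32 1600 13333 2004849 4 266227165296236467686449107198841293254677268094832035069465534630135678816327915090643074460874700719162212148410359437812769336732080546544650632280500059546349034384433210527147924175438600157224297070442691960366995031981327175281464339658348051636019514470957063996 266227165296713202343762237568665381573652073121360333104311456201896908001097678629326654875106830865297163114073120672356180914322482541672422802001630529923706919906156518669372066030458336486339252898143894901870452655879327987627168890927414992383966102603856945723 (by decide +kernel)
theorem big_c34 : BI big_pp big_np big_ps big_ns 2323694 11 25 190869827988492265 190617076731120887 193857290973202966 194323810823094732 :=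
  BI.step big_wf big_c33 1600 13333 2164934 4 266227165296713195012202726257142224466575324382954616306476348184142069253420865012626207902643219903391247443907111242164903847996388157799530549199255353941206513170907525544869497477397404471452890947203736277966376028015255106026411574599299709704066087137460626112 266227165296713195012202726257090136224659413144327971124844832882602809603338329471499924004463998728136951579063317647525688335389071338164015657155969714475749426488322622569713915367449937800562645656339152229574146293433101115397776104657728390807694039656270864446 (by decide +kernel)
theorem big_c35 : BI big_pp big_np big_ps big_ns 2483690 16 33 191018803772439258 190766349662319884 194009708149447639 194482722954718153 :=
  BI.step big_wf big_c34 1600 13333 2324703 4 266227165296713195012202726257142226907135660364645676996889244975801300728038425254050282547237298460290793354292077759110448688856690413565012488752922413924688132906392926044514000120494481375469230778876700383324163050609944503004090347795200741115700088843319385160 266227165296713195012202726257142226907135660361220016300665295291774078455120914243046290535843589780854054235426903519139626033949937536241239253031886968617153481080192357603818277411924451181568839756416830476885542918797694303470282833231809193343690943915344289872 (by decide +kernel)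
theorem big_c36 : BI big_pp big_np big_ps big_ns 2643686 39 6 191134284051677640 190877657566971892 194122492408172705 194589502913365569 :=
  BI.step big_wf big_c35 1600 13333 2483822 4 266227165296713195012202726257142226907135660364659664694405399242913177558023656677557871655904429685150667994691742901698191508213669182048977946488450517721817205227337647810081345019501686737544019249858189083708579990093269636203054702387800871790190906297505814993 266227165296713195012202726257142226907135660364659664694405067941408532908045865391553666269486895488850790559723880771199558260628684771481638239019362314747711346998066890041612174394706085367380543416820753058973467394055807510649623844568313425516340743885018030146 (by decide +kernel)
theorem big_c37 : BI big_pp big_np big_ps big_ns 2803682 40 8 191226619212265008 190968764957906656 194208652057241357 194675709200072422 :=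
  BI.step big_wf big_c36 1600 13333 2643904 3 9874840295982012140216326729688617002856757121176705146430935902523162652134577353477588754771093850297390594686558453025454571726986183652756911723203664794431873354548382606341732014104895679617652185 9874916413999242668844656761557269055252510738208684230705200946864644834231492243424901649480582898644198617675760389297812959303348115777870913602853962865387928181200496713534927198556601491106177086 (by decide +kernel)
theorem big_c38 : BI big_pp big_np big_ps big_ns 2963678 26 13 191302625751881584 191048325846914278 194290910556420099 194758007656469903 :=
  BI.step big_wf big_c37 1600 13333 2803785 3 9874914389986452140374782750127939103660048943790564682482587879296553256968587253258831844921625127000265480723209973200653781668727346803016440658955100135687361202703361695072296821265754303260205113 9874914389986454056753852786970124840343571798959034842286132379336138607703776650303986663295742744349327758846268240349236482572045596085408161476217739538514824554945599607215511846695180478354302393 (by decide +kernel)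
theorem big_c39 : BI big_pp big_np big_ps big_ns 3123674 42 21 191371705427053036 191110978093375455 194369093950008011 194838818371459607 :=
  BI.step big_wf big_c38 1600 13333 2964067 3 9874914389986454046131100029644325621350791277154945582607395288832325619435922754213562365233904652278043925281900265267121667182024590376678384140607199299877148459728445241977262057126416309709268672 9874914389986454046131100021841824567615992457547889527847270277762220327006904169543184357939472791792267160018982051805842751921412785885980367672389541279841996536252653335466812117878221557422055228 (by decide +kernel)
theorem big_c40 : BI big_pp big_np big_ps big_ns 3283670 23 23 191429389096748155 191172300801231902 194428213504642546 194895428760851118 :=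
  BI.step big_wf big_c39 1600 13333 3123743 3 9874914389986454046131100021722989923380504638744257216908673467044865871783189953840427031920805353817321478439711449516923004032630061102311778563968657460288391201713357676730664790986108398191239225 9874914389986454046131100021722990069868780309911112020035961761001727237293044294083029541787675443721483273869707296715824293885111323875502170587807321384561169310510534452593118184385190663189176895 (by decide +kernel)
theorem big_c41 : BI big_pp big_np big_ps big_ns 3443666 6 37 191481593531215672 191226498541154065 194481013891358850 194949275366086382 :=
  BI.step big_wf big_c40 1600 13333 3283809 3 9874914389986454046131100021722990068958213556157454036633000632777183659609080119371476174141203638729862805738711264118581060184064711093059909551618045159244757849625204925792868533400280783087853632 9874914389986454046131100021722990068958016741597309217608617516867908639337584788166699823770751772955660055673956145166759519341601829136021002249472202667262686127053052514992417603313261890835078720 (by decide +kernel)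
theorem big_c42 : BI big_pp big_np big_ps big_ns 3603662 30 7 191523791857515317 191267648105526420 194536827307327768 195002212817888113 :=
  BI.step big_wf big_c41 1600 13333 3445615 3 9874914389986454046131100021722990068958199498828325391780200264549265374346809566328171236856731751455523886065881769769774136714303773777350475411703380951292480832629220594749175755881718778898160585 9874914389986454046131100021722990068958199498828332318940236416693208650822358428423867404151514502865957030153783844049880077699564297122814891884285966492786424494236157100565938707674350178901435070 (by decide +kernel)
theorem big_c43 : BI big_pp big_np big_ps big_ns 3763658 16 32 191580977203390098 191324764233337782 194583123862678459 195052036026893188 :=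
  BI.step big_wf big_c42 1600 13333 3604120 3 9874914389986454046131100021722990068958199498828328236666346883131965498779073360730820170314735355607985235511976410777306348538402539894428354997790075248389705073704463324969790849186669496875622336 9874914389986454046131100021722990068958199498828328237040744833044015715857175658540180020911196400169363449053546682215215081115336988954054960718016927581341166273922866709377170468671100182938524864 (by decide +kernel)
theorem big_c44 : BI big_pp big_np big_ps big_ns 3923654 7 64 191622663594201710 191360792997574228 194621802242240069 195091887013833824 :=
  BI.step big_wf big_c43 1600 13333 3765213 3 9874914389986454046131100021722990068958199498828328236816963630519883663235361751205141556678065841077106233506186341532970556468669200458483176441424512635366597550764915528281037271998874211889209408 9874914389986454046131100021722990068958199498828328236816963629030653180226496943895590471520837944800712930625460012590156509699511013614433331910679412951632044571746322628877388530578233319203283008 (by decide +kernel)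
theorem big_c45 : BI big_pp big_np big_ps big_ns 4083650 25 19 191657617880673947 191400432769426481 194671099419774131 195138028431689813 :=
  BI.step big_wf big_c44 1600 13333 3923690 2 377638480162210878891867875575930302458138007259729568456766989491643765362755790953391765198216970629579705943720667348023386359879620 366285407732231926180662134786787169784777167146607877173519900483307052532089553624453760394125899129330650497340002424996419603587644 (by decide +kernel)
theorem big_c46 : BI big_pp big_np big_ps big_ns 4243646 34 32 191691592776718663 191429778294422851 194706540064971940 195174880781768698 :=
  BI.step big_wf big_c45 1600 13333 4083735 2 366286130663190506703494929329196314902565307379624942647365880619253770276481814849840141432525570054528907256836521789569669618737215 366281278616488104736213824553767485191590512546818715151273793383902026119967513364518889979957592485371186102906588220819586247828914 (by decide +kernel)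
theorem big_c47 : BI big_pp big_np big_ps big_ns 4403642 26 25 191721186216696832 191462657999749856 194744204759070687 195211785514424679 :=
  BI.step big_wf big_c46 1600 13333 4245002 2 366280931928990602958442479280839394207035495739540421153614804295926152462436458901751778223482036199982349289634849224652533124882484 366280931929810468160872168006921112946249868952306154312963208169000058154877306815572544422387574801328682760124960573853763611023680 (by decide +kernel)
theorem big_c48 : BI big_pp big_np big_ps big_ns 4563638 40 14 191744133326123031 191485869526755235 194768666951686329 195237299169407041 :=
  BI.step big_wf big_c47 1600 13333 4404380 2 366280931928494811143094075786098737139138484398975936301681755360983881559147491755576128576957692559911867243944363822646470418374206 366280931928494850860316096291861401323603626920384937411067909584491910984725452081298611083693736523052624402403384295378216075206723 (by decide +kernel)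
theorem big_c49 : BI big_pp big_np big_ps big_ns 4723634 20 21 191769521839769447 191513213014680191 194806887999384102 195274308691587799 :=
  BI.step big_wf big_c48 1600 13333 4564034 2 366280931928494810512647659927845090368322846711467015625722285250403938811127181559853157391103803699972997857812233331812468979144653 366280931928494811143709917961547749382340451373049914532708163108285744486518683389330609733868183992788619816171554727281676763783241 (by decide +kernel)
theorem big_c50 : BI big_pp big_np big_ps big_ns 4883630 24 35 191795172087721090 191536931012736928 194837613812702471 195307428016293498 :=
  BI.step big_wf big_c49 1600 13333 4726524 2 366280931928494810985485714865579633236893580212637096548796257114893940410357960258811957374165189740417471250221506692626498337120832 366280931928494810985486196610251231041552260070976268503038017756816558078724453985048428101081858853638741446191201768353487198870976 (by decide +kernel)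
theorem big_c51 : BI big_pp big_np big_ps big_ns 5043626 31 16 191819056427351573 191560136867330834 194870310066032653 195336666335428685 :=
  BI.step big_wf big_c50 1600 13333 4885634 2 366280931928494810985486013414773978085754606807150687258443016620220210678924013805087677058448962081467917802139805782244475339382844 366280931928494810985486013492536235894554649450152047254997965510624318669881311237610417550832355614777748646197068126252886058345408 (by decide +kernel)
theorem big_c52 : BI big_pp big_np big_ps big_ns 5203622 30 26 191840926817190545 191581811072686169 194889192674200148 195357398734991959 :=
  BI.step big_wf big_c51 1600 13333 5043795 2 366280931928494810985486013424001724286404928484896049719449249009523220537388874910575811819998775190464342832132008249815940151123515 366280931928494810985486013423876301870263568893258300232118634449175999530883871400534260844635113628744777622774057296695348486560704 (by decide +kernel)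
theorem big_c53 : BI big_pp big_np big_ps big_ns 5363618 13 48 191865159371536106 191605863045247269 194908586068800435 195377680824834540 :=
  BI.step big_wf big_c52 1600 13333 5203840 2 366280931928494810985486013423877000561501922251807683116191621048177138533910073825269270561571679132500285543264138412923526411657268 366280931928494810985486013423876585102140833005945474242534172971019608180518445287682254273514288823925874349688061815272388833402815 (by decide +kernel)
theorem big_c54 : BI big_pp big_np big_ps big_ns 5523614 16 25 191886537331473610 191630618558697947 194930022758913026 195398266550574244 :=
  BI.step big_wf big_c53 1600 13333 5365596 2 366280931928494810985486013423876300776372731856995033482777872676485819389661488427443091479105431032621583424707041356937569904877629 366280931928494810985486013423876300733918429498630823944159170580617169534688258066603444922841054877194643635049287455405055488712384 (by decide +kernel)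
theorem big_c55 : BI big_pp big_np big_ps big_ns 5683610 21 27 191909420977428409 191651821231266814 194950802312519715 195418863983671512 :=
  BI.step big_wf big_c54 1600 13333 5525473 2 366280931928494810985486013423876300776971877135383139329945318734835144467111585010115824194350543015640157930405487293888960595418961 366280931928494810985486013423876300776838479506254235558709531079840492294300228732927525522618957716642776768556172843774471541106093 (by decide +kernel)
theorem big_c56 : BI big_pp big_np big_ps big_ns 5843606 32 26 191925204898567172 191667207936268680 194969199508033093 195438860511560374 :=
  BI.step big_wf big_c55 1600 13333 5686561 2 366280931928494810985486013423876300776638174162562770238440049100389939963437133526163239241114477173939109542828873426246082000544320 366280931928494810985486013423876300776638133423094367726167979267742819856154880238449793370443505816447847110705647471790377954892480 (by decide +kernel)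
theorem big_c57 : BI big_pp big_np big_ps big_ns 6003602 3 69 191944492969413895 191684555242849750 194989662943086935 195460095577946983 :=
  BI.step big_wf big_c56 1600 13333 5845040 2 366280931928494810985486013423876300776638166270280029547277053963833137262493903580943470407480509175706290881045396917959016173135813 366280931928494810985486013423876300776638165983821830441591646956014082569382047128912295005167333675250699107010638071643378436481076 (by decide +kernel)
theorem big_c58 : BI big_pp big_np big_ps big_ns 6163598 41 10 191962520833584331 191705056469003048 195006154908697576 195475057904679187 :=
  BI.step big_wf big_c57 1600 13333 6004183 2 366280931928494810985486013423876300776638166014420808278882075947678037447852896391238524526825651728937075727291329074641400890959680 366280931928494810985486013423876300776638166015906843399064676623495772661184596614441817635165031619995956205599375239164728001486913 (by decide +kernel)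
theorem big_c59 : BI big_pp big_np big_ps big_ns 6323594 47 15 191979863628104645 191720729888614916 195020381815961091 195489674076502121 :=
  BI.step big_wf big_c58 1600 13333 6163807 2 366280931928494810985486013423876300776638166015656314974313764807960965647805814090413722686468925610577312597189710631791110187508032 366280931928494810985486013423876300776638166015660426911657589629407102062088791383445281902999370925748759163100352884802972837420992 (by decide +kernel)
theorem big_c60 : BI big_pp big_np big_ps big_ns 6483590 10 40 191994610941839589 191736569577710112 195034567822569919 195502790973939011 :=
  BI.step big_wf big_c59 1600 13333 6323725 2 366280931928494810985486013423876300776638166015656406032350351449431752747457516477383389986790388403524419039469265664729163385233471 366280931928494810985486013423876300776638166015656346872718046811849330015553006388504869453629328045564133449826589000518939643437120 (by decide +kernel)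
theorem big_c61 : BI big_pp big_np big_ps big_ns 6643586 19 29 192006560560185513 191749566286731910 195047225482522223 195516147733741688 :=
  BI.step big_wf big_c60 1600 13333 6483745 2 366280931928494810985486013423876300776638166015656344512454795202199838146001559544169184648937792944306108039510940822937595227937733 366280931928494810985486013423876300776638166015656345334072375878351413795899966443718601063667110704801982727080279013361379687015602 (by decide +kernel)
theorem big_c62 : BI big_pp big_np big_ps big_ns 6803582 59 13 192019788225168440 191760719976618421 195067496782183076 195538466774822531 :=
  BI.step big_wf big_c61 1600 13333 6643658 2 366280931928494810985486013423876300776638166015656345105266869194121884899992568732700295047910775684184618420971870601452222061373248 366280931928494810985486013423876300776638166015656344860713978087732419055551186644069206323607569275735293895383657371824165508768563 (by decide +kernel)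
theorem big_c63 : BI big_pp big_np big_ps big_ns 6963578 20 30 192027657405525594 191769926367633988 195083718652854362 195552337606855309 :=
  BI.step big_wf big_c62 1600 13333 6807516 2 366280931928494810985486013423876300776638166015656345338703716686523061109892975217989741623068407904595342675602092935555778276794944 366280931928494810985486013423876300776638166015656345338704284717366134130895319525786215012916016944007446748828242020080162922668098 (by decide +kernel)
theorem big_c64 : BI big_pp big_np big_ps big_ns 7123574 26 16 192036507009837773 191779406927734124 195097775669197897 195565756175522409 :=
  BI.step big_wf big_c63 1600 13333 6966707 2 366280931928494810985486013423876300776638166015656345338703323997915095887540074917098923499596092604922987322611793770856020072996293 366280931928494810985486013423876300776638166015656345338703725541301429936531975481427864847143437334379418811394020429949323438858309 (by decide +kernel)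
theorem big_c65 : BI big_pp big_np big_ps big_ns 7283570 55 24 192050106409649916 191789334540100691 195108500210003757 195578720778887896 :=
  BI.step big_wf big_c64 1600 13333 7125166 2 366280931928494810985486013423876300776638166015656345338703729930839492716753277870794297721721688769965365564306323840530807774094016 366280931928494810985486013423876300776638166015656345338703097841624129679876612584324121418131139151362327237194990930428803108921397 (by decide +kernel)
theorem big_c66 : BI big_pp big_np big_ps big_ns 7443566 26 27 192056526606180090 191798429062438557 195117275958585801 195586083945602113 :=
  BI.step big_wf big_c65 1600 13333 7287229 2 366280931928494810985486013423876300776638166015656345338703722421657761423494789313189388366542411576741706218952848191695074133809729 366280931928494810985486013423876300776638166015656345338703722432280612296445368015983600812620860129428305211300610142037202053440829 (by decide +kernel)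
theorem big_c67 : BI big_pp big_np big_ps big_ns 7603562 39 19 192071220100916406 191812653400817455 195126595940738970 195595729103762057 :=
  BI.step big_wf big_c66 1600 13333 7443673 2 366280931928494810985486013423876300776638166015656345338703723746763825984063409881704612838679108931445501724898570883269190323544768 366280931928494810985486013423876300776638166015656345338703722438996133601482629161997314805437252536038099202277262282405200626966336 (by decide +kernel)
theorem big_c68 : BI big_pp big_np big_ps big_ns 7763558 16 33 192080964043672965 191823439590823329 195138269074016912 195607110038313173 :=
  BI.step big_wf big_c67 1600 13333 7608229 2 366280931928494810985486013423876300776638166015656345338703722421362041357881979885802534851530552276629956254021977070583423058320575 366280931928494810985486013423876300776638166015656345338703722421741366192345094113613077946993181971707530872760842836493263805882812 (by decide +kernel)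
theorem big_c69 : BI big_pp big_np big_ps big_ns 7923554 36 26 192089063144613741 191830350395865569 195146504993027695 195616099388170299 :=
  BI.step big_wf big_c68 1600 13333 7766709 2 366280931928494810985486013423876300776638166015656345338703722421955373855901086179283231237004455615428035112686286970038295379059136 366280931928494810985486013423876300776638166015656345338703722421685142631189283632842415960304660294670749762148753820097084652528568 (by decide +kernel)
theorem big_c70 : BI big_pp big_np big_ps big_ns 8083550 12 33 192097428908238335 191839859324182438 195157446717556137 195625754787256225 :=
  BI.step big_wf big_c69 1600 13333 7928494 1 14007363216732099302040564223051588953000866379220408523258967728186 13586154123823212019021038883442403938201995825822197640747709292853 (by decide +kernel)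
theorem big_c71 : BI big_pp big_np big_ps big_ns 8243546 21 44 192105063564521038 191846638830918950 195164936419673250 195635225728926153 :=
  BI.step big_wf big_c70 1600 13333 8088594 1 13582837106364881651138238941864926419284102071357076370808858747201 13584468547872950463600882112479060618605568795989267194485333318336 (by decide +kernel)
theorem big_c72 : BI big_pp big_np big_ps big_ns 8403542 34 24 192112414660437928 191853713665547011 195172831071161454 195641867980785645 :=
  BI.step big_wf big_c71 1600 13333 8246773 1 13592696874116269289706102578826660960892676107894406645754864083008 13586190783758660471944198098629012236035009037135230813104583516230 (by decide +kernel)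
theorem big_c73 : BI big_pp big_np big_ps big_ns 8563538 36 25 192120554009992593 191861049922575525 195179888272188533 195648527815111726 :=
  BI.step big_wf big_c72 1600 13333 8408047 1 13586217693669186639024133140424511917617524805330633992471667662912 13586217298199659865290022333723926458934784984295129052464716570694 (by decide +kernel)
theorem big_c74 : BI big_pp big_np big_ps big_ns 8723534 53 7 192127099215551203 191868538069556410 195184298137584505 195653741966038820 :=
  BI.step big_wf big_c73 1600 13333 8567121 1 13586114849683393891678866059863221206339496228860936274261882969780 13586114755453545282524512049223856507943039119158849664985840181315 (by decide +kernel)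
theorem big_c75 : BI big_pp big_np big_ps big_ns 8883530 72 11 192137324593263568 191877206982808929 195193093454542882 195663964640165400 :=
  BI.step big_wf big_c74 1600 13333 8723752 1 13586256567723454703398511474364030767035424569439886669801004344516 13585985396941034056922491360079158997105465612609379040789871551032 (by decide +kernel)
theorem big_c76 : BI big_pp big_np big_ps big_ns 9043526 25 31 192145816458999206 191887762638609326 195201472737615487 195670919924701113 :=
  BI.step big_wf big_c75 1600 13333 8888799 1 13586114844178766438103059670404936220826103663445257644194034442289 13586114857431644212800489688873245596546780045409874651951028789325 (by decide +kernel)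
theorem big_c77 : BI big_pp big_np big_ps big_ns 9203522 17 34 192154528312251431 191896211997140057 195209794447039820 195678368723704782 :=
  BI.step big_wf big_c76 1600 13333 9045656 1 13586114844184804006366625059501344890356004398727312261473186490432 13586114855893732174910958370170995918892789609133601449208674524608 (by decide +kernel)
theorem big_c78 : BI big_pp big_np big_ps big_ns 9363518 43 15 192158630584934556 191900432995999730 195219096501339091 195688676839694175 :=
  BI.step big_wf big_c77 1600 13333 9205284 1 13586114856671287343438345632436311479519308475258926808885948867136 13586114867667994931542927559525616085348965384156098143549587101885 (by decide +kernel)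
theorem big_c79 : BI big_pp big_np big_ps big_ns 9523514 39 19 192165341151284441 191907016834188274 195223978172902730 195693437642741637 :=
  BI.step big_wf big_c78 1600 13333 9367729 1 13586114855886740952829317178249623583012816271764635543644975080640 13586114855887223163603618674226442237512994385068657539819397570631 (by decide +kernel)
theorem big_c80 : BI big_pp big_np big_ps big_ns 9683510 20 31 192171588348754907 191913615071261831 195231043084984785 195700028518719545 :=
  BI.step big_wf big_c79 1600 13333 9527086 1 13586114855886741689426147826490657344693513919960304587838411727555 13586114855893074022336592965721417212088918844382001383804696011583 (by decide +kernel)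
theorem big_c81 : BI big_pp big_np big_ps big_ns 9843506 10 42 192177617229870576 191919284333723599 195236951860653124 195705706032023851 :=
  BI.step big_wf big_c80 1600 13333 9689156 1 13586114855886887971123245676242853685455946254975541149189392130369 13586114855886888713591047306159054554473651393834114100920423848640 (by decide +kernel)
theorem big_c82 : BI big_pp big_np big_ps big_ns 10003502 19 44 192182616392459477 191924161763180306 195241366872917463 195711287348305693 :=
  BI.step big_wf big_c81 1600 13333 9847829 1 13586114855886936963401301861080023315726221390204638925007019319360 13586114855886936589459904561723627817272053863280607047748452097725 (by decide +kernel)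
theorem big_c83 : BI big_pp big_np big_ps big_ns 10163498 19 38 192188332735635983 191930331495089017 195248002467662666 195717688502691410 :=
  BI.step big_wf big_c82 1600 13333 10009099 1 13586114855886932500157628098273841722540948827821101099693156342851 13586114855886935840921302116637740652900507330402469961668278280267 (by decide +kernel)
theorem big_c84 : BI big_pp big_np big_ps big_ns 10323494 48 8 192194967608536187 191936171853590196 195256763884409616 195725556622882098 :=
  BI.step big_wf big_c83 1600 13333 10166658 1 13586114855886937337205139878366109260081743255648332045006175938752 13586114855886936668197056528596718706556122647097630569978567596736 (by decide +kernel)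
theorem big_c85 : BI big_pp big_np big_ps big_ns 10483490 34 35 192199723404131826 191939936981528691 195261644679874998 195730891536278993 :=
  BI.step big_wf big_c84 1600 13333 10326700 1 13586114855886942575589338013341244044036018140030954210135521550397 13586114855886936583594986936911531523952377539175179329733498315825 (by decide +kernel)
theorem big_c86 : BI big_pp big_np big_ps big_ns 10643486 55 11 192204742365130726 191945727174496584 195266446947130458 195736132383969867 :=
  BI.step big_wf big_c85 1600 13333 10489259 1 13586114855886936604052982522919757666099984866991851739635036200630 13586114855886936566054654904207695769253354522641288504751722373434 (by decide +kernel)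
theorem big_c87 : BI big_pp big_np big_ps big_ns 10803482 24 41 192208503583703030 191949596455472229 195271071084537053 195740758677250104 :=
  BI.step big_wf big_c86 1600 13333 10647721 1 13586114855886936589347696913506409392283674514209265513696473390911 13586114855886936589552664456669916313360753684184690039888228065352 (by decide +kernel)
theorem big_c88 : BI big_pp big_np big_ps big_ns 10963478 46 20 192212948869318721 191953941760617432 195277428268418605 195747115921836484 :=
  BI.step big_wf big_c87 1600 13333 10808577 1 13586114855886936589552682575011188310966942520420472527207890313270 13586114855886936589575850263380079716627758443893066211546855579715 (by decide +kernel)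
theorem big_c89 : BI big_pp big_np big_ps big_ns 11123474 32 25 192215665178383534 191957698172310567 195281187161643657 195750976366983186 :=
  BI.step big_wf big_c88 1600 13333 10965011 1 13586114855886936589438304830862116652995935178553808927984127548993 13586114855886936589346616873772185409545312473535636114310337339461 (by decide +kernel)
theorem big_c90 : BI big_pp big_np big_ps big_ns 11283470 35 38 192219992558945413 191961196136486772 195285610200451600 195756216990747204 :=
  BI.step big_wf big_c89 1600 13333 11123709 1 13586114855886936589461331657140680728608143014894723729842477474115 13586114855886936589255815023022852934683238173252813313506559385667 (by decide +kernel)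
theorem big_c91 : BI big_pp big_np big_ps big_ns 11443466 25 33 192224350327516947 191965962895606079 195290186087945349 195759669230549905 :=
  BI.step big_wf big_c90 1600 13333 11284706 1 13586114855886936589438317353935715008098613972864460996511422931006 13586114855886936589484169068290956949715232209363553107598784864332 (by decide +kernel)
theorem big_c92 : BI big_pp big_np big_ps big_ns 11603462 59 16 192229249448858964 191970261696824510 195293395980232413 195763976235662976 :=
  BI.step big_wf big_c91 1600 13333 11448033 1 13586114855886936589439744589044017910264393212609712012467041723712 13586114855886936589438138914624523549627783487924050609987411679680 (by decide +kernel)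
theorem big_c93 : BI big_pp big_np big_ps big_ns 11763458 43 17 192233102281134916 191974410010579677 195300906333474372 195770302592640076 :=
  BI.step big_wf big_c92 1600 13333 11606467 1 13586114855886936589438492971878862783448594942783194515679493496250 13586114855886936589438495836453587723247031143712099932338863841361 (by decide +kernel)
theorem big_c94 : BI big_pp big_np big_ps big_ns 11923454 53 8 192236700912827905 191978008153551619 195304118112171630 195773613076101334 :=
  BI.step big_wf big_c93 1600 13333 11767097 1 13586114855886936589438490325672984819566914050863155204112088309695 13586114855886936589439035180264045341416197652655832201042680881849 (by decide +kernel)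
theorem big_c95 : BI big_pp big_np big_ps big_ns 11999990 34 35 192238631562209255 191979649540877997 195304600110787080 195774575389607277 :=
  BI.step big_wf big_c94 1600 6378 11929950 1 13586114855886936589438495791883908370966749945217440483755672213966 13586114855886936589438495791883908370966749945216719907679202451392 (by decide +kernel)

end

section

/-- one term of the series for `artanh (a/b)`, in fixed point -/
def atT (a b j : ℕ) : ℕ :=
  Nat.div (Nat.mul (Nat.pow 2 60) (Nat.pow a (Nat.succ (Nat.mul 2 j))))
    (Nat.mul (Nat.succ (Nat.mul 2 j)) (Nat.pow b (Nat.succ (Nat.mul 2 j))))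

noncomputable def logQ2 (e k : ℕ) : ℕ :=
  Nat.add (Nat.mul 2 (cumI (atT (Nat.sub e (Nat.pow 2 k)) (Nat.add e (Nat.pow 2 k))) 14)) (Nat.mul k 799144290025469441)

/-- fixed point logarithm -/
noncomputable def logQ (e : ℕ) : ℕ := logQ2 e (Nat.log2 e)

theorem atT_bounds (a b j : ℕ) (hb : 0 < b) :
    ((atT a b j : ℕ) : ℝ) / 2 ^ 60 ≤ ((a:ℝ) / b) ^ (2 * j + 1) / (2 * j + 1) ∧
    ((a:ℝ) / b) ^ (2 * j + 1) / (2 * j + 1) ≤ ((atT a b j : ℕ) : ℝ) / 2 ^ 60 + 1 / 2 ^ 60 := by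
  have e0 : atT a b j = (2 ^ 60 * a ^ (2 * j + 1)) / ((2 * j + 1) * b ^ (2 * j + 1)) := rfl
  obtain ⟨h1, h2⟩ := div_bounds (2 ^ 60 * a ^ (2 * j + 1)) ((2 * j + 1) * b ^ (2 * j + 1))
    (Nat.one_le_iff_ne_zero.2 (by positivity))
  rw [← e0] at h1 h2
  have hb' : (0:ℝ) < b := by exact_mod_cast hb
  have e1 : ((2 ^ 60 * a ^ (2 * j + 1) : ℕ) : ℝ) / (((2 * j + 1) * b ^ (2 * j + 1) : ℕ) : ℝ)
    = 2 ^ 60 * (((a:ℝ) / b) ^ (2 * j + 1) / (2 * j + 1)) := by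
    rw [div_pow, Nat.cast_mul, Nat.cast_mul, Nat.cast_pow, Nat.cast_pow, Nat.cast_pow]
    have : ((2 * j + 1 : ℕ) : ℝ) = 2 * j + 1 := by norm_num
    rw [this, Nat.cast_ofNat]
    field_simp
  rw [e1] at h1 h2
  generalize ((a:ℝ) / b) ^ (2 * j + 1) / (2 * j + 1) = t at *
  constructor
  · rw [div_le_iff₀ (by positivity)]; linarith
  · rw [← add_div, le_div_iff₀ (by positivity)]; linarith

theorem logQ_bounds {e : ℕ} (he : 1 ≤ e) (he2 : e < 65536) :
    (logQ e : ℝ) / 2 ^ 60 ≤ Real.log e ∧ Real.log e ≤ ((logQ e + 2 ^ 34 : ℕ) : ℝ) / 2 ^ 60 := by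
  unfold logQ
  have hk1 : 2 ^ Nat.log2 e ≤ e := Nat.log2_self_le (by omega)
  have hk2 : e < 2 ^ (Nat.log2 e + 1) := Nat.lt_log2_self
  have hk3 : Nat.log2 e < 16 := (Nat.log2_lt (by omega)).2 (by norm_num; exact he2)
  generalize Nat.log2 e = k at *
  obtain ⟨a, ha⟩ : ∃ a, a = e - 2 ^ k := ⟨_, rfl⟩
  obtain ⟨b, hb⟩ : ∃ b, b = e + 2 ^ k := ⟨_, rfl⟩
  have e0 : logQ2 e k = 2 * (cumI (atT a b) 14) + k * 799144290025469441 := by rw [ha, hb]; rfl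
  rw [e0, cumI_eq]
  have hp : 0 < 2 ^ k := by positivity
  have hb0 : 0 < b := by omega
  have hb' : (0:ℝ) < b := by exact_mod_cast hb0
  have h3a : 3 * a ≤ b := by rw [pow_succ] at hk2; omega
  set z : ℝ := (a:ℝ) / b with hz
  have hz0 : 0 ≤ z := by positivity
  have hz1 : z ≤ 1 / 3 := by
    rw [hz, div_le_div_iff₀ hb' (by norm_num)]
    have : (3:ℝ) * a ≤ b := by exact_mod_cast h3a
    linarith
  have hlog : Real.log e = Real.log ((1 + z) / (1 - z)) + k * Real.log 2 := by
    have h1 : (1 + z) / (1 - z) = e / 2 ^ k := by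
      have hab : (a:ℝ) = e - 2 ^ k := by rw [ha, Nat.cast_sub hk1]; norm_num
      have hbb : (b:ℝ) = e + 2 ^ k := by rw [hb]; norm_num
      have hpp : (0:ℝ) < 2 ^ k := by positivity
      have : (1:ℝ) - z ≠ 0 := by linarith
      rw [div_eq_div_iff this hpp.ne', hz]
      rw [hbb] at hb'
      rw [hab, hbb]; field_simp; ring
    have he' : (e:ℝ) ≠ 0 := by positivity
    rw [h1, Real.log_div he' (by positivity), Real.log_pow]; ring
  have s1 := Real.sum_range_le_log_div hz0 (by linarith) 14
  have s2 := Real.log_div_le_sum_range_add hz0 (by linarith) 14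
  have t1 : ((∑ j ∈ Finset.range 14, atT a b j : ℕ) : ℝ) / 2 ^ 60 ≤ ∑ j ∈ Finset.range 14, z ^ (2 * j + 1) / (2 * j + 1) := by
    rw [Nat.cast_sum, Finset.sum_div]
    exact Finset.sum_le_sum fun j _ => (atT_bounds a b j hb0).1
  have t2 : ∑ j ∈ Finset.range 14, z ^ (2 * j + 1) / (2 * j + 1) ≤ ((∑ j ∈ Finset.range 14, atT a b j : ℕ) : ℝ) / 2 ^ 60 + 14 / 2 ^ 60 := by
    have : (14:ℝ) / 2 ^ 60 = ∑ j ∈ Finset.range 14, 1 / 2 ^ 60 := by simp; norm_num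
    rw [Nat.cast_sum, Finset.sum_div, this, ← Finset.sum_add_distrib]
    exact Finset.sum_le_sum fun j _ => (atT_bounds a b j hb0).2
  have t3 : z ^ (2 * 14 + 1) / (1 - z ^ 2) ≤ 1 / 2 ^ 40 := by
    have h1 : z ^ 29 ≤ (1 / 3) ^ 29 := pow_le_pow_left₀ hz0 hz1 29
    have h2 : z ^ 2 ≤ (1 / 3) ^ 2 := pow_le_pow_left₀ hz0 hz1 2
    rw [div_le_iff₀ (by linarith)]
    norm_num at h1 h2 ⊢
    linarith
  generalize ((∑ j ∈ Finset.range 14, atT a b j : ℕ)) = T at *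
  generalize ∑ j ∈ Finset.range 14, z ^ (2 * j + 1) / (2 * j + 1) = U at *
  generalize Real.log ((1 + z) / (1 - z)) = V at *
  have l1 := Real.log_two_gt_d9
  have l2 := Real.log_two_lt_d9
  have hk' : (k:ℝ) ≤ 15 := by exact_mod_cast (by omega : k ≤ 15)
  have hk0 : (0:ℝ) ≤ k := Nat.cast_nonneg _
  rw [hlog]
  have m1 : (k:ℝ) * (799144290025469441 / 2 ^ 60) ≤ k * Real.log 2 :=
    mul_le_mul_of_nonneg_left (le_trans (by norm_num) l1.le) hk0
  have m2 : k * Real.log 2 ≤ (k:ℝ) * (799144290025469441 / 2 ^ 60 + 0.0000000007) :=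
    mul_le_mul_of_nonneg_left (le_trans l2.le (by norm_num)) hk0
  push_cast
  constructor
  · norm_num at m1 m2 t1 t2 t3 s1 s2 hk' ⊢; have hk2 : (k:ℝ) ≤ 15 := by exact_mod_cast hk'
    linarith
  · norm_num at m1 m2 t1 t2 t3 s1 s2 hk' ⊢; have hk2 : (k:ℝ) ≤ 15 := by exact_mod_cast hk'
    linarith

/-- `1/e` fixed point sums -/
noncomputable def rcpS (LL : List (List ℕ)) : ℕ := sumKK (fun e => Nat.div (Nat.pow 2 60) e) LL
noncomputable def rcpT (LL : List (List ℕ)) : ℕ := sumKK (fun e => Nat.succ (Nat.div (Nat.pow 2 60) e)) LL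
noncomputable def lgS (LL : List (List ℕ)) : ℕ := sumKK (fun e => Nat.div (logQ e) e) LL
noncomputable def lgT (LL : List (List ℕ)) : ℕ := sumKK (fun e => Nat.succ (Nat.div (Nat.add (logQ e) (Nat.pow 2 34)) e)) LL

theorem div_up (T N : ℕ) (hN : 1 ≤ N) : (T:ℝ) / N ≤ ((T / N + 1 : ℕ) : ℝ) := by
  have := (div_bounds T N hN).1
  push_cast; linarith

theorem rcp_bounds {LL : List (List ℕ)} (h : ∀ e ∈ LL.flatten, 1 ≤ e) :
    (rcpS LL : ℝ) / 2 ^ 60 ≤ ls LL.flatten (fun e => 1 / (e:ℝ)) ∧ ls LL.flatten (fun e => 1 / (e:ℝ)) ≤ (rcpT LL : ℝ) / 2 ^ 60 := by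
  unfold rcpS rcpT
  rw [sumKK_eq, sumKK_eq, natsum_cast, natsum_cast, div_eq_inv_mul, div_eq_inv_mul, ← ls_mul, ← ls_mul]
  have hT : ((2 ^ 60 : ℕ) : ℝ) = 2 ^ 60 := by norm_num
  constructor
  · apply ls_le; intro e he
    have := (div_bounds (2 ^ 60) e (h e he)).2
    rw [inv_mul_le_iff₀ (by positivity), mul_one_div, ← hT]
    exact this
  · apply ls_le; intro e he
    have := div_up (2 ^ 60) e (h e he)
    rw [le_inv_mul_iff₀ (by positivity), mul_one_div, ← hT]
    exact this

theorem lg_bounds {LL : List (List ℕ)} (h : ∀ e ∈ LL.flatten, 1 ≤ e ∧ e < 65536) :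
    (lgS LL : ℝ) / 2 ^ 60 ≤ ls LL.flatten (fun e => Real.log e / e) ∧
    ls LL.flatten (fun e => Real.log e / e) ≤ (lgT LL : ℝ) / 2 ^ 60 := by
  unfold lgS lgT
  rw [sumKK_eq, sumKK_eq, natsum_cast, natsum_cast, div_eq_inv_mul, div_eq_inv_mul, ← ls_mul, ← ls_mul]
  constructor
  · apply ls_le; intro e he
    have h1 := (div_bounds (logQ e) e (h e he).1).2
    have h2 := (logQ_bounds (h e he).1 (h e he).2).1
    have he0 : (0:ℝ) < e := by exact_mod_cast (h e he).1
    rw [inv_mul_le_iff₀ (by positivity)]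
    rw [div_le_iff₀ (by positivity)] at h2
    refine h1.trans ?_
    rw [mul_div_assoc']
    apply div_le_div_of_nonneg_right _ he0.le
    linarith
  · apply ls_le; intro e he
    have h1 := div_up (logQ e + 2 ^ 34) e (h e he).1
    have h2 := (logQ_bounds (h e he).1 (h e he).2).2
    have he0 : (0:ℝ) < e := by exact_mod_cast (h e he).1
    rw [le_inv_mul_iff₀ (by positivity)]
    rw [le_div_iff₀ (by positivity)] at h2
    refine le_trans ?_ h1
    rw [mul_div_assoc']
    apply div_le_div_of_nonneg_right _ he0.le
    linarith

theorem sC_itm {pp np ps ns : List (List ℕ)} : sC (itm pp np ps ns) =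
    (ls pp.flatten (fun e => 1 / (e:ℝ)) - ls np.flatten (fun e => 1 / (e:ℝ))) / 2
    + (ls ps.flatten (fun e => 1 / (e:ℝ)) - ls ns.flatten (fun e => 1 / (e:ℝ))) := by
  have h : ∀ L : List ℕ, ls L (fun e => 1 / (e:ℝ) - 1 / ((2 * e : ℕ):ℝ)) = 1 / 2 * ls L (fun e => 1 / (e:ℝ)) := by
    intro L; rw [← ls_mul]; apply ls_congr; intro e _
    push_cast
    rcases eq_or_ne (e:ℝ) 0 with h | h
    · simp [h]
    · field_simp; norm_num
  unfold sC
  rw [lsum_itm, h, h]; ring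

theorem aC_itm {pp np ps ns : List (List ℕ)} (h1 : ∀ e ∈ pp.flatten, 1 ≤ e) (h2 : ∀ e ∈ np.flatten, 1 ≤ e) : aC (itm pp np ps ns) =
    (ls np.flatten (fun e => Real.log e / e) - ls pp.flatten (fun e => Real.log e / e)) / 2
    + Real.log 2 / 2 * (ls pp.flatten (fun e => 1 / (e:ℝ)) - ls np.flatten (fun e => 1 / (e:ℝ)))
    + (ls ns.flatten (fun e => Real.log e / e) - ls ps.flatten (fun e => Real.log e / e)) := by
  have h : ∀ L : List ℕ, (∀ e ∈ L, 1 ≤ e) → ls L (fun e => Real.log e / (e:ℝ) - Real.log ((2 * e : ℕ):ℝ) / ((2 * e : ℕ):ℝ))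
      = 1 / 2 * ls L (fun e => Real.log e / e) - Real.log 2 / 2 * ls L (fun e => 1 / (e:ℝ)) := by
    intro L hL; rw [← ls_mul, ← ls_mul, ← ls_sub]; apply ls_congr; intro e he
    have : (e:ℝ) ≠ 0 := by have := hL e he; positivity
    push_cast
    rw [Real.log_mul (by norm_num) this]
    field_simp; ring
  unfold aC
  rw [lsum_itm, h _ h1, h _ h2]; ring

end

section

theorem big_len : sumKK (fun _ => 1) big_pp = 587 ∧ sumKK (fun _ => 1) big_np = 617 ∧
    sumKK (fun _ => 1) big_ps = 602 ∧ sumKK (fun _ => 1) big_ns = 604 := by decide +kernel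
theorem big_one : fls big_pp big_ps 1 = fls big_np big_ns 1 + 1 := by rw [fls_K, fls_K]; decide +kernel
theorem big_end : fls big_pp big_ps 11999989 = fls big_np big_ns 11999989 + 1 := by rw [fls_K, fls_K]; decide +kernel
theorem big_rng : and (allL (rangeChk 1 65536) big_pp) (and (allL (rangeChk 1 65536) big_np)
    (and (allL (rangeChk 1 65536) big_ps) (allL (rangeChk 1 65536) big_ns))) = true := by decide +kernel
theorem big_pp_num : rcpS big_pp = 2321562179724558886 ∧ rcpT big_pp = 2321562179724559473 ∧ lgS big_pp = 6307123531108252750 ∧ lgT big_pp = 6307123565702225595 := by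
  decide +kernel
--
theorem big_np_num : rcpS big_np = 2324988235274349386 ∧ rcpT big_np = 2324988235274350003 ∧ lgS big_np = 8639061813074080446 ∧ lgT big_np = 8639061847719105527 := by
  decide +kernel
--
theorem big_ps_num : rcpS big_ps = 162993495310197916 ∧ rcpT big_ps = 162993495310198518 ∧ lgS big_ps = 1358587849709703058 ∧ lgT big_ps = 1358587852138496017 := by
  decide +kernel
--
theorem big_ns_num : rcpS big_ns = 161280467585713337 ∧ rcpT big_ns = 161280467585713941 ∧ lgS big_ns = 1346833101799080764 ∧ lgT big_ns = 1346833104202347602 := by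
  decide +kernel

theorem big_rng' : (∀ e ∈ big_pp.flatten, 1 ≤ e ∧ e < 65536) ∧ (∀ e ∈ big_np.flatten, 1 ≤ e ∧ e < 65536) ∧
    (∀ e ∈ big_ps.flatten, 1 ≤ e ∧ e < 65536) ∧ (∀ e ∈ big_ns.flatten, 1 ≤ e ∧ e < 65536) := by
  have h := big_rng
  simp only [Bool.and_eq_true] at h
  obtain ⟨h1, h2, h3, h4⟩ := h
  exact ⟨allRange_sound h1, allRange_sound h2, allRange_sound h3, allRange_sound h4⟩

noncomputable def bigI : List (ℕ × ℝ) := itm big_pp big_np big_ps big_ns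

theorem big_sC : |sC bigI| ≤ 5 / 10 ^ 11 := by
  obtain ⟨r1, r2, r3, r4⟩ := big_rng'
  have a1 := rcp_bounds fun e he => (r1 e he).1
  have a2 := rcp_bounds fun e he => (r2 e he).1
  have a3 := rcp_bounds fun e he => (r3 e he).1
  have a4 := rcp_bounds fun e he => (r4 e he).1
  rw [big_pp_num.1, big_pp_num.2.1] at a1
  rw [big_np_num.1, big_np_num.2.1] at a2
  rw [big_ps_num.1, big_ps_num.2.1] at a3
  rw [big_ns_num.1, big_ns_num.2.1] at a4
  rw [bigI, sC_itm, abs_le]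
  norm_num at a1 a2 a3 a4 ⊢
  constructor <;> linarith

theorem big_aC : 1.00009147 ≤ aC bigI ∧ aC bigI ≤ 1.00009156 := by
  obtain ⟨r1, r2, r3, r4⟩ := big_rng'
  have a1 := rcp_bounds fun e he => (r1 e he).1
  have a2 := rcp_bounds fun e he => (r2 e he).1
  have b1 := lg_bounds r1
  have b2 := lg_bounds r2
  have b3 := lg_bounds r3
  have b4 := lg_bounds r4
  rw [big_pp_num.1, big_pp_num.2.1] at a1
  rw [big_np_num.1, big_np_num.2.1] at a2
  rw [big_pp_num.2.2.1, big_pp_num.2.2.2] at b1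
  rw [big_np_num.2.2.1, big_np_num.2.2.2] at b2
  rw [big_ps_num.2.2.1, big_ps_num.2.2.2] at b3
  rw [big_ns_num.2.2.1, big_ns_num.2.2.2] at b4
  rw [bigI, aC_itm (fun e he => (r1 e he).1) (fun e he => (r2 e he).1)]
  have l1 := Real.log_two_gt_d9
  have l2 := Real.log_two_lt_d9
  have hd : -0.00297163 ≤ ls big_pp.flatten (fun e => 1 / (e:ℝ)) - ls big_np.flatten (fun e => 1 / (e:ℝ)) ∧
     ls big_pp.flatten (fun e => 1 / (e:ℝ)) - ls big_np.flatten (fun e => 1 / (e:ℝ)) ≤ -0.002971629 := by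
    norm_num at a1 a2 ⊢
    constructor <;> linarith
  generalize ls big_pp.flatten (fun e => 1 / (e:ℝ)) - ls big_np.flatten (fun e => 1 / (e:ℝ)) = d at *
  have m1 : Real.log 2 / 2 * d ≤ -0.00102988 := by nlinarith
  have m2 : -0.00102989 ≤ Real.log 2 / 2 * d := by nlinarith
  norm_num at b1 b2 b3 b4 m1 m2 ⊢
  constructor <;> linarith

theorem big_labs : labs bigI (fun _ => 1) = 3614 := by
  have h := big_len
  simp only [← len_K] at h
  obtain ⟨h1, h2, h3, h4⟩ := h
  simp only [bigI, itm, labs_append, labs_prs, labs_sgl, ls_const, h1, h2, h3, h4]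
  norm_num

theorem big_mem : ∀ p ∈ bigI, 1 ≤ p.1 ∧ p.1 ≤ 131072 := by
  obtain ⟨r1, r2, r3, r4⟩ := big_rng'
  have hp : ∀ (t : ℝ) (L : List ℕ), (∀ e ∈ L, 1 ≤ e ∧ e < 65536) → ∀ p ∈ prs t L, 1 ≤ p.1 ∧ p.1 ≤ 131072 := by
    intro t L
    induction L with
    | nil => simp [prs]
    | cons e L ih =>
      intro h p hp
      have he := h e (by simp)
      rcases List.mem_cons.1 hp with rfl | hp
      · simp only; omega
      rcases List.mem_cons.1 hp with rfl | hp
      · simp only; omega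
      exact ih (fun x hx => h x (by simp [hx])) p hp
  have hs : ∀ (t : ℝ) (L : List ℕ), (∀ e ∈ L, 1 ≤ e ∧ e < 65536) → ∀ p ∈ sgl t L, 1 ≤ p.1 ∧ p.1 ≤ 131072 := by
    intro t L h p hp
    obtain ⟨e, he, rfl⟩ := List.mem_map.1 hp
    have := h e he
    simp only; omega
  intro p hp'
  simp only [bigI, itm, List.mem_append] at hp'
  rcases hp' with ((h | h) | h) | h
  · exact hp _ _ r1 p h
  · exact hp _ _ r2 p h
  · exact hs _ _ r3 p h
  · exact hs _ _ r4 p h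

theorem big_cert :
    (∃ S : List (ℕ × ℝ), (∀ p ∈ S, 1 ≤ p.1 ∧ p.1 ≤ 11999990) ∧ (∀ m, 1 ≤ m → Ct bigI m ≤ stp S m) ∧
      labs S (fun N => 1 / (N:ℝ)) ≤ 0.3394 ∧ lsum S (fun N => 1 / (N:ℝ)) ≤ 0.000323) ∧
    (∃ S : List (ℕ × ℝ), (∀ p ∈ S, 1 ≤ p.1 ∧ p.1 ≤ 11999990) ∧ (∀ m, 1 ≤ m → stp S m ≤ Ct bigI m) ∧
      labs S (fun N => 1 / (N:ℝ)) ≤ 0.3394 ∧ -0.000506 ≤ lsum S (fun N => 1 / (N:ℝ))) := by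
  have h := big_len
  simp only [← len_K] at h
  obtain ⟨h1, h2, h3, h4⟩ := h
  have hend : (fls big_pp big_ps (11999990 - 1) : ℝ) = fls big_np big_ns (11999990 - 1) + 1 := by
    rw [show 11999990 - 1 = 11999989 from rfl, big_end, Nat.cast_add, Nat.cast_one]
  obtain ⟨⟨S, s1, s2, s3, s4⟩, ⟨S', t1, t2, t3, t4⟩⟩ := cert_bounds (R := 1205) (M1 := 10000) (Ru := 1171) (Rl := 1170) (Cc := 0)
    big_wf (by norm_num) big_c95 big_one
    (by rw [h1, h2, h3]; norm_num) (by rw [h1, h2, h4]; norm_num) big_sC (by norm_num) (by norm_num)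
    (by rw [hend]; ring) (by norm_num) (by norm_num) (by norm_num) (by norm_num)
  refine ⟨⟨S, s1, s2, s3.trans ?_, s4.trans ?_⟩, ⟨S', t1, t2, t3.trans ?_, le_trans ?_ t4⟩⟩ <;> norm_num

theorem big_level {X ε x : ℝ} (hX : 1 ≤ X) (hε0 : 0 ≤ ε) (hε : ∀ y, X ≤ y → |Chebyshev.psi y - y| ≤ ε * y)
    (hx : 12000000 * X ≤ x) : |Chebyshev.psi x - x| ≤ (0.000415 + 0.3394 * ε) * x + 3615 * (Real.log x + 1) := by
  obtain ⟨⟨S, s1, s2, s3, s4⟩, ⟨S', t1, t2, t3, t4⟩⟩ := big_cert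
  have hx1 : 12000000 ≤ x := by linarith
  have hx0 : 0 ≤ x := by linarith
  have hmem : ∀ p ∈ bigI, 1 ≤ p.1 ∧ (p.1 : ℝ) ≤ x := fun p hp => ⟨(big_mem p hp).1, by
    have : (p.1 : ℝ) ≤ 131072 := by exact_mod_cast (big_mem p hp).2
    linarith⟩
  have hS : ∀ S : List (ℕ × ℝ), (∀ p ∈ S, 1 ≤ p.1 ∧ p.1 ≤ 11999990) → ∀ p ∈ S, 1 ≤ p.1 ∧ X * p.1 ≤ x := by
    intro S h p hp
    refine ⟨(h p hp).1, ?_⟩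
    have : (p.1 : ℝ) ≤ 11999990 := by exact_mod_cast (h p hp).2
    nlinarith
  have u1 := step_upper bigI S (fun p hp => (s1 p hp).1) s2 (by linarith : 1 ≤ x) hmem
  have l1 := step_lower bigI S' (fun p hp => (t1 p hp).1) t2 (by linarith : 1 ≤ x) hmem
  have u2 := abs_le.1 (lsum_psi S hε (hS S s1))
  have l2 := abs_le.1 (lsum_psi S' hε (hS S' t1))
  rw [big_labs] at u1 l1
  have hlog : 0 ≤ Real.log x + 1 := by have := Real.log_nonneg (by linarith : 1 ≤ x); linarith
  have hE : (3614 + |sC bigI|) * (Real.log x + 1) ≤ 3615 * (Real.log x + 1) := by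
    apply mul_le_mul_of_nonneg_right _ hlog
    have := big_sC
    norm_num at this ⊢
    linarith
  obtain ⟨A1, A2⟩ := big_aC
  have v1 : aC bigI * x ≤ 1.00009156 * x := mul_le_mul_of_nonneg_right A2 hx0
  have v2 : 1.00009147 * x ≤ aC bigI * x := mul_le_mul_of_nonneg_right A1 hx0
  have v3 : lsum S (fun N => 1 / (N:ℝ)) * x ≤ 0.000323 * x := mul_le_mul_of_nonneg_right s4 hx0
  have v4 : -0.000506 * x ≤ lsum S' (fun N => 1 / (N:ℝ)) * x := mul_le_mul_of_nonneg_right t4 hx0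
  have v5 : ε * labs S (fun N => 1 / (N:ℝ)) * x ≤ 0.3394 * ε * x :=
    mul_le_mul_of_nonneg_right (by nlinarith) hx0
  have v6 : ε * labs S' (fun N => 1 / (N:ℝ)) * x ≤ 0.3394 * ε * x :=
    mul_le_mul_of_nonneg_right (by nlinarith) hx0
  rw [abs_le]
  constructor <;> linarith [u2.1, u2.2, l2.1, l2.2]

end

section

theorem log_lin {X x : ℝ} (k : ℕ) (hX1 : 1 ≤ X) (hXk : X ≤ 2 ^ k) (hx : X ≤ x) :
    Real.log x + 1 ≤ (k * 0.6931472 + 1) / X * x := by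
  have hX0 : 0 < X := by linarith
  have hx0 : 0 < x := by linarith
  have h1 : Real.log X ≤ k * 0.6931472 := by
    have := Real.log_le_log hX0 hXk
    rw [Real.log_pow] at this
    exact this.trans (mul_le_mul_of_nonneg_left (Real.log_two_lt_d9.le.trans (by norm_num)) (Nat.cast_nonneg _))
  have h2 : Real.log (x / X) ≤ x / X - 1 := Real.log_le_sub_one_of_pos (by positivity)
  rw [Real.log_div (by linarith) hX0.ne'] at h2
  have h3 : 1 ≤ x / X := by rw [le_div_iff₀ hX0]; linarith
  have h4 : 0 ≤ (k:ℝ) * 0.6931472 := by positivity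
  have e : (k * 0.6931472 + 1) / X * x = (k * 0.6931472 + 1) * (x / X) := by ring
  rw [e]
  nlinarith

noncomputable def chI : List (ℕ × ℝ) := [(1, 1), (30, 1), (2, -1), (3, -1), (5, -1)]

theorem chI_sC : sC chI = 0 := by
  simp [sC, chI]; norm_num

theorem chI_labs : labs chI (fun _ => 1) = 5 := by
  simp [chI]; norm_num

theorem chI_Ct (m : ℕ) : Ct chI m = 1 - (((m : ℤ) + (m / 30 : ℕ) - (m / 2 : ℕ) - (m / 3 : ℕ) - (m / 5 : ℕ) : ℤ) : ℝ) := by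
  unfold Ct
  rw [chI_sC]
  have e : ∀ k : ℕ, ((m / k : ℕ) : ℝ) = (((m / k : ℕ) : ℤ) : ℝ) := fun k => (Int.cast_natCast _).symm
  simp only [Int.cast_sub, Int.cast_add, Int.cast_natCast]
  simp only [chI, lsum_cons, lsum_nil, Nat.div_one]
  ring

theorem logQ235 : logQ 3 ≤ 1266613740000000000 ∧ 1266613730000000000 ≤ logQ 3 ∧
   logQ 5 ≤ 1855555580000000000 ∧ 1855555570000000000 ≤ logQ 5 := by decide +kernel

theorem chI_aC : 0.92129 ≤ aC chI ∧ aC chI ≤ 0.9213 := by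
  have l1 := Real.log_two_gt_d9
  have l2 := Real.log_two_lt_d9
  have b3 := logQ_bounds (e := 3) (by norm_num) (by norm_num)
  have b5 := logQ_bounds (e := 5) (by norm_num) (by norm_num)
  obtain ⟨q1, q2, q3, q4⟩ := logQ235
  have r1 : (logQ 3 : ℝ) ≤ 1266613740000000000 := by exact_mod_cast q1
  have r2 : 1266613730000000000 ≤ (logQ 3 : ℝ) := by exact_mod_cast q2
  have r3 : (logQ 5 : ℝ) ≤ 1855555580000000000 := by exact_mod_cast q3
  have r4 : 1855555570000000000 ≤ (logQ 5 : ℝ) := by exact_mod_cast q4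
  have h30 : Real.log 30 = Real.log 2 + Real.log 3 + Real.log 5 := by
    rw [← Real.log_mul (by norm_num) (by norm_num), ← Real.log_mul (by norm_num) (by norm_num)]; norm_num
  have e : aC chI = Real.log 2 / 2 + Real.log 3 / 3 + Real.log 5 / 5 - Real.log 30 / 30 := by
    simp [aC, chI]; ring
  rw [e, h30]
  push_cast at b3 b5
  norm_num at b3 b5 l1 l2 ⊢
  constructor <;> linarith

theorem ch_upper1 {x : ℝ} (hx : 30 ≤ x) : Chebyshev.psi x ≤ 0.9213 * x + Chebyshev.psi (x / 6) + 5 * (Real.log x + 1) := by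
  have h := step_upper chI [(6, 1)] (by simp) (by
    intro m hm
    rw [chI_Ct]
    simp only [stp, lsum_cons, lsum_nil]
    split_ifs with h6
    · have : (0:ℤ) ≤ (m : ℤ) + (m / 30 : ℕ) - (m / 2 : ℕ) - (m / 3 : ℕ) - (m / 5 : ℕ) := by omega
      have : (0:ℝ) ≤ (((m : ℤ) + (m / 30 : ℕ) - (m / 2 : ℕ) - (m / 3 : ℕ) - (m / 5 : ℕ) : ℤ) : ℝ) := by exact_mod_cast this
      linarith
    · have : (1:ℤ) ≤ (m : ℤ) + (m / 30 : ℕ) - (m / 2 : ℕ) - (m / 3 : ℕ) - (m / 5 : ℕ) := by omega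
      have : (1:ℝ) ≤ (((m : ℤ) + (m / 30 : ℕ) - (m / 2 : ℕ) - (m / 3 : ℕ) - (m / 5 : ℕ) : ℤ) : ℝ) := by exact_mod_cast this
      linarith) (by linarith : 1 ≤ x) (by
    intro p hp
    simp only [chI, List.mem_cons, List.not_mem_nil, or_false] at hp
    rcases hp with rfl | rfl | rfl | rfl | rfl <;> constructor <;> norm_num <;> linarith)
  rw [chI_labs, chI_sC] at h
  simp only [lsum_cons, lsum_nil, abs_zero] at h
  have := mul_le_mul_of_nonneg_right chI_aC.2 (by linarith : 0 ≤ x)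
  push_cast at h
  linarith

theorem ch_upper2 {x : ℝ} (hx : 30 ≤ x) : Chebyshev.psi x ≤ 0.9213 * x + Chebyshev.psi (x / 6) - Chebyshev.psi (x / 7)
    + Chebyshev.psi (x / 10) + 5 * (Real.log x + 1) := by
  have h := step_upper chI [(6, 1), (7, -1), (10, 1)] (by simp) (by
    intro m hm
    rw [chI_Ct]
    simp only [stp, lsum_cons, lsum_nil]
    have h1 : (0:ℤ) ≤ (m : ℤ) + (m / 30 : ℕ) - (m / 2 : ℕ) - (m / 3 : ℕ) - (m / 5 : ℕ) := by omega
    have h2 : (m < 6 ∨ (7 ≤ m ∧ m < 10)) → (1:ℤ) ≤ (m : ℤ) + (m / 30 : ℕ) - (m / 2 : ℕ) - (m / 3 : ℕ) - (m / 5 : ℕ) := by omega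
    generalize (m : ℤ) + (m / 30 : ℕ) - (m / 2 : ℕ) - (m / 3 : ℕ) - (m / 5 : ℕ) = t at *
    have h1' : (0:ℝ) ≤ t := by exact_mod_cast h1
    have h2' : (m < 6 ∨ (7 ≤ m ∧ m < 10)) → (1:ℝ) ≤ t := fun h => by exact_mod_cast h2 h
    split_ifs with a b c c b c c
    all_goals first
      | (exfalso; omega)
      | linarith
      | (have := h2' (by omega); linarith)) (by linarith : 1 ≤ x) (by
    intro p hp
    simp only [chI, List.mem_cons, List.not_mem_nil, or_false] at hp
    rcases hp with rfl | rfl | rfl | rfl | rfl <;> constructor <;> norm_num <;> linarith)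
  rw [chI_labs, chI_sC] at h
  simp only [lsum_cons, lsum_nil, abs_zero] at h
  have := mul_le_mul_of_nonneg_right chI_aC.2 (by linarith : 0 ≤ x)
  push_cast at h
  linarith

theorem ch_lower {x : ℝ} (hx : 30 ≤ x) : 0.92129 * x - 5 * (Real.log x + 1) ≤ Chebyshev.psi x := by
  have h := step_lower chI [] (by simp) (by
    intro m hm
    rw [chI_Ct]
    simp only [stp, lsum_nil]
    have h1 : (m : ℤ) + (m / 30 : ℕ) - (m / 2 : ℕ) - (m / 3 : ℕ) - (m / 5 : ℕ) ≤ 1 := by omega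
    have h1' : (((m : ℤ) + (m / 30 : ℕ) - (m / 2 : ℕ) - (m / 3 : ℕ) - (m / 5 : ℕ) : ℤ) : ℝ) ≤ 1 := by exact_mod_cast h1
    linarith) (by linarith : 1 ≤ x) (by
    intro p hp
    simp only [chI, List.mem_cons, List.not_mem_nil, or_false] at hp
    rcases hp with rfl | rfl | rfl | rfl | rfl <;> constructor <;> norm_num <;> linarith)
  rw [chI_labs, chI_sC] at h
  simp only [lsum_nil, abs_zero] at h
  have := mul_le_mul_of_nonneg_right chI_aC.1 (by linarith : 0 ≤ x)
  linarith

theorem chU1 {x : ℝ} (hx : 56 ≤ x) : Chebyshev.psi x ≤ 2.29 * x := by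
  have h1 := ch_upper1 (by linarith : 30 ≤ x)
  have h2 := Chebyshev.psi_le_const_mul_self (x := x / 6) (by linarith)
  have h3 := log_lin 6 (by norm_num) (by norm_num) hx
  have h4 : Real.log 4 ≤ 1.3862944 := by
    rw [show (4:ℝ) = 2 ^ 2 by norm_num, Real.log_pow]
    have := Real.log_two_lt_d9
    norm_num at this ⊢; linarith
  have h5 : (Real.log 4 + 4) * (x / 6) ≤ 5.3862944 * (x / 6) := mul_le_mul_of_nonneg_right (by linarith) (by linarith)
  norm_num at h3 h5 ⊢
  linarith

theorem chU2 {x : ℝ} (hx : 336 ≤ x) : Chebyshev.psi x ≤ 1.412 * x := by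
  have h1 := ch_upper1 (by linarith : 30 ≤ x)
  have h2 := chU1 (x := x / 6) (by linarith)
  have h3 := log_lin 9 (by norm_num) (by norm_num) hx
  norm_num at h2 h3 ⊢
  linarith

theorem chU3 {x : ℝ} (hx : 2016 ≤ x) : Chebyshev.psi x ≤ 1.1785 * x := by
  have h1 := ch_upper1 (by linarith : 30 ≤ x)
  have h2 := chU2 (x := x / 6) (by linarith)
  have h3 := log_lin 11 (by norm_num) (by norm_num) hx
  norm_num at h2 h3 ⊢
  linarith

theorem chU4 {x : ℝ} (hx : 12096 ≤ x) : Chebyshev.psi x ≤ 1.1223 * x := by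
  have h1 := ch_upper1 (by linarith : 30 ≤ x)
  have h2 := chU3 (x := x / 6) (by linarith)
  have h3 := log_lin 14 (by norm_num) (by norm_num) hx
  norm_num at h2 h3 ⊢
  linarith

theorem chL4 {x : ℝ} (hx : 12096 ≤ x) : 0.9168 * x ≤ Chebyshev.psi x := by
  have h1 := ch_lower (by linarith : 30 ≤ x)
  have h3 := log_lin 14 (by norm_num) (by norm_num) hx
  norm_num at h3 ⊢
  linarith

theorem chU5 {x : ℝ} (hx : 120960 ≤ x) : Chebyshev.psi x ≤ 1.0903 * x := by
  have h1 := ch_upper2 (by linarith : 30 ≤ x)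
  have h2 := chU4 (x := x / 6) (by linarith)
  have h4 := chU4 (x := x / 10) (by linarith)
  have h5 := chL4 (x := x / 7) (by linarith)
  have h3 := log_lin 17 (by norm_num) (by norm_num) hx
  norm_num at h2 h3 h4 h5 ⊢
  linarith

theorem chL5 {x : ℝ} (hx : 120960 ≤ x) : 0.9207 * x ≤ Chebyshev.psi x := by
  have h1 := ch_lower (by linarith : 30 ≤ x)
  have h3 := log_lin 17 (by norm_num) (by norm_num) hx
  norm_num at h3 ⊢
  linarith

theorem lev0 (x : ℝ) (hx : 1209600 ≤ x) : |Chebyshev.psi x - x| ≤ 0.0807 * x := by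
  have h1 := ch_upper2 (by linarith : 30 ≤ x)
  have h2 := chU5 (x := x / 6) (by linarith)
  have h4 := chU5 (x := x / 10) (by linarith)
  have h5 := chL5 (x := x / 7) (by linarith)
  have h6 := chL5 (x := x) (by linarith)
  have h3 := log_lin 21 (by norm_num) (by norm_num) hx
  rw [abs_le]
  norm_num at h2 h3 h4 h5 h6 ⊢
  constructor <;> linarith

theorem levS {X ε ε' : ℝ} (k : ℕ) (hX : 1 ≤ X) (hε0 : 0 ≤ ε) (hε : ∀ y, X ≤ y → |Chebyshev.psi y - y| ≤ ε * y)
    (hk : 12000000 * X ≤ 2 ^ k) (h : 0.000415 + 0.3394 * ε + 3615 * ((k * 0.6931472 + 1) / (12000000 * X)) ≤ ε')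
    (x : ℝ) (hx : 12000000 * X ≤ x) : |Chebyshev.psi x - x| ≤ ε' * x := by
  have h1 := big_level hX hε0 hε hx
  have h3 := log_lin k (by linarith) hk hx
  have h4 := mul_le_mul_of_nonneg_right h (by linarith : 0 ≤ x)
  linarith

end

section

open Complex Set Filter Topology MeasureTheory

/-- Mellin-type integral `∫_1^∞ {t} t^{-s-1} dt`. -/
noncomputable def fractInd : ℝ → ℂ := (Set.Ioi (1:ℝ)).indicator (fun t => ((Int.fract t : ℝ) : ℂ))

noncomputable def Qz (s : ℂ) : ℂ := mellin fractInd (-s)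

lemma fractInd_norm_le (t : ℝ) : ‖fractInd t‖ ≤ 1 := by
  unfold fractInd
  by_cases h : t ∈ Set.Ioi (1:ℝ)
  · rw [indicator_of_mem h]
    simp only [norm_real, Real.norm_eq_abs]
    rw [abs_of_nonneg (Int.fract_nonneg t)]
    exact (Int.fract_lt_one t).le
  · rw [indicator_of_notMem h]; simp

lemma fractInd_meas : Measurable fractInd := by
  unfold fractInd
  exact (Complex.measurable_ofReal.comp measurable_fract).indicator measurableSet_Ioi

lemma fractInd_li : LocallyIntegrableOn fractInd (Ioi 0) := by
  apply LocallyIntegrable.locallyIntegrableOn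
  refine (locallyIntegrable_const (1:ℝ)).mono fractInd_meas.aestronglyMeasurable ?_
  exact Eventually.of_forall (fun t => by simpa using fractInd_norm_le t)

lemma Qz_diff {s : ℂ} (hs : 0 < s.re) : DifferentiableAt ℂ Qz s := by
  have h : DifferentiableAt ℂ (mellin fractInd) (-s) := by
    refine mellin_differentiableAt_of_isBigO_rpow (a := 0) (b := -s.re - 1) fractInd_li ?_ ?_ ?_ ?_
    · simp only [neg_zero, Real.rpow_zero]
      exact Asymptotics.isBigO_of_le _ (fun t => by simpa using fractInd_norm_le t)
    · simpa using hs
    · refine Asymptotics.IsBigO.of_bound 1 ?_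
      have : Iio (1:ℝ) ∈ 𝓝[>] (0:ℝ) := mem_nhdsWithin_of_mem_nhds (Iio_mem_nhds one_pos)
      filter_upwards [this] with t ht
      have : fractInd t = 0 := by
        unfold fractInd; rw [indicator_of_notMem]; simpa using (le_of_lt ht)
      rw [this]; simp
    · simp
  have := h.comp s (differentiableAt_id.neg)
  exact this

lemma Qz_eq (s : ℂ) : Qz s = ∫ t in Ioi (1:ℝ), ((Int.fract t : ℝ) : ℂ) * (t:ℂ) ^ (-(s+1)) := by
  unfold Qz mellin fractInd
  have : (fun t : ℝ => (t:ℂ) ^ (-s - 1) • (Set.Ioi (1:ℝ)).indicator (fun t => ((Int.fract t : ℝ) : ℂ)) t)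
      = (Set.Ioi (1:ℝ)).indicator (fun t : ℝ => ((Int.fract t : ℝ) : ℂ) * (t:ℂ) ^ (-(s+1))) := by
    ext t
    by_cases h : t ∈ Set.Ioi (1:ℝ)
    · rw [indicator_of_mem h, indicator_of_mem h, smul_eq_mul, mul_comm]
      congr 2; ring
    · rw [indicator_of_notMem h, indicator_of_notMem h]; simp
  rw [this, setIntegral_indicator measurableSet_Ioi]
  congr 2
  ext x; simp

lemma Qz_norm_le {s : ℂ} (hs : 0 < s.re) : ‖Qz s‖ ≤ 1 / s.re := by
  rw [Qz_eq]
  have hi : IntegrableOn (fun t : ℝ => t ^ (-(s.re+1))) (Ioi 1) :=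
    integrableOn_Ioi_rpow_of_lt (by linarith) one_pos
  calc ‖∫ t in Ioi (1:ℝ), ((Int.fract t : ℝ) : ℂ) * (t:ℂ) ^ (-(s+1))‖
      ≤ ∫ t in Ioi (1:ℝ), t ^ (-(s.re+1)) := by
        refine norm_integral_le_of_norm_le hi ?_
        filter_upwards [ae_restrict_mem measurableSet_Ioi] with t ht
        have ht0 : (0:ℝ) < t := lt_trans one_pos ht
        rw [norm_mul, norm_cpow_eq_rpow_re_of_pos ht0]
        simp only [norm_real, Real.norm_eq_abs, neg_re, add_re, one_re]
        rw [abs_of_nonneg (Int.fract_nonneg t)]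
        have := (Int.fract_lt_one t).le
        have h2 : 0 ≤ t ^ (-(s.re + 1)) := by positivity
        nlinarith
    _ = 1 / s.re := by
        rw [integral_Ioi_rpow_of_lt (by linarith) one_pos]
        simp

lemma zeta1_eq_aux {s : ℂ} (hs : 1 < s.re) : riemannZeta₁ s = s - s * (s - 1) * Qz s := by
  have hs1 : s ≠ 1 := by rintro rfl; simp at hs
  have hs1' : s - 1 ≠ 0 := sub_ne_zero.mpr hs1
  have h1 : riemannZeta s = s * ∫ t in Ioi (1:ℝ), ((⌊t⌋₊ : ℕ) : ℂ) * (t:ℂ) ^ (-(s + 1)) := by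
    rw [← LSeries_one_eq_riemannZeta hs]
    have := LSeries_eq_mul_integral_of_nonneg (fun _ => 1) zero_le_one hs (by
      simp only [Finset.sum_const, Nat.card_Icc, add_tsub_cancel_right, nsmul_eq_mul, mul_one,
        Real.rpow_one]
      exact Asymptotics.isBigO_refl _ _) (fun _ => zero_le_one)
    simp only [ofReal_one] at this
    rw [show (1 : ℕ → ℂ) = fun _ => 1 from rfl, this]
    simp
  have h2 : ∫ t in Ioi (1:ℝ), (t:ℂ) ^ (-s) = 1 / (s - 1) := by
    rw [integral_Ioi_cpow_of_lt (by simpa using hs) one_pos]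
    simp only [ofReal_one, one_cpow]
    rw [show -s + 1 = -(s-1) by ring, neg_div_neg_eq]
  have i1 : IntegrableOn (fun t : ℝ => (t:ℂ) ^ (-s)) (Ioi 1) :=
    integrableOn_Ioi_cpow_of_lt (by simpa using hs) one_pos
  have i2 : IntegrableOn (fun t : ℝ => ((Int.fract t : ℝ) : ℂ) * (t:ℂ) ^ (-(s+1))) (Ioi 1) := by
    have hi : IntegrableOn (fun t : ℝ => (t:ℂ) ^ (-(s+1))) (Ioi 1) :=
      integrableOn_Ioi_cpow_of_lt (by simp; linarith) one_pos
    refine Integrable.bdd_mul (c := 1) hi ?_ ?_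
    · exact (Complex.measurable_ofReal.comp measurable_fract).aestronglyMeasurable
    · refine Eventually.of_forall (fun t => ?_)
      simp only [norm_real, Real.norm_eq_abs]
      rw [abs_of_nonneg (Int.fract_nonneg t)]
      exact (Int.fract_lt_one t).le
  have h3 : ∫ t in Ioi (1:ℝ), ((⌊t⌋₊ : ℕ) : ℂ) * (t:ℂ) ^ (-(s + 1)) = 1 / (s-1) - Qz s := by
    rw [← h2, Qz_eq, ← integral_sub i1 i2]
    refine setIntegral_congr_fun measurableSet_Ioi (fun t ht => ?_)
    have ht0 : (0:ℝ) < t := lt_trans one_pos ht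
    have : (t:ℂ) ^ (-s) = t * (t:ℂ) ^ (-(s+1)) := by
      rw [show -s = 1 + (-(s+1)) by ring, cpow_add _ _ (by exact_mod_cast ht0.ne')]
      simp
    simp only [this]
    rw [← sub_mul]
    congr 1
    have : ((⌊t⌋₊ : ℕ) : ℝ) = t - Int.fract t := by
      rw [← Int.self_sub_floor]
      rw [natCast_floor_eq_intCast_floor ht0.le]; ring
    rw [← ofReal_sub, ← this]; simp
  have h4 := riemannZeta_eq_inv_sub_mul hs1
  rw [h1, h3] at h4
  have : riemannZeta₁ s = (s-1) * (s * (1 / (s - 1) - Qz s)) := by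
    rw [h4]; field_simp
  rw [this]; field_simp

lemma zeta1_eq {s : ℂ} (hs : 0 < s.re) : riemannZeta₁ s = s - s * (s - 1) * Qz s := by
  have hopen : IsOpen {s : ℂ | 0 < s.re} := isOpen_lt continuous_const continuous_re
  have hopen1 : IsOpen {s : ℂ | 1 < s.re} := isOpen_lt continuous_const continuous_re
  have hconv : Convex ℝ {s : ℂ | 0 < s.re} := convex_halfSpace_re_gt 0
  have a1 : AnalyticOnNhd ℂ riemannZeta₁ {s : ℂ | 0 < s.re} :=
    differentiable_riemannZeta₁.differentiableOn.analyticOnNhd hopen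
  have a2 : AnalyticOnNhd ℂ (fun s => s - s * (s - 1) * Qz s) {s : ℂ | 0 < s.re} := by
    refine DifferentiableOn.analyticOnNhd (fun z hz => DifferentiableAt.differentiableWithinAt ?_) hopen
    have := Qz_diff hz
    fun_prop
  have := a1.eqOn_of_preconnected_of_eventuallyEq a2 hconv.isPreconnected
    (z₀ := 2) (by simp) (by
      filter_upwards [hopen1.mem_nhds (x := 2) (by simp)] with z hz
      exact zeta1_eq_aux hz)
  exact this hs

/-- Crude bound for `Z(s) = (s-1) ζ(s)`. -/
lemma zeta1_norm_le {s : ℂ} (hs : 0 < s.re) : ‖riemannZeta₁ s‖ ≤ ‖s‖ * (1 + ‖s - 1‖ / s.re) := by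
  rw [zeta1_eq hs]
  calc ‖s - s * (s - 1) * Qz s‖ ≤ ‖s‖ + ‖s * (s-1) * Qz s‖ := norm_sub_le _ _
    _ = ‖s‖ + ‖s‖ * ‖s-1‖ * ‖Qz s‖ := by rw [norm_mul, norm_mul]
    _ ≤ ‖s‖ + ‖s‖ * ‖s-1‖ * (1 / s.re) := by gcongr; exact Qz_norm_le hs
    _ = _ := by ring

lemma zeta1_ne_zero_of_near {s : ℂ} (hs : 0 < s.re) (h : ‖s - 1‖ < s.re) : riemannZeta₁ s ≠ 0 := by
  rw [zeta1_eq hs]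
  intro h0
  have hs0 : s ≠ 0 := by rintro rfl; simp at hs
  have h1 : (s - 1) * Qz s = 1 := by
    have : s * (1 - (s-1) * Qz s) = 0 := by rw [← h0]; ring
    rcases mul_eq_zero.mp this with h | h
    · exact absurd h hs0
    · linear_combination -h
  have h2 : ‖s-1‖ * ‖Qz s‖ = 1 := by rw [← norm_mul, h1]; simp
  have h3 := Qz_norm_le hs
  have h4 : ‖s-1‖ * ‖Qz s‖ ≤ ‖s-1‖ * (1 / s.re) := by gcongr
  have h5 : ‖s-1‖ * (1 / s.re) < 1 := by
    rw [mul_one_div, div_lt_one hs]; exact h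
  linarith

lemma zeta_norm_le {s : ℂ} (hs : 0 < s.re) (h1 : s ≠ 1) :
    ‖riemannZeta s‖ ≤ ‖s‖ * (1 / ‖s - 1‖ + 1 / s.re) := by
  have h1' : 0 < ‖s - 1‖ := norm_pos_iff.mpr (sub_ne_zero.mpr h1)
  rw [riemannZeta_eq_inv_sub_mul h1, norm_mul, norm_inv]
  calc ‖s-1‖⁻¹ * ‖riemannZeta₁ s‖ ≤ ‖s-1‖⁻¹ * (‖s‖ * (1 + ‖s - 1‖ / s.re)) := by
        gcongr; exact zeta1_norm_le hs
    _ = _ := by field_simp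

end

section

open Complex Set Filter Topology MeasureTheory Metric
open scoped ComplexConjugate Real

/-- holomorphic logarithm on a closed ball -/
lemma exists_log_ball {g : ℂ → ℂ} {R : ℝ} (hR : 0 < R) (hg : AnalyticOnNhd ℂ g (closedBall 0 R))
    (hne : ∀ z ∈ closedBall (0:ℂ) R, g z ≠ 0) :
    ∃ h : ℂ → ℂ, DifferentiableOn ℂ h (closedBall 0 R) ∧ deriv h 0 = deriv g 0 / g 0 ∧ 
      ∀ z ∈ closedBall (0:ℂ) R, Real.log ‖g z‖ = (h z).re + Real.log ‖g 0‖ := by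
  obtain ⟨R1, hR1, hsub⟩ : ∃ R1, R < R1 ∧ ∀ z ∈ ball (0:ℂ) R1, AnalyticAt ℂ g z ∧ g z ≠ 0 := by
    have hop : IsOpen {z : ℂ | AnalyticAt ℂ g z ∧ g z ≠ 0} := by
      rw [isOpen_iff_mem_nhds]
      rintro z ⟨h1, h2⟩
      filter_upwards [h1.eventually_analyticAt, h1.continuousAt.eventually_ne h2] with w a b
      exact ⟨a, b⟩
    obtain ⟨δ, hδ, hs⟩ := (isCompact_closedBall (0:ℂ) R).exists_thickening_subset_open hop
      (fun z hz => ⟨hg z hz, hne z hz⟩)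
    refine ⟨R + δ, by linarith, fun z hz => hs ?_⟩
    rw [thickening_closedBall hδ hR.le]
    simpa [add_comm] using hz
  have hR1' : 0 < R1 := hR.trans hR1
  have hdiff : DifferentiableOn ℂ (fun z => deriv g z / g z) (ball 0 R1) := by
    intro z hz
    exact ((hsub z hz).1.deriv.differentiableAt.div (hsub z hz).1.differentiableAt
      (hsub z hz).2).differentiableWithinAt
  obtain ⟨h, hh⟩ := hdiff.isExactOn_ball
  have hconst : ∀ z ∈ ball (0:ℂ) R1, g z * Complex.exp (-(h z)) = g 0 * Complex.exp (-(h 0)) := by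
    intro z hz
    have h0 : (0:ℂ) ∈ ball (0:ℂ) R1 := by simpa using hR1'
    have hd : ∀ w ∈ ball (0:ℂ) R1, HasDerivAt (fun z => g z * Complex.exp (-(h z))) 0 w := by
      intro w hw
      have a1 := (hsub w hw).1.differentiableAt.hasDerivAt
      have a2 := (hh w hw).neg.cexp
      have a3 := a1.mul a2
      have hg0 := (hsub w hw).2
      have a4 : deriv g w * Complex.exp ((-h) w) + g w * (Complex.exp ((-h) w) * -(deriv g w / g w)) = 0 := by
        field_simp
        ring
      exact a4 ▸ a3
    have hdo : DifferentiableOn ℂ (fun z => g z * Complex.exp (-(h z))) (ball 0 R1) :=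
      fun w hw => (hd w hw).differentiableAt.differentiableWithinAt
    exact isOpen_ball.is_const_of_deriv_eq_zero (convex_ball (0:ℂ) R1).isPreconnected
      hdo (fun w hw => (hd w hw).deriv) hz h0
  have hcb : closedBall (0:ℂ) R ⊆ ball 0 R1 := closedBall_subset_ball hR1
  refine ⟨fun z => h z - h 0, ?_, ?_, ?_⟩
  · intro z hz
    exact ((hh z (hcb hz)).differentiableAt.sub_const _).differentiableWithinAt
  · have := (hh 0 (by simpa using hR1')).sub_const (h 0)
    exact this.deriv
  · intro z hz
    have h1 := hconst z (hcb hz)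
    have h2 : g z = g 0 * Complex.exp (h z - h 0) := by
      calc g z = g z * Complex.exp (-(h z)) * Complex.exp (h z) := by
              rw [mul_assoc, ← Complex.exp_add]; simp
        _ = _ := by rw [h1, mul_assoc, ← Complex.exp_add]; congr 2; ring
    rw [h2, norm_mul, Complex.norm_exp, Real.log_mul (norm_ne_zero_iff.mpr (hne 0 (by simp [hR.le])))
      (Real.exp_ne_zero _), Real.log_exp]
    ring

lemma circ_eq {g : ℂ → ℂ} {R : ℝ} (hR : 0 < R) (hg : AnalyticOnNhd ℂ g (closedBall 0 R))
    (hne : ∀ z ∈ closedBall (0:ℂ) R, g z ≠ 0) :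
    (deriv g 0 / g 0).re = 1 / (π * R) *
      ∫ θ in (0:ℝ)..2*π, Real.log ‖g (circleMap 0 R θ)‖ * Real.cos θ := by
  obtain ⟨h, hd, hder, hlog⟩ := exists_log_ball hR hg hne
  rw [← hder]
  have hmem : ∀ θ, circleMap 0 R θ ∈ closedBall (0:ℂ) R := fun θ => circleMap_mem_closedBall 0 hR.le θ
  have hcont : Continuous (fun θ : ℝ => h (circleMap 0 R θ)) :=
    hd.continuousOn.comp_continuous (continuous_circleMap 0 R) hmem
  have e1 := DifferentiableOn.deriv_eq_smul_circleIntegral hR hd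
  have e2 : (∮ z in C(0, R), h z) = 0 := by
    refine circleIntegral_eq_zero_of_differentiable_on_off_countable hR.le (s := ∅) countable_empty
      hd.continuousOn ?_
    intro z hz
    exact (hd.mono ball_subset_closedBall).differentiableAt (isOpen_ball.mem_nhds hz.1)
  rw [circleIntegral] at e1 e2
  simp only [deriv_circleMap, smul_eq_mul, sub_zero] at e1 e2
  have hRc : (R:ℂ) ≠ 0 := by exact_mod_cast hR.ne'
  have hcm : ∀ θ : ℝ, circleMap 0 R θ = R * Complex.exp (θ * I) := by intro θ; simp [circleMap]
  have key : ∫ θ in (0:ℝ)..2*π, (h (circleMap 0 R θ)) * (Real.cos θ : ℂ) = π * R * deriv h 0 := by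
    have i1 : IntervalIntegrable (fun θ : ℝ => circleMap 0 R θ * I * (1 / circleMap 0 R θ ^ 2 * h (circleMap 0 R θ))) volume 0 (2*π) := by
      apply Continuous.intervalIntegrable
      have c0 : ∀ θ, circleMap 0 R θ ^ 2 ≠ 0 := fun θ => pow_ne_zero 2 (circleMap_ne_center hR.ne')
      have c := continuous_circleMap 0 R
      exact (c.mul continuous_const).mul ((continuous_const.div (c.pow 2) c0).mul hcont)
    have i2 : IntervalIntegrable (fun θ : ℝ => circleMap 0 R θ * I * h (circleMap 0 R θ)) volume 0 (2*π) := by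
      apply Continuous.intervalIntegrable
      have c := continuous_circleMap 0 R
      exact (c.mul continuous_const).mul hcont
    have : (fun θ : ℝ => (h (circleMap 0 R θ)) * (Real.cos θ : ℂ)) = fun θ : ℝ =>
       (R / (2 * I)) * (circleMap 0 R θ * I * (1 / circleMap 0 R θ ^ 2 * h (circleMap 0 R θ)))
       + (1 / (2 * R * I)) * (circleMap 0 R θ * I * h (circleMap 0 R θ)) := by
      ext θ
      have : (Real.cos θ : ℂ) = (Complex.exp (θ * I) + Complex.exp (-θ * I)) / 2 := by
        rw [ofReal_cos]; rfl
      rw [this, hcm]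
      have h3 : Complex.exp (-θ * I) = 1 / Complex.exp (θ * I) := by
        rw [neg_mul, Complex.exp_neg]; simp
      rw [h3]
      have := Complex.exp_ne_zero (θ * I)
      field_simp
      ring
    rw [this, intervalIntegral.integral_add (i1.const_mul _) (i2.const_mul _),
      intervalIntegral.integral_const_mul, intervalIntegral.integral_const_mul, e1, e2]
    field_simp
    ring
  have key2 : ∫ θ in (0:ℝ)..2*π, (h (circleMap 0 R θ)).re * Real.cos θ = π * R * (deriv h 0).re := by
    have hc : IntervalIntegrable (fun θ : ℝ => (h (circleMap 0 R θ)) * (Real.cos θ : ℂ)) volume 0 (2*π) := by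
      apply Continuous.intervalIntegrable
      have := Complex.continuous_ofReal.comp Real.continuous_cos
      exact hcont.mul this
    have := Complex.reCLM.intervalIntegral_comp_comm hc
    rw [key] at this
    simp only [reCLM_apply, re_mul_ofReal] at this
    rw [this, ← ofReal_mul, re_ofReal_mul]
  have key3 : ∫ θ in (0:ℝ)..2*π, Real.log ‖g (circleMap 0 R θ)‖ * Real.cos θ = π * R * (deriv h 0).re := by
    have : (fun θ : ℝ => Real.log ‖g (circleMap 0 R θ)‖ * Real.cos θ) = fun θ =>
       (h (circleMap 0 R θ)).re * Real.cos θ + Real.log ‖g 0‖ * Real.cos θ := by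
      ext θ; rw [hlog _ (hmem θ)]; ring
    have c1 : Continuous (fun θ : ℝ => (h (circleMap 0 R θ)).re) := continuous_re.comp hcont
    rw [this, intervalIntegral.integral_add (by apply Continuous.intervalIntegrable; fun_prop)
      (by apply Continuous.intervalIntegrable; fun_prop), key2, intervalIntegral.integral_const_mul]
    simp
  rw [key3]
  field_simp

/-- Removing one zero (with multiplicity) by a Blaschke factor. -/
lemma remove_zero {f : ℂ → ℂ} {R : ℝ} (hR : 0 < R) (hf : AnalyticOnNhd ℂ f (closedBall 0 R))
    (h0 : f 0 ≠ 0) {a : ℂ} (ha : ‖a‖ < R) (haz : f a = 0) (hare : a.re < 0) :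
    ∃ F : ℂ → ℂ, AnalyticOnNhd ℂ F (closedBall 0 R) ∧ F a ≠ 0 ∧
      (∀ z ∈ closedBall (0:ℂ) R, z ≠ a → (F z = 0 ↔ f z = 0)) ∧
      (∀ θ, ‖F (circleMap 0 R θ)‖ = ‖f (circleMap 0 R θ)‖) ∧
      (deriv F 0 / F 0).re + (-a.re) * (1 / ‖a‖^2 - 1 / R^2) ≤ (deriv f 0 / f 0).re := by
  have hacb : a ∈ closedBall (0:ℂ) R := by simp [ha.le]
  have ha0 : a ≠ 0 := by rintro rfl; simp at hare
  have hRc : (R:ℂ) ≠ 0 := by exact_mod_cast hR.ne'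
  have hnz : ¬ ∀ᶠ z in 𝓝 a, f z = 0 := by
    intro h
    have := hf.eqOn_zero_of_preconnected_of_eventuallyEq_zero
      (convex_closedBall (0:ℂ) R).isPreconnected hacb h
    exact h0 (this (by simp [hR.le]))
  obtain ⟨m, g, hg, hga, hfg⟩ := (hf a hacb).exists_eventuallyEq_pow_smul_nonzero_iff.mpr hnz
  have hm : 1 ≤ m := by
    rcases Nat.eq_zero_or_pos m with h | h
    · have := hfg.self_of_nhds
      rw [h] at this; simp at this
      exact absurd (this.symm.trans haz) hga
    · exact h
  set B : ℂ → ℂ := fun z => (R^2 - conj a * z) / R with hB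
  have hBne : ∀ z ∈ closedBall (0:ℂ) R, B z ≠ 0 := by
    intro z hz h
    have hz' : ‖z‖ ≤ R := by simpa using hz
    rw [hB] at h
    simp only [div_eq_zero_iff, hRc, or_false] at h
    have : (R:ℂ)^2 = conj a * z := by linear_combination h
    have h2 : R^2 = ‖a‖ * ‖z‖ := by
      have := congrArg norm this
      simpa [abs_of_pos hR] using this
    nlinarith [norm_nonneg a, norm_nonneg z]
  have hBan : ∀ z, AnalyticAt ℂ B z := by
    intro z; rw [hB]; fun_prop (disch := assumption)
  set F : ℂ → ℂ := fun z => if z = a then g a * B a ^ m else f z / (z - a)^m * B z ^ m with hF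
  have hF1 : ∀ z, z ≠ a → F z = f z / (z - a)^m * B z ^ m := fun z hz => by simp [hF, hz]
  have hFne : ∀ z, z ≠ a → F =ᶠ[𝓝 z] fun z => f z / (z - a)^m * B z ^ m := by
    intro z hz
    filter_upwards [isOpen_ne.mem_nhds hz] with w hw
    exact hF1 w hw
  refine ⟨F, ?_, ?_, ?_, ?_, ?_⟩
  · intro z hz
    by_cases hza : z = a
    · subst hza
      have : (fun w => g w * B w ^ m) =ᶠ[𝓝 z] F := by
        filter_upwards [hfg] with w hw
        by_cases hwz : w = z
        · simp [hF, hwz]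
        · rw [hF1 w hwz, hw, smul_eq_mul]
          have : w - z ≠ 0 := sub_ne_zero.mpr hwz
          field_simp
      exact (hg.mul ((hBan z).pow m)).congr this
    · refine AnalyticAt.congr ?_ (hFne z hza).symm
      have : (z - a)^m ≠ 0 := pow_ne_zero _ (sub_ne_zero.mpr hza)
      exact ((hf z hz).div ((analyticAt_id.sub analyticAt_const).pow m) this).mul ((hBan z).pow m)
  · simp only [hF, if_true]
    exact mul_ne_zero hga (pow_ne_zero _ (hBne a hacb))
  · intro z hz hza
    rw [hF1 z hza]
    have h1 : (z - a)^m ≠ 0 := pow_ne_zero _ (sub_ne_zero.mpr hza)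
    have h2 := pow_ne_zero m (hBne z hz)
    simp [h1, h2]
  · intro θ
    set z := circleMap 0 R θ with hz
    have hzn : ‖z‖ = R := by simp [hz, abs_of_pos hR]
    have hza : z ≠ a := by rintro h; rw [h] at hzn; linarith
    rw [hF1 z hza, norm_mul, norm_div, norm_pow, norm_pow]
    have : ‖B z‖ = ‖z - a‖ := by
      have h1 : (R:ℂ)^2 = z * conj z := by
        rw [mul_conj, normSq_eq_norm_sq, hzn]; simp
      have h2 : B z = z * conj (z - a) / R := by
        simp only [hB]; rw [h1, map_sub]; ring
      rw [h2, norm_div, norm_mul, RCLike.norm_conj, hzn]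
      simp [abs_of_pos hR]
      field_simp
    rw [this]
    have : ‖z - a‖ ≠ 0 := norm_ne_zero_iff.mpr (sub_ne_zero.mpr hza)
    field_simp
  · have hd : deriv F 0 / F 0 = deriv f 0 / f 0 + m * (1 / a) - m * (conj a / R^2) := by
      rw [(hFne 0 ha0.symm).deriv_eq, hF1 0 ha0.symm]
      have hfd : HasDerivAt f (deriv f 0) 0 := (hf 0 (by simp [hR.le])).differentiableAt.hasDerivAt
      have hBd : HasDerivAt B (-(conj a) / R) 0 := by
        have := (((hasDerivAt_id (0:ℂ)).const_mul (conj a)).const_sub ((R:ℂ)^2)).div_const (R:ℂ)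
        simpa [hB] using this
      have hpd : HasDerivAt (fun z => (z - a)^m) (m * (0 - a)^(m-1) * 1) 0 :=
        ((hasDerivAt_id (0:ℂ)).sub_const a).pow m
      have hna : (0 - a)^m ≠ 0 := pow_ne_zero _ (by simpa using ha0)
      have := (hfd.div hpd hna).mul (hBd.pow m)
      have e := this.deriv
      have e' : deriv (fun z => f z / (z - a)^m * B z ^ m) 0 = _ := e
      rw [e']
      have hB0 : B 0 = R := by simp [hB]; field_simp
      simp only [hB0, Pi.pow_apply, Pi.div_apply]
      obtain ⟨k, rfl⟩ : ∃ k, m = k + 1 := ⟨m - 1, by omega⟩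
      simp only [add_tsub_cancel_right]
      have hna' : (0 - a) ≠ 0 := by simpa using ha0
      have : (0 - a) = -a := by ring
      rw [this]
      have hna'' : (-a) ≠ 0 := by simpa using ha0
      rw [pow_succ (-a) k, pow_succ (R:ℂ) k]
      have h5 : (-a)^k ≠ 0 := pow_ne_zero _ hna''
      have h6 : (R:ℂ)^k ≠ 0 := pow_ne_zero _ hRc
      field_simp
      ring
    rw [hd]
    have e1 : (1 / a).re = a.re / ‖a‖^2 := by rw [one_div, inv_re, normSq_eq_norm_sq]
    have e2 : (conj a / (R:ℂ)^2).re = a.re / R^2 := by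
      rw [← ofReal_pow, div_ofReal_re, conj_re]
    have e3 : (deriv f 0 / f 0 + m * (1 / a) - m * (conj a / R^2)).re
       = (deriv f 0 / f 0).re + m * (a.re / ‖a‖^2) - m * (a.re / R^2) := by
      rw [sub_re, add_re, ← ofReal_natCast, re_ofReal_mul, re_ofReal_mul, e1, e2]
    rw [e3]
    have hap : 0 < ‖a‖ := norm_pos_iff.mpr ha0
    have h7 : 1 / R^2 ≤ 1 / ‖a‖^2 := by
      apply one_div_le_one_div_of_le (by positivity)
      gcongr
    have h8 : (1:ℝ) ≤ m := by exact_mod_cast hm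
    have h9 : 0 ≤ (-a.re) * (1 / ‖a‖^2 - 1 / R^2) := mul_nonneg (by linarith) (by linarith)
    have h10 : (m:ℝ) * (a.re / ‖a‖^2) - m * (a.re / R^2) = - (m * ((-a.re) * (1 / ‖a‖^2 - 1 / R^2))) := by ring
    nlinarith

lemma circ_ineq {R : ℝ} (hR : 0 < R) (n : ℕ) : ∀ (f : ℂ → ℂ), AnalyticOnNhd ℂ f (closedBall 0 R) →
    f 0 ≠ 0 → (∀ z ∈ closedBall (0:ℂ) R, f z = 0 → z.re < 0 ∧ ‖z‖ < R) →
    {z ∈ closedBall (0:ℂ) R | f z = 0}.Finite → {z ∈ closedBall (0:ℂ) R | f z = 0}.ncard = n →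
    1 / (π * R) * ∫ θ in (0:ℝ)..2*π, Real.log ‖f (circleMap 0 R θ)‖ * Real.cos θ ≤
    (deriv f 0 / f 0).re := by
  induction n with
  | zero =>
    intro f hf h0 hz hfin hc
    have he := (Set.ncard_eq_zero hfin).mp hc
    refine (circ_eq hR hf ?_).ge
    intro z hz' h
    have : z ∈ {z ∈ closedBall (0:ℂ) R | f z = 0} := ⟨hz', h⟩
    rw [he] at this; exact this
  | succ n ih =>
    intro f hf h0 hz hfin hc
    have hne : {z ∈ closedBall (0:ℂ) R | f z = 0}.Nonempty := by
      rw [← Set.ncard_pos hfin]; omega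
    obtain ⟨a, ha, haz⟩ := hne
    obtain ⟨F, h1, h2, h3, h4, h5⟩ := remove_zero hR hf h0 (hz a ha haz).2 haz (hz a ha haz).1
    have hare := (hz a ha haz).1
    have ha0 : a ≠ 0 := by rintro rfl; simp at hare
    have h0cb : (0:ℂ) ∈ closedBall (0:ℂ) R := by simp [hR.le]
    have hset : {z ∈ closedBall (0:ℂ) R | F z = 0} = {z ∈ closedBall (0:ℂ) R | f z = 0} \ {a} := by
      ext z
      by_cases hza : z = a
      · subst hza; simp [h2]
      · constructor
        · rintro ⟨u, v⟩; exact ⟨⟨u, (h3 z u hza).mp v⟩, hza⟩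
        · rintro ⟨⟨u, v⟩, _⟩; exact ⟨u, (h3 z u hza).mpr v⟩
    have := ih F h1 (by rw [Ne, h3 0 h0cb ha0.symm]; exact h0) (by
      intro z hz1 hz2
      have : z ∈ {z ∈ closedBall (0:ℂ) R | F z = 0} := ⟨hz1, hz2⟩
      rw [hset] at this
      exact hz z this.1.1 this.1.2) (by rw [hset]; exact hfin.sdiff) (by
      have hmem : a ∈ {z ∈ closedBall (0:ℂ) R | f z = 0} := ⟨ha, haz⟩
      rw [hset, Set.ncard_sdiff_singleton_of_mem hmem, hc]; simp)
    simp only [h4] at this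
    have ha' : ‖a‖ < R := (hz a ha haz).2
    have hap : 0 < ‖a‖ := norm_pos_iff.mpr ha0
    have h7 : 1 / R^2 ≤ 1 / ‖a‖^2 := by
      apply one_div_le_one_div_of_le (by positivity)
      gcongr
    have h9 : 0 ≤ (-a.re) * (1 / ‖a‖^2 - 1 / R^2) := mul_nonneg (by linarith) (by linarith)
    linarith

/-- version with one distinguished zero on the negative real axis -/
lemma circ_ineq_zero {R : ℝ} (hR : 0 < R) (f : ℂ → ℂ) (hf : AnalyticOnNhd ℂ f (closedBall 0 R))
    (h0 : f 0 ≠ 0) (hz : ∀ z ∈ closedBall (0:ℂ) R, f z = 0 → z.re < 0 ∧ ‖z‖ < R)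
    (hfin : {z ∈ closedBall (0:ℂ) R | f z = 0}.Finite) {y : ℝ} (hy : 0 < y) (hyR : y < R)
    (hfy : f (-(y:ℂ)) = 0) :
    1 / (π * R) * (∫ θ in (0:ℝ)..2*π, Real.log ‖f (circleMap 0 R θ)‖ * Real.cos θ)
      + (1 / y - y / R^2) ≤ (deriv f 0 / f 0).re := by
  have hny : ‖(-(y:ℂ))‖ = y := by simp [abs_of_pos hy]
  obtain ⟨F, h1, h2, h3, h4, h5⟩ := remove_zero hR hf h0 (a := -(y:ℂ)) (by rw [hny]; exact hyR) hfy (by simp [hy])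
  have hy0 : (0:ℂ) ≠ -(y:ℂ) := by simpa using hy.ne'
  have h0cb : (0:ℂ) ∈ closedBall (0:ℂ) R := by simp [hR.le]
  have hset : {z ∈ closedBall (0:ℂ) R | F z = 0} ⊆ {z ∈ closedBall (0:ℂ) R | f z = 0} := by
    rintro z ⟨u, v⟩
    by_cases hza : z = -(y:ℂ)
    · rw [hza] at v; exact absurd v h2
    · exact ⟨u, (h3 z u hza).mp v⟩
  have := circ_ineq hR _ F h1 (by rw [Ne, h3 0 h0cb hy0]; exact h0) (by
      intro z hz1 hz2
      have : z ∈ {z ∈ closedBall (0:ℂ) R | F z = 0} := ⟨hz1, hz2⟩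
      have := hset this
      exact hz z this.1 this.2) (hfin.subset hset) rfl
  simp only [h4] at this
  rw [hny] at h5
  have h6 : (-(-(y:ℂ)).re) * (1 / y^2 - 1 / R^2) = 1 / y - y / R^2 := by
    simp; field_simp
  rw [h6] at h5
  linarith

end

section

open Complex Set Filter Topology MeasureTheory Metric
open scoped ComplexConjugate Real

lemma Qz_re_nonneg {σ : ℝ} (hσ : 0 < σ) : 0 ≤ (Qz (σ:ℂ)).re := by
  rw [Qz_eq (s := (σ:ℂ))]
  have hi : ∫ t in Ioi (1:ℝ), ((Int.fract t : ℝ) : ℂ) * (t:ℂ)^(-((σ:ℂ)+1)) =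
      ((∫ t in Ioi (1:ℝ), (Int.fract t : ℝ) * t^(-(σ+1)) : ℝ) : ℂ) := by
    rw [← integral_complex_ofReal]
    refine setIntegral_congr_fun measurableSet_Ioi ?_
    intro t ht
    have : (0:ℝ) ≤ t := by linarith [mem_Ioi.mp ht]
    simp only [ofReal_mul]
    rw [Complex.ofReal_cpow this]; push_cast; rfl
  rw [hi, ofReal_re]
  refine setIntegral_nonneg measurableSet_Ioi ?_
  intro t ht
  have : (0:ℝ) ≤ t := by linarith [mem_Ioi.mp ht]
  have := Int.fract_nonneg t
  positivity

lemma zeta_real_le {σ : ℝ} (hσ : 1 < σ) : (riemannZeta (σ:ℂ)).re ≤ σ / (σ - 1) := by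
  have h1 := zeta1_eq (s := (σ:ℂ)) (by simp; linarith)
  have hne : (σ:ℂ) ≠ 1 := by exact_mod_cast hσ.ne'
  have h2 : riemannZeta₁ (σ:ℂ) = ((σ:ℂ) - 1) * riemannZeta σ := by
    rw [riemannZeta_eq_inv_sub_mul hne]
    have : (σ:ℂ) - 1 ≠ 0 := sub_ne_zero.mpr hne
    field_simp
  have h3 := Qz_re_nonneg (σ := σ) (by linarith)
  have h4 : (σ - 1) * (riemannZeta (σ:ℂ)).re = σ - σ * (σ - 1) * (Qz (σ:ℂ)).re := by
    have := congrArg Complex.re (h2.symm.trans h1)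
    have e1 : ((σ:ℂ) - 1) = ((σ - 1 : ℝ):ℂ) := by push_cast; rfl
    rw [e1, ← ofReal_mul, sub_re, re_ofReal_mul, re_ofReal_mul, ofReal_re] at this
    exact this
  rw [le_div_iff₀ (by linarith)]
  have : 0 ≤ σ * (σ - 1) * (Qz (σ:ℂ)).re := by
    have : 0 < σ - 1 := by linarith
    positivity
  linarith

open ArithmeticFunction in
lemma zeta_norm_ge {s : ℂ} (hs : 1 < s.re) : (s.re - 1) / s.re ≤ ‖riemannZeta s‖ := by
  have h1 : riemannZeta s * LSeries (fun n => ((moebius n : ℤ) : ℂ)) s = 1 := by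
    rw [← LSeries_zeta_eq_riemannZeta hs]; exact LSeries_zeta_mul_Lseries_moebius hs
  have h2 : ‖LSeries (fun n => ((moebius n : ℤ) : ℂ)) s‖ ≤ s.re / (s.re - 1) := by
    refine le_trans ?_ (zeta_real_le hs)
    have hσ : 1 < ((s.re:ℝ):ℂ).re := by simpa using hs
    rw [← LSeries_zeta_eq_riemannZeta hσ]
    have hsum := LSeriesSummable_zeta_iff.mpr hσ
    unfold LSeries
    rw [Complex.re_tsum hsum]
    have hsum' := Complex.reCLM.summable hsum
    have hb : ∀ n, ‖LSeries.term (fun n => ((moebius n : ℤ) : ℂ)) s n‖ ≤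
        (LSeries.term (fun n => ((ArithmeticFunction.zeta n : ℕ) : ℂ)) (s.re:ℂ) n).re := by
      intro n
      rcases eq_or_ne n 0 with rfl | hn
      · simp
      rw [LSeries.norm_term_eq, if_neg hn, LSeries.term_of_ne_zero hn]
      have hn' : (0:ℝ) < n := by positivity
      have e : (((ArithmeticFunction.zeta n : ℕ) : ℂ) / (n:ℂ)^((s.re:ℝ):ℂ)) = ((1 / (n:ℝ)^s.re : ℝ):ℂ) := by
        rw [ofReal_div, Complex.ofReal_cpow hn'.le]; simp [hn]
      rw [e, ofReal_re]
      gcongr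
      have := abs_moebius_le_one (n := n)
      rw [Complex.norm_intCast]
      exact_mod_cast this
    exact tsum_of_norm_bounded hsum'.hasSum hb
  have h3 : 0 < s.re - 1 := by linarith
  have h4 : ‖riemannZeta s‖ * ‖LSeries (fun n => ((moebius n : ℤ) : ℂ)) s‖ = 1 := by
    rw [← norm_mul, h1, norm_one]
  rw [div_le_iff₀ (by linarith)]
  rw [le_div_iff₀ h3] at h2
  have h5 := norm_nonneg (riemannZeta s)
  nlinarith [mul_le_mul_of_nonneg_left h2 h5]

lemma circ_lower {R M : ℝ} (hR : 0 < R) (f : ℂ → ℂ) (hf : ContinuousOn f (sphere 0 R))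
    (hne : ∀ z ∈ sphere (0:ℂ) R, f z ≠ 0) 
    (hl : ∀ z ∈ sphere (0:ℂ) R, z.re ≤ 0 → Real.log ‖f z‖ ≤ M)
    (hr : ∀ z ∈ sphere (0:ℂ) R, 0 < z.re → -(1 / z.re) ≤ Real.log ‖f z‖) :
    -(2 / (π * R) * M) - 1 / R^2 ≤ 
    1 / (π * R) * ∫ θ in (0:ℝ)..2*π, Real.log ‖f (circleMap 0 R θ)‖ * Real.cos θ := by
  have hmem : ∀ θ, circleMap 0 R θ ∈ sphere (0:ℂ) R := fun θ => circleMap_mem_sphere 0 hR.le θ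
  have hc : Continuous (fun θ : ℝ => Real.log ‖f (circleMap 0 R θ)‖ * Real.cos θ) := by
    have h1 : Continuous (fun θ : ℝ => f (circleMap 0 R θ)) :=
      hf.comp_continuous (continuous_circleMap 0 R) hmem
    exact (h1.norm.log (fun θ => norm_ne_zero_iff.mpr (hne _ (hmem θ)))).mul Real.continuous_cos
  have hre : ∀ θ, (circleMap 0 R θ).re = R * Real.cos θ := by
    intro θ; simp [circleMap, Complex.exp_ofReal_mul_I_re]
  set F := (fun θ : ℝ => Real.log ‖f (circleMap 0 R θ)‖ * Real.cos θ) with hF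
  have hper : Function.Periodic F (2*π) := by
    intro θ; simp only [hF]; rw [periodic_circleMap, Real.cos_add_two_pi]
  have e1 : ∫ θ in (0:ℝ)..2*π, F θ = ∫ θ in (-(π/2))..(-(π/2) + 2*π), F θ := by
    have := hper.intervalIntegral_add_eq 0 (-(π/2)); simpa using this
  have hpi := Real.pi_pos
  have hIntg : ∀ a b, IntervalIntegrable F volume a b := fun a b => hc.intervalIntegrable a b
  have e2 : ∫ θ in (-(π/2))..(-(π/2) + 2*π), F θ = (∫ θ in (-(π/2))..(π/2), F θ) + ∫ θ in (π/2)..(-(π/2)+2*π), F θ :=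
    (intervalIntegral.integral_add_adjacent_intervals (hIntg _ _) (hIntg _ _)).symm
  have b1 : -(π / R) ≤ ∫ θ in (-(π/2))..(π/2), F θ := by
    have : ∫ θ in (-(π/2))..(π/2), (-(1/R) : ℝ) = -(π/R) := by
      rw [intervalIntegral.integral_const]; simp; ring
    rw [← this]
    refine intervalIntegral.integral_mono_on (by linarith) (by simp) (hIntg _ _) ?_
    intro θ hθ
    have hcos := Real.cos_nonneg_of_mem_Icc hθ
    simp only [hF]
    rcases hcos.eq_or_lt with h0 | h0
    · rw [← h0, mul_zero]; have : 0 < 1 / R := by positivity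
      linarith
    · have := hr _ (hmem θ) (by rw [hre]; positivity)
      rw [hre] at this
      have h2 := mul_le_mul_of_nonneg_right this h0.le
      refine le_trans (le_of_eq ?_) h2
      field_simp
  have b2 : -(2 * M) ≤ ∫ θ in (π/2)..(-(π/2)+2*π), F θ := by
    have : ∫ θ in (π/2)..(-(π/2)+2*π), M * Real.cos θ = -(2*M) := by
      rw [intervalIntegral.integral_const_mul, integral_cos]
      have : Real.sin (-(π/2)+2*π) = -1 := by rw [Real.sin_add_two_pi, Real.sin_neg, Real.sin_pi_div_two]
      rw [this, Real.sin_pi_div_two]; ring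
    rw [← this]
    refine intervalIntegral.integral_mono_on (by linarith) ((continuous_const.mul Real.continuous_cos).intervalIntegrable _ _) (hIntg _ _) ?_
    intro θ hθ
    have hcos : Real.cos θ ≤ 0 := Real.cos_nonpos_of_pi_div_two_le_of_le hθ.1 (by linarith [hθ.2])
    simp only [hF]
    have := hl _ (hmem θ) (by rw [hre]; nlinarith)
    nlinarith
  rw [e1, e2]
  have h3 : -(π/R) - 2*M ≤ (∫ θ in (-(π/2))..(π/2), F θ) + ∫ θ in (π/2)..(-(π/2)+2*π), F θ := by linarith
  have h4 := mul_le_mul_of_nonneg_left h3 (show 0 ≤ 1 / (π * R) by positivity)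
  refine le_trans (le_of_eq ?_) h4
  field_simp
  ring

/-- the constant of the local log derivative bound -/
noncomputable def bb (τ : ℝ) : ℝ := 0.716 * Real.log (11 * τ) + 1.263

lemma zeta_left_bound {s : ℂ} {τ : ℝ} (hτ : 100 ≤ τ) (h1 : 0.1 ≤ s.re) (h2 : 0.08 ≤ |s.im|) (h3 : ‖s‖ ≤ τ + 2) :
    ‖riemannZeta s‖ ≤ 11 * τ := by
  have hs1 : 0.08 ≤ ‖s - 1‖ := by
    refine h2.trans ?_
    have := Complex.abs_im_le_norm (s - 1); simpa using this
  have hne : s ≠ 1 := by rintro rfl; norm_num at hs1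
  refine (zeta_norm_le (by linarith) hne).trans ?_
  have i2 : 1 / s.re ≤ 10 := by rw [div_le_iff₀ (by linarith)]; linarith
  have hn := norm_nonneg s
  rcases le_total ‖s‖ 3 with h | h
  · have i1 : 1 / ‖s-1‖ ≤ 12.5 := by rw [div_le_iff₀ (by linarith)]; linarith
    nlinarith
  · have h4 : 2 ≤ ‖s - 1‖ := by
      have := norm_sub_norm_le s 1; simp at this; linarith
    have i1 : 1 / ‖s-1‖ ≤ 0.5 := by rw [div_le_iff₀ (by linarith)]; linarith
    nlinarith

lemma local_all {a t τ : ℝ} (ha : 0 < a) (ha' : a ≤ 0.05) (ht : 0.98 ≤ |t|) (htτ : |t| ≤ τ) (hτ : 100 ≤ τ) :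
    -bb τ ≤ (deriv riemannZeta (1 + a + t * I) / riemannZeta (1 + a + t * I)).re ∧
    ∀ y : ℝ, 0 < y → y ≤ 0.89 → riemannZeta (1 + a + t * I - y) = 0 →
      1 / y - y / 0.89^2 - bb τ ≤ (deriv riemannZeta (1 + a + t * I) / riemannZeta (1 + a + t * I)).re := by
  set s0 : ℂ := 1 + a + t * I with hs0
  have s0re : s0.re = 1 + a := by simp [hs0]
  have s0im : s0.im = t := by simp [hs0]
  set f : ℂ → ℂ := fun z => riemannZeta (s0 + z) with hf
  have hfinZ := (isCompact_closedBall s0 1).inter_riemannZetaZeros_finite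
  obtain ⟨R, hRm, hRn⟩ : ((Ioo (0.89:ℝ) 0.9) \ ((fun z => ‖z - s0‖) '' (closedBall s0 1 ∩ riemannZetaZeros))).Nonempty :=
    ((Ioo_infinite (by norm_num)).sdiff (hfinZ.image _)).nonempty
  obtain ⟨hR1, hR2⟩ := hRm
  have hR : 0 < R := by linarith
  have hne1 : ∀ z ∈ closedBall (0:ℂ) R, s0 + z ≠ 1 := by
    intro z hz h
    have h1 := Complex.abs_im_le_norm z
    have h2 : s0.im + z.im = 0 := by have := congrArg Complex.im h; simpa using this
    have h3 : ‖z‖ ≤ R := by simpa using hz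
    rw [s0im] at h2
    have : t = -z.im := by linarith
    rw [this, abs_neg] at ht
    linarith
  have hfan : AnalyticOnNhd ℂ f (closedBall 0 R) := by
    intro z hz
    have h1 : AnalyticAt ℂ riemannZeta (s0 + z) := by
      have : DifferentiableOn ℂ riemannZeta {1}ᶜ := fun w hw => (differentiableAt_riemannZeta hw).differentiableWithinAt
      exact this.analyticAt (isOpen_compl_singleton.mem_nhds (hne1 z hz))
    exact h1.comp_of_eq (analyticAt_const.add analyticAt_id) rfl
  have hzero : ∀ z ∈ closedBall (0:ℂ) R, f z = 0 → z.re < 0 ∧ ‖z‖ < R := by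
    intro z hz h
    have h3 : ‖z‖ ≤ R := by simpa using hz
    constructor
    · by_contra hc
      push Not at hc
      exact riemannZeta_ne_zero_of_one_le_re (s := s0 + z) (by rw [add_re, s0re]; linarith) h
    · refine lt_of_le_of_ne h3 ?_
      intro he
      refine hRn ⟨s0 + z, ⟨?_, ?_⟩, ?_⟩
      · simp; linarith
      · simpa [riemannZetaZeros] using h
      · simpa using he
  have h0 : f 0 ≠ 0 := by
    intro h
    have := (hzero 0 (by simp [hR.le]) h).1
    simp at this
  have hfin : {z ∈ closedBall (0:ℂ) R | f z = 0}.Finite := by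
    refine (hfinZ.image (fun w => w - s0)).subset ?_
    rintro z ⟨hz, h⟩
    have h3 : ‖z‖ ≤ R := by simpa using hz
    refine ⟨s0 + z, ⟨?_, ?_⟩, by simp⟩
    · simp; linarith
    · simpa [riemannZetaZeros] using h
  have hder : deriv f 0 / f 0 = deriv riemannZeta s0 / riemannZeta s0 := by
    have : deriv f 0 = deriv riemannZeta s0 := by
      simp only [hf]; rw [deriv_comp_const_add]; simp
    rw [this]; simp [hf]
  have hlow := circ_lower (M := Real.log (11 * τ)) hR f (hfan.continuousOn.mono sphere_subset_closedBall)
    (fun z hz h => by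
      have := (hzero z (sphere_subset_closedBall hz) h).2
      have h3 : ‖z‖ = R := by simpa using hz
      linarith) (by
      intro z hz hzre
      have h3 : ‖z‖ = R := by simpa using hz
      have hpos : 0 < ‖f z‖ := by
        rw [norm_pos_iff]; intro h
        have := (hzero z (sphere_subset_closedBall hz) h).2
        linarith
      refine Real.log_le_log hpos ?_
      have hzr := Complex.abs_re_le_norm z
      have hzi := Complex.abs_im_le_norm z
      refine zeta_left_bound hτ ?_ ?_ ?_
      · rw [add_re, s0re]; linarith [neg_abs_le z.re]
      · rw [add_im, s0im]
        have := abs_sub_abs_le_abs_add t z.im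
        linarith
      · have e : ‖s0‖ ≤ 1 + a + |t| := by
          refine (norm_add_le _ _).trans ?_
          have : ‖(1 + a : ℂ)‖ = 1 + a := by
            rw [show (1 + a : ℂ) = ((1 + a : ℝ) : ℂ) by push_cast; rfl, Complex.norm_real, Real.norm_of_nonneg (by linarith)]
          rw [this]; simp
        have := norm_add_le s0 z
        linarith) (by
      intro z hz hzre
      have h1 := zeta_norm_ge (s := s0 + z) (by rw [add_re, s0re]; linarith)
      rw [add_re, s0re] at h1
      have hp : 0 < (1 + a + z.re - 1) / (1 + a + z.re) := by apply div_pos <;> linarith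
      refine le_trans ?_ (Real.log_le_log hp h1)
      have h2 := Real.one_sub_inv_le_log_of_pos hp
      refine le_trans ?_ h2
      have h3 : 1 - ((1 + a + z.re - 1) / (1 + a + z.re))⁻¹ = -(1/(a + z.re)) := by
        have : a + z.re ≠ 0 := by linarith
        rw [inv_div, show 1 + a + z.re - 1 = a + z.re by ring]; field_simp; ring
      rw [h3]
      have := one_div_le_one_div_of_le hzre (show z.re ≤ a + z.re by linarith)
      linarith)
  have hb : -bb τ ≤ -(2 / (π * R) * Real.log (11 * τ)) - 1 / R^2 := by
    unfold bb
    have hlog : 0 ≤ Real.log (11 * τ) := Real.log_nonneg (by linarith)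
    have h1 : 2 / (π * R) ≤ 0.716 := by
      rw [div_le_iff₀ (by positivity)]
      have := Real.pi_gt_d2
      nlinarith
    have h2 : 1 / R^2 ≤ 1.263 := by
      rw [div_le_iff₀ (by positivity)]; nlinarith
    nlinarith
  rw [← hder]
  refine ⟨?_, ?_⟩
  · have := circ_ineq hR _ f hfan h0 hzero hfin rfl
    linarith
  · intro y hy hyR hfy
    have := circ_ineq_zero hR f hfan h0 hzero hfin hy (by linarith) (by simpa [hf, sub_eq_add_neg] using hfy)
    have h3 : y / R^2 ≤ y / 0.89^2 := by gcongr
    linarith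

end

section

open Complex Set Filter Topology MeasureTheory Metric
open scoped ComplexConjugate Real

lemma neg_logderiv_real_le {a : ℝ} (ha : 0 < a) :
    (-(deriv riemannZeta (1 + a) / riemannZeta (1 + a)) : ℂ).re ≤ 1 / a + 8 * a := by
  set σ : ℂ := 1 + a with hσ
  have σre : σ.re = 1 + a := by simp [hσ]
  have hne : σ ≠ 1 := by simp [hσ, ha.ne']
  -- Z = 1 + (s-1) K
  set K : ℂ → ℂ := fun s => 1 - s * Qz s with hK
  have hKd : ∀ s : ℂ, 0 < s.re → DifferentiableAt ℂ K s := fun s hs =>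
    (differentiableAt_const _).sub (differentiableAt_id.mul (Qz_diff hs))
  have hnorm : ∀ z ∈ sphere σ (1/2), ‖K z‖ ≤ 4 := by
    intro z hz
    have h1 : ‖z - σ‖ = 1/2 := by simpa [dist_eq_norm] using hz
    have h2 : 1 + a - 1/2 ≤ z.re := by
      have := Complex.abs_re_le_norm (z - σ)
      rw [h1, sub_re, σre] at this
      linarith [neg_abs_le (z.re - (1+a))]
    have h3 : ‖z‖ ≤ 1 + a + 1/2 := by
      have : ‖σ‖ = 1 + a := by
        rw [hσ, show (1 + a : ℂ) = ((1 + a : ℝ) : ℂ) by push_cast; rfl, Complex.norm_real, Real.norm_of_nonneg (by linarith)]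
      calc ‖z‖ = ‖(z - σ) + σ‖ := by simp
        _ ≤ _ := norm_add_le _ _
        _ = _ := by rw [h1, this]; ring
    have hq := Qz_norm_le (s := z) (by linarith)
    calc ‖K z‖ ≤ ‖(1:ℂ)‖ + ‖z * Qz z‖ := norm_sub_le _ _
      _ ≤ 1 + 3 := by
        rw [norm_one, norm_mul]
        have : ‖z‖ * ‖Qz z‖ ≤ ‖z‖ * (1 / z.re) := by gcongr
        have h5 : ‖z‖ * (1 / z.re) ≤ 3 := by
          rw [mul_one_div, div_le_iff₀ (by linarith)]; linarith
        linarith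
      _ = 4 := by norm_num
  have hdK : ‖deriv K σ‖ ≤ 8 := by
    have := norm_deriv_le_of_forall_mem_sphere_norm_le (c := σ) (R := 1/2) (C := 4) (f := K) (by norm_num) ?_ hnorm
    · linarith
    · refine DifferentiableOn.diffContOnCl ?_
      rw [closure_ball _ (by norm_num)]
      intro z hz
      refine (hKd z ?_).differentiableWithinAt
      have h1 : ‖z - σ‖ ≤ 1/2 := by simpa [dist_eq_norm] using hz
      have := Complex.abs_re_le_norm (z - σ)
      rw [sub_re, σre] at this
      linarith [neg_abs_le (z.re - (1+a))]
  have hZ : ∀ᶠ s in 𝓝 σ, riemannZeta s = (s-1)⁻¹ * (1 + (s-1) * K s) := by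
    have h1 : ∀ᶠ s in 𝓝 σ, s ≠ 1 := eventually_ne_nhds hne
    have h2 : ∀ᶠ s in 𝓝 σ, 0 < s.re := 
      (Complex.continuous_re.isOpen_preimage _ isOpen_Ioi).mem_nhds (by simp [σre]; linarith)
    filter_upwards [h1, h2] with s hs hs2
    rw [riemannZeta_eq_inv_sub_mul hs, zeta1_eq hs2]
    congr 1; simp only [hK]; ring
  have hd := Filter.EventuallyEq.deriv_eq hZ
  have hKσ := (hKd σ (by rw [σre]; linarith)).hasDerivAt
  have hs1 : σ - 1 = (a:ℂ) := by simp [hσ]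
  have hane : (a:ℂ) ≠ 0 := by exact_mod_cast ha.ne'
  have hD : HasDerivAt (fun s => (s-1)⁻¹ * (1 + (s-1) * K s)) 
     (-(1) / (σ-1)^2 * (1 + (σ-1) * K σ) + (σ-1)⁻¹ * (1 * K σ + (σ-1) * deriv K σ)) σ := by
    have e1 : HasDerivAt (fun s : ℂ => s - 1) 1 σ := (hasDerivAt_id σ).sub_const 1
    exact (e1.inv (by rw [hs1]; exact hane)).mul ((e1.mul hKσ).const_add 1)
  rw [hd, hD.deriv, Filter.Eventually.self_of_nhds hZ, hs1]
  -- K σ real nonneg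
  obtain ⟨k, hk, hk0⟩ : ∃ k : ℝ, K σ = k ∧ 0 ≤ k := by
    have hreal : Qz σ = ((∫ t in Ioi (1:ℝ), (Int.fract t : ℝ) * t^(-(1 + a+1)) : ℝ) : ℂ) := by
      rw [Qz_eq, ← integral_complex_ofReal]
      refine setIntegral_congr_fun measurableSet_Ioi ?_
      intro t ht
      have : (0:ℝ) ≤ t := by linarith [mem_Ioi.mp ht]
      simp only [ofReal_mul]
      rw [Complex.ofReal_cpow this, hσ]; push_cast; rfl
    set q := ∫ t in Ioi (1:ℝ), (Int.fract t : ℝ) * t^(-(1 + a+1))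
    refine ⟨1 - (1 + a) * q, ?_, ?_⟩
    · simp only [hK]; rw [hreal, hσ]; push_cast; ring
    · have := Qz_norm_le (s := σ) (by rw [σre]; linarith)
      rw [hreal, Complex.norm_real, σre, Real.norm_eq_abs] at this
      have h2 := (le_abs_self q).trans this
      rw [le_div_iff₀ (by linarith)] at h2
      linarith
  rw [hk]
  have hpos : 0 < 1 + a * k := by positivity
  have hpc : (1 + a * k : ℂ) ≠ 0 := by exact_mod_cast hpos.ne'
  have e : -((-(1) / (a:ℂ)^2 * (1 + a * k) + (a:ℂ)⁻¹ * (1 * k + a * deriv K σ)) / ((a:ℂ)⁻¹ * (1 + a * k)))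
     = ((1 / a - k / (1 + a * k) : ℝ) : ℂ) - ((a / (1 + a * k) : ℝ) : ℂ) * deriv K σ := by
    push_cast; field_simp; ring
  rw [e, sub_re, ofReal_re, re_ofReal_mul]
  have h1 : -(8:ℝ) ≤ (deriv K σ).re := by
    have := Complex.abs_re_le_norm (deriv K σ)
    linarith [neg_abs_le (deriv K σ).re]
  have h2 : 0 ≤ k / (1 + a * k) := by positivity
  have h3 : a / (1 + a * k) ≤ a := by
    rw [div_le_iff₀ hpos]; nlinarith [mul_nonneg ha.le hk0]
  have h4 : 0 ≤ a / (1 + a * k) := by positivity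
  nlinarith

open ArithmeticFunction in
lemma hasSum_logderiv {σ : ℝ} (hσ : 1 < σ) (t : ℝ) :
    HasSum (fun n : ℕ => vonMangoldt n * (n:ℝ)^(-σ) * Real.cos (t * Real.log n))
      (-(deriv riemannZeta (σ + t * I) / riemannZeta (σ + t * I)) : ℂ).re := by
  have hs : 1 < (σ + t * I : ℂ).re := by simpa using hσ
  have h := (LSeriesSummable_vonMangoldt hs).hasSum
  have e : ∑' n, LSeries.term (fun n => (vonMangoldt n : ℂ)) (σ + t * I) n = -(deriv riemannZeta (σ + t * I) / riemannZeta (σ + t * I)) := by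
    have := LSeries_vonMangoldt_eq_deriv_riemannZeta_div hs
    rw [LSeries] at this; rw [this, neg_div]
  rw [e] at h
  have h2 := Complex.hasSum_re h
  convert h2 using 2 with n
  rcases eq_or_ne n 0 with rfl | hn
  · simp
  rw [LSeries.term_of_ne_zero hn, div_eq_mul_inv, ← Complex.cpow_neg]
  have hn' : (0:ℝ) < n := by positivity
  have hnc : (n:ℂ) ≠ 0 := by exact_mod_cast hn
  have e2 : (n:ℂ)^(-(σ + t * I : ℂ)) = (((n:ℝ)^(-σ) : ℝ) : ℂ) * Complex.exp (((-(t * Real.log n) : ℝ) : ℂ) * I) := by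
    rw [show (-(σ + t * I : ℂ)) = ((-σ : ℝ):ℂ) + (-(t * I)) by push_cast; ring, Complex.cpow_add _ _ hnc,
      Complex.ofReal_cpow hn'.le]
    congr 1
    rw [Complex.cpow_def_of_ne_zero hnc, ← Complex.natCast_log]
    congr 1; push_cast; ring
  rw [e2, ← mul_assoc, ← ofReal_mul, re_ofReal_mul, Complex.exp_ofReal_mul_I_re, Real.cos_neg]

lemma trig_sum {σ : ℝ} (hσ : 1 < σ) (γ : ℝ) :
    0 ≤ 11.1934 * (-(deriv riemannZeta (σ + (0:ℝ) * I) / riemannZeta (σ + (0:ℝ) * I)) : ℂ).re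
      + 19.08 * (-(deriv riemannZeta (σ + (γ:ℝ) * I) / riemannZeta (σ + (γ:ℝ) * I)) : ℂ).re
      + 11.684 * (-(deriv riemannZeta (σ + ((2 * γ : ℝ):ℂ) * I) / riemannZeta (σ + ((2*γ:ℝ):ℂ) * I)) : ℂ).re
      + 4.76 * (-(deriv riemannZeta (σ + ((3 * γ : ℝ):ℂ) * I) / riemannZeta (σ + ((3*γ:ℝ):ℂ) * I)) : ℂ).re
      + (-(deriv riemannZeta (σ + ((4 * γ : ℝ):ℂ) * I) / riemannZeta (σ + ((4*γ:ℝ):ℂ) * I)) : ℂ).re := by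
  have h := (((((hasSum_logderiv hσ 0).mul_left 11.1934).add ((hasSum_logderiv hσ γ).mul_left 19.08)).add
    ((hasSum_logderiv hσ (2*γ)).mul_left 11.684)).add ((hasSum_logderiv hσ (3*γ)).mul_left 4.76)).add
    (hasSum_logderiv hσ (4*γ))
  refine h.nonneg ?_
  intro n
  have e2 : Real.cos (2 * γ * Real.log n) = 2 * Real.cos (γ * Real.log n)^2 - 1 := by
    rw [← Real.cos_two_mul]; congr 1; ring
  have e3 : Real.cos (3 * γ * Real.log n) = 4 * Real.cos (γ * Real.log n)^3 - 3 * Real.cos (γ * Real.log n) := by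
    rw [← Real.cos_three_mul]; congr 1; ring
  have e4 : Real.cos (4 * γ * Real.log n) = 2 * (2 * Real.cos (γ * Real.log n)^2 - 1)^2 - 1 := by
    rw [← Real.cos_two_mul, ← Real.cos_two_mul]; congr 1; ring
  rw [e2, e3, e4, zero_mul, Real.cos_zero]
  set c := Real.cos (γ * Real.log n)
  have hL : 0 ≤ ArithmeticFunction.vonMangoldt n * (n:ℝ)^(-σ) := by
    have := ArithmeticFunction.vonMangoldt_nonneg (n := n)
    positivity
  have hc : 0 ≤ 11.1934 + 19.08 * c + 11.684 * (2 * c^2 - 1) + 4.76 * (4 * c^3 - 3 * c) + (2 * (2 * c^2 - 1)^2 - 1) := by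
    nlinarith [sq_nonneg (c^2 + 1.19 * c + 0.2523)]
  have := mul_nonneg hL hc
  nlinarith

/-- zero-free region -/
lemma zero_free {τ : ℝ} (hτ : 100 ≤ τ) (hb : 6.2 ≤ bb τ) {s : ℂ} (him : |s.im| ≤ τ / 4)
    (hre : 1 - 0.028 / bb τ < s.re) : riemannZeta₁ s ≠ 0 := by
  have hb0 : 0 < bb τ := by linarith
  have hc : 0.028 / bb τ ≤ 0.005 := by rw [div_le_iff₀ hb0]; linarith
  rcases le_or_gt 1 s.re with h1 | h1
  · rcases eq_or_ne s 1 with rfl | hs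
    · simp
    · intro h
      refine riemannZeta_ne_zero_of_one_le_re h1 ?_
      rw [riemannZeta_eq_inv_sub_mul hs, h, mul_zero]
  rcases lt_or_ge |s.im| 0.98 with h2 | h2
  · refine zeta1_ne_zero_of_near (by linarith) ?_
    have : ‖s - 1‖^2 < s.re^2 := by
      rw [Complex.sq_norm, Complex.normSq_apply]
      simp only [sub_re, one_re, sub_im, one_im, sub_zero]
      have : s.im * s.im < 0.98 * 0.98 := by
        rw [← abs_mul_abs_self]; exact mul_self_lt_mul_self (abs_nonneg _) h2
      nlinarith
    exact lt_of_pow_lt_pow_left₀ 2 (by linarith) this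
  intro h
  have hs : s ≠ 1 := by rintro rfl; simp at h1
  have hz : riemannZeta s = 0 := by rw [riemannZeta_eq_inv_sub_mul hs, h, mul_zero]
  set b := bb τ with hbdef
  set a := 0.0937 / b with ha
  have ha0 : 0 < a := by positivity
  have hab : a * b = 0.0937 := by rw [ha]; field_simp
  have ha1 : a ≤ 0.0937/6.2 := by rw [ha]; gcongr
  set γ := s.im with hγ
  set y := a + 1 - s.re with hy
  have hy0 : 0 < y := by rw [hy]; linarith
  have hyb : y * b < 0.1217 := by
    have : (1 - s.re) * b < 0.028 := by
      have h3 : 1 - s.re < 0.028 / b := by linarith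
      rwa [lt_div_iff₀ hb0] at h3
    rw [hy]; nlinarith
  have hy1 : y ≤ 0.89 := by nlinarith
  have habs : ∀ k : ℝ, 1 ≤ k → k ≤ 4 → 0.98 ≤ |k * γ| ∧ |k * γ| ≤ τ := by
    intro k h1 h2'
    rw [abs_mul, abs_of_nonneg (by linarith : 0 ≤ k)]
    constructor <;> nlinarith
  have ht := trig_sum (σ := 1 + a) (by linarith) γ
  have t0 := neg_logderiv_real_le ha0
  have l1 := (local_all ha0 (by linarith) (by simpa using (habs 1 (by norm_num) (by norm_num)).1)
    (by simpa using (habs 1 (by norm_num) (by norm_num)).2) hτ).2 y hy0 hy1 (by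
      rw [← hz]; congr 1
      apply Complex.ext <;> simp [hy, hγ]
      ring)
  have l2 := (local_all ha0 (by linarith) ((habs 2 (by norm_num) (by norm_num)).1)
    ((habs 2 (by norm_num) (by norm_num)).2) hτ).1
  have l3 := (local_all ha0 (by linarith) ((habs 3 (by norm_num) (by norm_num)).1)
    ((habs 3 (by norm_num) (by norm_num)).2) hτ).1
  have l4 := (local_all ha0 (by linarith) ((habs 4 (by norm_num) (by norm_num)).1)
    ((habs 4 (by norm_num) (by norm_num)).2) hτ).1
  have e0 : (((1 + a : ℝ):ℂ) + ((0:ℝ):ℂ) * I) = 1 + a := by push_cast; ring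
  rw [e0] at ht
  push_cast [neg_re] at ht t0 l1 l2 l3 l4
  rw [← hbdef] at l1 l2 l3 l4
  have key : 19.08 * (1 / y) ≤ 11.1934 * (1/a + 8 * a) + 19.08 * (y / 0.89^2) + 36.524 * b := by
    linarith
  have h1a : 1 / a = b / 0.0937 := by rw [ha]; field_simp
  have h1y : b / 0.1217 < 1 / y := by
    rw [div_lt_div_iff₀ (by norm_num) hy0]; linarith
  rw [h1a] at key
  have : y ≤ 0.1217 / 6.2 := by
    rw [le_div_iff₀ (by norm_num)]; nlinarith
  norm_num at *
  nlinarith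

end

section

open Complex Set Filter Topology MeasureTheory Metric
open scoped ComplexConjugate Real

lemma deriv_bound_center {f : ℂ → ℂ} {z : ℂ} {R M : ℝ} (hR : 0 < R) (hM : 0 < M)
    (hf : DifferentiableOn ℂ f (ball z R)) (hre : ∀ w ∈ ball z R, (f w - f z).re ≤ M) :
    ‖deriv f z‖ ≤ 2 * M / R := by
  set F : ℂ → ℂ := fun w => f (z + w) - f z with hF
  have hmem : ∀ w ∈ ball (0:ℂ) R, z + w ∈ ball z R := by intro w hw; simpa using hw
  have hFd : DifferentiableOn ℂ F (ball 0 R) := by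
    refine DifferentiableOn.sub_const ?_ _
    exact hf.comp (differentiableOn_const _ |>.add differentiableOn_id) hmem
  have hF0 : F 0 = 0 := by simp [hF]
  have hB : ∀ w ∈ ball (0:ℂ) R, ‖F w‖ ≤ 2 * M * ‖w‖ / (R - ‖w‖) := fun w hw =>
    borelCaratheodory_zero hM hFd (fun w hw => hre _ (hmem w hw)) hR hw hF0
  have hder : deriv F 0 = deriv f z := by
    simp only [hF, deriv_sub_const]; rw [deriv_comp_const_add]; simp
  rw [← hder]
  have key : ∀ r, 0 < r → r < R → ‖deriv F 0‖ * (R - r) ≤ 2 * M := by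
    intro r hr hrR
    have : ‖deriv F 0‖ ≤ (2 * M * r / (R - r)) / r := by
      refine norm_deriv_le_of_forall_mem_sphere_norm_le hr ?_ ?_
      · refine (hFd.mono ?_).diffContOnCl
        rw [closure_ball _ hr.ne']; exact closedBall_subset_ball hrR
      · intro w hw
        have h1 : ‖w‖ = r := by simpa using hw
        have := hB w (by simpa [h1] using hrR)
        rwa [h1] at this
    have h2 : (2 * M * r / (R - r)) / r = 2 * M / (R - r) := by field_simp
    rw [h2, le_div_iff₀ (by linarith)] at this
    exact this
  rw [le_div_iff₀ hR]
  have hlim : Tendsto (fun r : ℝ => ‖deriv F 0‖ * (R - r)) (𝓝[>] 0) (𝓝 (‖deriv F 0‖ * (R - 0))) := by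
    refine Tendsto.mono_left ?_ nhdsWithin_le_nhds
    exact ((continuous_const.mul (continuous_const.sub continuous_id)).tendsto 0)
  rw [sub_zero] at hlim
  refine le_of_tendsto hlim ?_
  filter_upwards [Ioo_mem_nhdsGT hR] with r hr
  exact key r hr.1 hr.2

lemma logderiv_bound {g : ℂ → ℂ} {c z : ℂ} {R r M : ℝ} (hrR : r < R) (hM : 0 < M)
    (hg : DifferentiableOn ℂ g (ball c R)) (hne : ∀ w ∈ ball c R, g w ≠ 0)
    (hb : ∀ w ∈ ball c R, ‖g w‖ ≤ Real.exp M * ‖g c‖) (hz : ‖z - c‖ ≤ r) :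
    ‖deriv g z / g z‖ ≤ 2 * M * (R + r) / (R - r)^2 := by
  have hr0 : 0 ≤ r := (norm_nonneg _).trans hz
  have hR : 0 < R := by linarith
  have hgan : AnalyticOnNhd ℂ g (ball c R) := hg.analyticOnNhd isOpen_ball
  have hdiff : DifferentiableOn ℂ (fun z => deriv g z / g z) (ball c R) := by
    intro w hw
    exact ((hgan w hw).deriv.differentiableAt.div (hgan w hw).differentiableAt
      (hne w hw)).differentiableWithinAt
  obtain ⟨h, hh⟩ := hdiff.isExactOn_ball
  have hc : c ∈ ball c R := mem_ball_self hR
  have hconst : ∀ z ∈ ball c R, g z * Complex.exp (-(h z)) = g c * Complex.exp (-(h c)) := by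
    intro z hz
    have hd : ∀ w ∈ ball c R, HasDerivAt (fun z => g z * Complex.exp (-(h z))) 0 w := by
      intro w hw
      have a1 := (hgan w hw).differentiableAt.hasDerivAt
      have a2 := (hh w hw).neg.cexp
      have a3 := a1.mul a2
      have hg0 := hne w hw
      have a4 : deriv g w * Complex.exp ((-h) w) + g w * (Complex.exp ((-h) w) * -(deriv g w / g w)) = 0 := by
        field_simp
        ring
      exact a4 ▸ a3
    have hdo : DifferentiableOn ℂ (fun z => g z * Complex.exp (-(h z))) (ball c R) :=
      fun w hw => (hd w hw).differentiableAt.differentiableWithinAt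
    exact isOpen_ball.is_const_of_deriv_eq_zero (convex_ball c R).isPreconnected
      hdo (fun w hw => (hd w hw).deriv) hz hc
  have hreb : ∀ w ∈ ball c R, (h w - h c).re ≤ M := by
    intro w hw
    have h1 := hconst w hw
    have h2 : g w = g c * Complex.exp (h w - h c) := by
      calc g w = g w * Complex.exp (-(h w)) * Complex.exp (h w) := by
              rw [mul_assoc, ← Complex.exp_add]; simp
        _ = _ := by rw [h1, mul_assoc, ← Complex.exp_add]; congr 2; ring
    have h3 := hb w hw
    rw [h2, norm_mul, Complex.norm_exp, mul_comm] at h3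
    have h4 := le_of_mul_le_mul_right h3 (norm_pos_iff.mpr (hne c hc))
    exact Real.exp_le_exp.mp h4
  have hhd : DifferentiableOn ℂ h (ball c R) := fun w hw => (hh w hw).differentiableAt.differentiableWithinAt
  have hzb : z ∈ ball c R := by rw [mem_ball, dist_eq_norm]; linarith
  -- Borel Caratheodory at z
  have hBC : ‖h z - h c‖ ≤ 2 * M * r / (R - r) := by
    have hmem : ∀ w ∈ ball (0:ℂ) R, c + w ∈ ball c R := by intro w hw; simpa using hw
    have := borelCaratheodory_zero (f := fun w => h (c + w) - h c) (z := z - c) hM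
      ((hhd.comp (differentiableOn_const _ |>.add differentiableOn_id) hmem).sub_const _)
      (fun w hw => hreb _ (hmem w hw)) hR (by rw [mem_ball, dist_zero_right]; linarith) (by simp)
    simp only [add_sub_cancel] at this
    refine this.trans ?_
    gcongr
  have hsub : ball z (R - r) ⊆ ball c R := by
    apply ball_subset_ball'
    rw [dist_eq_norm]; linarith
  have hRr : 0 < R - r := by linarith
  have hfin := deriv_bound_center (f := h) (z := z) (R := R - r) (M := M + 2 * M * r / (R - r)) hRr
    (by positivity) (hhd.mono hsub) (by
      intro w hw
      have h1 := hreb w (hsub hw)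
      have h2 : -(h z - h c).re ≤ 2 * M * r / (R - r) := by
        have := Complex.abs_re_le_norm (h z - h c)
        linarith [neg_abs_le (h z - h c).re]
      have h3 : (h w - h z).re = (h w - h c).re - (h z - h c).re := by simp
      linarith)
  rw [(hh z hzb).deriv] at hfin
  refine hfin.trans (le_of_eq ?_)
  field_simp
  ring

lemma zeta1_eq_mul {s : ℂ} (hs : s ≠ 1) : riemannZeta₁ s = (s - 1) * riemannZeta s := by
  rw [riemannZeta_eq_inv_sub_mul hs]
  have : s - 1 ≠ 0 := sub_ne_zero.mpr hs
  field_simp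

set_option maxHeartbeats 1000000 in
lemma zeta1_logderiv_bound {τ T η : ℝ} (hτ : 100 ≤ τ) (hb : 6.2 ≤ bb τ) (hη : η = 0.028 / bb τ)
    (hT : T + 1 ≤ τ / 4) (hT2 : 50 / η ≤ T) {s : ℂ} (h1 : 1 - 0.9 * η ≤ s.re) (h2 : s.re ≤ 1 + 2.9 * η)
    (him : |s.im| ≤ T) :
    ‖deriv riemannZeta₁ s / riemannZeta₁ s‖ ≤ 780 * Real.log (3.2 * T / η) / η := by
  have hb0 : 0 < bb τ := by linarith
  have hη0 : 0 < η := by rw [hη]; positivity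
  have hη1 : η ≤ 0.005 := by rw [hη, div_le_iff₀ hb0]; linarith
  have hT3 : 10000 ≤ T := by
    refine le_trans ?_ hT2
    rw [le_div_iff₀ hη0]; linarith
  have hTη : 50 ≤ T * η := by rwa [div_le_iff₀ hη0] at hT2
  set t := s.im
  set c : ℂ := ((1 + η : ℝ) : ℂ) + t * I with hc
  have cre : c.re = 1 + η := by simp [hc]
  have cim : c.im = t := by simp [hc]
  have hcne : c ≠ 1 := by intro h; have := congrArg Complex.re h; rw [cre] at this; simp at this; linarith
  have hc1 : η ≤ ‖c - 1‖ := by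
    have := Complex.abs_re_le_norm (c - 1)
    rw [sub_re, cre, one_re] at this
    linarith [le_abs_self (1 + η - 1)]
  have hzc : ‖c - 1‖ * (η / (1 + η)) ≤ ‖riemannZeta₁ c‖ := by
    rw [zeta1_eq_mul hcne, norm_mul]
    have := zeta_norm_ge (s := c) (by rw [cre]; linarith)
    rw [cre] at this
    gcongr
    refine le_trans (le_of_eq ?_) this
    ring
  have hval : 1 < 3.2 * T / η := by rw [lt_div_iff₀ hη0]; nlinarith
  have hM : 0 < Real.log (3.2 * T / η) := Real.log_pos hval
  have hwb : ∀ w ∈ ball c (2 * η), 1 - η < w.re ∧ ‖w - c‖ < 2 * η ∧ |w.im| ≤ T + 2 * η := by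
    intro w hw
    rw [mem_ball, dist_eq_norm] at hw
    have a1 := Complex.abs_re_le_norm (w - c)
    have a2 := Complex.abs_im_le_norm (w - c)
    rw [sub_re, cre] at a1
    rw [sub_im, cim] at a2
    refine ⟨by linarith [neg_abs_le (w.re - (1+η))], hw, ?_⟩
    have := abs_sub_abs_le_abs_sub w.im t
    linarith
  have main := logderiv_bound (g := riemannZeta₁) (c := c) (z := s) (R := 2 * η) (r := 1.9 * η)
    (M := Real.log (3.2 * T / η)) (by linarith) hM differentiable_riemannZeta₁.differentiableOn
    (fun w hw => by
      obtain ⟨a1, a2, a3⟩ := hwb w hw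
      refine zero_free hτ hb ?_ (by rw [← hη]; exact a1)
      linarith) 
    (fun w hw => by
      obtain ⟨a1, a2, a3⟩ := hwb w hw
      rw [Real.exp_log (by linarith)]
      have hw1 : ‖w - 1‖ ≤ 3 * ‖c - 1‖ := by
        have : ‖w - 1‖ ≤ ‖w - c‖ + ‖c - 1‖ := by
          have := norm_add_le (w - c) (c - 1); simpa using this
        linarith
      have hw2 : ‖w‖ ≤ 1 + 2 * η + ‖c - 1‖ := by
        have : ‖w‖ ≤ ‖w - c‖ + ‖c - 1‖ + ‖(1:ℂ)‖ := by
          calc ‖w‖ = ‖(w - c) + (c - 1) + 1‖ := by congr 1; ring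
            _ ≤ _ := norm_add₃_le
        rw [norm_one] at this
        linarith
      have hc2 : ‖c - 1‖ ≤ η + T := by
        have e : c - 1 = (η : ℂ) + t * I := by rw [hc]; push_cast; ring
        rw [e]
        refine (norm_add_le _ _).trans ?_
        simp only [norm_mul, Complex.norm_real, Complex.norm_I, mul_one, Real.norm_eq_abs, abs_of_pos hη0]
        linarith
      refine (zeta1_norm_le (by linarith)).trans ?_
      have b1 : ‖w - 1‖ / w.re ≤ 3.02 * ‖c - 1‖ := by
        rw [div_le_iff₀ (by linarith)]
        have := norm_nonneg (c - 1)
        nlinarith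
      have b2 : 3.2 * T / η * (‖c - 1‖ * (η / (1 + η))) ≤ 3.2 * T / η * ‖riemannZeta₁ c‖ := by
        gcongr
      refine le_trans ?_ b2
      have b3 : 3.2 * T / η * (‖c - 1‖ * (η / (1 + η))) = 3.2 * T * ‖c - 1‖ / (1 + η) := by field_simp
      rw [b3, le_div_iff₀ (by linarith)]
      set x := ‖c - 1‖
      have b4 : ‖w‖ * (1 + ‖w - 1‖ / w.re) ≤ ‖w‖ * (1 + 3.02 * x) := by gcongr
      have b5 : ‖w‖ ≤ x * (1.0202 * T / 50 + 1) := by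
        have : 1 ≤ x * T / 50 := by
          rw [le_div_iff₀ (by norm_num)]; nlinarith
        nlinarith
      have hx0 : 0 < x := by linarith
      have hn := norm_nonneg w
      have b6 : ‖w‖ * (1 + 3.02 * x) ≤ x * (1.0202 * T / 50 + 1) + 3.02 * x * (T + 1.02) := by
        have : ‖w‖ ≤ T + 1.02 := by linarith
        nlinarith
      have b7 : x * (1.0202 * T / 50 + 1) + 3.02 * x * (T + 1.02) ≤ x * (3.18 * T) := by
        have : (1.0202 * T / 50 + 1) + 3.02 * (T + 1.02) ≤ 3.18 * T := by linarith
        have := mul_le_mul_of_nonneg_left this hx0.le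
        linarith
      have b8 : x * (3.18 * T) * (1 + η) ≤ 3.2 * T * x := by
        have : 0 ≤ x * T := by positivity
        nlinarith
      calc ‖w‖ * (1 + ‖w - 1‖ / w.re) * (1 + η) ≤ x * (3.18 * T) * (1 + η) := by
            exact mul_le_mul_of_nonneg_right (by linarith) (by linarith)
        _ ≤ _ := b8)
    (by
      have e : s - c = ((s.re - (1 + η) : ℝ) : ℂ) := by
        apply Complex.ext <;> simp [hc, t]
      rw [e, Complex.norm_real, Real.norm_eq_abs, abs_le]
      constructor <;> linarith)
  refine main.trans (le_of_eq ?_)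
  field_simp
  ring

end

section

open Complex Set Filter Topology MeasureTheory Metric
open scoped ComplexConjugate Real

/-- relative error of psi in logarithmic scale -/
noncomputable def rr (v : ℝ) : ℝ := Chebyshev.psi (Real.exp v) * Real.exp (-v) - 1

lemma rr_ge (v : ℝ) : -1 ≤ rr v := by
  unfold rr
  have := Chebyshev.psi_nonneg (Real.exp v)
  have := Real.exp_pos (-v)
  have : 0 ≤ Chebyshev.psi (Real.exp v) * Real.exp (-v) := by positivity
  linarith

lemma rr_abs (v : ℝ) : |rr v| ≤ 5 := by
  have h0 := rr_ge v
  rw [abs_le]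
  refine ⟨by linarith, ?_⟩
  unfold rr
  have h1 := Chebyshev.psi_le_const_mul_self (x := Real.exp v) (Real.exp_pos v).le
  have h2 : Real.log 4 ≤ 2 := by
    rw [show (4:ℝ) = 2^2 by norm_num, Real.log_pow]
    have := Real.log_two_lt_d9
    push_cast; linarith
  have h3 := mul_le_mul_of_nonneg_right h1 (Real.exp_pos (-v)).le
  rw [mul_assoc, ← Real.exp_add] at h3
  simp at h3
  linarith

lemma rr_meas : Measurable rr := by
  unfold rr
  exact ((Chebyshev.psi_mono.measurable.comp Real.measurable_exp).mul
    (Real.measurable_exp.comp measurable_neg)).sub_const 1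

lemma integral_Ioi_one_exp (g : ℝ → ℂ) : ∫ t in Ioi (1:ℝ), g t = ∫ v in Ioi (0:ℝ), (Real.exp v : ℂ) * g (Real.exp v) := by
  have himg : Real.exp '' (Ioi 0) = Ioi 1 := by
    ext x; constructor
    · rintro ⟨v, hv, rfl⟩; simpa using hv
    · intro hx
      have : 0 < x := by linarith [mem_Ioi.mp hx]
      exact ⟨Real.log x, Real.log_pos hx, Real.exp_log this⟩
  rw [← himg, integral_image_eq_integral_abs_deriv_smul measurableSet_Ioi
    (fun x _ => (Real.hasDerivAt_exp x).hasDerivWithinAt) Real.exp_injective.injOn]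
  refine setIntegral_congr_fun measurableSet_Ioi ?_
  intro v hv
  simp [abs_of_pos (Real.exp_pos v)]

lemma integrable_rr {s : ℂ} (hs : 1 < s.re) : IntegrableOn (fun v : ℝ => (rr v : ℂ) * Complex.exp (-(s-1) * v)) (Ioi 0) := by
  have h1 : IntegrableOn (fun v : ℝ => Complex.exp (-(s-1) * v)) (Ioi 0) := by
    apply integrableOn_exp_mul_complex_Ioi; simp; linarith
  refine Integrable.bdd_mul (c := 5) h1 ?_ ?_
  · exact (Complex.measurable_ofReal.comp rr_meas).aestronglyMeasurable
  · exact Eventually.of_forall (fun v => by simpa using rr_abs v)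

/-- The function H. -/
noncomputable def HH (s : ℂ) : ℂ := -(deriv riemannZeta₁ s / riemannZeta₁ s + 1) / s

open ArithmeticFunction in
lemma HH_eq {s : ℂ} (hs : 1 < s.re) :
    ∫ v in Ioi (0:ℝ), (rr v : ℂ) * Complex.exp (-(s-1) * v) = HH s := by
  have hs1 : s ≠ 1 := by rintro rfl; simp at hs
  have hs0 : s ≠ 0 := by rintro rfl; simp at hs; linarith
  have hs1' : s - 1 ≠ 0 := sub_ne_zero.mpr hs1
  have hzne : riemannZeta s ≠ 0 := riemannZeta_ne_zero_of_one_le_re hs.le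
  have h1 : -(deriv riemannZeta s / riemannZeta s) = s * ∫ v in Ioi (0:ℝ), 
      ((Chebyshev.psi (Real.exp v) * Real.exp (-v) : ℝ) : ℂ) * Complex.exp (-(s-1) * v) := by
    have e1 := LSeries_vonMangoldt_eq_deriv_riemannZeta_div hs
    rw [neg_div] at e1
    rw [← e1]
    have e2 := LSeries_eq_mul_integral_of_nonneg (fun n => vonMangoldt n) zero_le_one hs (by
      simp only [Real.rpow_one]
      refine Asymptotics.IsBigO.of_bound (Real.log 4 + 4) (Eventually.of_forall fun n => ?_)
      have hp : ∑ k ∈ Finset.Icc 1 n, vonMangoldt k = Chebyshev.psi n := by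
        simp [Chebyshev.psi, ← Finset.Icc_add_one_left_eq_Ioc]
      rw [hp, Real.norm_of_nonneg (Chebyshev.psi_nonneg _), Real.norm_of_nonneg (by positivity)]
      exact Chebyshev.psi_le_const_mul_self (by positivity)) (fun _ => vonMangoldt_nonneg)
    rw [e2, integral_Ioi_one_exp]
    congr 1
    refine setIntegral_congr_fun measurableSet_Ioi ?_
    intro v hv
    have hp : ∑ k ∈ Finset.Icc 1 ⌊Real.exp v⌋₊, (vonMangoldt k : ℂ) = ((Chebyshev.psi (Real.exp v) : ℝ) : ℂ) := by
      rw [Chebyshev.psi]; push_cast; simp [← Finset.Icc_add_one_left_eq_Ioc]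
    simp only [hp]
    have hc : ((Real.exp v : ℝ) : ℂ) ^ (-(s + 1)) = Complex.exp (-(s+1) * v) := by
      rw [Complex.cpow_def_of_ne_zero (by simp [Complex.exp_ne_zero]), ← Complex.ofReal_log (Real.exp_pos v).le, Real.log_exp]
      congr 1; ring
    rw [hc]
    push_cast
    have : Complex.exp (-(s-1) * v) = Complex.exp v * Complex.exp v * Complex.exp (-(s+1) * v) := by
      rw [← Complex.exp_add, ← Complex.exp_add]; congr 1; ring
    rw [this, Complex.exp_neg]
    have := Complex.exp_ne_zero v
    field_simp
  have hE : IntegrableOn (fun v : ℝ => Complex.exp (-(s-1) * v)) (Ioi 0) := by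
    apply integrableOn_exp_mul_complex_Ioi; simp; linarith
  have h2 : ∫ v in Ioi (0:ℝ), Complex.exp (-(s-1) * v) = 1 / (s - 1) := by
    rw [integral_exp_mul_complex_Ioi (by simp; linarith)]
    have h5 : (1:ℂ) - s ≠ 0 := by rw [← neg_sub]; exact neg_ne_zero.mpr hs1'
    simp; field_simp; ring
  have h3 : ∫ v in Ioi (0:ℝ), ((Chebyshev.psi (Real.exp v) * Real.exp (-v) : ℝ) : ℂ) * Complex.exp (-(s-1) * v) 
     = (∫ v in Ioi (0:ℝ), (rr v : ℂ) * Complex.exp (-(s-1) * v)) + 1 / (s-1) := by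
    rw [← h2, ← integral_add (integrable_rr hs) hE]
    refine setIntegral_congr_fun measurableSet_Ioi ?_
    intro v hv
    simp only [rr]; push_cast; ring
  rw [h3] at h1
  have hder : deriv riemannZeta₁ s = riemannZeta s + (s - 1) * deriv riemannZeta s := by
    have hev : riemannZeta₁ =ᶠ[𝓝 s] fun z => (z - 1) * riemannZeta z := by
      filter_upwards [eventually_ne_nhds hs1] with z hz using zeta1_eq_mul hz
    rw [hev.deriv_eq]
    have a1 : HasDerivAt (fun z : ℂ => z - 1) 1 s := (hasDerivAt_id s).sub_const 1
    have := a1.mul (differentiableAt_riemannZeta hs1).hasDerivAt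
    exact this.deriv.trans (by ring)
  unfold HH
  rw [hder, zeta1_eq_mul hs1]
  set X := ∫ v in Ioi (0:ℝ), (rr v : ℂ) * Complex.exp (-(s-1) * v)
  have h4 : deriv riemannZeta s = -(s * (X + 1/(s-1))) * riemannZeta s := by
    field_simp at h1 ⊢
    linear_combination -h1
  rw [h4]
  field_simp
  ring

lemma HH_norm_le {s : ℂ} (hs : 1 < s.re) : ‖HH s‖ ≤ 5 / (s.re - 1) := by
  rw [← HH_eq hs]
  refine (norm_integral_le_integral_norm _).trans ?_
  have h1 : ∫ v in Ioi (0:ℝ), 5 * Real.exp (-(s.re-1) * v) = 5 / (s.re - 1) := by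
    rw [integral_const_mul, integral_exp_mul_Ioi (by linarith)]
    simp
    have : s.re - 1 ≠ 0 := by linarith
    have h5 : 1 - s.re ≠ 0 := by linarith
    field_simp
    ring
  rw [← h1]
  refine integral_mono_of_nonneg (Eventually.of_forall fun _ => norm_nonneg _) ?_ ?_
  · exact (integrableOn_exp_mul_Ioi (by linarith) 0).const_mul 5
  · refine Eventually.of_forall fun v => ?_
    simp only [norm_mul, Complex.norm_real, Real.norm_eq_abs, Complex.norm_exp]
    have : (-(s-1) * (v:ℂ)).re = -(s.re - 1) * v := by simp
    rw [this]
    gcongr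
    exact rr_abs v

end

section

open Complex Set Filter Topology MeasureTheory Metric
open scoped ComplexConjugate Real

/-- kernel -/
noncomputable def GK (δ x : ℝ) (w : ℂ) : ℂ := cexp (w * x + δ^2 * w^2 / 2)

lemma GK_norm (δ x k t : ℝ) : ‖GK δ x (k + t * I)‖ = Real.exp (k * x + δ^2 * k^2 / 2 - δ^2 * t^2 / 2) := by
  unfold GK
  rw [Complex.norm_exp]
  congr 1
  have : ((k:ℂ) + t * I) * x + δ^2 * ((k:ℂ) + t * I)^2 / 2 =
    ((k * x + δ^2 * k^2 / 2 - δ^2 * t^2 / 2 : ℝ) : ℂ) + ((t * x + δ^2 * k * t : ℝ) : ℂ) * I := by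
    push_cast
    linear_combination (δ:ℂ)^2 * t^2 / 2 * I_sq
  rw [this, Complex.add_re, Complex.ofReal_re, Complex.re_ofReal_mul]
  simp

lemma GK_integrable {δ : ℝ} (hδ : 0 < δ) (x k : ℝ) : Integrable (fun t : ℝ => GK δ x (k + t * I)) := by
  have hb : (-(δ:ℂ)^2/2).re < 0 := by
    have : (-(δ:ℂ)^2/2) = ((-δ^2/2 : ℝ) : ℂ) := by push_cast; ring
    rw [this, ofReal_re]; have := pow_pos hδ 2; linarith
  have h := integrable_cexp_quadratic' hb (I * (x + δ^2 * k)) (k * x + δ^2 * k^2/2)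
  refine h.congr (Eventually.of_forall fun t => ?_)
  unfold GK
  simp only
  congr 1
  linear_combination -(δ:ℂ)^2 * t^2 / 2 * I_sq

lemma GK_integral {δ : ℝ} (hδ : 0 < δ) (x k : ℝ) :
    ∫ t : ℝ, GK δ x (k + t * I) = ((√(2 * π) / δ * Real.exp (-x^2/(2*δ^2)) : ℝ) : ℂ) := by
  have hb : (-(δ:ℂ)^2/2).re < 0 := by
    have : (-(δ:ℂ)^2/2) = ((-δ^2/2 : ℝ) : ℂ) := by push_cast; ring
    rw [this, ofReal_re]; have := pow_pos hδ 2; linarith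
  have h := integral_cexp_quadratic hb (I * (x + δ^2 * k)) (k * x + δ^2 * k^2/2)
  have hδc : (δ:ℂ) ≠ 0 := by exact_mod_cast hδ.ne'
  have e1 : ∫ t : ℝ, GK δ x (k + t * I) = ∫ t : ℝ, cexp (-(δ:ℂ)^2/2 * t^2 + (I * (x + δ^2 * k)) * t + (k * x + δ^2 * k^2/2)) := by
    refine integral_congr_ae (Eventually.of_forall fun t => ?_)
    unfold GK
    simp only
    congr 1
    linear_combination (δ:ℂ)^2 * t^2 / 2 * I_sq
  rw [e1, h]
  have e2 : ((π:ℂ) / -(-(δ:ℂ)^2/2)) ^ (1/2:ℂ) = ((√(2*π)/δ : ℝ) : ℂ) := by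
    have : ((π:ℂ) / -(-(δ:ℂ)^2/2)) = ((2 * π / δ^2 : ℝ) : ℂ) := by
      push_cast; field_simp
    rw [this, show (1/2:ℂ) = ((1/2:ℝ):ℂ) by push_cast; rfl, ← Complex.ofReal_cpow (by positivity),
      ← Real.sqrt_eq_rpow, Real.sqrt_div (by positivity), Real.sqrt_sq hδ.le]
  rw [e2]
  rw [Complex.ofReal_mul, Complex.ofReal_exp]
  congr 2
  push_cast
  field_simp
  linear_combination (4 : ℂ) * (((x:ℂ) + k * δ^2)^2) * I_sq

lemma fubini_id {δ κ : ℝ} (hδ : 0 < δ) (hκ : 0 < κ) (U : ℝ) :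
    ∫ t : ℝ, HH (1 + (κ + t * I)) * GK δ U (κ + t * I) =
      ((√(2 * π) / δ * ∫ v in Ioi (0:ℝ), rr v * Real.exp (-(U-v)^2/(2*δ^2)) : ℝ) : ℂ) := by
  have h1 : ∀ t : ℝ, HH (1 + (κ + t * I)) * GK δ U (κ + t * I) =
      ∫ v in Ioi (0:ℝ), (rr v : ℂ) * GK δ (U - v) (κ + t * I) := by
    intro t
    rw [← HH_eq (by simp [hκ]), ← integral_mul_const]
    refine integral_congr_ae (Eventually.of_forall fun v => ?_)
    simp only
    unfold GK
    rw [mul_assoc, ← Complex.exp_add]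
    congr 2
    push_cast
    ring
  simp_rw [h1]
  rw [integral_integral_swap]
  · have h2 : ∀ v : ℝ, ∫ t : ℝ, (rr v : ℂ) * GK δ (U - v) (κ + t * I) =
        ((√(2 * π) / δ * (rr v * Real.exp (-(U-v)^2/(2*δ^2))) : ℝ) : ℂ) := by
      intro v
      rw [integral_const_mul, GK_integral hδ]
      push_cast; ring
    simp_rw [h2]
    rw [integral_complex_ofReal, integral_const_mul]
  · have hA : Integrable (fun t : ℝ => Real.exp (κ * U + δ^2 * κ^2 / 2 - δ^2 * t^2 / 2)) := by
      have := (GK_integrable hδ U κ).norm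
      simpa only [GK_norm] using this
    have hB : IntegrableOn (fun v : ℝ => 5 * Real.exp (-κ * v)) (Ioi 0) :=
      (integrableOn_exp_mul_Ioi (by linarith) 0).const_mul 5
    refine (hA.mul_prod hB).mono' ?_ ?_
    · apply Measurable.aestronglyMeasurable
      have : Measurable (fun p : ℝ × ℝ => (rr p.2 : ℂ)) := Complex.measurable_ofReal.comp (rr_meas.comp measurable_snd)
      refine this.mul ?_
      have : Continuous (fun p : ℝ × ℝ => GK δ (U - p.2) (κ + p.1 * I)) := by
        unfold GK; fun_prop
      exact this.measurable
    · refine Eventually.of_forall fun p => ?_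
      simp only [Function.uncurry]
      rw [norm_mul, GK_norm]
      have := rr_abs p.2
      have e : Real.exp (κ * (U - p.2) + δ^2 * κ^2 / 2 - δ^2 * p.1^2 / 2) =
        Real.exp (κ * U + δ^2 * κ^2 / 2 - δ^2 * p.1^2 / 2) * Real.exp (-κ * p.2) := by
        rw [← Real.exp_add]; congr 1; ring
      rw [e]
      have h0 : 0 ≤ Real.exp (κ * U + δ^2 * κ^2 / 2 - δ^2 * p.1^2 / 2) * Real.exp (-κ * p.2) := by positivity
      simp only [norm_real, Real.norm_eq_abs]
      nlinarith

end

section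

open Complex Set Filter Topology MeasureTheory Metric
open scoped ComplexConjugate Real

lemma HH_differentiableAt {s : ℂ} (hs : s ≠ 0) (hZ : riemannZeta₁ s ≠ 0) : DifferentiableAt ℂ HH s := by
  have h2 : DifferentiableAt ℂ (deriv riemannZeta₁) s :=
    (differentiable_riemannZeta₁.analyticAt s).deriv.differentiableAt
  have h1 : DifferentiableAt ℂ riemannZeta₁ s := differentiable_riemannZeta₁ s
  exact (((h2.div h1 hZ).add_const 1).neg).div differentiableAt_id hs

lemma integral_inv_one_add_abs {T : ℝ} (hT : 0 ≤ T) :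
    IntervalIntegrable (fun t : ℝ => (1 + |t|)⁻¹) volume (-T) T ∧
    ∫ t in (-T)..T, (1 + |t|)⁻¹ = 2 * Real.log (1 + T) := by
  have hc : Continuous (fun t : ℝ => (1 + |t|)⁻¹) := by
    refine (continuous_const.add continuous_abs).inv₀ (fun t => ?_)
    have := abs_nonneg t
    have : (0:ℝ) < 1 + |t| := by linarith
    exact this.ne'
  refine ⟨hc.intervalIntegrable _ _, ?_⟩
  have h1 : ∫ t in (0:ℝ)..T, (1 + |t|)⁻¹ = Real.log (1 + T) := by
    rw [intervalIntegral.integral_eq_sub_of_hasDerivAt (f := fun t => Real.log (1 + t))]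
    · simp
    · intro t ht
      rw [uIcc_of_le hT] at ht
      rw [abs_of_nonneg ht.1]
      have := ((hasDerivAt_id t).const_add 1).log (by simp; linarith [ht.1])
      simpa using this
    · exact hc.intervalIntegrable _ _
  have h2 : ∫ t in (-T)..0, (1 + |t|)⁻¹ = Real.log (1 + T) := by
    have := intervalIntegral.integral_comp_neg (a := -T) (b := 0) (fun t : ℝ => (1 + |t|)⁻¹)
    simp only [abs_neg, neg_neg, neg_zero] at this
    rw [this, h1]
  rw [← intervalIntegral.integral_add_adjacent_intervals (hc.intervalIntegrable (-T) 0) (hc.intervalIntegrable 0 T), h1, h2]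
  ring

lemma HH_le {s : ℂ} {M : ℝ} (hM : ‖deriv riemannZeta₁ s / riemannZeta₁ s‖ ≤ M) {a : ℝ} (ha : 0 < a) (has : a ≤ ‖s‖) :
    ‖HH s‖ ≤ (M + 1) / a := by
  unfold HH
  rw [norm_div, norm_neg]
  have h1 : ‖deriv riemannZeta₁ s / riemannZeta₁ s + 1‖ ≤ M + 1 := (norm_add_le _ _).trans (by simpa using hM)
  have : 0 ≤ M + 1 := (norm_nonneg _).trans h1
  gcongr

lemma contour_mid {δ κ U T η M : ℝ} (hδ : 0 < δ) (hδ1 : δ ≤ 1/10) (hκ : 0 < κ) (hκ1 : κ ≤ 1/100)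
    (hη : 0 < η) (hη1 : η ≤ 1/100) (hU : 0 < U) (hT : 1 ≤ T)
    (hM : ∀ s : ℂ, 1 - η ≤ s.re → s.re ≤ 1 + κ → |s.im| ≤ T →
      riemannZeta₁ s ≠ 0 ∧ ‖deriv riemannZeta₁ s / riemannZeta₁ s‖ ≤ M) :
    ‖∫ t in (-T)..T, HH (1 + (κ + t * I)) * GK δ U (κ + t * I)‖ ≤
      (M + 1) * (3 * Real.log (1 + T) * Real.exp (-η * U + 0.01) +
        2 * (κ + η) * Real.exp (κ * U + 0.01 - δ^2 * T^2 / 2)) := by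
  have hM0 : 0 ≤ M := (norm_nonneg _).trans (hM 1 (by simp; linarith) (by simp; linarith) (by simp; linarith)).2
  set F : ℂ → ℂ := fun w => HH (1 + w) * GK δ U w with hF
  have hdiff : DifferentiableOn ℂ F (Set.uIcc (-η) κ ×ℂ Set.uIcc (-T) T) := by
    intro w hw
    rw [uIcc_of_le (by linarith), uIcc_of_le (by linarith), Complex.mem_reProdIm] at hw
    obtain ⟨⟨h1, h2⟩, h3, h4⟩ := hw
    have hz := (hM (1 + w) (by simp; linarith) (by simp; linarith) (by simp; exact abs_le.mpr ⟨h3, h4⟩)).1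
    have hne : (1 + w) ≠ 0 := by
      intro h
      have := congrArg Complex.re h
      simp at this; linarith
    have hd : DifferentiableAt ℂ (fun w => HH (1 + w)) w :=
      (HH_differentiableAt hne hz).comp w (differentiableAt_id.const_add 1)
    have hg : DifferentiableAt ℂ (GK δ U) w := by unfold GK; fun_prop
    exact (hd.mul hg).differentiableWithinAt
  have key := Complex.integral_boundary_rect_eq_zero_of_differentiableOn F (-η - T * I) (κ + T * I)
    (by simpa using hdiff)
  simp only [sub_re, neg_re, ofReal_re, mul_re, I_re, mul_zero, ofReal_im, I_im, mul_one, sub_self, sub_zero,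
    add_re, add_zero, sub_im, neg_im, neg_zero, mul_im, zero_add, add_im, zero_sub] at key
  have hsq : ∀ x : ℝ, -η ≤ x → x ≤ κ → δ^2 * x^2 / 2 ≤ 0.01 := by
    intro x h1 h2
    have : x^2 ≤ 1 := by nlinarith
    have : δ^2 ≤ 1/100 := by nlinarith
    nlinarith [sq_nonneg x, sq_nonneg δ]
  -- horizontals
  have hor : ∀ y : ℝ, |y| = T → ‖∫ x in (-η)..κ, F (x + y * I)‖ ≤
      (M + 1) * Real.exp (κ * U + 0.01 - δ^2 * T^2 / 2) * (κ + η) := by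
    intro y hy
    have := intervalIntegral.norm_integral_le_of_norm_le_const (a := -η) (b := κ) (f := fun x : ℝ => F (x + y * I))
      (C := (M + 1) * Real.exp (κ * U + 0.01 - δ^2 * T^2 / 2)) ?_
    · rwa [sub_neg_eq_add, abs_of_pos (by linarith)] at this
    · intro x hx
      rw [uIoc_of_le (by linarith)] at hx
      simp only [hF]
      rw [norm_mul, GK_norm]
      have hT2 : y^2 = T^2 := by rw [← sq_abs, hy]
      have hb := (hM (1 + (x + y * I)) (by simp; linarith [hx.1]) (by simp; linarith [hx.2]) (by simp [hy])).2
      have h1 := HH_le hb (a := 1) (by norm_num) (by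
        have := Complex.abs_im_le_norm (1 + (x + y * I))
        simp [hy] at this; linarith)
      rw [div_one] at h1
      have h2 : Real.exp (x * U + δ ^ 2 * x ^ 2 / 2 - δ ^ 2 * y ^ 2 / 2) ≤ Real.exp (κ * U + 0.01 - δ^2 * T^2 / 2) := by
        rw [hT2]
        apply Real.exp_le_exp.mpr
        have := hsq x hx.1.le hx.2
        nlinarith [hx.2]
      gcongr
  have hl := hor (-T) (by rw [abs_neg, abs_of_pos (by linarith)])
  have hu := hor T (by rw [abs_of_pos (by linarith)])
  -- left
  have left : ‖∫ y in (-T)..T, F (-η + y * I)‖ ≤ (M + 1) * (3 * Real.log (1 + T) * Real.exp (-η * U + 0.01)) := by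
    obtain ⟨hi, he⟩ := integral_inv_one_add_abs (T := T) (by linarith)
    have := intervalIntegral.norm_integral_le_of_norm_le (a := -T) (b := T) (μ := volume) (f := fun y : ℝ => F (-η + y * I))
      (g := fun y => (M + 1) * 1.5 * Real.exp (-η * U + 0.01) * (1 + |y|)⁻¹) (by linarith) ?_ (hi.const_mul _)
    · rw [intervalIntegral.integral_const_mul, he] at this
      refine this.trans (le_of_eq ?_)
      ring
    · refine Eventually.of_forall fun y hy => ?_
      simp only [hF]
      have e0 : (-(η:ℂ)) = ((-η : ℝ) : ℂ) := by push_cast; rfl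
      rw [norm_mul, e0, GK_norm]
      have hyT : |y| ≤ T := abs_le.mpr ⟨hy.1.le, hy.2⟩
      have hb := (hM (1 + (((-η:ℝ):ℂ) + y * I)) (by simp) (by simp; linarith [hy.2]) (by simpa using hyT)).2
      have h1 := HH_le hb (a := (1 + |y|)/1.5) (by positivity) (by
        rw [Complex.norm_def]
        apply Real.le_sqrt_of_sq_le
        rw [normSq_apply]
        simp
        have := abs_mul_abs_self y
        have h98 : 0.98 ≤ (1 + -η) * (1 + -η) := by nlinarith
        rw [div_pow, div_le_iff₀ (by norm_num)]
        nlinarith [sq_nonneg (|y| - 1), abs_nonneg y])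
      have h2 : Real.exp (-η * U + δ ^ 2 * (-η) ^ 2 / 2 - δ ^ 2 * y ^ 2 / 2) ≤ Real.exp (-η * U + 0.01) := by
        apply Real.exp_le_exp.mpr
        have := hsq (-η) le_rfl (by linarith)
        have : 0 ≤ δ ^ 2 * y ^ 2 / 2 := by positivity
        linarith
      calc _ ≤ (M + 1) / ((1 + |y|)/1.5) * Real.exp (-η * U + 0.01) := by gcongr
        _ = _ := by field_simp
  have e : ∫ y in (-T)..T, F (κ + y * I) = (∫ y in (-T)..T, F (-η + y * I)) +
      I * ((∫ x in (-η)..κ, F (x + (-T:ℝ) * I)) - ∫ x in (-η)..κ, F (x + T * I)) := by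
    simp only [smul_eq_mul] at key
    push_cast at key ⊢
    linear_combination (-I) * key + ((∫ y in (-T)..T, F (κ + y * I)) - ∫ y in (-T)..T, F (-η + y * I)) * I_sq
  change ‖∫ y in (-T)..T, F (κ + y * I)‖ ≤ _
  rw [e]
  refine (norm_add_le _ _).trans ?_
  rw [norm_mul, Complex.norm_I, one_mul]
  have := norm_sub_le (∫ x in (-η)..κ, F (x + (-T:ℝ) * I)) (∫ x in (-η)..κ, F (x + T * I))
  linarith

lemma HH_line_integrable {δ κ : ℝ} (hδ : 0 < δ) (hκ : 0 < κ) (U : ℝ) :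
    Integrable (fun t : ℝ => HH (1 + (κ + t * I)) * GK δ U (κ + t * I)) := by
  refine Integrable.bdd_mul (c := 5 / κ) (GK_integrable hδ U κ) ?_ ?_
  · apply Continuous.aestronglyMeasurable
    rw [continuous_iff_continuousAt]
    intro t
    have hre : (1 + ((κ:ℂ) + t * I)).re = 1 + κ := by simp
    have hne1 : (1 + ((κ:ℂ) + t * I)) ≠ 1 := by
      intro h; rw [h] at hre; simp at hre; linarith
    have hne0 : (1 + ((κ:ℂ) + t * I)) ≠ 0 := by
      intro h; rw [h] at hre; simp at hre; linarith
    have hZ : riemannZeta₁ (1 + ((κ:ℂ) + t * I)) ≠ 0 := by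
      rw [zeta1_eq_mul hne1]
      exact mul_ne_zero (sub_ne_zero.mpr hne1) (riemannZeta_ne_zero_of_one_le_re (by rw [hre]; linarith))
    have hc := (HH_differentiableAt hne0 hZ).continuousAt
    exact ContinuousAt.comp (f := fun t : ℝ => 1 + ((κ:ℂ) + t * I)) hc (by fun_prop)
  · refine Eventually.of_forall fun t => ?_
    have := HH_norm_le (s := 1 + (κ + t * I)) (by simp [hκ])
    simpa using this

lemma contour_tail {δ κ U T : ℝ} (hδ : 0 < δ) (hδ1 : δ ≤ 1/10) (hκ : 0 < κ) (hκ1 : κ ≤ 1/100) (hT : 1 ≤ T) :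
    ‖∫ t : ℝ, HH (1 + (κ + t * I)) * GK δ U (κ + t * I)‖ ≤
     ‖∫ t in (-T)..T, HH (1 + (κ + t * I)) * GK δ U (κ + t * I)‖ +
       2 * (5 / κ) * Real.exp (κ * U + 0.01 - δ^2 * T^2 / 2) / (δ^2 * T) := by
  have hIntg := HH_line_integrable hδ hκ U
  set f := fun t : ℝ => HH (1 + (κ + t * I)) * GK δ U (κ + t * I) with hf
  have ha : 0 < δ^2 * T := by positivity
  have hb : ∀ t : ℝ, T ≤ |t| → ‖f t‖ ≤ (5 / κ * Real.exp (κ * U + 0.01 + δ^2 * T^2/2)) * Real.exp (-(δ^2 * T) * |t|) := by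
    intro t ht
    simp only [hf]
    rw [norm_mul, GK_norm]
    have h1 := HH_norm_le (s := 1 + (κ + t * I)) (by simp [hκ])
    have h1' : ‖HH (1 + (κ + t * I))‖ ≤ 5 / κ := by simpa using h1
    rw [mul_assoc, ← Real.exp_add]
    have h2 : κ * U + δ ^ 2 * κ ^ 2 / 2 - δ ^ 2 * t ^ 2 / 2 ≤ κ * U + 0.01 + δ ^ 2 * T ^ 2 / 2 + -(δ ^ 2 * T) * |t| := by
      have : κ^2 ≤ 1 := by nlinarith
      have : δ^2 ≤ 1/100 := by nlinarith
      have : δ ^ 2 * κ ^ 2 / 2 ≤ 0.01 := by nlinarith [sq_nonneg κ, sq_nonneg δ]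
      have h3 : δ^2 * (|t| - T)^2 ≥ 0 := by positivity
      rw [← sq_abs t]
      nlinarith
    have := Real.exp_le_exp.mpr h2
    gcongr
  have eqexp : (5 / κ * Real.exp (κ * U + 0.01 + δ^2 * T^2/2)) * (Real.exp (-(δ^2*T)*T) / (δ^2 * T)) =
      (5 / κ) * Real.exp (κ * U + 0.01 - δ^2 * T^2 / 2) / (δ^2 * T) := by
    rw [mul_assoc, mul_div_assoc', ← Real.exp_add, ← mul_div_assoc]
    congr 3; ring
  have hR : ‖∫ t in Ioi T, f t‖ ≤ (5 / κ) * Real.exp (κ * U + 0.01 - δ^2 * T^2 / 2) / (δ^2 * T) := by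
    have h := MeasureTheory.norm_integral_le_of_norm_le (μ := volume.restrict (Ioi T)) (f := f)
      ((integrableOn_exp_mul_Ioi (a := -(δ^2*T)) (by linarith) T).const_mul (5 / κ * Real.exp (κ * U + 0.01 + δ^2 * T^2/2))) ?_
    · rw [integral_const_mul, integral_exp_mul_Ioi (by linarith), neg_div_neg_eq, eqexp] at h
      exact h
    · filter_upwards [self_mem_ae_restrict measurableSet_Ioi] with t ht
      have ht' : T < t := ht
      have := hb t (by rw [abs_of_pos (by linarith)]; linarith)
      rwa [abs_of_pos (by linarith)] at this
  have hL : ‖∫ t in Iic (-T), f t‖ ≤ (5 / κ) * Real.exp (κ * U + 0.01 - δ^2 * T^2 / 2) / (δ^2 * T) := by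
    have h := MeasureTheory.norm_integral_le_of_norm_le (μ := volume.restrict (Iic (-T))) (f := f)
      ((integrableOn_exp_mul_Iic (a := (δ^2*T)) (by linarith) (-T)).const_mul (5 / κ * Real.exp (κ * U + 0.01 + δ^2 * T^2/2))) ?_
    · rw [integral_const_mul, integral_exp_mul_Iic (by linarith), mul_neg, ← neg_mul, eqexp] at h
      exact h
    · filter_upwards [self_mem_ae_restrict measurableSet_Iic] with t ht
      have ht' : t ≤ -T := ht
      have := hb t (by rw [abs_of_neg (by linarith)]; linarith)
      rwa [abs_of_neg (by linarith), neg_mul_neg] at this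
  rw [← intervalIntegral.integral_Iic_add_Ioi (b := -T) hIntg.integrableOn hIntg.integrableOn,
    ← intervalIntegral.integral_interval_add_Ioi (a := -T) (b := T) hIntg.integrableOn hIntg.integrableOn]
  have h1 := norm_add_le (∫ t in Iic (-T), f t) ((∫ t in (-T)..T, f t) + ∫ t in Ioi T, f t)
  have h2 := norm_add_le (∫ t in (-T)..T, f t) (∫ t in Ioi T, f t)
  have : 2 * (5 / κ) * Real.exp (κ * U + 0.01 - δ^2 * T^2 / 2) / (δ^2 * T) =
    (5 / κ) * Real.exp (κ * U + 0.01 - δ^2 * T^2 / 2) / (δ^2 * T) + (5 / κ) * Real.exp (κ * U + 0.01 - δ^2 * T^2 / 2) / (δ^2 * T) := by ring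
  rw [this]
  linarith

end

section

open Complex Set Filter Topology MeasureTheory Metric
open scoped ComplexConjugate Real

lemma exp_nat_ge (n : ℕ) (a : ℝ) (ha : 0 ≤ a) :
    (2.7182818283:ℝ)^n * (1 + a + a^2/2) ≤ Real.exp (n + a) := by
  rw [Real.exp_add, ← Real.exp_one_pow]
  have h1 := Real.exp_one_gt_d9
  have h2 := Real.quadratic_le_exp_of_nonneg ha
  gcongr

set_option maxHeartbeats 2000000 in
lemma J_bound {u : ℝ} (hu : 12800 ≤ u) {δ U : ℝ} (hδ : 0 < δ) (hδ2 : δ^2 = 38400 / u^3) (hU : U = u + 4 / u) :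
    ∃ κ : ℝ, 0 < κ ∧ ‖∫ t : ℝ, HH (1 + (κ + t * I)) * GK δ U (κ + t * I)‖ ≤ 6 / u := by
  have hu0 : 0 < u := by linarith
  obtain ⟨l, hl⟩ : ∃ l, Real.exp l = u / 12800 := ⟨Real.log (u/12800), Real.exp_log (by positivity)⟩
  have hue : u = 12800 * Real.exp l := by rw [hl]; ring
  have hl0 : 0 ≤ l := by
    rw [← Real.one_le_exp_iff, hl, le_div_iff₀ (by norm_num)]; linarith
  have hel : 1 + l + l^2/2 ≤ Real.exp l := Real.quadratic_le_exp_of_nonneg hl0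
  set T : ℝ := u^2 / 2800 with hTd
  have hTe : T = 12800^2/2800 * Real.exp (2 * l) := by
    rw [hTd, hue, two_mul, Real.exp_add]; ring
  have he2 : 1 ≤ Real.exp (2*l) := Real.one_le_exp (by linarith)
  have hT1 : 58514 ≤ T := by rw [hTe]; nlinarith
  set τ : ℝ := 4 * T + 4 with hτ
  have hlog1 : Real.log (11 * τ) ≤ 14.77 + 2 * l := by
    rw [Real.log_le_iff_le_exp (by positivity), Real.exp_add]
    have h2 : (2574700:ℝ) ≤ Real.exp (14.77) := by
      have e : (14.77:ℝ) = ((14:ℕ):ℝ) + 0.25 + 0.25 + 0.27 := by norm_num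
      rw [e, Real.exp_add, Real.exp_add]
      have h3 := exp_nat_ge 14 0.25 (by norm_num)
      have h4 := Real.quadratic_le_exp_of_nonneg (show (0:ℝ) ≤ 0.25 by norm_num)
      have h5 := Real.quadratic_le_exp_of_nonneg (show (0:ℝ) ≤ 0.27 by norm_num)
      calc (2574700:ℝ) ≤ (2.7182818283:ℝ)^14 * (1 + 0.25 + 0.25^2/2) * (1 + 0.25 + 0.25^2/2) * (1 + 0.27 + 0.27^2/2) := by norm_num
        _ ≤ _ := by gcongr
    rw [hτ, hTe]
    nlinarith
  have hlog2 : 8 ≤ Real.log (11 * τ) := by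
    rw [Real.le_log_iff_exp_le (by positivity)]
    have h1 := Real.exp_one_lt_d9
    have : Real.exp 8 = Real.exp 1 ^ 8 := by rw [Real.exp_one_pow]; norm_num
    rw [this]
    calc _ ≤ (2.7182818286:ℝ)^8 := by gcongr
      _ ≤ 11 * (4 * 58514 + 4) := by norm_num
      _ ≤ _ := by rw [hτ]; linarith
  have hb1 : bb τ ≤ 11.84 * (1 + 0.121 * l) := by unfold bb; linarith
  have hb2 : 6.2 ≤ bb τ := by unfold bb; linarith
  have hb0 : 0 < bb τ := by linarith
  obtain ⟨η, hη⟩ : ∃ η, η = 0.028 / bb τ := ⟨_, rfl⟩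
  have hη0 : 0 < η := by rw [hη]; positivity
  have hη1 : η ≤ 1/100 := by rw [hη, div_le_iff₀ hb0]; linarith
  have hηinv : 1 / η = bb τ / 0.028 := by rw [hη]; field_simp
  have hηinv' : 1 / η ≤ 423 * (1 + 0.121 * l) := by
    rw [hηinv, div_le_iff₀ (by norm_num)]; linarith
  have hbl : 1 + 0.121 * l ≤ Real.exp (0.121 * l) := by linarith [Real.add_one_le_exp (0.121 * l)]
  have h50 : 50 / η ≤ T := by
    have : 50 / η = 50 * (1 / η) := by ring
    rw [this, hTe]
    have : Real.exp (2*l) ≥ 1 + 2 * l := by linarith [Real.add_one_le_exp (2 * l)]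
    nlinarith
  have hU1 : u ≤ U := by rw [hU]; linarith [show 0 < 4 / u by positivity]
  have hU2 : U ≤ 1.001 * u := by
    rw [hU]
    have : 4 / u ≤ 1 := by rw [div_le_one hu0]; linarith
    linarith
  have hU0 : 0 < U := by linarith
  obtain ⟨κ, hκ⟩ : ∃ κ, κ = 1 / U := ⟨_, rfl⟩
  have hκ0 : 0 < κ := by rw [hκ]; positivity
  have hκ1 : κ ≤ 1/100 := by rw [hκ]; exact one_div_le_one_div_of_le (by norm_num) (by linarith)
  have hκη : κ ≤ 2.9 * η := by
    rw [hκ, hη, div_le_iff₀ hU0, mul_div_assoc', div_mul_eq_mul_div, le_div_iff₀ hb0]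
    nlinarith
  have hκU : κ * U = 1 := by rw [hκ]; field_simp
  refine ⟨κ, hκ0, ?_⟩
  have hδ1 : δ ≤ 1/10 := by
    have : δ^2 ≤ (1/10)^2 := by
      rw [hδ2, div_le_iff₀ (by positivity)]
      have : (12800:ℝ)^3 ≤ u^3 := by gcongr
      nlinarith
    exact le_of_sq_le_sq this (by norm_num) |> fun h => h
  have hZ : ∀ s : ℂ, 1 - 0.9 * η ≤ s.re → s.re ≤ 1 + κ → |s.im| ≤ T →
      riemannZeta₁ s ≠ 0 ∧ ‖deriv riemannZeta₁ s / riemannZeta₁ s‖ ≤ 780*Real.log (3.2*T/η)/η := by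
    intro s h1 h2 h3
    refine ⟨zero_free (τ := τ) (by rw [hτ]; linarith) hb2 (by rw [hτ]; linarith) (by rw [← hη]; linarith),
      zeta1_logderiv_bound (τ := τ) (by rw [hτ]; linarith) hb2 hη (by rw [hτ]; linarith) h50 h1 (by linarith) h3⟩
  have hmid := contour_mid (M := 780*Real.log (3.2*T/η)/η) hδ hδ1 hκ0 hκ1 (show 0 < 0.9 * η by positivity) (by linarith) hU0 (by linarith) hZ
  have htail := contour_tail (U := U) (T := T) hδ hδ1 hκ0 hκ1 (by linarith)
  rw [hκU] at hmid htail
  have hlogM : Real.log (3.2*T/η) ≤ 18.2 * (1 + 0.121 * l) := by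
    have hx : 3.2*T/η ≤ Real.exp (18.2 * (1 + 0.121 * l)) := by
      have e1 : 3.2*T/η = 3.2 * T * (1/η) := by ring
      have e2 : Real.exp (18.2 * (1 + 0.121 * l)) = Real.exp 18.2 * Real.exp (18.2 * 0.121 * l) := by
        rw [← Real.exp_add]; congr 1; ring
      have e3 : Real.exp (2 * l) * Real.exp (0.121 * l) ≤ Real.exp (18.2 * 0.121 * l) := by
        rw [← Real.exp_add]; apply Real.exp_le_exp.mpr; linarith
      have h18 : (79300000:ℝ) ≤ Real.exp 18.2 := by
        have h := exp_nat_ge 18 0.2 (by norm_num)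
        have e : ((18:ℕ):ℝ) + 0.2 = 18.2 := by norm_num
        rw [e] at h
        refine le_trans (by norm_num) h
      rw [e1, e2]
      calc 3.2 * T * (1/η) ≤ 3.2 * T * (423 * Real.exp (0.121 * l)) := by
            gcongr; exact hηinv'.trans (by gcongr)
        _ = (3.2 * (12800^2/2800) * 423) * (Real.exp (2 * l) * Real.exp (0.121 * l)) := by rw [hTe]; ring
        _ ≤ 79300000 * Real.exp (18.2 * 0.121 * l) := by gcongr; norm_num
        _ ≤ _ := by gcongr
    exact (Real.log_le_iff_le_exp (by positivity)).mpr hx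
  have hMb : 780*Real.log (3.2*T/η)/η + 1 ≤ (6.02 * 10 ^ 6) * Real.exp l := by
    have e1 : 780*Real.log (3.2*T/η)/η = 780*Real.log (3.2*T/η) * (1/η) := by ring
    have hlp : 0 ≤ Real.log (3.2*T/η) := Real.log_nonneg (by
      rw [le_div_iff₀ hη0]; linarith)
    rw [e1]
    calc _ ≤ 780 * (18.2 * (1 + 0.121 * l)) * (423 * (1 + 0.121 * l)) + 1 := by gcongr
      _ ≤ (6.02 * 10 ^ 6) * (1 + l + l^2/2) := by linarith [sq_nonneg l]
      _ ≤ _ := by gcongr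
  have hlogT : Real.log (1 + T) ≤ 11 * Real.exp l := by
    have : Real.log (1 + T) ≤ 11 + 2 * l := by
      rw [Real.log_le_iff_le_exp (by positivity), Real.exp_add]
      have h := exp_nat_ge 11 0 (by norm_num)
      have e : ((11:ℕ):ℝ) + 0 = 11 := by norm_num
      rw [e] at h
      have : (58520:ℝ) ≤ Real.exp 11 := le_trans (by norm_num) h
      rw [hTe]; linarith [mul_nonneg (sub_nonneg.mpr this) (sub_nonneg.mpr he2), mul_le_mul_of_nonneg_right this (Real.exp_pos (2*l)).le]
    have := Real.add_one_le_exp l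
    linarith
  have hE1 : Real.exp (-(0.9 * η) * U + 0.01) ≤ (1.53 / 10 ^ 12) * Real.exp (-4 * l) := by
    have h1 : 27.22 + 4 * l ≤ 0.9 * η * U := by
      have hA : 0.9 * η * U ≥ 0.9 * η * u := by gcongr
      refine le_trans ?_ hA
      rw [hη, mul_div_assoc', div_mul_eq_mul_div, le_div_iff₀ hb0]
      calc (27.22 + 4 * l) * bb τ ≤ (27.22 + 4 * l) * (11.84 * (1 + 0.121 * l)) := by gcongr
        _ ≤ 0.9 * 0.028 * (12800 * (1 + l + l^2/2)) := by linarith [sq_nonneg l]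
        _ ≤ 0.9 * 0.028 * u := by rw [hue]; gcongr
    have h2 : Real.exp (-(0.9 * η) * U + 0.01) ≤ Real.exp (-27.21) * Real.exp (-4 * l) := by
      rw [← Real.exp_add]; apply Real.exp_le_exp.mpr; linarith
    have h3 : Real.exp (-27.21) ≤ (1.53 / 10 ^ 12) := by
      rw [Real.exp_neg, inv_le_comm₀ (Real.exp_pos _) (by norm_num)]
      have h := exp_nat_ge 27 0.21 (by norm_num)
      have e : ((27:ℕ):ℝ) + 0.21 = 27.21 := by norm_num
      rw [e] at h
      refine le_trans (by norm_num) h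
    exact h2.trans (by gcongr)
  have hE2 : Real.exp (1 + 0.01 - δ^2 * T^2 / 2) ≤ (7 / 10 ^ 14) * Real.exp (-4 * l) := by
    have h1 : δ^2 * T^2 / 2 = 38400 / (2 * 2800^2) * u := by
      rw [hδ2, hTd]; field_simp
    rw [h1]
    have h2 : Real.exp (1 + 0.01 - 38400 / (2 * 2800^2) * u) ≤ Real.exp (-30.33) * Real.exp (-4 * l) := by
      rw [← Real.exp_add]; apply Real.exp_le_exp.mpr; rw [hue]; linarith [sq_nonneg l]
    have h3 : Real.exp (-30.33) ≤ (7 / 10 ^ 14) := by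
      rw [Real.exp_neg, inv_le_comm₀ (Real.exp_pos _) (by norm_num)]
      have h := exp_nat_ge 30 0.33 (by norm_num)
      have e : ((30:ℕ):ℝ) + 0.33 = 30.33 := by norm_num
      rw [e] at h
      refine le_trans (by norm_num) h
    exact h2.trans (by gcongr)
  set E := Real.exp l with hE
  have hEm : Real.exp (-4 * l) = (E^4)⁻¹ := by
    rw [hE, ← Real.exp_nat_mul, ← Real.exp_neg]; congr 1; push_cast; ring
  have hE1' : 1 ≤ E := Real.one_le_exp hl0
  have hlogTn : 0 ≤ Real.log (1 + T) := Real.log_nonneg (by linarith)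
  have hMn : 0 ≤ 780*Real.log (3.2*T/η)/η + 1 := by
    have hlp : 0 ≤ Real.log (3.2*T/η) := Real.log_nonneg (by
      rw [le_div_iff₀ hη0]; linarith)
    positivity
  have hA : ‖∫ t in (-T)..T, HH (1 + (κ + t * I)) * GK δ U (κ + t * I)‖ ≤ (3.1 / 10 ^ 4) * E⁻¹ := by
    refine hmid.trans ?_
    calc _ ≤ (6.02 * 10 ^ 6) * E * (3 * (11 * E) * ((1.53 / 10 ^ 12) * Real.exp (-4 * l)) + 2 * (1/100 + 1/100) * ((7 / 10 ^ 14) * Real.exp (-4 * l))) := by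
          gcongr; linarith
      _ = ((6.02 * 10 ^ 6) * 33 * (1.53 / 10 ^ 12) * E^2 + (6.02 * 10 ^ 6) * 0.04 * (7 / 10 ^ 14) * E) * (E^4)⁻¹ := by rw [hEm]; ring
      _ ≤ ((3.1 / 10 ^ 4) * E^3) * (E^4)⁻¹ := by
          have h23 : E^2 ≤ E^3 := pow_le_pow_right₀ hE1' (by norm_num)
          have h13 : E ≤ E^3 := le_self_pow₀ hE1' (by norm_num)
          have h2p := sq_nonneg E
          refine mul_le_mul_of_nonneg_right ?_ (by positivity)
          linarith
      _ = (3.1 / 10 ^ 4) * E⁻¹ := by field_simp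
  have hB : 2 * (5 / κ) * Real.exp (1 + 0.01 - δ^2 * T^2 / 2) / (δ^2 * T) ≤ (1 / 10 ^ 5) * E⁻¹ := by
    have e1 : δ^2 * T = 38400/2800 / u := by rw [hδ2, hTd]; field_simp
    have e2 : 5 / κ = 5 * U := by rw [hκ]; field_simp
    rw [e1, e2]
    calc _ ≤ 2 * (5 * (1.001 * u)) * ((7 / 10 ^ 14) * Real.exp (-4 * l)) / (38400/2800 / u) := by gcongr
      _ = (2 * 5 * 1.001 * (7 / 10 ^ 14) / (38400/2800) * 12800^2 * E^2) * (E^4)⁻¹ := by rw [hEm, hue]; field_simp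
      _ ≤ ((1 / 10 ^ 5) * E^3) * (E^4)⁻¹ := by
          have h23 : E^2 ≤ E^3 := pow_le_pow_right₀ hE1' (by norm_num)
          have h2p := sq_nonneg E
          refine mul_le_mul_of_nonneg_right ?_ (by positivity)
          linarith
      _ = (1 / 10 ^ 5) * E⁻¹ := by field_simp
  have hfin : 6 / u = 6 / 12800 * E⁻¹ := by rw [hue]; field_simp
  rw [hfin]
  have hEi : 0 < E⁻¹ := by positivity
  linarith

end

section

open Complex Set Filter Topology MeasureTheory Metric
open scoped ComplexConjugate Real

lemma gauss_moments {δ : ℝ} (hδ : 0 < δ) (U : ℝ) :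
    Integrable (fun v : ℝ => Real.exp (-(U-v)^2/(2*δ^2))) ∧
    Integrable (fun v : ℝ => (v-U)^2 * Real.exp (-(U-v)^2/(2*δ^2))) ∧
    ∫ v : ℝ, Real.exp (-(U-v)^2/(2*δ^2)) = √(2*π) * δ ∧
    ∫ v : ℝ, (v-U)^2 * Real.exp (-(U-v)^2/(2*δ^2)) = δ^2 * (√(2*π) * δ) := by
  set b : ℝ := 1/(2*δ^2) with hb
  have hb0 : 0 < b := by positivity
  have hI0 := integrable_exp_neg_mul_sq hb0
  have hI2 : Integrable (fun x : ℝ => x^2 * Real.exp (-b * x^2)) := by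
    have := integrable_rpow_mul_exp_neg_mul_sq hb0 (s := 2) (by norm_num)
    simpa using this
  have h0 : ∫ x : ℝ, Real.exp (-b * x^2) = √(2*π) * δ := by
    rw [integral_gaussian, hb]
    have : π / (1/(2*δ^2)) = 2 * π * δ^2 := by field_simp
    rw [this, Real.sqrt_mul (by positivity), Real.sqrt_sq hδ.le]
  have h2 : ∫ x : ℝ, x^2 * Real.exp (-b * x^2) = δ^2 * (√(2*π) * δ) := by
    have hd : ∀ x : ℝ, HasDerivAt (fun x : ℝ => x * Real.exp (-b * x^2))
        (Real.exp (-b * x^2) - 2 * b * (x^2 * Real.exp (-b * x^2))) x := by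
      intro x
      have h1 : HasDerivAt (fun x : ℝ => -b * x^2) (-b * (2 * x)) x := by
        simpa using (hasDerivAt_pow 2 x).const_mul (-b)
      have h3 : HasDerivAt (fun x : ℝ => x * Real.exp (-b * x^2))
        (1 * Real.exp (-b * x^2) + x * (Real.exp (-b * x^2) * (-b * (2 * x)))) x :=
        (hasDerivAt_id x).mul h1.exp
      exact h3.congr_deriv (by ring)
    have hI1 : Integrable (fun x : ℝ => x * Real.exp (-b * x^2)) := integrable_mul_exp_neg_mul_sq hb0
    have hz := integral_eq_zero_of_hasDerivAt_of_integrable hd (hI0.sub (hI2.const_mul (2*b))) hI1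
    rw [integral_sub hI0 (hI2.const_mul (2*b)), integral_const_mul, h0] at hz
    have : 2 * b = 1 / δ^2 := by rw [hb]; field_simp
    rw [this] at hz
    generalize (∫ x : ℝ, x^2 * Real.exp (-b * x^2)) = Q at hz ⊢
    have hδ2 : δ^2 ≠ 0 := by positivity
    field_simp at hz
    linarith
  have e : ∀ v : ℝ, -(U-v)^2/(2*δ^2) = -b * (v - U)^2 := by
    intro v; rw [hb]; field_simp; ring
  simp_rw [e]
  refine ⟨hI0.comp_sub_right U, hI2.comp_sub_right U, ?_, ?_⟩
  · rw [← h0]; exact integral_sub_right_eq_self (fun x : ℝ => Real.exp (-b * x^2)) U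
  · rw [← h2]; exact integral_sub_right_eq_self (fun x : ℝ => x^2 * Real.exp (-b * x^2)) U

set_option maxHeartbeats 1000000 in
theorem rr_upper (hlow : ∀ v : ℝ, 200 ≤ v → -0.0007 ≤ rr v) {u : ℝ} (hu : 12800 ≤ u) : rr u ≤ 8 / u := by
  by_contra hcon
  push Not at hcon
  have hu0 : 0 < u := by linarith
  set U := u + 4 / u with hU
  set δ := √(38400 / u^3) with hδd
  have hδ : 0 < δ := Real.sqrt_pos.mpr (by positivity)
  have hδ2 : δ^2 = 38400 / u^3 := Real.sq_sqrt (by positivity)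
  obtain ⟨κ, hκ, hJ⟩ := J_bound hu hδ hδ2 hU
  rw [fubini_id hδ hκ U, Complex.norm_real, Real.norm_eq_abs] at hJ
  have hJ' := (le_abs_self _).trans hJ
  obtain ⟨hI0, hI2, hm0, hm2⟩ := gauss_moments hδ U
  set g := fun v : ℝ => Real.exp (-(U-v)^2/(2*δ^2)) with hg
  set q := fun v : ℝ => 3.6/u - (u^2/16000) * (v - U)^2 with hq
  have hiu : 0 < 4 / u := by positivity
  have hiu1 : 4 / u ≤ 0.0003125 + 0 := by rw [div_le_iff₀ hu0]; linarith
  have h5 : 2 ≤ (u^2/16000) := by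
    rw [le_div_iff₀ (by norm_num)]
    have : (12800:ℝ)^2 ≤ u^2 := by gcongr
    linarith
  have hmin : ∀ v, 0 < v → q v ≤ rr v := by
    intro v hv
    simp only [hq]
    rcases le_or_gt u v with h | h
    · -- right of u
      have hmono : Chebyshev.psi (Real.exp u) ≤ Chebyshev.psi (Real.exp v) :=
        Chebyshev.psi_mono (Real.exp_le_exp.mpr h)
      obtain ⟨D, hD⟩ : ∃ D, D = v - u := ⟨_, rfl⟩
      have hv' : v = u + D := by linarith
      have h1 : rr v + 1 ≥ (rr u + 1) * Real.exp (-D) := by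
        have e1 : rr v + 1 = Chebyshev.psi (Real.exp v) * Real.exp (-v) := by unfold rr; ring
        have e2 : (rr u + 1) * Real.exp (-D) = Chebyshev.psi (Real.exp u) * Real.exp (-v) := by
          unfold rr
          rw [sub_add_cancel, mul_assoc, ← Real.exp_add]; congr 2; linarith
        rw [e1, e2]; gcongr
      have h2 : 1 - D ≤ Real.exp (-D) := by linarith [Real.add_one_le_exp (-D)]
      have h3 : rr v + 1 ≥ (8/u + 1) * (1 - D) := by
        rcases le_or_gt (1 - D) 0 with hneg | hpos
        · have : (8/u+1) * (1 - D) ≤ 0 := mul_nonpos_of_nonneg_of_nonpos (by positivity) hneg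
          linarith [rr_ge v]
        · have hp : 0 ≤ rr u + 1 := by linarith [rr_ge u]
          calc (8/u + 1) * (1 - D) ≤ (rr u + 1) * Real.exp (-D) := by gcongr
            _ ≤ _ := h1
      obtain ⟨y, hy⟩ : ∃ y, y = D * u := ⟨_, rfl⟩
      have hDy : D = y / u := by rw [hy]; field_simp
      have hy0 : 0 ≤ y := by rw [hy]; exact mul_nonneg (by linarith) hu0.le
      have hgoal : 3.6/u - (u^2/16000) * (v - U)^2 ≤ (8/u+1) * (1 - D) - 1 := by
        have e1 : v - U = (y - 4)/u := by rw [hv', hU, hDy]; field_simp; ring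
        have e2 : (u^2/16000) * ((y-4)/u)^2 = (y-4)^2/16000 := by field_simp
        have e3 : (8/u+1) * (1 - D) - 1 = (8 - y - 8 * y / u)/u := by rw [hDy]; field_simp; ring
        rw [e1, e2, e3]
        have e4 : 3.6/u - (y-4)^2/16000 = (3.6 - u * (y-4)^2/16000)/u := by field_simp
        rw [e4]
        apply div_le_div_of_nonneg_right _ hu0.le
        have h8 : 8 * y / u ≤ y / 1600 := by
          rw [div_le_div_iff₀ hu0 (by norm_num)]; nlinarith
        have h9 : u * (y-4)^2/16000 ≥ 0.8 * (y-4)^2 := by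
          have := mul_le_mul_of_nonneg_right hu (sq_nonneg (y-4))
          linarith
        nlinarith [sq_nonneg (y - 4 - 0.6254)]
      linarith
    · have hz : U - v ≥ 4/u + (u - v) := by rw [hU]; linarith
      rcases le_or_gt 200 v with h2 | h2
      · have := hlow v h2
        have hsq : (4/u)^2 ≤ (v - U)^2 := by
          rw [← neg_sub U v, neg_sq]
          gcongr; linarith
        have : (u^2/16000) * (v-U)^2 ≥ (u^2/16000) * (4/u)^2 := by gcongr
        have e : (u^2/16000) * (4/u)^2 = 0.001 := by field_simp; norm_num
        have : 3.6/u ≤ 0.0003 := by rw [div_le_iff₀ hu0]; linarith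
        linarith
      · have := rr_ge v
        have hsq : (1:ℝ)^2 ≤ (v - U)^2 := by
          rw [← neg_sub U v, neg_sq]
          gcongr; linarith
        have : 3.6/u ≤ 0.0003 := by rw [div_le_iff₀ hu0]; linarith
        linarith [mul_le_mul h5 hsq (by norm_num) (by linarith)]
  have hneg : ∀ v, v ≤ 0 → q v ≤ 0 := by
    intro v hv
    simp only [hq]
    have hsq : (1:ℝ)^2 ≤ (v - U)^2 := by
      rw [← neg_sub U v, neg_sq]
      gcongr; rw [hU]; linarith
    have : 3.6/u ≤ 0.0003 := by rw [div_le_iff₀ hu0]; linarith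
    linarith [mul_le_mul h5 hsq (by norm_num) (by linarith)]
  have hqI : Integrable (fun v => q v * g v) := by
    have : (fun v => q v * g v) = fun v => 3.6/u * g v - (u^2/16000) * ((v-U)^2 * g v) := by
      funext v; simp only [hq]; ring
    rw [this]
    exact (hI0.const_mul _).sub (hI2.const_mul _)
  have hqV : ∫ v, q v * g v = 1.2/u * (√(2*π) * δ) := by
    have : (fun v => q v * g v) = fun v => 3.6/u * g v - (u^2/16000) * ((v-U)^2 * g v) := by
      funext v; simp only [hq]; ring
    rw [this, integral_sub (hI0.const_mul _) (hI2.const_mul _), integral_const_mul, integral_const_mul, hm0, hm2, hδ2]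
    field_simp
    ring
  have hrI : IntegrableOn (fun v => rr v * g v) (Ioi 0) := by
    refine Integrable.bdd_mul (c := 5) hI0.integrableOn rr_meas.aestronglyMeasurable ?_
    exact Eventually.of_forall (fun v => by simpa using rr_abs v)
  have h1 : ∫ v in Ioi (0:ℝ), q v * g v ≤ ∫ v in Ioi (0:ℝ), rr v * g v := by
    refine setIntegral_mono_on hqI.integrableOn hrI measurableSet_Ioi ?_
    intro v hv
    exact mul_le_mul_of_nonneg_right (hmin v hv) (Real.exp_pos _).le
  have h2 : ∫ v in Iic (0:ℝ), q v * g v ≤ 0 := by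
    refine setIntegral_nonpos measurableSet_Iic ?_
    intro v hv
    exact mul_nonpos_of_nonpos_of_nonneg (hneg v hv) (Real.exp_pos _).le
  have h3 := intervalIntegral.integral_Iic_add_Ioi (b := 0) hqI.integrableOn hqI.integrableOn
  rw [hqV] at h3
  have h4 : 1.2/u * (√(2*π) * δ) ≤ ∫ v in Ioi (0:ℝ), rr v * g v := by linarith
  have h5' : √(2*π)/δ * (1.2/u * (√(2*π) * δ)) ≤ 6 / u :=
    (mul_le_mul_of_nonneg_left h4 (by positivity)).trans hJ'
  have h6 : √(2*π)/δ * (1.2/u * (√(2*π) * δ)) = 2.4 * π / u := by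
    have : √(2*π) * √(2*π) = 2 * π := Real.mul_self_sqrt (by positivity)
    field_simp
    rw [Real.sq_sqrt (by positivity)]
    ring
  rw [h6, div_le_div_iff_of_pos_right hu0] at h5'
  have := Real.pi_gt_three
  linarith

end

section

theorem lev1 (x : ℝ) (hx : 1209600 * 12000000 ^ 1 ≤ x) : |Chebyshev.psi x - x| ≤ 0.027805 * x :=
  levS (X := 1209600 * 12000000 ^ 0) 44 (by norm_num) (by norm_num) (fun y hy => lev0 y (by linarith)) (by norm_num) (by norm_num) x (by linarith)

theorem lev2 (x : ℝ) (hx : 1209600 * 12000000 ^ 2 ≤ x) : |Chebyshev.psi x - x| ≤ 0.009853 * x :=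
  levS (X := 1209600 * 12000000 ^ 1) 68 (by norm_num) (by norm_num) lev1 (by norm_num) (by norm_num) x (by linarith)

theorem lev3 (x : ℝ) (hx : 1209600 * 12000000 ^ 3 ≤ x) : |Chebyshev.psi x - x| ≤ 0.00376 * x :=
  levS (X := 1209600 * 12000000 ^ 2) 91 (by norm_num) (by norm_num) lev2 (by norm_num) (by norm_num) x (by linarith)

theorem lev4 (x : ℝ) (hx : 1209600 * 12000000 ^ 4 ≤ x) : |Chebyshev.psi x - x| ≤ 0.001692 * x :=
  levS (X := 1209600 * 12000000 ^ 3) 115 (by norm_num) (by norm_num) lev3 (by norm_num) (by norm_num) x (by linarith)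

theorem lev5 (x : ℝ) (hx : 1209600 * 12000000 ^ 5 ≤ x) : |Chebyshev.psi x - x| ≤ 0.00099 * x :=
  levS (X := 1209600 * 12000000 ^ 4) 138 (by norm_num) (by norm_num) lev4 (by norm_num) (by norm_num) x (by linarith)

theorem lev6 (x : ℝ) (hx : 1209600 * 12000000 ^ 6 ≤ x) : |Chebyshev.psi x - x| ≤ 0.000752 * x :=
  levS (X := 1209600 * 12000000 ^ 5) 162 (by norm_num) (by norm_num) lev5 (by norm_num) (by norm_num) x (by linarith)

theorem lev7 (x : ℝ) (hx : 1209600 * 12000000 ^ 7 ≤ x) : |Chebyshev.psi x - x| ≤ 0.000671 * x :=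
  levS (X := 1209600 * 12000000 ^ 6) 185 (by norm_num) (by norm_num) lev6 (by norm_num) (by norm_num) x (by linarith)

theorem lev8 (x : ℝ) (hx : 1209600 * 12000000 ^ 8 ≤ x) : |Chebyshev.psi x - x| ≤ 0.000643 * x :=
  levS (X := 1209600 * 12000000 ^ 7) 209 (by norm_num) (by norm_num) lev7 (by norm_num) (by norm_num) x (by linarith)

theorem lev9 (x : ℝ) (hx : 1209600 * 12000000 ^ 9 ≤ x) : |Chebyshev.psi x - x| ≤ 0.00064 * x :=
  levS (X := 1209600 * 12000000 ^ 8) 232 (by norm_num) (by norm_num) lev8 (by norm_num) (by norm_num) x (by linarith)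

theorem rr_low (v : ℝ) (hv : 200 ≤ v) : -0.0007 ≤ rr v := by
  have e1 : (2.7:ℝ) ^ 200 ≤ Real.exp v := by
    have h1 : (2.7:ℝ) ≤ Real.exp 1 := by have := Real.exp_one_gt_d9; linarith
    have h2 : (Real.exp 1) ^ 200 = Real.exp 200 := by rw [← Real.exp_nat_mul]; norm_num
    calc (2.7:ℝ) ^ 200 ≤ (Real.exp 1) ^ 200 := pow_le_pow_left₀ (by norm_num) h1 _
      _ = Real.exp 200 := h2
      _ ≤ _ := Real.exp_le_exp.2 hv
  have h := lev9 (Real.exp v) (le_trans (by norm_num) e1)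
  rw [abs_le] at h
  unfold rr
  have e2 : Real.exp v * Real.exp (-v) = 1 := by rw [← Real.exp_add]; simp
  have := mul_le_mul_of_nonneg_right h.1 (Real.exp_pos (-v)).le
  nlinarith

end

section

theorem log_chord {a b A B ε c l : ℝ} (ha : 0 < a) (hab : a < b) (hA : A ≤ Real.log a) (hB : B ≤ Real.log b)
    (h1 : ε * a + c < A) (h2 : ε * b + c < B) (hl1 : a ≤ l) (hl2 : l ≤ b) : ε * l + c < Real.log l := by
  have hba : 0 < b - a := by linarith
  set s := (b - l) / (b - a) with hs
  set t := (l - a) / (b - a) with ht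
  have hs0 : 0 ≤ s := div_nonneg (by linarith) hba.le
  have ht0 : 0 ≤ t := div_nonneg (by linarith) hba.le
  have hst : s + t = 1 := by rw [hs, ht]; field_simp; ring
  have hl : s * a + t * b = l := by rw [hs, ht]; field_simp; ring
  have h := strictConcaveOn_log_Ioi.concaveOn.2 (Set.mem_Ioi.2 ha) (Set.mem_Ioi.2 (ha.trans hab)) hs0 ht0 hst
  simp only [smul_eq_mul] at h
  rw [hl] at h
  have h3 : s * (ε * a + c) + t * (ε * b + c) = ε * l + c := by rw [← hl]; linear_combination c * hst
  have h4 : s * A ≤ s * Real.log a := mul_le_mul_of_nonneg_left hA hs0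
  have h5 : t * B ≤ t * Real.log b := mul_le_mul_of_nonneg_left hB ht0
  rcases hs0.eq_or_lt with h0 | h0
  · have : t = 1 := by linarith
    rw [← h0, this] at h h3
    linarith
  · have h6 : s * (ε * a + c) < s * A := mul_lt_mul_of_pos_left h1 h0
    have h7 : t * (ε * b + c) ≤ t * B := mul_le_mul_of_nonneg_left h2.le ht0
    linarith

theorem log_ge_two {a : ℝ} (k m : ℕ) (hk : 0 < k) (ha : 0 < a) (h : 2 ^ m ≤ a ^ k) : m / k * 0.693147 ≤ Real.log a := by
  have h1 := Real.log_le_log (by positivity) h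
  rw [Real.log_pow, Real.log_pow] at h1
  have h2 := Real.log_two_gt_d9
  have hk' : (0:ℝ) < k := by exact_mod_cast hk
  rw [div_mul_eq_mul_div, div_le_iff₀ hk']
  have : (m:ℝ) * 0.693147 ≤ m * Real.log 2 := mul_le_mul_of_nonneg_left (by linarith) (Nat.cast_nonneg _)
  linarith

theorem exp_ge_pow (k : ℕ) {l : ℝ} (hl : (k:ℝ) ≤ l) : (2.718:ℝ) ^ k ≤ Real.exp l := by
  have h1 : (2.718:ℝ) ≤ Real.exp 1 := by have := Real.exp_one_gt_d9; linarith
  have h2 : (Real.exp 1) ^ k = Real.exp k := by rw [← Real.exp_nat_mul, mul_one]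
  exact ((pow_le_pow_left₀ (by norm_num) h1 _).trans_eq h2).trans (Real.exp_le_exp.2 hl)

/-- If the bound with constant `ε` holds at `x` and the chord inequality holds, we get the strict bound. -/
theorem key_aux {l ε a : ℝ} (ha : 0 < a) (hal : a ≤ l) (h : Chebyshev.psi (Real.exp l * l) ≤ (1 + ε) * (Real.exp l * l))
    (h2 : ε * l + (1.01 + 1.5 / a) < Real.log l) :
    Chebyshev.psi (Real.exp l * l) < Real.exp l * (l + Real.log l - 1 - 1.5 / l - 0.01) := by
  have h3 : 1.5 / l ≤ 1.5 / a := div_le_div_of_nonneg_left (by norm_num) ha hal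
  have h4 : Real.exp l * ((1 + ε) * l) < Real.exp l * (l + Real.log l - 1 - 1.5 / l - 0.01) :=
    mul_lt_mul_of_pos_left (by linarith) (Real.exp_pos l)
  linarith

theorem key {l : ℝ} (hl : 9.45 ≤ l) (hx : 120960 ≤ Real.exp l * l) :
    Chebyshev.psi (Real.exp l * l) < Real.exp l * (l + Real.log l - 1 - 1.5 / l - 0.01) := by
  have l9 : (2.0794:ℝ) ≤ Real.log 9.45 := le_trans (by norm_num) (log_ge_two 1 3 (by norm_num) (by norm_num) (by norm_num))
  have l12 : (2.42:ℝ) ≤ Real.log 12 := le_trans (by norm_num) (log_ge_two 2 7 (by norm_num) (by norm_num) (by norm_num))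
  have l20 : (2.772:ℝ) ≤ Real.log 20 := le_trans (by norm_num) (log_ge_two 1 4 (by norm_num) (by norm_num) (by norm_num))
  have l27 : (3.29:ℝ) ≤ Real.log 27.1 := le_trans (by norm_num) (log_ge_two 4 19 (by norm_num) (by norm_num) (by norm_num))
  have l80 : (4.158:ℝ) ≤ Real.log 80 := le_trans (by norm_num) (log_ge_two 1 6 (by norm_num) (by norm_num) (by norm_num))
  have l300 : (5.54:ℝ) ≤ Real.log 300 := le_trans (by norm_num) (log_ge_two 1 8 (by norm_num) (by norm_num) (by norm_num))
  have l128 : (9.35:ℝ) ≤ Real.log 12800 := le_trans (by norm_num) (log_ge_two 2 27 (by norm_num) (by norm_num) (by norm_num))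
  have hE := Real.exp_pos l
  rcases le_total l 12 with c1 | c1
  · refine key_aux (a := 9.45) (ε := 0.0903) (by norm_num) hl ?_ ?_
    · have := chU5 hx
      linarith
    · exact log_chord (by norm_num) (by norm_num) l9 l12 (by norm_num) (by norm_num) hl c1
  rcases le_total l 20 with c2 | c2
  · refine key_aux (a := 12) (ε := 0.0807) (by norm_num) c1 ?_ ?_
    · have h := exp_ge_pow 12 (l := l) (by norm_num; exact c1)
      have := (abs_le.1 (lev0 (Real.exp l * l) (by norm_num at h; nlinarith))).2
      linarith
    · exact log_chord (by norm_num) (by norm_num) l12 l20 (by norm_num) (by norm_num) c1 c2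
  rcases le_total l 27.1 with c3 | c3
  · refine key_aux (a := 20) (ε := 0.0807) (by norm_num) c2 ?_ ?_
    · have h := exp_ge_pow 20 (l := l) (by norm_num; exact c2)
      have := (abs_le.1 (lev0 (Real.exp l * l) (by norm_num at h; nlinarith))).2
      linarith
    · exact log_chord (by norm_num) (by norm_num) l20 l27 (by norm_num) (by norm_num) c2 c3
  rcases le_total l 80 with c4 | c4
  · refine key_aux (a := 27.1) (ε := 0.027805) (by norm_num) c3 ?_ ?_
    · have h := exp_ge_pow 27 (l := 27) (by norm_num)
      have h2 := Real.add_one_le_exp (l - 27)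
      have h3 : Real.exp l = Real.exp 27 * Real.exp (l - 27) := by rw [← Real.exp_add]; ring_nf
      have h4 : (2.718:ℝ) ^ 27 * 1.1 ≤ Real.exp l := by
        rw [h3]; exact mul_le_mul h (by linarith) (by norm_num) (Real.exp_pos _).le
      have h5 := mul_le_mul h4 c3 (by norm_num) hE.le
      have := (abs_le.1 (lev1 (Real.exp l * l) (le_trans (by norm_num) h5))).2
      linarith
    · exact log_chord (by norm_num) (by norm_num) l27 l80 (by norm_num) (by norm_num) c3 c4
  rcases le_total l 300 with c5 | c5
  · refine key_aux (a := 80) (ε := 0.009853) (by norm_num) c4 ?_ ?_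
    · have h := exp_ge_pow 80 (l := l) (by norm_num; exact c4)
      have h5 := mul_le_mul h c4 (by norm_num) hE.le
      have := (abs_le.1 (lev2 (Real.exp l * l) (le_trans (by norm_num) h5))).2
      linarith
    · exact log_chord (by norm_num) (by norm_num) l80 l300 (by norm_num) (by norm_num) c4 c5
  rcases le_total l 12800 with c6 | c6
  · refine key_aux (a := 300) (ε := 0.00064) (by norm_num) c5 ?_ ?_
    · have h := exp_ge_pow 200 (l := l) (by norm_num; linarith)
      have h5 := mul_le_mul h c5 (by norm_num) hE.le
      have := (abs_le.1 (lev9 (Real.exp l * l) (le_trans (by norm_num) h5))).2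
      linarith
    · exact log_chord (by norm_num) (by norm_num) l300 l128 (by norm_num) (by norm_num) c5 c6
  · have l0 : 0 < l := by linarith
    have hl' : Real.log 12800 ≤ Real.log l := Real.log_le_log (by norm_num) c6
    refine key_aux (a := 12800) (ε := 8 / l) (by norm_num) c6 ?_ ?_
    · have h := rr_upper rr_low (u := l + Real.log l) (by linarith)
      have e : Real.exp (l + Real.log l) = Real.exp l * l := by rw [Real.exp_add, Real.exp_log l0]
      unfold rr at h
      rw [Real.exp_neg, e] at h
      have hp : 0 < Real.exp l * l := mul_pos hE l0
      have h8 : 8 / (l + Real.log l) ≤ 8 / l := div_le_div_of_nonneg_left (by norm_num) l0 (by linarith)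
      have h9 : Chebyshev.psi (Real.exp l * l) * (Real.exp l * l)⁻¹ ≤ 1 + 8 / l := by linarith
      rwa [← div_eq_mul_inv, div_le_iff₀ hp] at h9
    · rw [div_mul_cancel₀ _ l0.ne']
      norm_num
      linarith

end

section

noncomputable def GG (t : ℝ) : ℝ := t * (Real.log t + Real.log (Real.log t) - 1 - 1.5 / Real.log t)

theorem log21 : 3 ≤ Real.log 21 := by
  rw [Real.le_log_iff_exp_le (by norm_num)]
  have : Real.exp 3 = Real.exp 1 ^ 3 := by rw [← Real.exp_nat_mul]; norm_num
  rw [this]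
  have h := Real.exp_one_lt_d9
  calc Real.exp 1 ^ 3 ≤ 2.7182818286 ^ 3 := pow_le_pow_left₀ (Real.exp_pos _).le h.le _
    _ ≤ 21 := by norm_num

theorem GG_deriv {t : ℝ} (ht : 21 ≤ t) : HasDerivAt GG (Real.log t + Real.log (Real.log t) - 1 - 1.5 / Real.log t
    + (1 + 1 / Real.log t + 1.5 / Real.log t ^ 2)) t := by
  have h3 : 3 ≤ Real.log t := log21.trans (Real.log_le_log (by norm_num) ht)
  have h0 : t ≠ 0 := by linarith
  have hl0 : Real.log t ≠ 0 := by linarith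
  have d1 := Real.hasDerivAt_log h0
  have d2 := d1.log hl0
  have d3 := (hasDerivAt_const t (1.5:ℝ)).div d1 hl0
  have d := (hasDerivAt_id t).mul (((d1.add d2).sub_const 1).sub d3)
  refine d.congr_deriv ?_
  simp
  field_simp
  ring

theorem GG_step {i : ℝ} (hi : 22 ≤ i) : GG i - GG (i - 1) ≤ Real.log (i * Real.log i) := by
  obtain ⟨c, hc, h⟩ := exists_hasDerivAt_eq_slope GG _ (by linarith : i - 1 < i)
    (fun x hx => (GG_deriv (by linarith [hx.1])).continuousAt.continuousWithinAt)
    (fun x hx => GG_deriv (by linarith [hx.1]))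
  have e : i - (i - 1) = 1 := by ring
  rw [e, div_one] at h
  rw [← h]
  have hc21 : 21 ≤ c := by linarith [hc.1]
  have h3 : 3 ≤ Real.log c := log21.trans (Real.log_le_log (by norm_num) hc21)
  have h4 : Real.log c ≤ Real.log i := Real.log_le_log (by linarith) hc.2.le
  have h5 : Real.log (Real.log c) ≤ Real.log (Real.log i) := Real.log_le_log (by linarith) h4
  rw [Real.log_mul (by linarith) (by linarith)]
  have h6 : 1.5 / Real.log c ^ 2 ≤ 0.5 / Real.log c := by
    rw [div_le_div_iff₀ (by positivity) (by linarith)]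
    nlinarith
  have h7 : 1.5 / Real.log c = 1 / Real.log c + 0.5 / Real.log c := by rw [← add_div]; norm_num
  linarith

theorem theta_nth_le {n : ℕ} {y : ℝ} (h : ∀ i < n, (Nat.nth Nat.Prime i : ℝ) ≤ y) :
    ∑ i ∈ Finset.range n, Real.log (Nat.nth Nat.Prime i) ≤ Chebyshev.psi y := by
  refine le_trans ?_ (Chebyshev.theta_le_psi y)
  have e : ∑ i ∈ Finset.range n, Real.log (Nat.nth Nat.Prime i) =
      ∑ p ∈ (Finset.range n).image (Nat.nth Nat.Prime), Real.log (p:ℝ) := by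
    rw [Finset.sum_image]
    exact fun a _ b _ hab => Nat.nth_injective Nat.infinite_setOfPred_prime hab
  rw [e]
  unfold Chebyshev.theta
  refine Finset.sum_le_sum_of_subset_of_nonneg ?_ ?_
  · intro p hp
    obtain ⟨i, hi, rfl⟩ := Finset.mem_image.1 hp
    have hpr := Nat.prime_nth_prime i
    simp only [Finset.mem_filter, Finset.mem_Ioc]
    exact ⟨⟨hpr.pos, Nat.le_floor (h i (Finset.mem_range.1 hi))⟩, hpr⟩
  · intro p _ _
    exact Real.log_natCast_nonneg p

theorem sum_low {n : ℕ} (hn : 21 ≤ n) (ih : ∀ i, 22 ≤ i → i ≤ n → (i : ℝ) * Real.log i ≤ Nat.nth Nat.Prime (i - 1)) :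
    GG n - GG 21 ≤ ∑ i ∈ Finset.range n, Real.log (Nat.nth Nat.Prime i) := by
  induction n, hn using Nat.le_induction with
  | base =>
    have : 0 ≤ ∑ i ∈ Finset.range 21, Real.log (Nat.nth Nat.Prime i) :=
      Finset.sum_nonneg fun i _ => Real.log_natCast_nonneg _
    norm_num; exact this
  | succ n hn IH =>
    rw [Finset.sum_range_succ]
    have h1 := IH (fun i h1 h2 => ih i h1 (by omega))
    have h2 := ih (n + 1) (by omega) le_rfl
    rw [Nat.add_sub_cancel] at h2
    have hn' : (22:ℝ) ≤ ((n + 1 : ℕ) : ℝ) := by exact_mod_cast (by omega : 22 ≤ n + 1)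
    have h3 := GG_step hn'
    have h3l : 0 < Real.log ((n + 1 : ℕ) : ℝ) := Real.log_pos (by linarith)
    have h4 := Real.log_le_log (by positivity) h2
    have e : ((n + 1 : ℕ) : ℝ) - 1 = n := by push_cast; ring
    rw [e] at h3
    linarith

theorem GG21 : GG 21 ≤ 100 := by
  unfold GG
  have h3 := log21
  have h4 : Real.log 21 ≤ 3.12 := by
    have h := Real.log_le_log (by norm_num) (by norm_num : (21:ℝ) ^ 2 ≤ 2 ^ 9)
    rw [Real.log_pow, Real.log_pow] at h
    push_cast at h
    have := Real.log_two_lt_d9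
    linarith
  have h5 : Real.log (Real.log 21) ≤ Real.log 21 - 1 := Real.log_le_sub_one_of_pos (by linarith)
  have h6 : 0 ≤ 1.5 / Real.log 21 := by positivity
  nlinarith

theorem ind_step {n : ℕ} (hn : 13000 ≤ n) (ih : ∀ i, 22 ≤ i → i < n → (i : ℝ) * Real.log i ≤ Nat.nth Nat.Prime (i - 1)) :
    (n : ℝ) * Real.log n ≤ Nat.nth Nat.Prime (n - 1) := by
  by_contra hcon
  push Not at hcon
  have hnR : (13000:ℝ) ≤ n := by exact_mod_cast hn
  have hn0 : (0:ℝ) < n := by linarith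
  set l := Real.log n with hl
  have hexp : Real.exp l = n := Real.exp_log hn0
  have l1 : 9.45 ≤ l := by
    have h := log_ge_two (a := n) 11 150 (by norm_num) hn0 (le_trans (by norm_num) (pow_le_pow_left₀ (by norm_num) hnR 11))
    have h' : Real.log 13000 ≤ l := Real.log_le_log (by norm_num) hnR
    norm_num at h ⊢
    linarith
  have hx : 120960 ≤ Real.exp l * l := by rw [hexp]; nlinarith
  have hk := key l1 hx
  rw [hexp] at hk
  have h1 : ∑ i ∈ Finset.range (n - 1), Real.log (Nat.nth Nat.Prime i) ≤ Chebyshev.psi (n * l) := by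
    refine theta_nth_le fun i hi => ?_
    have : Nat.nth Nat.Prime i ≤ Nat.nth Nat.Prime (n - 1) := (Nat.nth_le_nth Nat.infinite_setOfPred_prime).2 hi.le
    have : (Nat.nth Nat.Prime i : ℝ) ≤ Nat.nth Nat.Prime (n - 1) := by exact_mod_cast this
    linarith
  have h2 := sum_low (n := n - 1) (by omega) (fun i h1 h2 => ih i h1 (by omega))
  have h3 := GG_step (i := n) (by linarith)
  have e : ((n - 1 : ℕ) : ℝ) = (n:ℝ) - 1 := by rw [Nat.cast_sub (by omega)]; simp
  rw [e] at h2
  have h4 := GG21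
  have h5 : GG n = n * (l + Real.log l - 1 - 1.5 / l) := rfl
  rw [← hl, Real.log_mul hn0.ne' (by linarith), ← hl] at h3
  have h6 : Real.log l ≤ l - 1 := Real.log_le_sub_one_of_pos (by linarith)
  have h7 : l ≤ 14 * 0.6931472 + n / 13000 := by
    have := log_lin (X := 13000) (x := n) 14 (by norm_num) (by norm_num) hnR
    have h8 : Real.log (n / 13000) ≤ n / 13000 - 1 := Real.log_le_sub_one_of_pos (by positivity)
    rw [Real.log_div hn0.ne' (by norm_num), ← hl] at h8
    have h9 : Real.log 13000 ≤ Real.log (2 ^ 14) := Real.log_le_log (by norm_num) (by norm_num)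
    rw [Real.log_pow] at h9
    have := Real.log_two_lt_d9
    norm_num at h9 this ⊢
    linarith
  nlinarith

end

/-- number of set bits among the lowest `2 ^ k` bits -/
noncomputable def popK (k : ℕ) : ℕ → ℕ :=
  Nat.rec (motive := fun _ => ℕ → ℕ) (fun M => Nat.mod M 2)
    (fun k ih M => Nat.add (ih (Nat.mod M (Nat.pow 2 (Nat.pow 2 k)))) (ih (Nat.div M (Nat.pow 2 (Nat.pow 2 k))))) k

theorem popK_eq (k : ℕ) : ∀ M, popK k M = ∑ t ∈ Finset.range (2 ^ k), bt M t := by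
  induction k with
  | zero =>
    intro M
    have : popK 0 M = M % 2 := rfl
    rw [this]
    simp only [pow_zero, Finset.sum_range_one, bt]
    rw [Nat.testBit_zero]
    rcases Nat.mod_two_eq_zero_or_one M with h | h <;> simp [h]
  | succ k ih =>
    intro M
    have : popK (k + 1) M = popK k (M % 2 ^ 2 ^ k) + popK k (M / 2 ^ 2 ^ k) := rfl
    rw [this, ih, ih, pow_succ, mul_two, Finset.sum_range_add]
    congr 1
    · refine Finset.sum_congr rfl fun t ht => ?_
      simp [bt, Nat.testBit_mod_two_pow, Finset.mem_range.1 ht]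
    · refine Finset.sum_congr rfl fun t ht => ?_
      simp [bt, Nat.testBit_div_two_pow, add_comm]

/-- the running upper bound for the prime count after one more segment -/
noncomputable def nxt (k M c : ℕ) : ℕ :=
  Nat.add c (Nat.sub (Nat.pow 2 k) (popK k (Nat.mod M (Nat.pow 2 (Nat.pow 2 k)))))

noncomputable def okQ (c q : ℕ) : Bool :=
  and (Nat.ble (Nat.mul c (Nat.add (logQ c) (Nat.pow 2 34))) (Nat.mul q (Nat.pow 2 60))) (and (Nat.ble 1 c) (Nat.ble c 65535))

noncomputable def segChkG (g : ℕ → ℕ → Bool) (k C fuel : ℕ) : ℕ → ℕ → ℕ → Bool :=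
  Nat.rec (motive := fun _ => ℕ → ℕ → ℕ → Bool) (fun _ c _ => Nat.beq c C)
    (fun _ ih M c q => Bool.rec false (ih (Nat.div M (Nat.pow 2 (Nat.pow 2 k))) (nxt k M c) (Nat.add q (Nat.pow 2 k)))
      (g (nxt k M c) q)) fuel

noncomputable def segChk (k C fuel : ℕ) : ℕ → ℕ → ℕ → Bool := segChkG okQ k C fuel

noncomputable def orK (B c : ℕ) (L : List ℕ) : ℕ :=
  List.rec (motive := fun _ => ℕ) 0 (fun p _ ih => Nat.lor (pat B c 0 p) ih) L

theorem orK_sound {B c : ℕ} {L : List ℕ} (hL : ∀ p ∈ L, 2 ≤ p ∧ p < c) {t : ℕ} (ht : t < B)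
    (h : (orK B c L).testBit t = true) : ¬ Nat.Prime (c + t) := by
  induction L with
  | nil => simp [orK] at h
  | cons p L ih =>
    have e : orK B c (p :: L) = pat B c 0 p ||| orK B c L := rfl
    rw [e, Nat.testBit_or, Bool.or_eq_true] at h
    rcases h with h | h
    · obtain ⟨h1, h2⟩ := hL p (by simp)
      have h3 := pat_sound (B := B) (c := c) (a := 0) (t := t) h1 (by omega) ht
      unfold bt at h3
      rw [h] at h3
      have h4 : (c + t) % p = 0 := by
        by_contra h5
        simp [h5] at h3
      intro hp
      have := (Nat.prime_dvd_prime_iff_eq (Nat.prime_of_mem_primeFactorsList (n := p) (p := p.minFac) (by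
        rw [Nat.mem_primeFactorsList (by omega)]; exact ⟨Nat.minFac_prime (by omega), Nat.minFac_dvd p⟩)) hp).1
          ((Nat.minFac_dvd p).trans (Nat.dvd_of_mod_eq_zero h4))
      have := Nat.minFac_le (n := p) (by omega)
      omega
    · exact ih (fun p hp => hL p (by simp [hp])) h

def Good (n : ℕ) : Prop := (n : ℝ) * Real.log n ≤ Nat.nth Nat.Prime (n - 1)

theorem count_nxt {k M c q : ℕ} (hc : Nat.count Nat.Prime q ≤ c)
    (hM : ∀ t < 2 ^ k, M.testBit t = true → ¬ Nat.Prime (q + t)) : Nat.count Nat.Prime (q + 2 ^ k) ≤ nxt k M c := by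
  have e : nxt k M c = c + (2 ^ k - popK k (M % 2 ^ 2 ^ k)) := rfl
  rw [e, popK_eq, Nat.count_add]
  refine add_le_add hc ?_
  rw [Nat.count_eq_card_filter_range]
  have h1 : ∑ t ∈ Finset.range (2 ^ k), bt (M % 2 ^ 2 ^ k) t = ((Finset.range (2 ^ k)).filter (fun t => M.testBit t = true)).card := by
    rw [Finset.card_filter]
    refine Finset.sum_congr rfl fun t ht => ?_
    simp only [bt, Nat.testBit_mod_two_pow, Finset.mem_range.1 ht, decide_true, Bool.true_and]
    cases M.testBit t <;> simp
  rw [h1]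
  have h2 := Finset.card_filter_add_card_filter_not (s := Finset.range (2 ^ k)) (fun t => M.testBit t = true)
  rw [Finset.card_range] at h2
  have h3 : ((Finset.range (2 ^ k)).filter (fun t => Nat.Prime (q + t))).card ≤
      ((Finset.range (2 ^ k)).filter (fun t => ¬ M.testBit t = true)).card := by
    apply Finset.card_le_card
    intro t ht
    rw [Finset.mem_filter] at ht ⊢
    exact ⟨ht.1, fun h => hM t (Finset.mem_range.1 ht.1) h ht.2⟩
  omega

theorem good_of_okQ {c q n : ℕ} (h : okQ c q = true) (hn : 1 ≤ n) (hnc : n ≤ c) (hq : Nat.count Nat.Prime q ≤ n - 1) : Good n := by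
  unfold okQ at h
  simp only [Bool.and_eq_true] at h
  obtain ⟨h1, h2, h3⟩ := h
  have h1' : c * (logQ c + 2 ^ 34) ≤ q * 2 ^ 60 := Nat.le_of_ble_eq_true h1
  have h3' := Nat.le_of_ble_eq_true h3
  have hb := (logQ_bounds (e := c) (by omega) (by omega)).2
  have h4 : (c : ℝ) * ((logQ c + 2 ^ 34 : ℕ) : ℝ) ≤ q * 2 ^ 60 := by exact_mod_cast h1'
  have h5 : (q:ℝ) ≤ Nat.nth Nat.Prime (n - 1) := by
    exact_mod_cast (Nat.count_le_iff_le_nth Nat.infinite_setOfPred_prime).1 hq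
  have hn1 : (1:ℝ) ≤ n := by exact_mod_cast hn
  have hnc' : (n:ℝ) ≤ c := by exact_mod_cast hnc
  have h6 : Real.log n ≤ Real.log c := Real.log_le_log (by linarith) hnc'
  unfold Good
  calc (n:ℝ) * Real.log n ≤ c * Real.log c := mul_le_mul hnc' h6 (Real.log_nonneg hn1) (by linarith)
    _ ≤ c * (((logQ c + 2 ^ 34 : ℕ) : ℝ) / 2 ^ 60) := mul_le_mul_of_nonneg_left hb (by linarith)
    _ ≤ q := by rw [← mul_div_assoc, div_le_iff₀ (by positivity)]; exact h4
    _ ≤ _ := h5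

theorem brec_true {a b : Bool} (h : Bool.rec (motive := fun _ => Bool) false a b = true) : b = true ∧ a = true := by
  cases b
  · exact absurd h (by simp)
  · exact ⟨rfl, h⟩

theorem segChkG_succ {g : ℕ → ℕ → Bool} {k C f M c q : ℕ} (h : segChkG g k C (f + 1) M c q = true) :
    g (nxt k M c) q = true ∧ segChkG g k C f (Nat.div M (Nat.pow 2 (Nat.pow 2 k))) (nxt k M c) (Nat.add q (Nat.pow 2 k)) = true :=
  brec_true h

theorem segChk_succ {k C f M c q : ℕ} (h : segChk k C (f + 1) M c q = true) :
    okQ (nxt k M c) q = true ∧ segChk k C f (Nat.div M (Nat.pow 2 (Nat.pow 2 k))) (nxt k M c) (Nat.add q (Nat.pow 2 k)) = true := by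
  unfold segChk at h ⊢
  exact segChkG_succ h

theorem segChk_sound (k C fuel : ℕ) : ∀ (M c q : ℕ), segChk k C fuel M c q = true → Nat.count Nat.Prime q ≤ c →
    (∀ t < 2 ^ k * fuel, M.testBit t = true → ¬ Nat.Prime (q + t)) →
    (∀ n, c < n → n ≤ C → Good n) ∧ Nat.count Nat.Prime (q + 2 ^ k * fuel) ≤ C := by
  induction fuel with
  | zero =>
    intro M c q h hc _
    have : c = C := Nat.eq_of_beq_eq_true h
    subst this
    exact ⟨fun n h1 h2 => by omega, by simpa using hc⟩
  | succ f ih =>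
    intro M c q h hc hM
    obtain ⟨hok, h⟩ := segChk_succ h
    have e1 : Nat.div M (Nat.pow 2 (Nat.pow 2 k)) = M / 2 ^ 2 ^ k := rfl
    have e2 : Nat.add q (Nat.pow 2 k) = q + 2 ^ k := rfl
    rw [e1, e2] at h
    have hpos : 0 < 2 ^ k := by positivity
    obtain ⟨h1, h2⟩ := ih _ _ _ h (count_nxt hc (fun t ht => hM t (by nlinarith))) (by
      intro t ht hb
      rw [Nat.testBit_div_two_pow] at hb
      have := hM (t + 2 ^ k) (by rw [Nat.mul_succ]; omega) hb
      rwa [show q + 2 ^ k + t = q + (t + 2 ^ k) by ring])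
    refine ⟨fun n hn1 hn2 => ?_, by rw [Nat.mul_succ]; rwa [show q + (2 ^ k * f + 2 ^ k) = q + 2 ^ k + 2 ^ k * f by ring]⟩
    rcases le_or_gt n (nxt k M c) with h3 | h3
    · exact good_of_okQ hok (by omega) h3 (by omega)
    · exact h1 n h3 hn2

theorem stage (k C fuel c q : ℕ) (L : List ℕ) (h : segChk k C fuel (orK (2 ^ k * fuel) q L) c q = true)
    (hL : rangeChk 2 q L = true) (hc : Nat.count Nat.Prime q ≤ c) :
    (∀ n, c < n → n ≤ C → Good n) ∧ Nat.count Nat.Prime (q + 2 ^ k * fuel) ≤ C :=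
  segChk_sound k C fuel _ c q h hc fun _ ht hb => orK_sound (rangeChk_sound hL) ht hb

theorem stg0 : (∀ n, 1 < n → n ≤ 4 → Good n) ∧ Nat.count Nat.Prime 9 ≤ 4 :=
  stage 0 4 6 1 3 [2] (by decide +kernel) (by decide +kernel) (by decide +kernel)

theorem stg1 : (∀ n, 4 < n → n ≤ 30 → Good n) ∧ Nat.count Nat.Prime 121 ≤ 30 :=
  stage 0 30 112 4 9 [2, 3, 5, 7] (by decide +kernel) (by decide +kernel) stg0.2

theorem stg2 : (∀ n, 30 < n → n ≤ 375 → Good n) ∧ Nat.count Nat.Prime 2561 ≤ 375 :=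
  stage 3 375 305 30 121 [2, 3, 5, 7, 11, 13, 17, 19, 23, 29, 31, 37, 41, 43, 47] (by decide +kernel) (by decide +kernel) stg1.2

theorem stg3 : (∀ n, 375 < n → n ≤ 13011 → Good n) ∧ Nat.count Nat.Prime 140033 ≤ 13011 :=
  stage 8 13011 537 375 2561 [2, 3, 5, 7, 11, 13, 17, 19, 23, 29, 31, 37, 41, 43, 47, 53, 59, 61, 67, 71, 73, 79, 83, 89, 97, 101, 103, 107, 109, 113, 127, 131, 137, 139, 149, 151, 157, 163, 167, 173, 179, 181, 191, 193, 197, 199, 211, 223, 227, 229, 233, 239, 241, 251, 257, 263, 269, 271, 277, 281, 283, 293, 307, 311, 313, 317, 331, 337, 347, 349, 353, 359, 367, 373, 379] (by decide +kernel) (by decide +kernel) stg2.2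

theorem good_small {n : ℕ} (h1 : 1 ≤ n) (h2 : n ≤ 13000) : Good n := by
  rcases Nat.eq_or_lt_of_le h1 with rfl | h
  · unfold Good; simp
  rcases le_or_gt n 4 with a | a
  · exact stg0.1 n h a
  rcases le_or_gt n 30 with b | b
  · exact stg1.1 n a b
  rcases le_or_gt n 375 with c | c
  · exact stg2.1 n b c
  · exact stg3.1 n c (by omega)

theorem good_all (n : ℕ) (hn : 1 ≤ n) : Good n := by
  induction n using Nat.strong_induction_on with
  | _ n ih =>
    rcases le_or_gt n 13000 with h | h
    · exact good_small hn h
    · exact ind_step h.le (fun i h1 h2 => ih i h2 (by omega))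

theorem nth_prime_ge (n : ℕ) (hn : 1 ≤ n) : (Nat.nth Nat.Prime (n - 1) : ℝ) ≥ n * Real.log n :=
  good_all n hn
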